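/- There exist radial Schwartz functions a_n, b_n, ã_n, b̃_n : ℝ⁸ → ℂ, indexed by integers n ≥ 1, with the following property: for every radial Schwartz function f : ℝ⁸ → ℂ and every x ∈ ℝ⁸, each of the four series Σ_{n≥1} f(√(2n))·a_n(x), Σ_{n≥1} f′(√(2n))·b_n(x), Σ_{n≥1} f̂(√(2n))·ã_n(x), and Σ_{n≥1} f̂′(√(2n))·b̃_n(x) converges absolutely, and f(x) equals the sum of these four series. -/

import Mathlib

noncomputable section

/-- A function on `ℝ⁸` is radial if its value depends only on the norm of the argument. -/
def IsRadial (f : EuclideanSpace ℝ (Fin 8) → ℂ) : Prop :=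
  ∀ x y : EuclideanSpace ℝ (Fin 8), ‖x‖ = ‖y‖ → f x = f y

/-- The first standard basis vector of `ℝ⁸`. -/
def e₁ : EuclideanSpace ℝ (Fin 8) := EuclideanSpace.single 0 1

/-- The radial value `f(r) = f(r·e₁)` of a Schwartz function. -/
def radVal (f : SchwartzMap (EuclideanSpace ℝ (Fin 8)) ℂ) (r : ℝ) : ℂ := f (r • e₁)

/-- The radial derivative `f′(r)`, the derivative at `t = r` of `t ↦ f(t·e₁)`. -/
def radDeriv (f : SchwartzMap (EuclideanSpace ℝ (Fin 8)) ℂ) (r : ℝ) : ℂ :=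
  deriv (fun t : ℝ => f (t • e₁)) r

/-- The Fourier transform `f̂(y) = ∫ f(x) e^{-2πi⟨x,y⟩} dx` of a Schwartz function. -/
def FT (f : SchwartzMap (EuclideanSpace ℝ (Fin 8)) ℂ) :
    SchwartzMap (EuclideanSpace ℝ (Fin 8)) ℂ :=
  SchwartzMap.fourierTransformCLM ℂ f

/- Plan: theta functions and modular kernels (`Gr` growth calculus), the vector-valued generating function `W`
on the upper half plane (`Base`, `Glob`), its Fourier coefficients (`Cf`), and a representation of radial
Schwartz functions as superpositions of Gaussians (`rep`). -/
namespace Interp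
open Complex Filter Topology Set Asymptotics
open scoped Real UpperHalfPlane MatrixGroups ModularForm
variable {Q : ℂ}
section
abbrev imInf : Filter ℂ := comap Complex.im atTop
def HH : Set ℂ := {Q | 0 < Q.im}
lemma mem_HH : Q ∈ HH ↔ 0 < Q.im := Iff.rfl
lemma isOpen_HH : IsOpen HH := isOpen_lt continuous_const continuous_im
lemma convex_HH : Convex ℝ HH := by
  have : HH = {Q : ℂ | 0 < Q.im} := rfl
  rw [this]; exact convex_halfSpace_im_gt 0
lemma HH_mem_nhds (h : Q ∈ HH) : HH ∈ 𝓝 Q := isOpen_HH.mem_nhds h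
lemma HH_add_one (h : Q ∈ HH) : Q+1 ∈ HH := by simpa [HH] using h
lemma HH_ne_zero (h : Q ∈ HH) : Q ≠ 0 := by rintro rfl; simp [HH] at h
lemma im_neg_inv (Q : ℂ) : (-1/Q).im = Q.im/normSq Q := by
  rw [div_eq_mul_inv, neg_one_mul, neg_im, inv_im]; ring
lemma re_neg_inv (Q : ℂ) : (-1/Q).re = -Q.re/normSq Q := by
  rw [div_eq_mul_inv, neg_one_mul, neg_re, inv_re]; ring
lemma HH_neg_inv (h : Q ∈ HH) : -1/Q ∈ HH := by
  rw [mem_HH, im_neg_inv]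
  exact div_pos h (normSq_pos.2 (HH_ne_zero h))
lemma eventually_imInf (c : ℝ) : ∀ᶠ Q in imInf, c < Q.im :=
  (tendsto_comap (f := Complex.im) (x := atTop)).eventually (eventually_gt_atTop c)
instance : NeBot imInf := by
  refine (atTop_neBot (α := ℝ)).comap_of_range_mem ?_
  have : range Complex.im = univ := Complex.im_surjective.range_eq
  rw [this]; exact univ_mem
lemma periodic_bound {φ : ℂ → ℂ} {h : ℝ} (hh : 0 < h) {L : ℂ}
    (hφ : DifferentiableOn ℂ φ HH) (hper : ∀ Q ∈ HH, φ (Q+h) = φ Q)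
    (hL : Tendsto φ imInf (𝓝 L)) {c : ℝ} (hc : 0 < c) :
    ∃ C : ℝ, 0 < C ∧ ∀ Q : ℂ, c ≤ Q.im → ‖φ Q-L‖ ≤ C*rexp (-2*π*Q.im/h) := by
  classical
  set f : ℂ → ℂ := fun Q => if 0 < Q.im then φ Q-L else 0 with hf
  have hfper : Function.Periodic f (h : ℂ) := by
    intro Q
    by_cases h0 : 0 < Q.im
    · have h1 : 0 < (Q+(h:ℂ)).im := by simpa using h0
      simp only [hf, h0, h1, if_true, hper Q h0]
    · have h1 : ¬ 0 < (Q+(h:ℂ)).im := by simpa using h0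
      simp only [hf, h0, h1, if_false]
  have hdiff : ∀ Q ∈ HH, DifferentiableAt ℂ f Q := by
    intro Q hQ
    have : f =ᶠ[𝓝 Q] fun w => φ w-L := by
      filter_upwards [HH_mem_nhds hQ] with w hw
      simp [hf, mem_HH.1 hw]
    refine DifferentiableAt.congr_of_eventuallyEq ?_ this
    exact (hφ.differentiableAt (HH_mem_nhds hQ)).sub_const L
  have hev : ∀ᶠ Q in imInf, DifferentiableAt ℂ f Q :=
    (eventually_imInf 0).mono fun Q hQ => hdiff Q hQ
  have hz : ZeroAtFilter imInf f := by
    have : Tendsto (fun Q => φ Q-L) imInf (𝓝 0) := by simpa using hL.sub_const L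
    refine this.congr' ?_
    filter_upwards [eventually_imInf 0] with w hw
    simp [hf, hw]
  set F := Function.Periodic.cuspFunction h f with hF
  have hF0 : F 0 = 0 := Function.Periodic.cuspFunction_zero_of_zero_at_inf hh hz
  have hFd0 : DifferentiableAt ℂ F 0 :=
    Function.Periodic.differentiableAt_cuspFunction_zero hh hfper hev hz.boundedAtFilter
  have hFd : ∀ q : ℂ, ‖q‖ < 1 → DifferentiableAt ℂ F q := by
    intro q hq
    by_cases hq0 : q = 0
    · rw [hq0]; exact hFd0
    · have := Function.Periodic.differentiableAt_cuspFunction hh.ne' hfper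
        (z := Function.Periodic.invQParam h q) (hdiff _ ?_)
      · rwa [Function.Periodic.qParam_right_inv hh.ne' hq0] at this
      · rw [mem_HH, Function.Periodic.im_invQParam]
        have h1 : Real.log ‖q‖ < 0 := Real.log_neg (norm_pos_iff.2 hq0) hq
        have h2 : -h/(2*π) < 0 := div_neg_of_neg_of_pos (by linarith) (by positivity)
        exact mul_pos_of_neg_of_neg h2 h1
  set ρ := rexp (-2*π*c/h) with hρ
  have hρ1 : ρ < 1 := by
    rw [hρ, Real.exp_lt_one_iff]
    apply div_neg_of_neg_of_pos _ hh
    nlinarith [mul_pos Real.pi_pos hc]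
  have hcont : ContinuousOn (dslope F 0) (Metric.closedBall 0 ρ) := by
    intro q hq
    have hq1 : ‖q‖ < 1 := by simpa using lt_of_le_of_lt (mem_closedBall_zero_iff.1 hq) hρ1
    apply ContinuousAt.continuousWithinAt
    by_cases hq0 : q = 0
    · rw [hq0]; exact continuousAt_dslope_same.2 hFd0
    · exact (continuousAt_dslope_of_ne hq0).2 (hFd q hq1).continuousAt
  obtain ⟨C, hC⟩ := (isCompact_closedBall (0:ℂ) ρ).exists_bound_of_continuousOn hcont
  refine ⟨|C|+1, by positivity, fun Q hQ => ?_⟩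
  have hQ0 : 0 < Q.im := lt_of_lt_of_le hc hQ
  have h1 : φ Q-L = F (Function.Periodic.qParam h Q) := by
    rw [hF, Function.Periodic.eq_cuspFunction hh.ne' hfper]; simp [hf, hQ0]
  have hn := Function.Periodic.norm_qParam h Q
  have hmem : Function.Periodic.qParam h Q ∈ Metric.closedBall (0:ℂ) ρ := by
    rw [mem_closedBall_zero_iff, hn, hρ]
    apply Real.exp_le_exp.2
    apply div_le_div_of_nonneg_right _ hh.le
    nlinarith [mul_le_mul_of_nonneg_left hQ Real.pi_pos.le]
  have h2 := sub_smul_dslope F 0 (Function.Periodic.qParam h Q)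
  rw [sub_zero, hF0, sub_zero] at h2
  rw [h1, ← h2, norm_smul, hn, mul_comm]
  apply mul_le_mul_of_nonneg_right _ (Real.exp_pos _).le
  exact (hC _ hmem).trans ((le_abs_self C).trans (by linarith))
lemma deriv_tendsto_zero {φ : ℂ → ℂ} {L : ℂ} (hφ : DifferentiableOn ℂ φ HH)
    (hL : Tendsto φ imInf (𝓝 L)) : Tendsto (deriv φ) imInf (𝓝 0) := by
  rw [Metric.tendsto_nhds] at *
  intro ε hε
  have h1 := hL (ε/2) (by positivity)
  rw [eventually_comap] at h1
  obtain ⟨Y, hY⟩ := eventually_atTop.1 h1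
  filter_upwards [eventually_imInf (max Y 0+1)] with Q hQ
  have hball : ∀ w ∈ Metric.closedBall Q 1, max Y 0 ≤ w.im := by
    intro w hw
    have h2 : |(w-Q).im| ≤ 1 := (abs_im_le_norm _).trans (by simpa [dist_eq_norm] using hw)
    rw [sub_im] at h2
    have := (abs_le.1 h2).1
    linarith
  have hball2 : ∀ w ∈ Metric.ball Q 1, 0 < w.im := by
    intro w hw
    have h2 : |(w-Q).im| < 1 := (abs_im_le_norm _).trans_lt (by simpa [dist_eq_norm] using hw)
    rw [sub_im] at h2
    have := (abs_lt.1 h2).1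
    have := le_max_right Y 0
    linarith
  have hd : DiffContOnCl ℂ (fun w => φ w-L) (Metric.ball Q 1) := by
    apply DifferentiableOn.diffContOnCl
    intro w hw
    have hw' : w ∈ Metric.closedBall Q 1 := Metric.closure_ball_subset_closedBall hw
    have h2 : |(w-Q).im| ≤ 1 := (abs_im_le_norm _).trans (by simpa [dist_eq_norm] using hw')
    rw [sub_im] at h2
    have h3 := (abs_le.1 h2).1
    have h4 := le_max_right Y 0
    have : w ∈ HH := by rw [mem_HH]; linarith
    exact ((hφ.differentiableAt (HH_mem_nhds this)).sub_const L).differentiableWithinAt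
  have hb : ∀ w ∈ Metric.sphere Q 1, ‖φ w-L‖ ≤ ε/2 := by
    intro w hw
    have := hY w.im ((le_max_left Y 0).trans (hball w (Metric.sphere_subset_closedBall hw))) w rfl
    rw [dist_eq_norm] at this
    exact this.le
  have := norm_deriv_le_of_forall_mem_sphere_norm_le one_pos hd hb
  rw [deriv_sub_const] at this
  rw [dist_zero_right]
  linarith
def mkCusp (φ : ℂ → ℂ) (k : ℕ) (hφ : DifferentiableOn ℂ φ HH)
    (hT : ∀ Q ∈ HH, φ (Q+1) = φ Q) (hS : ∀ Q ∈ HH, φ (-1/Q) = Q^k*φ Q)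
    (h0 : Tendsto φ imInf (𝓝 0)) : CuspForm 𝒮ℒ (k : ℤ) := by
  have hS' : (fun z : ℍ => φ z) ∣[(k:ℤ)] ModularGroup.S = (fun z : ℍ => φ z) := by
    ext z
    rw [ModularForm.SL_slash_apply, UpperHalfPlane.modular_S_smul, UpperHalfPlane.coe_mk]
    rw [ModularGroup.denom_S]
    have h1 : ((-(z:ℂ))⁻¹ : ℂ) = -1/z := by rw [inv_neg, neg_div, one_div]
    rw [h1, hS _ z.im_pos]
    have hz : (z:ℂ) ≠ 0 := UpperHalfPlane.ne_zero z
    rw [zpow_neg, zpow_natCast]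
    field_simp
  have hT' : (fun z : ℍ => φ z) ∣[(k:ℤ)] ModularGroup.T = (fun z : ℍ => φ z) := by
    ext z
    rw [ModularForm.SL_slash_apply, UpperHalfPlane.modular_T_smul]
    have : UpperHalfPlane.denom (ModularGroup.T : GL (Fin 2) ℝ) z = 1 := by
      rw [ModularGroup.denom_apply]; simp [ModularGroup.T]
    rw [this]
    simp only [UpperHalfPlane.coe_vadd, one_zpow, mul_one]
    rw [add_comm]
    simpa using hT _ z.im_pos
  exact {
    toFun := fun z => φ z
    slash_action_eq' := by
      rintro A ⟨A, rfl⟩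
      exact SlashInvariantForm.slash_action_generators_SL2Z hS' hT' A
    holo' := by
      rw [UpperHalfPlane.mdifferentiable_iff]
      refine hφ.congr fun z hz ↦ ?_
      have := UpperHalfPlane.ofComplex_apply_of_im_pos hz
      simp [this]
    zero_at_cusps' := by
      intro c hc
      rw [Subgroup.IsArithmetic.isCusp_iff_isCusp_SL2Z] at hc
      rw [OnePoint.isZeroAt_iff_forall_SL2Z hc]
      intro γ _
      rw [SlashInvariantForm.slash_action_generators_SL2Z hS' hT']
      rw [UpperHalfPlane.IsZeroAtImInfty, UpperHalfPlane.atImInfty]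
      refine h0.comp ?_
      rw [tendsto_comap_iff]
      exact tendsto_comap }
lemma cusp_four {φ : ℂ → ℂ} (hφ : DifferentiableOn ℂ φ HH)
    (hT : ∀ Q ∈ HH, φ (Q+1) = φ Q) (hS : ∀ Q ∈ HH, φ (-1/Q) = Q^4*φ Q)
    (h0 : Tendsto φ imInf (𝓝 0)) : ∀ Q ∈ HH, φ Q = 0 := by
  intro Q hQ
  have h1 := rank_zero_iff_forall_zero.1
    (CuspForm.rank_eq_zero_of_weight_lt_twelve (k := ((4:ℕ):ℤ)) (by norm_num))
    (mkCusp φ 4 hφ hT hS h0)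
  have h2 := DFunLike.congr_fun h1 (⟨Q, hQ⟩ : ℍ)
  exact h2
lemma cusp_twelve {φ : ℂ → ℂ} (hφ : DifferentiableOn ℂ φ HH)
    (hT : ∀ Q ∈ HH, φ (Q+1) = φ Q) (hS : ∀ Q ∈ HH, φ (-1/Q) = Q^12*φ Q)
    (h0 : Tendsto φ imInf (𝓝 0)) : ∃ c : ℂ, ∀ Q : ℍ, φ Q = c*ModularForm.discriminant Q := by
  obtain ⟨c, hc⟩ := CuspForm.exists_smul_discriminant_of_weight_eq_twelve (mkCusp φ 12 hφ hT hS h0)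
  refine ⟨c, fun Q => ?_⟩
  exact (DFunLike.congr_fun hc Q).symm
def thA (Q : ℂ) : ℂ := cexp (π*I*Q)*jacobiTheta₂ (Q/2) Q^4
def thB (Q : ℂ) : ℂ := jacobiTheta₂ (1/2) Q^4
def thC (Q : ℂ) : ℂ := jacobiTheta₂ 0 Q^4
lemma jt_add_one (z Q : ℂ) : jacobiTheta₂ z (Q+1) = jacobiTheta₂ (z+1/2) Q := by
  refine tsum_congr (fun n ↦ ?_)
  simp only [jacobiTheta₂_term]
  have hn : ∃ k : ℤ, (n:ℂ)^2 = n+2*k := by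
    obtain ⟨k, hk⟩ := Int.even_mul_succ_self n
    refine ⟨k-n, ?_⟩
    have h2 : (n*(n+1) : ℂ) = k+k := by exact_mod_cast hk
    push_cast
    linear_combination h2
  obtain ⟨k, hk⟩ := hn
  rw [Complex.exp_eq_exp_iff_exists_int]
  refine ⟨k, ?_⟩
  have : (π*I*(n:ℂ)^2*(Q+1)) = π*I*n^2*Q+π*I*(n+2*k) := by
    rw [← hk]; ring
  rw [this]; ring
lemma thA_add_one (Q : ℂ) : thA (Q+1) = -thA Q := by
  have h1 : (Q+1)/2+1/2 = Q/2+1 := by ring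
  rw [thA, jt_add_one, h1, jacobiTheta₂_add_left, thA, mul_add, Complex.exp_add, mul_one,
    Complex.exp_pi_mul_I]
  ring
lemma thB_add_one (Q : ℂ) : thB (Q+1) = thC Q := by
  have h1 : (1/2+1/2 : ℂ) = 0+1 := by ring
  rw [thB, jt_add_one, h1, jacobiTheta₂_add_left, thC]
lemma thC_add_one (Q : ℂ) : thC (Q+1) = thB Q := by
  rw [thC, jt_add_one, zero_add, thB]
lemma jt_pow_four (z : ℂ) {Q : ℂ} (hQ : Q ∈ HH) :
    jacobiTheta₂ (z/Q) (-1/Q)^4 =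
      -Q^2*cexp (4*(π*I*z^2/Q))*jacobiTheta₂ z Q^4 := by
  have hQ0 := HH_ne_zero hQ
  have h1 := jacobiTheta₂_functional_equation z Q
  have h2 : ((-I*Q)^(1/2 : ℂ))^4 = -Q^2 := by
    rw [← Complex.cpow_nat_mul]
    have : ((4:ℕ):ℂ)*(1/2) = ((2:ℕ):ℂ) := by norm_num
    rw [this, Complex.cpow_natCast, mul_pow, neg_sq, I_sq]; ring
  have h3 : (-I*Q)^(1/2 : ℂ) ≠ 0 := by
    intro h; rw [h] at h2; simp at h2; exact hQ0 h2
  rw [h1, mul_pow, mul_pow, div_pow, h2, ← Complex.exp_nat_mul]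
  have h4 : cexp (4*(π*I*z^2/Q))*cexp ((4:ℕ)*(-π*I*z^2/Q)) = 1 := by
    rw [← Complex.exp_add, ← Complex.exp_zero]; congr 1; push_cast; ring
  have h5 : (-Q^2)*(1^4/(-Q^2)) = 1 := by field_simp
  linear_combination (-1 : ℂ)*(cexp (4*(π*I*z^2/Q)) *
    cexp ((4:ℕ)*(-π*I*z^2/Q))*jacobiTheta₂ (z/Q) (-1/Q)^4)*h5 -
    jacobiTheta₂ (z/Q) (-1/Q)^4*h4
lemma thC_S (hQ : Q ∈ HH) : thC (-1/Q) = -Q^2*thC Q := by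
  have := jt_pow_four 0 hQ
  simpa [thC] using this
lemma thA_S (hQ : Q ∈ HH) : thA (-1/Q) = -Q^2*thB Q := by
  have hQ0 := HH_ne_zero hQ
  have h := jt_pow_four (1/2) hQ
  have h1 : -1/Q/2 = -((1/2)/Q) := by ring
  have h2 : cexp (π*I*(-1/Q))*cexp (4*(π*I*(1/2)^2/Q)) = 1 := by
    rw [← Complex.exp_add]
    have : π*I*(-1/Q)+4*(π*I*(1/2)^2/Q) = 0 := by ring
    rw [this, Complex.exp_zero]
  rw [thA, h1, jacobiTheta₂_neg_left, h, thB]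
  linear_combination (-Q^2*jacobiTheta₂ (1/2) Q^4)*h2
lemma thB_S (hQ : Q ∈ HH) : thB (-1/Q) = -Q^2*thA Q := by
  have hQ0 := HH_ne_zero hQ
  have h := thA_S (HH_neg_inv hQ)
  have h1 : -1/(-1/Q) = Q := by field_simp
  rw [h1] at h
  rw [h]; field_simp
lemma jt_diff {a : ℂ → ℂ} {Q : ℂ} (hQ : Q ∈ HH) (ha : DifferentiableAt ℂ a Q) :
    DifferentiableAt ℂ (fun Q => jacobiTheta₂ (a Q) Q) Q := by
  have h1 := (hasFDerivAt_jacobiTheta₂ (a Q) hQ).differentiableAt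
  exact DifferentiableAt.comp (f := fun Q : ℂ => (a Q, Q)) Q h1 (ha.prodMk differentiableAt_id)
lemma thA_diffAt (hQ : Q ∈ HH) : DifferentiableAt ℂ thA Q := by
  unfold thA
  have h1 : DifferentiableAt ℂ (fun Q => jacobiTheta₂ (Q/2) Q) Q :=
    jt_diff hQ (by fun_prop)
  exact DifferentiableAt.mul (by fun_prop) (h1.pow 4)
lemma thB_diffAt (hQ : Q ∈ HH) : DifferentiableAt ℂ thB Q :=
  (differentiableAt_jacobiTheta₂_snd _ hQ).pow 4
lemma thC_diffAt (hQ : Q ∈ HH) : DifferentiableAt ℂ thC Q :=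
  (differentiableAt_jacobiTheta₂_snd _ hQ).pow 4
lemma tendsto_jt_half : Tendsto (fun Q => jacobiTheta₂ (Q/2) Q) imInf (𝓝 2) := by
  have key : Tendsto (fun Q => ∑' n : ℤ, jacobiTheta₂_term n (Q/2) Q) imInf
      (𝓝 (∑' n : ℤ, if n ∈ ({0, -1} : Finset ℤ) then (1:ℂ) else 0)) := by
    refine tendsto_tsum_of_dominated_convergence
      (bound := fun n : ℤ => rexp (-π*(1*n^2-2*(1/2)*|n|))) ?_ ?_ ?_
    · simpa using summable_pow_mul_jacobiTheta₂_term_bound (1/2) one_pos 0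
    · intro n
      by_cases hn : n ∈ ({0, -1} : Finset ℤ)
      · rw [if_pos hn]
        refine tendsto_const_nhds.congr fun Q => ?_
        simp only [Finset.mem_insert, Finset.mem_singleton] at hn
        rcases hn with rfl | rfl
        · simp [jacobiTheta₂_term]
        · rw [jacobiTheta₂_term, ← Complex.exp_zero]; congr 1; push_cast; ring
      · rw [if_neg hn, tendsto_zero_iff_norm_tendsto_zero]
        have hn2 : (1:ℝ) ≤ (n:ℝ)^2+n := by
          have : 1 ≤ n^2+n := by
            simp only [Finset.mem_insert, Finset.mem_singleton, not_or] at hn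
            rcases lt_trichotomy n 0 with h | h | h
            · have : n ≤ -2 := by omega
              nlinarith
            · omega
            · nlinarith
          exact_mod_cast this
        have h1 : ∀ Q : ℂ, ‖jacobiTheta₂_term n (Q/2) Q‖ =
            rexp (-(π*(n^2+n))*Q.im) := by
          intro Q
          rw [norm_jacobiTheta₂_term]; congr 1
          simp; ring
        simp_rw [h1]
        apply Real.tendsto_exp_atBot.comp
        apply (tendsto_comap (f := Complex.im) (x := atTop)).const_mul_atTop_of_neg
        nlinarith [Real.pi_pos]
    · filter_upwards [eventually_imInf 1] with Q hQ n
      rw [norm_jacobiTheta₂_term, Real.exp_le_exp]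
      have hn2 : (0:ℝ) ≤ (n:ℝ)^2+n := by
        have : 0 ≤ n^2+n := by
          rcases lt_trichotomy n 0 with h | h | h <;> nlinarith
        exact_mod_cast this
      have h2 : (Q/2).im = Q.im/2 := by simp
      rw [h2]
      have h3 : -|(n:ℝ)| ≤ n := neg_abs_le _
      have h4 : ((n:ℝ)^2+n) ≤ ((n:ℝ)^2+n)*Q.im := le_mul_of_one_le_right hn2 hQ.le
      have h5 : ((n:ℝ)^2-|(n:ℝ)|) ≤ ((n:ℝ)^2+n)*Q.im := by linarith
      have := mul_le_mul_of_nonneg_left h5 Real.pi_pos.le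
      push_cast
      nlinarith
  have h2 : (∑' n : ℤ, if n ∈ ({0, -1} : Finset ℤ) then (1:ℂ) else 0) = 2 := by
    rw [tsum_eq_sum (s := ({0, -1} : Finset ℤ)) (fun n hn => if_neg hn)]
    rw [Finset.sum_pair (by norm_num)]; norm_num
  rw [h2] at key
  exact key
lemma norm_cexp_pi (Q : ℂ) : ‖cexp (π*I*Q)‖ = rexp (-π*Q.im) := by
  rw [Complex.norm_exp]; congr 1; simp
lemma tendsto_cexp_pi : Tendsto (fun Q => cexp (π*I*Q)) imInf (𝓝 0) := by
  rw [tendsto_zero_iff_norm_tendsto_zero]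
  simp_rw [norm_cexp_pi]
  apply Real.tendsto_exp_atBot.comp
  exact (tendsto_comap (f := Complex.im) (x := atTop)).const_mul_atTop_of_neg
    (by linarith [Real.pi_pos])
lemma tendsto_thA : Tendsto thA imInf (𝓝 0) := by
  simpa using! tendsto_cexp_pi.mul (tendsto_jt_half.pow 4)
lemma thC_eq (Q : ℂ) : thC Q = jacobiTheta Q^4 := by
  rw [thC, jacobiTheta_eq_jacobiTheta₂]
lemma tendsto_thC : Tendsto thC imInf (𝓝 1) := by
  have h : Tendsto jacobiTheta imInf (𝓝 1) := by
    have h1 := isBigO_at_im_infty_jacobiTheta_sub_one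
    have h2 : Tendsto (fun Q : ℂ => rexp (-π*Q.im)) imInf (𝓝 0) := by
      have := tendsto_cexp_pi.norm
      simpa [norm_cexp_pi] using this
    have := h1.trans_tendsto h2
    simpa using this.add_const 1
  have := h.pow 4
  rw [one_pow] at this
  exact this.congr fun Q => (thC_eq Q).symm
lemma tendsto_add_one : Tendsto (fun Q : ℂ => Q+1) imInf imInf := by
  rw [tendsto_comap_iff]
  refine (tendsto_comap (f := Complex.im) (x := atTop)).congr fun Q => ?_
  simp
lemma tendsto_thB : Tendsto thB imInf (𝓝 1) :=
  (tendsto_thC.comp tendsto_add_one).congr thC_add_one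
lemma jacobi_id (hQ : Q ∈ HH) : thC Q = thA Q+thB Q := by
  have := cusp_four (φ := fun Q => (thC Q-thA Q-thB Q)^2) ?_ ?_ ?_ ?_ Q hQ
  · have h := pow_eq_zero_iff (two_ne_zero) |>.1 this
    linear_combination h
  · intro w hw
    exact (((thC_diffAt hw).sub (thA_diffAt hw)).sub (thB_diffAt hw)).pow 2
      |>.differentiableWithinAt
  · intro w hw
    simp only [thA_add_one, thB_add_one, thC_add_one]; ring
  · intro w hw
    simp only [thA_S hw, thB_S hw, thC_S hw]; ring
  · have := ((tendsto_thC.sub tendsto_thA).sub tendsto_thB).pow 2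
    simpa using! this
def thD (Q : ℂ) : ℂ := thA Q*thB Q*(thA Q+thB Q)
lemma thD_diffAt (hQ : Q ∈ HH) : DifferentiableAt ℂ thD Q :=
  ((thA_diffAt hQ).mul (thB_diffAt hQ)).mul ((thA_diffAt hQ).add (thB_diffAt hQ))
lemma thB_add_one' (hQ : Q ∈ HH) : thB (Q+1) = thA Q+thB Q := by
  rw [thB_add_one, jacobi_id hQ]
lemma thD_add_one (hQ : Q ∈ HH) : thD (Q+1) = -thD Q := by
  rw [thD, thD, thA_add_one, thB_add_one' hQ]; ring
lemma thD_S (hQ : Q ∈ HH) : thD (-1/Q) = -Q^6*thD Q := by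
  rw [thD, thD, thA_S hQ, thB_S hQ]; ring
lemma tendsto_thD : Tendsto thD imInf (𝓝 0) := by
  have := (tendsto_thA.mul tendsto_thB).mul (tendsto_thA.add tendsto_thB)
  simpa using! this
lemma eventually_thA_ne : ∀ᶠ Q in imInf, thA Q ≠ 0 := by
  filter_upwards [tendsto_jt_half.eventually_ne (two_ne_zero)] with Q hQ
  exact mul_ne_zero (exp_ne_zero _) (pow_ne_zero _ hQ)
lemma eventually_thD_ne : ∀ᶠ Q in imInf, thD Q ≠ 0 := by
  filter_upwards [eventually_thA_ne, tendsto_thB.eventually_ne one_ne_zero,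
    tendsto_thC.eventually_ne one_ne_zero, eventually_imInf 0] with Q h1 h2 h3 h4
  rw [jacobi_id h4] at h3
  exact mul_ne_zero (mul_ne_zero h1 h2) h3
lemma thD_sq : ∃ c : ℂ, c ≠ 0 ∧ ∀ Q : ℍ, thD Q^2 = c*ModularForm.discriminant Q := by
  obtain ⟨c, hc⟩ := cusp_twelve (φ := fun Q => thD Q^2)
    (fun w hw => ((thD_diffAt hw).pow 2).differentiableWithinAt)
    (fun w hw => by simp only [thD_add_one hw]; ring)
    (fun w hw => by simp only [thD_S hw]; ring)
    (by simpa using! tendsto_thD.pow 2)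
  refine ⟨c, ?_, hc⟩
  rintro rfl
  obtain ⟨Q, h1, h2⟩ := (eventually_thD_ne.and (eventually_imInf 0)).exists
  have := hc ⟨Q, h2⟩
  rw [zero_mul] at this
  exact h1 (pow_eq_zero_iff two_ne_zero |>.1 this)
lemma thD_ne (hQ : Q ∈ HH) : thD Q ≠ 0 := by
  obtain ⟨c, hc, h⟩ := thD_sq
  intro h0
  have h1 := h ⟨Q, hQ⟩
  have h2 : thD ((⟨Q, hQ⟩ : ℍ) : ℂ) = 0 := h0
  rw [h2] at h1
  have h3 := mul_ne_zero hc (ModularForm.discriminant_ne_zero ⟨Q, hQ⟩)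
  rw [← h1] at h3
  simp at h3
lemma thA_ne (hQ : Q ∈ HH) : thA Q ≠ 0 := by
  intro h; exact thD_ne hQ (by rw [thD, h]; ring)
lemma thB_ne (hQ : Q ∈ HH) : thB Q ≠ 0 := by
  intro h; exact thD_ne hQ (by rw [thD, h]; ring)
lemma thAB_ne (hQ : Q ∈ HH) : thA Q+thB Q ≠ 0 := by
  intro h; exact thD_ne hQ (by rw [thD, h]; ring)
lemma deriv_S {f g : ℂ → ℂ} {k : ℕ} (hfg : ∀ Q ∈ HH, f (-1/Q) = -Q^k*g Q) {Q : ℂ}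
    (hQ : Q ∈ HH) (hf : DifferentiableAt ℂ f (-1/Q)) (hg : DifferentiableAt ℂ g Q) :
    deriv f (-1/Q) = -Q^2*(k*Q^(k-1)*g Q+Q^k*deriv g Q) := by
  have hQ0 := HH_ne_zero hQ
  have h1 : HasDerivAt (fun Q : ℂ => -1/Q) (1/Q^2) Q := by
    have := (hasDerivAt_inv hQ0).neg
    have e : (fun Q : ℂ => -1/Q) = -fun y => y⁻¹ := by ext w; simp [neg_div]
    rw [e]
    simpa using this
  have h2 : HasDerivAt (fun w => f (-1/w)) (deriv f (-1/Q)*(1/Q^2)) Q :=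
    HasDerivAt.comp Q hf.hasDerivAt h1
  have h3 : HasDerivAt (fun w => -w^k*g w)
      (-(k*Q^(k-1))*g Q + -Q^k*deriv g Q) Q :=
    (hasDerivAt_pow k Q).neg.mul hg.hasDerivAt
  have h4 : (fun w => f (-1/w)) =ᶠ[𝓝 Q] fun w => -w^k*g w := by
    filter_upwards [HH_mem_nhds hQ] with w hw using hfg w hw
  have h5 := (h3.congr_of_eventuallyEq h4).unique h2
  generalize deriv f (-1/Q) = d at h5 ⊢
  have h6 : d = (d*(1/Q^2))*Q^2 := by field_simp
  rw [h6, ← h5]; ring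
lemma deriv_T {f g : ℂ → ℂ} (hfg : ∀ Q ∈ HH, f (Q+1) = g Q) {Q : ℂ}
    (hQ : Q ∈ HH) : deriv f (Q+1) = deriv g Q := by
  rw [← deriv_comp_add_const]
  apply Filter.EventuallyEq.deriv_eq
  filter_upwards [HH_mem_nhds hQ] with w hw using hfg w hw
lemma thA_S' (hQ : Q ∈ HH) :
    deriv thA (-1/Q) = -Q^2*(2*Q*thB Q+Q^2*deriv thB Q) := by
  simpa using deriv_S (k := 2) (fun Q hQ => thA_S hQ) hQ (thA_diffAt (HH_neg_inv hQ)) (thB_diffAt hQ)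
lemma thB_S' (hQ : Q ∈ HH) :
    deriv thB (-1/Q) = -Q^2*(2*Q*thA Q+Q^2*deriv thA Q) := by
  simpa using deriv_S (k := 2) (fun Q hQ => thB_S hQ) hQ (thB_diffAt (HH_neg_inv hQ)) (thA_diffAt hQ)
lemma thA_T' (hQ : Q ∈ HH) : deriv thA (Q+1) = -deriv thA Q := by
  rw [deriv_T (g := fun w => -thA w) (fun w hw => thA_add_one w) hQ, deriv.fun_neg]
lemma thB_T' (hQ : Q ∈ HH) : deriv thB (Q+1) = deriv thA Q+deriv thB Q := by
  rw [deriv_T (g := fun w => thA w+thB w) (fun w hw => thB_add_one' hw) hQ,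
    deriv_fun_add (thA_diffAt hQ) (thB_diffAt hQ)]
lemma diffOn_deriv {f : ℂ → ℂ} (hf : ∀ Q ∈ HH, DifferentiableAt ℂ f Q) :
    ∀ Q ∈ HH, DifferentiableAt ℂ (deriv f) Q := by
  intro Q hQ
  have h : DifferentiableOn ℂ f HH := fun w hw => (hf w hw).differentiableWithinAt
  exact (h.deriv isOpen_HH).differentiableAt (HH_mem_nhds hQ)
lemma tendsto_thA_logderiv : Tendsto (fun Q => deriv thA Q/thA Q) imInf (𝓝 (π*I)) := by
  set a : ℂ → ℂ := fun Q => jacobiTheta₂ (Q/2) Q^4 with ha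
  have hlim : Tendsto a imInf (𝓝 (2^4)) := tendsto_jt_half.pow 4
  have hd : ∀ Q ∈ HH, DifferentiableAt ℂ a Q := fun Q hQ =>
    DifferentiableAt.pow (jt_diff hQ (by fun_prop)) 4
  have hd' := deriv_tendsto_zero (fun Q hQ => (hd Q hQ).differentiableWithinAt) hlim
  have h1 : Tendsto (fun Q => π*I+deriv a Q/a Q) imInf (𝓝 (π*I+0/2^4)) :=
    tendsto_const_nhds.add (hd'.div hlim (by norm_num))
  rw [zero_div, add_zero] at h1
  refine h1.congr' ?_
  filter_upwards [eventually_imInf 0] with Q hQ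
  have h2 : HasDerivAt thA (cexp (π*I*Q)*(π*I)*a Q+cexp (π*I*Q)*deriv a Q) Q := by
    have h3 : HasDerivAt (fun Q => cexp (π*I*Q)) (cexp (π*I*Q)*(π*I)) Q := by
      have := ((hasDerivAt_id Q).const_mul (π*I)).cexp
      simpa using this
    exact h3.mul (hd Q hQ).hasDerivAt
  have h4 : a Q ≠ 0 := by
    intro h; apply thA_ne (Q := Q) hQ; change _*a Q = 0; rw [h, mul_zero]
  rw [h2.deriv]
  change _ = _/(cexp (π*I*Q)*a Q)
  have h5 := exp_ne_zero (π*I*Q)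
  field_simp
lemma wronskian (hQ : Q ∈ HH) :
    deriv thA Q*thB Q-thA Q*deriv thB Q = π*I*thD Q := by
  set W : ℂ → ℂ := fun Q => deriv thA Q*thB Q-thA Q*deriv thB Q with hW
  have hA' := diffOn_deriv (fun Q hQ => thA_diffAt hQ)
  have hB' := diffOn_deriv (fun Q hQ => thB_diffAt hQ)
  have hAl := deriv_tendsto_zero (fun Q hQ => (thA_diffAt hQ).differentiableWithinAt) tendsto_thA
  have hBl := deriv_tendsto_zero (fun Q hQ => (thB_diffAt hQ).differentiableWithinAt) tendsto_thB
  obtain ⟨c, hc⟩ := cusp_twelve (φ := fun Q => W Q*thD Q)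
    (fun w hw => ((((hA' w hw).mul (thB_diffAt hw)).sub ((thA_diffAt hw).mul (hB' w hw))).mul
      (thD_diffAt hw)).differentiableWithinAt)
    (fun w hw => by
      simp only [hW, thD_add_one hw, thA_add_one, thB_add_one' hw, thA_T' hw, thB_T' hw]; ring)
    (fun w hw => by
      simp only [hW, thD_S hw, thA_S hw, thB_S hw, thA_S' hw, thB_S' hw]; ring)
    (by simpa using! ((hAl.mul tendsto_thB).sub (tendsto_thA.mul hBl)).mul tendsto_thD)
  obtain ⟨c2, hc2, hD⟩ := thD_sq
  have hrat : ∀ Q ∈ HH, W Q = c/c2*thD Q := by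
    intro w hw
    have h1 : W w*thD w = c*ModularForm.discriminant ⟨w, hw⟩ := hc ⟨w, hw⟩
    have h2 : thD w^2 = c2*ModularForm.discriminant ⟨w, hw⟩ := hD ⟨w, hw⟩
    have h3 := thD_ne hw
    apply mul_right_cancel₀ h3
    rw [h1]
    field_simp
    linear_combination (-c)*h2
  have hlim : Tendsto (fun Q => W Q/thD Q) imInf (𝓝 (π*I)) := by
    have h1 : Tendsto (fun Q => (deriv thA Q/thA Q*thB Q-deriv thB Q) /
        (thB Q*(thA Q+thB Q))) imInf (𝓝 ((π*I*1-0)/(1*(0+1)))) := by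
      refine Tendsto.div ((tendsto_thA_logderiv.mul tendsto_thB).sub hBl)
        (tendsto_thB.mul (tendsto_thA.add tendsto_thB)) (by norm_num)
    have h0 : (π*I*1-0)/(1*(0+1)) = (π*I : ℂ) := by ring
    rw [h0] at h1
    refine h1.congr' ?_
    filter_upwards [eventually_imInf 0] with w hw
    have e1 := thA_ne (Q := w) hw
    have e2 := thB_ne (Q := w) hw
    have e3 := thAB_ne (Q := w) hw
    simp only [hW, thD]
    field_simp
  have hconst : Tendsto (fun Q => W Q/thD Q) imInf (𝓝 (c/c2)) := by
    refine tendsto_const_nhds.congr' ?_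
    filter_upwards [eventually_imInf 0] with w hw
    rw [hrat w hw, mul_div_assoc, div_self (thD_ne hw), mul_one]
  have := tendsto_nhds_unique hlim hconst
  rw [this]
  exact hrat Q hQ
def Gr (φ : ℂ → ℂ) (a : ℝ) (n : ℕ) : Prop :=
  ∀ c > 0, ∃ C : ℝ, 0 ≤ C ∧ ∀ Q : ℂ, c ≤ Q.im →
    ‖φ Q‖ ≤ C*rexp (-(a*π*Q.im))*(1+‖Q‖)^n
lemma Gr.mono {φ : ℂ → ℂ} {a b : ℝ} {n m : ℕ} (h : Gr φ a n) (hb : b ≤ a) (hm : n ≤ m) :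
    Gr φ b m := by
  intro c hc
  obtain ⟨C, hC, h⟩ := h c hc
  refine ⟨C, hC, fun Q hQ => (h Q hQ).trans ?_⟩
  have hy : 0 < Q.im := hc.trans_le hQ
  have h1 : rexp (-(a*π*Q.im)) ≤ rexp (-(b*π*Q.im)) := by
    apply Real.exp_le_exp.2
    have : b*(π*Q.im) ≤ a*(π*Q.im) := mul_le_mul_of_nonneg_right hb (by positivity)
    linarith
  have h2 : (1+‖Q‖)^n ≤ (1+‖Q‖)^m := pow_le_pow_right₀ (by simp) hm
  gcongr
lemma Gr.mul {φ ψ : ℂ → ℂ} {a b : ℝ} {n m : ℕ} (h : Gr φ a n) (h' : Gr ψ b m) :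
    Gr (fun Q => φ Q*ψ Q) (a+b) (n+m) := by
  intro c hc
  obtain ⟨C, hC, h⟩ := h c hc
  obtain ⟨D, hD, h'⟩ := h' c hc
  refine ⟨C*D, by positivity, fun Q hQ => ?_⟩
  rw [norm_mul]
  calc ‖φ Q‖*‖ψ Q‖ ≤ (C*rexp (-(a*π*Q.im))*(1+‖Q‖)^n) *
      (D*rexp (-(b*π*Q.im))*(1+‖Q‖)^m) := by
        gcongr
        · exact h Q hQ
        · exact h' Q hQ
    _ = _ := by
        rw [show -((a+b)*π*Q.im) = -(a*π*Q.im) + -(b*π*Q.im) by ring, Real.exp_add]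
        ring
lemma Gr.add {φ ψ : ℂ → ℂ} {a : ℝ} {n : ℕ} (h : Gr φ a n) (h' : Gr ψ a n) :
    Gr (fun Q => φ Q+ψ Q) a n := by
  intro c hc
  obtain ⟨C, hC, h⟩ := h c hc
  obtain ⟨D, hD, h'⟩ := h' c hc
  refine ⟨C+D, by positivity, fun Q hQ => ?_⟩
  refine (norm_add_le _ _).trans ((add_le_add (h Q hQ) (h' Q hQ)).trans (le_of_eq ?_))
  ring
lemma Gr.neg {φ : ℂ → ℂ} {a : ℝ} {n : ℕ} (h : Gr φ a n) : Gr (fun Q => -φ Q) a n := by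
  intro c hc
  obtain ⟨C, hC, h⟩ := h c hc
  exact ⟨C, hC, fun Q hQ => by rw [norm_neg]; exact h Q hQ⟩
lemma Gr.sub {φ ψ : ℂ → ℂ} {a : ℝ} {n : ℕ} (h : Gr φ a n) (h' : Gr ψ a n) :
    Gr (fun Q => φ Q-ψ Q) a n := by
  simpa only [sub_eq_add_neg] using h.add h'.neg
lemma Gr.const (k : ℂ) : Gr (fun _ => k) 0 0 := by
  intro c hc
  exact ⟨‖k‖, by positivity, fun Q _ => by simp⟩
lemma Gr.id : Gr (fun Q => Q) 0 1 := by
  intro c hc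
  exact ⟨1, by positivity, fun Q _ => by simp⟩
lemma Gr.const_mul {φ : ℂ → ℂ} {a : ℝ} {n : ℕ} (k : ℂ) (h : Gr φ a n) :
    Gr (fun Q => k*φ Q) a n := by
  simpa using (Gr.const k).mul h
lemma Gr.congr {φ ψ : ℂ → ℂ} {a : ℝ} {n : ℕ} (h : Gr φ a n) (e : ∀ Q ∈ HH, ψ Q = φ Q) :
    Gr ψ a n := by
  intro c hc
  obtain ⟨C, hC, h⟩ := h c hc
  exact ⟨C, hC, fun Q hQ => by rw [e Q (hc.trans_le hQ)]; exact h Q hQ⟩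
lemma Gr.pow {φ : ℂ → ℂ} {a : ℝ} {n : ℕ} (h : Gr φ a n) (k : ℕ) :
    Gr (fun Q => φ Q^k) (k*a) (k*n) := by
  induction k with
  | zero => simpa using Gr.const 1
  | succ k ih =>
    have := ih.mul h
    have e1 : (((k+1 : ℕ) : ℝ))*a = k*a+a := by push_cast; ring
    have e2 : (k+1)*n = k*n+n := by ring
    rw [e1, e2]
    simpa only [pow_succ] using this
lemma Gr.of_periodic {φ : ℂ → ℂ} {h : ℝ} (hh : 0 < h) {L : ℂ}
    (hφ : ∀ Q ∈ HH, DifferentiableAt ℂ φ Q) (hper : ∀ Q ∈ HH, φ (Q+h) = φ Q)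
    (hL : Tendsto φ imInf (𝓝 L)) : Gr (fun Q => φ Q-L) (2/h) 0 := by
  intro c hc
  obtain ⟨C, hC, h'⟩ := periodic_bound hh (fun Q hQ => (hφ Q hQ).differentiableWithinAt) hper hL hc
  refine ⟨C, hC.le, fun Q hQ => (h' Q hQ).trans (le_of_eq ?_)⟩
  rw [pow_zero, mul_one]; congr 2; ring
lemma Gr.of_sub {φ : ℂ → ℂ} {L : ℂ} {a : ℝ} (ha : 0 ≤ a) (h : Gr (fun Q => φ Q-L) a 0) :
    Gr φ 0 0 := by
  simpa using (h.mono ha le_rfl).add (Gr.const L)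
lemma Gr.tendsto {φ : ℂ → ℂ} {a : ℝ} (ha : 0 < a) (h : Gr φ a 0) : Tendsto φ imInf (𝓝 0) := by
  obtain ⟨C, hC, h⟩ := h 1 one_pos
  have h1 : Tendsto (fun Q : ℂ => C*rexp (-(a*π*Q.im))*(1+‖Q‖)^0) imInf (𝓝 0) := by
    simp only [pow_zero, mul_one]
    have : Tendsto (fun y : ℝ => C*rexp (-(a*π*y))) atTop (𝓝 (C*0)) := by
      refine (Real.tendsto_exp_neg_atTop_nhds_zero.comp ?_).const_mul C
      exact tendsto_id.const_mul_atTop (by positivity)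
    rw [mul_zero] at this
    exact this.comp tendsto_comap
  refine squeeze_zero_norm' ?_ h1
  filter_upwards [eventually_imInf 1] with Q hQ using h Q hQ.le
lemma gr_exp : Gr (fun Q => cexp (π*I*Q)) 1 0 := by
  intro c hc
  refine ⟨1, zero_le_one, fun Q _ => ?_⟩
  rw [norm_cexp_pi]; simp
lemma gr_exp_neg : Gr (fun Q => cexp (-(π*I*Q))) (-1) 0 := by
  intro c hc
  refine ⟨1, zero_le_one, fun Q _ => ?_⟩
  simp only [Complex.exp_neg, norm_inv, norm_cexp_pi]; simp [Real.exp_neg]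
def thA0 (Q : ℂ) : ℂ := jacobiTheta₂ (Q/2) Q^4
lemma thA_eq (Q : ℂ) : thA Q = cexp (π*I*Q)*thA0 Q := rfl
lemma thA0_eq (Q : ℂ) : thA0 Q = cexp (-(π*I*Q))*thA Q := by
  rw [thA_eq, ← mul_assoc, ← Complex.exp_add]; simp
lemma thA0_diffAt (hQ : Q ∈ HH) : DifferentiableAt ℂ thA0 Q :=
  DifferentiableAt.pow (jt_diff hQ (by fun_prop)) 4
lemma thA0_add_one (Q : ℂ) : thA0 (Q+1) = thA0 Q := by
  rw [thA0_eq, thA0_eq, thA_add_one, show -(π*I*(Q+1)) = -(π*I*Q)-π*I by ring,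
    Complex.exp_sub, Complex.exp_pi_mul_I]; ring
lemma tendsto_thA0 : Tendsto thA0 imInf (𝓝 16) := by
  have := tendsto_jt_half.pow 4
  norm_num at this
  exact this
lemma gr_thA0 : Gr (fun Q => thA0 Q-16) 2 0 := by
  have := Gr.of_periodic (h := 1) one_pos (fun Q h => thA0_diffAt h)
    (fun Q _ => by simpa using thA0_add_one Q) tendsto_thA0
  simpa using this
lemma gr_of_eq' {φ : ℂ → ℂ} {a b : ℝ} {n : ℕ} (h : Gr φ a n) (e : a = b) : Gr φ b n := e ▸ h
lemma gr_A : Gr thA 1 0 := by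
  have := gr_exp.mul (gr_thA0.of_sub (by norm_num))
  exact gr_of_eq' this (by norm_num)
lemma gr_B1 : Gr (fun Q => thB Q-1) 1 0 := by
  have := Gr.of_periodic (h := 2) two_pos (fun Q h => thB_diffAt h)
    (fun Q _ => by
      push_cast
      rw [show Q+2 = Q+1+1 by ring, thB_add_one, thC_add_one]) tendsto_thB
  simpa using this
lemma gr_B : Gr thB 0 0 := gr_B1.of_sub (by norm_num)
lemma gr_of_eq {φ : ℂ → ℂ} {a b : ℝ} {n : ℕ} (h : Gr φ a n) (e : a = b) : Gr φ b n := e ▸ h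
lemma gr_invD : Gr (fun Q => (thD Q)⁻¹) (-1) 0 := by
  have h1 : Gr (fun Q => (thA0 Q*thB Q*thC Q)⁻¹) 0 0 := by
    have hp : Tendsto (fun Q => (thA0 Q*thB Q*thC Q)⁻¹) imInf (𝓝 ((16*1*1)⁻¹)) :=
      ((tendsto_thA0.mul tendsto_thB).mul tendsto_thC).inv₀ (by norm_num)
    refine (Gr.of_periodic (h := 1) one_pos ?_ ?_ hp).of_sub (by norm_num)
    · intro Q h
      refine (((thA0_diffAt h).mul (thB_diffAt h)).mul (thC_diffAt h)).inv ?_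
      have h2 := thA_ne h
      rw [thA_eq] at h2
      refine mul_ne_zero (mul_ne_zero (right_ne_zero_of_mul h2) (thB_ne h)) ?_
      rw [jacobi_id h]; exact thAB_ne h
    · intro Q _
      push_cast
      rw [thA0_add_one, thB_add_one, thC_add_one]; ring
  refine (gr_of_eq (h1.mul gr_exp_neg) (by norm_num) : Gr _ (-1) 0).congr fun Q hQ => ?_
  rw [thD, thA_eq, ← thA_eq, ← jacobi_id hQ, thA_eq, mul_assoc, mul_assoc, mul_inv, ← Complex.exp_neg]
  ring
def tE4 (Q : ℂ) : ℂ := thA Q^2+thA Q*thB Q+thB Q^2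
def tE6 (Q : ℂ) : ℂ := (2*thA Q+thB Q)*(thA Q+2*thB Q)*(thB Q-thA Q)/2
def ts (Q : ℂ) : ℂ := 16*tE6 Q/thD Q
def tj (Q : ℂ) : ℂ := 256*tE4 Q^3/thD Q^2
def tw (Q : ℂ) : ℂ := 256*tE4 Q^2*tE6 Q/thD Q^2
def te2 (Q : ℂ) : ℂ := -(1/6)*(deriv thD Q/thD Q)
lemma tj_eq (hQ : Q ∈ HH) : tj Q = 1728+ts Q^2 := by
  have h := thD_ne hQ
  rw [tj, ts]
  field_simp
  rw [tE4, tE6, thD]; ring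
lemma tE4_diffAt (hQ : Q ∈ HH) : DifferentiableAt ℂ tE4 Q := by
  have := thA_diffAt hQ; have := thB_diffAt hQ
  unfold tE4; fun_prop
lemma tE6_diffAt (hQ : Q ∈ HH) : DifferentiableAt ℂ tE6 Q := by
  have := thA_diffAt hQ; have := thB_diffAt hQ
  unfold tE6; fun_prop
lemma ts_diffAt (hQ : Q ∈ HH) : DifferentiableAt ℂ ts Q :=
  ((tE6_diffAt hQ).const_mul 16).div (thD_diffAt hQ) (thD_ne hQ)
lemma tj_diffAt (hQ : Q ∈ HH) : DifferentiableAt ℂ tj Q :=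
  (((tE4_diffAt hQ).pow 3).const_mul 256).div ((thD_diffAt hQ).pow 2) (pow_ne_zero 2 (thD_ne hQ))
lemma tw_diffAt (hQ : Q ∈ HH) : DifferentiableAt ℂ tw Q :=
  ((((tE4_diffAt hQ).pow 2).const_mul 256).mul (tE6_diffAt hQ)).div ((thD_diffAt hQ).pow 2)
    (pow_ne_zero 2 (thD_ne hQ))
lemma te2_diffAt (hQ : Q ∈ HH) : DifferentiableAt ℂ te2 Q :=
  ((diffOn_deriv (fun _ h => thD_diffAt h) Q hQ).div (thD_diffAt hQ) (thD_ne hQ)).const_mul _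
lemma tE4_T (hQ : Q ∈ HH) : tE4 (Q+1) = tE4 Q := by
  rw [tE4, tE4, thA_add_one, thB_add_one' hQ]; ring
lemma tE6_T (hQ : Q ∈ HH) : tE6 (Q+1) = tE6 Q := by
  rw [tE6, tE6, thA_add_one, thB_add_one' hQ]; ring
lemma tE4_S (hQ : Q ∈ HH) : tE4 (-1/Q) = Q^4*tE4 Q := by
  rw [tE4, tE4, thA_S hQ, thB_S hQ]; ring
lemma tE6_S (hQ : Q ∈ HH) : tE6 (-1/Q) = Q^6*tE6 Q := by
  rw [tE6, tE6, thA_S hQ, thB_S hQ]; ring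
lemma ts_T (hQ : Q ∈ HH) : ts (Q+1) = -ts Q := by
  rw [ts, ts, tE6_T hQ, thD_add_one hQ, div_neg]
lemma ts_S (hQ : Q ∈ HH) : ts (-1/Q) = -ts Q := by
  have h0 := HH_ne_zero hQ
  have h1 := thD_ne hQ
  rw [ts, ts, tE6_S hQ, thD_S hQ]; field_simp
lemma tj_T (hQ : Q ∈ HH) : tj (Q+1) = tj Q := by
  rw [tj, tj, tE4_T hQ, thD_add_one hQ, neg_sq]
lemma tj_S (hQ : Q ∈ HH) : tj (-1/Q) = tj Q := by
  rw [tj_eq hQ, tj_eq (HH_neg_inv hQ), ts_S hQ, neg_sq]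
lemma tw_T (hQ : Q ∈ HH) : tw (Q+1) = tw Q := by
  rw [tw, tw, tE4_T hQ, tE6_T hQ, thD_add_one hQ, neg_sq]
lemma tw_S (hQ : Q ∈ HH) : tw (-1/Q) = Q^2*tw Q := by
  have h0 := HH_ne_zero hQ
  have h1 := thD_ne hQ
  rw [tw, tw, tE4_S hQ, tE6_S hQ, thD_S hQ]; field_simp
lemma thD_T' (hQ : Q ∈ HH) : deriv thD (Q+1) = -deriv thD Q := by
  rw [deriv_T (g := fun w => -thD w) (fun w hw => thD_add_one hw) hQ, deriv.fun_neg]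
lemma te2_T (hQ : Q ∈ HH) : te2 (Q+1) = te2 Q := by
  rw [te2, te2, thD_T' hQ, thD_add_one hQ, neg_div_neg_eq]
lemma te2_S (hQ : Q ∈ HH) : te2 (-1/Q) = Q^2*te2 Q-Q := by
  have h0 := HH_ne_zero hQ
  have h1 := thD_ne hQ
  have h := deriv_S (k := 6) (fun Q hQ => thD_S hQ) hQ (thD_diffAt (HH_neg_inv hQ)) (thD_diffAt hQ)
  rw [te2, te2, h, thD_S hQ]; push_cast; field_simp
  ring
lemma deriv_thD (hQ : Q ∈ HH) : deriv thD Q =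
    (deriv thA Q*thB Q+thA Q*deriv thB Q)*(thA Q+thB Q) +
      thA Q*thB Q*(deriv thA Q+deriv thB Q) :=
  (((thA_diffAt hQ).hasDerivAt.mul (thB_diffAt hQ).hasDerivAt).mul
    ((thA_diffAt hQ).hasDerivAt.add (thB_diffAt hQ).hasDerivAt)).deriv
lemma deriv_thB (hQ : Q ∈ HH) : deriv thB Q =
    thB Q*(-2*te2 Q-π*I*(2*thA Q+thB Q)/3) := by
  have h1 := deriv_thD hQ
  have h2 := wronskian hQ
  have hA := thA_ne hQ
  have hB := thB_ne hQ
  have hC := thAB_ne hQ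
  have hD := thD_ne hQ
  rw [te2, h1]
  have h3 : deriv thA Q = (thA Q*deriv thB Q+π*I*thD Q)/thB Q := by
    field_simp; linear_combination h2
  rw [h3]
  unfold thD
  field_simp
  ring
lemma deriv_thA (hQ : Q ∈ HH) : deriv thA Q =
    thA Q*(-2*te2 Q+π*I*(thA Q+2*thB Q)/3) := by
  have h2 := wronskian hQ
  have hB := thB_ne hQ
  rw [deriv_thB hQ] at h2
  have h3 : deriv thA Q*thB Q =
    (thA Q*(-2*te2 Q+π*I*(thA Q+2*thB Q)/3))*thB Q := by
    unfold thD at h2; linear_combination h2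
  exact mul_right_cancel₀ hB h3
lemma tendsto_te2 : Tendsto te2 imInf (𝓝 (-(π*I)/6)) := by
  have hA := tendsto_thA_logderiv
  have hBl := deriv_tendsto_zero (fun Q hQ => (thB_diffAt hQ).differentiableWithinAt) tendsto_thB
  have h : Tendsto (fun Q => -(1/2)*(deriv thB Q/thB Q+π*I*(2*thA Q+thB Q)/3))
      imInf (𝓝 (-(1/2)*(0/1+π*I*(2*0+1)/3))) := by
    refine Tendsto.const_mul _ ((hBl.div tendsto_thB one_ne_zero).add ?_)
    exact (((tendsto_thA.const_mul 2).add tendsto_thB).const_mul _).div_const _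
  have e : (-(1/2)*(0/1+π*I*(2*0+1)/3)) = (-(π*I)/6 : ℂ) := by ring
  rw [e] at h
  refine h.congr' ?_
  filter_upwards [eventually_imInf 0] with Q hQ
  have hB := thB_ne (Q := Q) hQ
  rw [deriv_thB hQ]; field_simp; ring
lemma gr_e2' : Gr (fun Q => te2 Q-(-(π*I)/6)) 2 0 := by
  have := Gr.of_periodic (h := 1) one_pos (fun Q h => te2_diffAt h)
    (fun Q h => by simpa using te2_T h) tendsto_te2
  simpa using this
lemma tendsto_tE4 : Tendsto tE4 imInf (𝓝 1) := by
  have := ((tendsto_thA.pow 2).add (tendsto_thA.mul tendsto_thB)).add (tendsto_thB.pow 2)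
  norm_num at this
  exact this
lemma tendsto_tE6 : Tendsto tE6 imInf (𝓝 1) := by
  have := ((((tendsto_thA.const_mul 2).add tendsto_thB).mul
    (tendsto_thA.add (tendsto_thB.const_mul 2))).mul (tendsto_thB.sub tendsto_thA)).div_const 2
  norm_num at this
  exact this
lemma gr_E4' : Gr (fun Q => tE4 Q-1) 2 0 := by
  have := Gr.of_periodic (h := 1) one_pos (fun Q h => tE4_diffAt h)
    (fun Q h => by simpa using tE4_T h) tendsto_tE4
  simpa using this
lemma gr_E6' : Gr (fun Q => tE6 Q-1) 2 0 := by
  have := Gr.of_periodic (h := 1) one_pos (fun Q h => tE6_diffAt h)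
    (fun Q h => by simpa using tE6_T h) tendsto_tE6
  simpa using this
lemma gr_E4 : Gr tE4 0 0 := gr_E4'.of_sub (by norm_num)
lemma gr_E6 : Gr tE6 0 0 := gr_E6'.of_sub (by norm_num)
lemma gr_e2 : Gr te2 0 0 := gr_e2'.of_sub (by norm_num)
lemma gr_invD2 : Gr (fun Q => 256*(thD Q)⁻¹^2) (-2) 0 :=
  gr_of_eq ((gr_invD.pow 2).const_mul 256) (by norm_num)
lemma gr_j : Gr tj (-2) 0 := by
  refine (gr_of_eq ((gr_E4.pow 3).mul gr_invD2) (by norm_num) : Gr _ (-2) _).congr fun Q _ => ?_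
  rw [tj]; ring
lemma gr_w : Gr tw (-2) 0 := by
  refine (gr_of_eq (((gr_E4.pow 2).mul gr_E6).mul gr_invD2) (by norm_num) : Gr _ (-2) _).congr
    fun Q _ => ?_
  rw [tw]; ring
lemma deriv_ts (hQ : Q ∈ HH) :
    HasDerivAt ts (-16*π*I*tE4 Q^2/thD Q) Q := by
  have hA := (thA_diffAt hQ).hasDerivAt
  have hB := (thB_diffAt hQ).hasDerivAt
  have hD := (thD_diffAt hQ).hasDerivAt
  have h6 : HasDerivAt tE6 _ Q :=
    ((((hA.const_mul 2).add hB).mul (hA.add (hB.const_mul 2))).mul (hB.sub hA)).div_const 2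
  have h := (h6.const_mul 16).div hD (thD_ne hQ)
  refine h.congr_deriv ?_
  have h0 := thD_ne hQ
  have hD' : deriv thD Q = -6*te2 Q*thD Q := by rw [te2]; field_simp
  rw [hD', deriv_thA hQ, deriv_thB hQ]
  field_simp
  simp only [Pi.add_apply, Pi.mul_apply, Pi.sub_apply]
  unfold tE4 tE6
  ring
end
section
open MeasureTheory
lemma hol_integral' {α : Type*} [MeasurableSpace α] {μ : Measure α} {F : ℂ → α → ℂ} {U : Set ℂ}
    (hU : IsOpen U) {bound : α → ℝ} (hb : Integrable bound μ)
    (hm : ∀ Q ∈ U, AEStronglyMeasurable (F Q) μ)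
    (hd : ∀ᵐ t ∂μ, DifferentiableOn ℂ (fun Q => F Q t) U)
    (hle : ∀ᵐ t ∂μ, ∀ Q ∈ U, ‖F Q t‖ ≤ bound t) :
    ∀ x₀ ∈ U, Integrable (fun t => deriv (fun Q => F Q t) x₀) μ ∧
      HasDerivAt (fun Q => ∫ t, F Q t ∂μ) (∫ t, deriv (fun Q => F Q t) x₀ ∂μ) x₀ := by
  intro x₀ hx₀
  obtain ⟨R, hR, hball⟩ := Metric.isOpen_iff.1 hU x₀ hx₀
  have hR2 : 0 < R/2 := by positivity
  have hsub : ∀ x ∈ Metric.ball x₀ (R/2), Metric.closedBall x (R/2) ⊆ Metric.closedBall x (R/2) ∩ U := by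
    intro x hx y hy
    refine ⟨hy, hball ?_⟩
    rw [Metric.mem_ball] at *
    rw [Metric.mem_closedBall] at hy
    calc dist y x₀ ≤ dist y x+dist x x₀ := dist_triangle _ _ _
      _ < R := by linarith
  have hxU : ∀ x ∈ Metric.ball x₀ (R/2), x ∈ U := fun x hx =>
    hball (Metric.ball_subset_ball (by linarith) hx)
  have hI : ∀ x ∈ U, Integrable (F x) μ := fun x hx =>
    hb.mono' (hm x hx) (hle.mono fun t ht => ht x hx)
  have key := hasDerivAt_integral_of_dominated_loc_of_deriv_le (𝕜 := ℂ) (μ := μ) (F := F)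
    (F' := fun x t => deriv (fun Q => F Q t) x) (x₀ := x₀)
    (s := Metric.ball x₀ (R/2)) (bound := fun t => bound t/(R/2))
    (Metric.ball_mem_nhds x₀ hR2) ?_ (hI x₀ hx₀) ?_ ?_ (hb.div_const _) ?_
  · exact key
  · filter_upwards [hU.mem_nhds hx₀] with x hx using hm x hx
  · have hseq : ∀ n : ℕ, x₀+((R/2)/(n+1) : ℝ) ∈ U := by
      intro n
      apply hball
      rw [Metric.mem_ball, dist_eq_norm]
      simp only [add_sub_cancel_left, Complex.norm_real, Real.norm_eq_abs]
      rw [abs_of_pos (by positivity)]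
      have : R/2/(n+1) ≤ R/2 := div_le_self (by positivity) (by linarith [n.cast_nonneg (α := ℝ)])
      linarith
    refine aestronglyMeasurable_of_tendsto_ae atTop (f := fun n : ℕ => fun t =>
      (((R/2)/(n+1) : ℝ) : ℂ)⁻¹ • (F (x₀+((R/2)/(n+1) : ℝ)) t-F x₀ t)) ?_ ?_
    · intro n
      exact ((hm _ (hseq n)).sub (hm _ hx₀)).const_smul (((R/2)/(n+1) : ℝ) : ℂ)⁻¹
    · filter_upwards [hd] with t ht
      have h1 := (ht.differentiableAt (hU.mem_nhds hx₀)).hasDerivAt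
      have h2 := h1.tendsto_slope_zero
      refine h2.comp (f := fun n : ℕ => (((R/2)/(n+1) : ℝ) : ℂ)) ?_
      rw [tendsto_nhdsWithin_iff]
      constructor
      · have h3 : Tendsto (fun n : ℕ => (R/2)/((n:ℝ)+1)) atTop (𝓝 0) :=
          tendsto_const_nhds.div_atTop (tendsto_natCast_atTop_atTop.atTop_add tendsto_const_nhds)
        have := (Complex.continuous_ofReal.tendsto 0).comp h3
        rw [Complex.ofReal_zero] at this
        exact this
      · refine Eventually.of_forall fun n => ?_
        have : (R/2)/((n:ℝ)+1) ≠ 0 := by positivity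
        exact Complex.ofReal_ne_zero.2 this
  · filter_upwards [hd, hle] with t ht hlt x hx
    refine Complex.norm_deriv_le_of_forall_mem_sphere_norm_le hR2 ?_ ?_
    · refine (ht.mono ?_).diffContOnCl_ball (U := U) ?_
      · exact fun y hy => hy
      · exact fun y hy => (hsub x hx hy).2
    · intro z hz
      exact hlt z (hsub x hx (Metric.sphere_subset_closedBall hz)).2
  · filter_upwards [hd] with t ht x hx
    exact (ht.differentiableAt (hU.mem_nhds (hxU x hx))).hasDerivAt
lemma hol_integral {α : Type*} [MeasurableSpace α] {μ : Measure α} {F : ℂ → α → ℂ} {U : Set ℂ}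
    (hU : IsOpen U) {bound : α → ℝ} (hb : Integrable bound μ)
    (hm : ∀ Q ∈ U, AEStronglyMeasurable (F Q) μ)
    (hd : ∀ᵐ t ∂μ, DifferentiableOn ℂ (fun Q => F Q t) U)
    (hle : ∀ᵐ t ∂μ, ∀ Q ∈ U, ‖F Q t‖ ≤ bound t) :
    DifferentiableOn ℂ (fun Q => ∫ t, F Q t ∂μ) U := fun x hx =>
  (hol_integral' hU hb hm hd hle x hx).2.differentiableAt.differentiableWithinAt
def lm (Q : ℂ) : ℂ := -π*∫ t in Ioi (0:ℝ), thA (Q+I*t)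
def ll (Q : ℂ) : ℂ := lm (-1/Q)
lemma isOpen_im_gt (c : ℝ) : IsOpen {Q : ℂ | c < Q.im} := isOpen_lt continuous_const continuous_im
lemma HH_shift (hQ : Q ∈ HH) {t : ℝ} (ht : 0 ≤ t) : Q+I*t ∈ HH := by
  have : 0 < Q.im := hQ
  simp only [HH, mem_ofPred_eq, add_im, mul_im, I_re, ofReal_im, I_im, ofReal_re]
  linarith
lemma thA_vert_bound {c : ℝ} (hc : 0 < c) : ∃ C : ℝ, 0 ≤ C ∧ ∀ Q : ℂ, c ≤ Q.im → ∀ t : ℝ, 0 ≤ t →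
    ‖thA (Q+I*t)‖ ≤ C*rexp (-π*Q.im)*rexp (-π*t) := by
  obtain ⟨C, hC, h⟩ := gr_A c hc
  refine ⟨C, hC, fun Q hQ t ht => ?_⟩
  have := h (Q+I*t) (by simp; linarith)
  refine this.trans (le_of_eq ?_)
  rw [mul_assoc C (rexp _) (rexp _), ← Real.exp_add, pow_zero, mul_one]
  congr 2
  simp
  ring
lemma thA_vert_cont (hQ : Q ∈ HH) : ContinuousOn (fun t : ℝ => thA (Q+I*t)) (Ici 0) := by
  intro t ht
  apply ContinuousAt.continuousWithinAt
  have h1 : ContinuousAt thA (Q+I*t) := (thA_diffAt (HH_shift hQ ht)).continuousAt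
  exact ContinuousAt.comp (f := fun t : ℝ => Q+I*(t : ℂ)) h1 (by fun_prop)
lemma integrable_exp_pi : IntegrableOn (fun t : ℝ => rexp (-π*t)) (Ioi 0) :=
  integrableOn_exp_mul_Ioi (by linarith [Real.pi_pos]) 0
lemma lm_hasDeriv (hQ : Q ∈ HH) : HasDerivAt lm (-π*I*thA Q) Q := by
  have hy : 0 < Q.im := hQ
  obtain ⟨C, hC, hb⟩ := thA_vert_bound (c := Q.im/2) (by positivity)
  have hsub : ∀ w ∈ {w : ℂ | Q.im/2 < w.im}, w ∈ HH := fun w hw => by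
    have : Q.im/2 < w.im := hw
    exact (by linarith : 0 < w.im)
  have key := hol_integral' (μ := volume.restrict (Ioi (0:ℝ))) (F := fun Q t => thA (Q+I*t))
    (isOpen_im_gt (Q.im/2)) (bound := fun t => C*rexp (-π*t))
    (integrable_exp_pi.const_mul C) ?_ ?_ ?_ Q (by simp; linarith)
  · obtain ⟨k1, k2⟩ := key
    refine (k2.const_mul (-π : ℂ)).congr_deriv ?_
    have hv : ∀ t ∈ Ici (0:ℝ), HasDerivAt (fun t : ℝ => thA (Q+I*t))
        (I*deriv (fun w => thA (w+I*t)) Q) t := by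
      intro t ht
      have h1 := (thA_diffAt (HH_shift hQ ht)).hasDerivAt
      have h2 : HasDerivAt (fun t : ℝ => Q+I*(t : ℂ)) I t := by
        have := ((Complex.ofRealCLM.hasDerivAt (x := t)).const_mul I).const_add Q
        simpa using this
      have h3 := HasDerivAt.comp (𝕜 := ℝ) (𝕜' := ℂ) t h1 h2
      rw [deriv_comp_add_const, mul_comm]
      exact h3
    have h4 := integral_Ioi_of_hasDerivAt_of_tendsto (m := (0:ℂ)) (a := (0:ℝ))
      (hv 0 (by simp)).continuousAt.continuousWithinAt
      (fun t ht => hv t (mem_Ici.2 (le_of_lt ht))) (k1.const_mul I) ?_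
    · rw [integral_const_mul] at h4
      simp only [ofReal_zero, mul_zero, add_zero, zero_sub] at h4
      linear_combination (-π : ℂ)*(-I)*h4-π*(∫ t in Ioi (0:ℝ), deriv (fun w => thA (w+I*t)) Q)*(I_sq)
    · refine squeeze_zero_norm' (a := fun t : ℝ => C*rexp (-π*Q.im)*rexp (-π*t)) ?_ ?_
      · filter_upwards [eventually_ge_atTop 0] with t ht
        exact hb Q (by linarith) t ht
      · have : Tendsto (fun t : ℝ => rexp (-π*t)) atTop (𝓝 0) := by
          refine (Real.tendsto_exp_neg_atTop_nhds_zero.comp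
            (tendsto_id.const_mul_atTop Real.pi_pos)).congr fun t => ?_
          simp
        simpa using this.const_mul (C*rexp (-π*Q.im))
  · intro w hw
    exact ((thA_vert_cont (hsub w hw)).mono Ioi_subset_Ici_self).aestronglyMeasurable measurableSet_Ioi
  · filter_upwards [ae_restrict_mem measurableSet_Ioi] with t ht w hw
    have h1 := thA_diffAt (HH_shift (hsub w hw) (le_of_lt ht))
    exact (DifferentiableAt.comp (f := fun w : ℂ => w+I*(t : ℂ)) w h1 (by fun_prop)).differentiableWithinAt
  · filter_upwards [ae_restrict_mem measurableSet_Ioi] with t ht w hw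
    have hw' : Q.im/2 < w.im := hw
    refine (hb w hw'.le t (le_of_lt ht)).trans ?_
    gcongr
    have : rexp (-π*w.im) ≤ 1 := by
      rw [Real.exp_le_one_iff]
      have := Real.pi_pos
      nlinarith
    nlinarith
lemma gr_lm : Gr lm 1 0 := by
  intro c hc
  obtain ⟨C, hC, hb⟩ := thA_vert_bound hc
  refine ⟨C, hC, fun Q hQ => ?_⟩
  have hI : IntegrableOn (fun t : ℝ => C*rexp (-π*Q.im)*rexp (-π*t)) (Ioi 0) :=
    integrable_exp_pi.const_mul _
  have h1 : ‖∫ t in Ioi (0:ℝ), thA (Q+I*t)‖ ≤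
      ∫ t in Ioi (0:ℝ), C*rexp (-π*Q.im)*rexp (-π*t) :=
    norm_integral_le_of_norm_le hI (by
      filter_upwards [ae_restrict_mem measurableSet_Ioi] with t ht using hb Q hQ t (le_of_lt ht))
  have h2 : ∫ t in Ioi (0:ℝ), rexp (-π*t) = 1/π := by
    have := integral_exp_mul_Ioi (a := -π) (by linarith [Real.pi_pos]) 0
    simp only [mul_zero, Real.exp_zero] at this
    rw [this, neg_div_neg_eq]
  rw [integral_const_mul, h2] at h1
  rw [lm, norm_mul, norm_neg, Complex.norm_real, Real.norm_of_nonneg Real.pi_pos.le]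
  calc π*_ ≤ π*(C*rexp (-π*Q.im)*(1/π)) := by gcongr
    _ = _ := by
      have := Real.pi_ne_zero
      field_simp
lemma lm_T (Q : ℂ) : lm (Q+1) = -lm Q := by
  rw [lm, lm, ← mul_neg, ← integral_neg]
  congr 2
  ext t
  rw [show Q+1+I*t = Q+I*t+1 by ring, thA_add_one]
lemma lm_S (Q : ℂ) : lm (-1/Q) = ll Q := rfl
lemma ll_S (hQ : Q ∈ HH) : ll (-1/Q) = lm Q := by
  have := HH_ne_zero hQ
  rw [ll]; congr 1; field_simp
lemma hasDerivAt_neg_inv (hQ0 : Q ≠ 0) : HasDerivAt (fun Q : ℂ => -1/Q) (1/Q^2) Q := by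
  have := (hasDerivAt_inv hQ0).neg
  have e : (fun Q : ℂ => -1/Q) = -fun y => y⁻¹ := by ext w; simp [neg_div]
  rw [e]
  simpa using this
lemma ll_hasDeriv (hQ : Q ∈ HH) : HasDerivAt ll (π*I*thB Q) Q := by
  have h0 := HH_ne_zero hQ
  have := HasDerivAt.comp Q (lm_hasDeriv (HH_neg_inv hQ)) (hasDerivAt_neg_inv h0)
  refine this.congr_deriv ?_
  rw [thA_S hQ]; field_simp
lemma const_of_deriv_zero {φ : ℂ → ℂ} (h : ∀ Q ∈ HH, HasDerivAt φ 0 Q) {Q w : ℂ} (hQ : Q ∈ HH)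
    (hw : w ∈ HH) : φ Q = φ w :=
  convex_HH.is_const_of_fderivWithin_eq_zero (𝕜 := ℂ)
    (fun x hx => (h x hx).differentiableAt.differentiableWithinAt)
    (fun x hx => by
      rw [fderivWithin_of_isOpen isOpen_HH hx]
      have := (h x hx).hasFDerivAt.fderiv
      rw [this]; ext; simp) hQ hw
lemma const_of_deriv_zero' {φ : ℂ → ℂ} (h : ∀ Q ∈ HH, HasDerivAt φ 0 Q) {L : ℂ}
    (hL : Tendsto φ imInf (𝓝 L)) {Q : ℂ} (hQ : Q ∈ HH) : φ Q = L := by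
  have : Tendsto φ imInf (𝓝 (φ Q)) := by
    refine tendsto_const_nhds.congr' ?_
    filter_upwards [eventually_imInf 0] with w hw using const_of_deriv_zero h hQ hw
  exact tendsto_nhds_unique this hL
lemma tendsto_lm : Tendsto lm imInf (𝓝 0) := gr_lm.tendsto one_pos
lemma ll_T (hQ : Q ∈ HH) : ll (Q+1) = ll Q-lm Q+π*I := by
  have hder : ∀ Q ∈ HH, HasDerivAt (fun Q => ll (Q+1)-ll Q+lm Q) 0 Q := by
    intro Q hQ
    have h1 := (ll_hasDeriv (HH_add_one hQ)).comp_add_const Q 1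
    refine ((h1.sub (ll_hasDeriv hQ)).add (lm_hasDeriv hQ)).congr_deriv ?_
    rw [thB_add_one' hQ]; ring
  have hlim : Tendsto (fun Q => ll (Q+1)-ll Q+lm Q) imInf (𝓝 (π*I)) := by
    have h1 : Tendsto (fun Q => ll (Q+1)-ll Q) imInf (𝓝 (π*I)) := by
      rw [tendsto_iff_norm_sub_tendsto_zero]
      obtain ⟨C, hC, hb⟩ := gr_B1 1 one_pos
      refine squeeze_zero_norm' (a := fun Q : ℂ => π*C*rexp (-(1*π*Q.im))) ?_ ?_
      · filter_upwards [eventually_imInf 1] with Q hQ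
        have hseg : ∀ w ∈ {w : ℂ | w.im = Q.im}, HasDerivWithinAt (fun w => ll w-π*I*w)
            (π*I*thB w-π*I*1) {w : ℂ | w.im = Q.im} w := by
          intro w hw
          have hw' : w.im = Q.im := hw
          have hwH : w ∈ HH := show 0 < w.im by rw [hw']; linarith
          exact ((ll_hasDeriv hwH).sub ((hasDerivAt_id w).const_mul (π*I))).hasDerivWithinAt
        have hbd : ∀ w ∈ {w : ℂ | w.im = Q.im}, ‖π*I*thB w-π*I*1‖ ≤
            π*C*rexp (-(1*π*Q.im)) := by
          intro w hw
          have hw' : w.im = Q.im := hw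
          rw [← mul_sub, norm_mul, norm_mul, norm_I, mul_one, Complex.norm_real,
            Real.norm_of_nonneg Real.pi_pos.le, mul_assoc]
          gcongr
          have := hb w (by rw [hw']; exact hQ.le)
          rw [hw', pow_zero, mul_one] at this
          exact this
        have hconv : Convex ℝ {w : ℂ | w.im = Q.im} := by
          intro a ha b hb' s t hs ht hst
          simp only [mem_ofPred_eq] at *
          simp [ha, hb', ← add_mul, hst]
        have := hconv.norm_image_sub_le_of_norm_hasDerivWithin_le hseg hbd
          (x := Q) (y := Q+1) rfl (by simp)
        simp only [add_sub_cancel_left, norm_one, mul_one] at this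
        rw [norm_norm]
        have e : ll (Q+1)-ll Q-π*I = ll (Q+1)-π*I*(Q+1)-(ll Q-π*I*Q) := by
          ring
        rw [e]; exact this
      · have : Tendsto (fun y : ℝ => π*C*rexp (-(1*π*y))) atTop (𝓝 (π*C*0)) := by
          refine (Real.tendsto_exp_neg_atTop_nhds_zero.comp ?_).const_mul _
          exact tendsto_id.const_mul_atTop (by positivity)
        rw [mul_zero] at this
        exact this.comp tendsto_comap
    simpa using h1.add tendsto_lm
  have := const_of_deriv_zero' hder hlim hQ
  linear_combination this
lemma exp_lm (hQ : Q ∈ HH) : cexp (lm Q) = thB Q/(thA Q+thB Q) := by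
  have hder : ∀ Q ∈ HH, HasDerivAt (fun Q => cexp (-lm Q)*(thB Q/(thA Q+thB Q))) 0 Q := by
    intro Q hQ
    have hA := (thA_diffAt hQ).hasDerivAt
    have hB := (thB_diffAt hQ).hasDerivAt
    have h0 := thAB_ne hQ
    refine (((lm_hasDeriv hQ).neg.cexp).mul (hB.div (hA.add hB) h0)).congr_deriv ?_
    have h1 := wronskian hQ
    simp only [Pi.add_apply, Pi.neg_apply, Pi.div_apply]
    field_simp
    unfold thD at h1
    linear_combination (-cexp (-lm Q))*h1
  have hlim : Tendsto (fun Q => cexp (-lm Q)*(thB Q/(thA Q+thB Q))) imInf (𝓝 1) := by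
    have := (tendsto_lm.neg.cexp).mul (tendsto_thB.div (tendsto_thA.add tendsto_thB) (by norm_num))
    simpa using this
  have := const_of_deriv_zero' hder hlim hQ
  rw [Complex.exp_neg] at this
  have h1 := Complex.exp_ne_zero (lm Q)
  field_simp at this
  exact this.symm
lemma exp_ll (hQ : Q ∈ HH) : cexp (ll Q) = thA Q/(thA Q+thB Q) := by
  have h0 := HH_ne_zero hQ
  have := thAB_ne hQ
  rw [ll, exp_lm (HH_neg_inv hQ), thA_S hQ, thB_S hQ, ← mul_add, add_comm (thB Q)]
  have h2 : -Q^2 ≠ 0 := neg_ne_zero.2 (pow_ne_zero 2 h0)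
  rw [mul_div_mul_left _ _ h2]
lemma HH_axis {t : ℝ} (ht : 0 < t) : I*(t : ℂ) ∈ HH := by simp [HH, ht]
lemma neg_inv_axis {t : ℝ} : -1/(I*(t : ℂ)) = I*((1/t : ℝ) : ℂ) := by
  rcases eq_or_ne t 0 with h | h
  · simp [h]
  · push_cast
    have : (t : ℂ) ≠ 0 := ofReal_ne_zero.2 h
    field_simp
    rw [I_sq]
lemma pos_of_conj {w : ℂ} (hw : w ≠ 0) (h : (starRingEnd ℂ) w = w) : ∃ a : ℝ, 0 < a ∧ w^4 = a := by
  obtain ⟨r, rfl⟩ := Complex.conj_eq_iff_real.1 h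
  have : r ≠ 0 := by simpa using hw
  exact ⟨r^4, by positivity, by push_cast; ring⟩
lemma thB_axis {t : ℝ} (ht : 0 < t) : ∃ a : ℝ, 0 < a ∧ thB (I*t) = a := by
  apply pos_of_conj
  · intro h; apply thB_ne (HH_axis ht); rw [thB, h]; simp
  · rw [jacobiTheta₂_conj]; congr 1 <;> simp [Complex.conj_ofNat]
lemma thA_axis {t : ℝ} (ht : 0 < t) : ∃ a : ℝ, 0 < a ∧ thA (I*t) = a := by
  obtain ⟨a, ha, h⟩ := thB_axis (t := 1/t) (by positivity)
  have h1 := thA_S (HH_axis (t := 1/t) (by positivity))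
  rw [neg_inv_axis, one_div_one_div, h] at h1
  refine ⟨(1/t)^2*a, by positivity, ?_⟩
  rw [h1]; push_cast; rw [mul_pow, I_sq]; ring
lemma tE4_axis {t : ℝ} (ht : 0 < t) : ∃ a : ℝ, 0 < a ∧ tE4 (I*t) = a := by
  obtain ⟨a, ha, h⟩ := thB_axis ht
  obtain ⟨b, hb, h'⟩ := thA_axis ht
  exact ⟨b^2+b*a+a^2, by positivity, by rw [tE4, h, h']; push_cast; ring⟩
lemma thD_axis {t : ℝ} (ht : 0 < t) : ∃ a : ℝ, 0 < a ∧ thD (I*t) = a := by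
  obtain ⟨a, ha, h⟩ := thB_axis ht
  obtain ⟨b, hb, h'⟩ := thA_axis ht
  exact ⟨b*a*(b+a), by positivity, by rw [thD, h, h']; push_cast; ring⟩
def sr (t : ℝ) : ℝ := (ts (I*t)).re
lemma ts_axis {t : ℝ} (ht : 0 < t) : ts (I*t) = sr t := by
  obtain ⟨a, ha, h⟩ := thB_axis ht
  obtain ⟨b, hb, h'⟩ := thA_axis ht
  have : ts (I*t) = ((16*((2*b+a)*(b+2*a)*(a-b)/2)/(b*a*(b+a)) : ℝ) : ℂ) := by
    rw [ts, tE6, thD, h, h']; push_cast; ring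
  rw [sr, this, ofReal_re]
lemma sr_hasDeriv {t : ℝ} (ht : 0 < t) : ∃ d : ℝ, 0 < d ∧ HasDerivAt sr d t := by
  obtain ⟨a, ha, h⟩ := tE4_axis ht
  obtain ⟨b, hb, h'⟩ := thD_axis ht
  refine ⟨16*π*a^2/b, by have := Real.pi_pos; positivity, ?_⟩
  have h1 := deriv_ts (HH_axis ht)
  have h2 : HasDerivAt (fun t : ℝ => I*(t : ℂ)) I t := by
    have := ((Complex.ofRealCLM.hasDerivAt (x := t)).const_mul I)
    simpa using this
  have h3 := HasDerivAt.comp (𝕜 := ℝ) (𝕜' := ℂ) t h1 h2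
  have h4 := Complex.reCLM.hasFDerivAt.comp_hasDerivAt t h3
  refine h4.congr_deriv ?_
  rw [h, h']
  simp only [reCLM_apply]
  have : -16*π*I*(a:ℂ)^2/b*I = ((16*π*a^2/b : ℝ) : ℂ) := by
    push_cast; linear_combination (-16*π*(a:ℂ)^2/b)*I_sq
  rw [this, ofReal_re]
lemma sr_mono : StrictMonoOn sr (Ioi 0) := by
  apply strictMonoOn_of_deriv_pos (convex_Ioi 0)
  · intro t ht
    obtain ⟨d, _, h⟩ := sr_hasDeriv ht
    exact h.continuousAt.continuousWithinAt
  · intro t ht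
    rw [interior_Ioi] at ht
    obtain ⟨d, hd, h⟩ := sr_hasDeriv ht
    rwa [h.deriv]
lemma sr_inv {t : ℝ} (ht : 0 < t) : sr (1/t) = -sr t := by
  have := ts_S (HH_axis ht)
  rw [neg_inv_axis, ts_axis ht, ts_axis (by positivity)] at this
  exact_mod_cast this
lemma sr_one : sr 1 = 0 := by
  have := sr_inv one_pos
  rw [one_div_one] at this
  linarith
lemma sr_ne {t : ℝ} (ht : 0 < t) (h1 : t ≠ 1) : sr t ≠ 0 := by
  intro h
  exact h1 (sr_mono.injOn (mem_Ioi.2 ht) (mem_Ioi.2 one_pos) (by rw [h, sr_one]))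
lemma sr_sq_eq {t y : ℝ} (ht : 0 < t) (hy : 0 < y) (h : sr t^2 = sr y^2) : y = t ∨ y = 1/t := by
  rcases sq_eq_sq_iff_eq_or_eq_neg.1 h with h | h
  · left; exact (sr_mono.injOn (mem_Ioi.2 ht) (mem_Ioi.2 hy) h).symm
  · right
    apply sr_mono.injOn (mem_Ioi.2 hy) (mem_Ioi.2 (by positivity))
    rw [sr_inv ht]; linarith
lemma sr_cont : ContinuousOn sr (Ioi 0) := fun t ht => by
  obtain ⟨d, _, h⟩ := sr_hasDeriv ht
  exact h.continuousAt.continuousWithinAt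
lemma lm_axis {t : ℝ} (ht : 0 < t) : (lm (I*t)).im = 0 := by
  have : ∫ u in Ioi (0:ℝ), thA (I*t+I*u) = ((∫ u in Ioi (0:ℝ), (thA (I*t+I*u)).re : ℝ) : ℂ) := by
    refine Eq.trans ?_ (integral_ofReal (𝕜 := ℂ))
    refine setIntegral_congr_fun measurableSet_Ioi fun u hu => ?_
    have hu' : 0 < u := hu
    obtain ⟨a, ha, h⟩ := thA_axis (t := t+u) (by positivity)
    have e : I*(t:ℂ)+I*u = I*((t+u : ℝ) : ℂ) := by push_cast; ring
    simp only [e, h]; simp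
  rw [lm, this, ← ofReal_neg, ← ofReal_mul, ofReal_im]
lemma ll_axis {t : ℝ} (ht : 0 < t) : (ll (I*t)).im = 0 := by
  rw [ll, neg_inv_axis]; exact lm_axis (by positivity)
lemma re_pow_four {w : ℂ} (h : ‖w-1‖ ≤ 1/4) : 1/10 ≤ (w^4).re := by
  have h1 := (abs_re_le_norm (w-1)).trans h
  have h2 := (abs_im_le_norm (w-1)).trans h
  simp only [sub_re, one_re, sub_im, one_im, sub_zero] at h1 h2
  have e : (w^4).re = w.re^4-6*w.re^2*w.im^2+w.im^4 := by
    have : w^4 = w*w*(w*w) := by ring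
    rw [this]; simp only [mul_re, mul_im]; ring
  rw [e]
  have a1 : 3/4 ≤ w.re := by linarith [(abs_le.1 h1).1]
  have b1 : w.im^2 ≤ 1/16 := by
    have := sq_abs w.im
    nlinarith [abs_nonneg w.im]
  have a2 : 9/16 ≤ w.re^2 := by nlinarith
  have b0 := sq_nonneg w.im
  have : w.re^4-6*w.re^2*w.im^2+w.im^4 =
    w.re^2*(w.re^2-6*w.im^2)+(w.im^2)^2 := by ring
  rw [this]
  nlinarith [sq_nonneg (w.im^2)]
lemma exp_bound {y : ℝ} (hy : 18/25 ≤ y) : rexp (-π*y) ≤ 1/9 := by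
  have h1 : rexp (-π*y) ≤ rexp (-(2.25)) := by
    apply Real.exp_le_exp.2
    have := Real.pi_gt_d2
    nlinarith
  have h2 : (9:ℝ) ≤ rexp 2.25 := by
    have h3 := Real.add_one_le_exp (0.25 : ℝ)
    have h4 := Real.exp_one_gt_d9
    have : rexp 2.25 = rexp 1*rexp 1*rexp 0.25 := by
      rw [← Real.exp_add, ← Real.exp_add]; norm_num
    rw [this]
    nlinarith [Real.exp_pos 0.25]
  rw [Real.exp_neg] at h1
  refine h1.trans ?_
  rw [one_div]
  exact inv_anti₀ (by norm_num) h2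
lemma thB_re (h : 18/25 ≤ Q.im) : 1/10 ≤ (thB Q).re := by
  have h0 : 0 < (Q+1).im := by simp; linarith
  have h1 := norm_jacobiTheta_sub_one_le h0
  have e : thB Q = jacobiTheta (Q+1)^4 := by rw [← thC_eq, thC_add_one]
  rw [e]
  apply re_pow_four
  refine h1.trans ?_
  have h2 : rexp (-π*(Q+1).im) ≤ 1/9 := exp_bound (by simpa using h)
  have h3 := Real.exp_pos (-π*(Q+1).im)
  rw [div_mul_eq_mul_div, div_le_iff₀ (by linarith)]
  linarith
lemma ll_im_bounds {σ y : ℝ} (hy : 18/25 ≤ y) (h0 : 0 < σ) (h1 : σ < 1) :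
    π/10*σ ≤ (ll (σ+I*y)).im ∧ π/10*(1-σ) ≤ π-(ll (σ+I*y)).im := by
  set φ : ℝ → ℝ := fun σ => (ll (σ+I*y)).im with hφ
  have hH : ∀ σ : ℝ, (σ+I*y : ℂ) ∈ HH := fun σ => by simp [HH]; linarith
  have hd : ∀ σ : ℝ, HasDerivAt φ (π*(thB (σ+I*y)).re) σ := by
    intro σ
    have h1 := ll_hasDeriv (hH σ)
    have h2 : HasDerivAt (fun σ : ℝ => (σ : ℂ)+I*y) 1 σ := by
      have := ((Complex.ofRealCLM.hasDerivAt (x := σ)).add_const (I*(y:ℂ)))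
      simpa using this
    have h3 := HasDerivAt.comp (𝕜 := ℝ) (𝕜' := ℂ) σ h1 h2
    refine (Complex.imCLM.hasFDerivAt.comp_hasDerivAt σ h3).congr_deriv ?_
    simp
  have hcont : Continuous φ := continuous_iff_continuousAt.2 fun σ => (hd σ).continuousAt
  have hdiff : Differentiable ℝ φ := fun σ => (hd σ).differentiableAt
  have hder : ∀ σ, π/10 ≤ deriv φ σ := fun σ => by
    rw [(hd σ).deriv]
    have := thB_re (Q := σ+I*y) (by simpa using hy)
    nlinarith [Real.pi_pos]
  have hmv := fun a b (hab : a ≤ b) => convex_univ.mul_sub_le_image_sub_of_le_deriv (f := φ) (D := univ)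
    hcont.continuousOn hdiff.differentiableOn (fun x _ => hder x) a (mem_univ _) b (mem_univ _) hab
  have e0 : φ 0 = 0 := by
    simp only [hφ, ofReal_zero, zero_add]
    exact ll_axis (by linarith)
  have e1 : φ 1 = π := by
    have h2 := ll_T (HH_axis (t := y) (by linarith))
    simp only [hφ, ofReal_one]
    rw [add_comm, h2]
    simp [ll_axis (t := y) (by linarith), lm_axis (t := y) (by linarith)]
  have m1 := hmv 0 σ h0.le
  have m2 := hmv σ 1 h1.le
  rw [e0] at m1
  rw [e1] at m2
  constructor
  · change _ ≤ φ σ; linarith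
  · change _ ≤ π-φ σ; linarith
lemma sin_lower {φ m : ℝ} (h0 : π/10*m ≤ φ) (h1 : π/10*m ≤ π-φ) (hm : 0 ≤ m) :
    m/5 ≤ Real.sin φ := by
  have hpi := Real.pi_pos
  have hp : 0 ≤ π/10*m := by positivity
  have key : ∀ x : ℝ, 0 ≤ x → x ≤ π/2 → π/10*m ≤ x → m/5 ≤ Real.sin x := by
    intro x hx hx2 hmx
    refine le_trans ?_ (Real.mul_le_sin hx hx2)
    have : 2/π*(π/10*m) ≤ 2/π*x := by gcongr
    refine le_trans (le_of_eq ?_) this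
    field_simp
    ring
  rcases le_total φ (π/2) with h | h
  · exact key φ (by linarith) h h0
  · rw [← Real.sin_pi_sub]
    exact key _ (by linarith) (by linarith) h1
lemma ts_lam (hQ : Q ∈ HH) {lam : ℂ} (hl : lam = thA Q/(thA Q+thB Q)) :
    lam ≠ 0 ∧ 1-lam ≠ 0 ∧ ts Q = 8*(1-2*lam+2*lam⁻¹-2*(1-lam)⁻¹) := by
  have hA := thA_ne hQ
  have hB := thB_ne hQ
  have hC := thAB_ne hQ
  have e : 1-lam = thB Q/(thA Q+thB Q) := by rw [hl]; field_simp; ring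
  refine ⟨by rw [hl]; exact div_ne_zero hA hC, by rw [e]; exact div_ne_zero hB hC, ?_⟩
  rw [e, hl, ts, tE6, thD]
  field_simp
  ring
lemma im_s_lower {lam : ℂ} {S : ℝ} (h0 : lam ≠ 0) (h1 : 1-lam ≠ 0) (hS : 0 ≤ S)
    (him : S*‖lam‖ ≤ lam.im) {s : ℂ} (hs : s = 8*(1-2*lam+2*lam⁻¹-2*(1-lam)⁻¹)) :
    S*‖s‖*(5/12) ≤ |s.im| ∧ 30*S ≤ |s.im| := by
  set a := ‖lam‖ with ha
  set b := ‖1-lam‖ with hb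
  have ha0 : 0 < a := norm_pos_iff.2 h0
  have hb0 : 0 < b := norm_pos_iff.2 h1
  have hab : 1 ≤ a+b := by
    have := norm_add_le lam (1-lam)
    simpa using this
  have e : s.im = -(16*lam.im*(1+1/a^2+1/b^2)) := by
    rw [hs]
    simp only [mul_im, sub_im, add_im, inv_im, one_im, sub_re, one_re, mul_re, add_re]
    rw [normSq_eq_norm_sq, normSq_eq_norm_sq, ← ha, ← hb]
    simp
    ring
  have hn : ‖s‖ ≤ 8*(1+2*a+2/a+2/b) := by
    rw [hs, norm_mul]
    have h8 : ‖(8:ℂ)‖ = 8 := by simp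
    rw [h8]
    gcongr
    refine (norm_sub_le _ _).trans (add_le_add ((norm_add_le _ _).trans
      (add_le_add ((norm_sub_le _ _).trans (add_le_add ?_ ?_)) ?_)) ?_)
    · simp
    · simp [ha]
    · simp [ha, div_eq_mul_inv]
    · simp [hb, div_eq_mul_inv]
  have hA : 2 ≤ a+1/a := by
    have : a+1/a-2 = (a-1)^2/a := by field_simp; ring
    have h3 : 0 ≤ (a-1)^2/a := by positivity
    linarith
  have hB : 1/b ≤ a+1/a+a/b^2 := by
    rcases le_total (1/2) b with h | h
    · have h3 : 1/b ≤ 2 := by rw [div_le_iff₀ hb0]; linarith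
      have : 0 ≤ a/b^2 := by positivity
      linarith
    · have h4 : 1/b ≤ a/b^2 := by
        rw [div_le_div_iff₀ hb0 (by positivity)]
        nlinarith
      have : 0 ≤ 1/a := by positivity
      linarith
  set q := a+1/a+a/b^2 with hq
  have hq2 : 2 ≤ q := by
    have : 0 ≤ a/b^2 := by positivity
    linarith
  have hn2 : ‖s‖ ≤ 36*q := by
    refine hn.trans ?_
    have h5 : 2*a+2/a ≤ 2*q := by
      have : 0 ≤ a/b^2 := by positivity
      have e2 : 2/a = 2*(1/a) := by ring
      rw [e2]; linarith
    have e3 : 2/b = 2*(1/b) := by ring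
    rw [e3]; linarith
  have him2 : 16*S*q ≤ |s.im| := by
    rw [e, abs_neg]
    refine le_trans ?_ (le_abs_self _)
    have h6 : S*a*(1+1/a^2+1/b^2) ≤ lam.im*(1+1/a^2+1/b^2) := by
      gcongr
    have e4 : a*(1+1/a^2+1/b^2) = q := by rw [hq]; field_simp
    rw [mul_assoc S, e4] at h6
    linarith
  constructor
  · refine le_trans ?_ him2
    have : S*‖s‖ ≤ S*(36*q) := by gcongr
    have h7 : 0 ≤ S*q := by positivity
    linarith
  · refine le_trans ?_ him2
    nlinarith
lemma ts_im_pos (hy : 18/25 ≤ Q.im) (h0 : 0 < Q.re) (h1 : Q.re < 1) :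
    min Q.re (1-Q.re)/12*‖ts Q‖ ≤ |(ts Q).im| ∧ 6*min Q.re (1-Q.re) ≤ |(ts Q).im| := by
  have hQ : Q ∈ HH := show 0 < Q.im by linarith
  have eQ : Q = Q.re+I*Q.im := by rw [mul_comm]; exact (re_add_im Q).symm
  have hb := ll_im_bounds hy h0 h1
  rw [← eQ] at hb
  have hm0 : 0 ≤ min Q.re (1-Q.re) := le_min h0.le (by linarith)
  have hs := sin_lower (m := min Q.re (1-Q.re)) (φ := (ll Q).im)
    (le_trans (by have := Real.pi_pos; gcongr; exact min_le_left _ _) hb.1)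
    (le_trans (by have := Real.pi_pos; gcongr; exact min_le_right _ _) hb.2) hm0
  obtain ⟨l0, l1, ls⟩ := ts_lam hQ (exp_ll hQ)
  have := im_s_lower (S := min Q.re (1-Q.re)/5) l0 l1 (by positivity) (by
    rw [Complex.norm_exp, Complex.exp_im, mul_comm]
    gcongr) ls
  constructor
  · refine le_trans (le_of_eq ?_) this.1; ring
  · linarith [this.2]
lemma ts_im (hy : 18/25 ≤ Q.im) (h1 : |Q.re| ≤ 3/5) :
    |Q.re|/18*‖ts Q‖ ≤ |(ts Q).im| ∧ 4*|Q.re| ≤ |(ts Q).im| := by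
  have key : ∀ σ : ℝ, 0 ≤ σ → σ ≤ 3/5 → 2/3*σ ≤ min σ (1-σ) := fun σ h0 h1 =>
    le_min (by linarith) (by linarith)
  have hab := abs_le.1 h1
  rcases lt_trichotomy Q.re 0 with h | h | h
  · have hQ : Q ∈ HH := show 0 < Q.im by linarith
    have := ts_im_pos (Q := Q+1) (by simpa using hy) (by simp; linarith) (by simp; linarith)
    rw [ts_T hQ, norm_neg, neg_im, abs_neg] at this
    rw [abs_of_neg h] at h1 ⊢
    have hk := key (-Q.re) (by linarith) h1
    have e : min (Q+1).re (1-(Q+1).re) = min (-Q.re) (1 - -Q.re) := by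
      rw [min_comm]; congr 1 <;> simp <;> ring
    rw [e] at this
    constructor
    · refine le_trans ?_ this.1
      gcongr ?_*_
      linarith
    · linarith
  · simp [h]
  · have := ts_im_pos hy h (by linarith)
    rw [abs_of_pos h] at h1 ⊢
    have hk := key Q.re h.le h1
    constructor
    · refine le_trans ?_ this.1
      gcongr ?_*_
      linarith
    · linarith
lemma lower_bound (hy : 18/25 ≤ Q.im) (h1 : |Q.re| ≤ 3/5) (u : ℝ) :
    |Q.re|^4/324*(1+u^2+‖ts Q‖^2) ≤ ‖(u : ℂ)^2-ts Q^2‖ := by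
  obtain ⟨k1, k2⟩ := ts_im hy h1
  set w := ts Q
  set σ := |Q.re|
  have hσ : 0 ≤ σ := abs_nonneg _
  rcases hσ.eq_or_lt with h0 | h0
  · rw [← h0]; simp
  have hq : 0 < |w.im| := by linarith
  have hw : |w.im| ≤ ‖w‖ := abs_im_le_norm w
  have hwp : 0 < ‖w‖ := by linarith
  have hn : ‖w‖^2 = w.re^2+w.im^2 := by rw [← normSq_eq_norm_sq, normSq_apply]; ring
  have key : ∀ v : ℝ, |v| = |u| → σ/18*|u| ≤ ‖(v : ℂ)-w‖ ∧ σ/18*‖w‖ ≤ ‖(v : ℂ)-w‖ := by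
    intro v hv
    have e1 : |w.im| ≤ ‖(v : ℂ)-w‖ := by
      have := abs_im_le_norm ((v : ℂ)-w)
      simpa using this
    refine ⟨?_, k1.trans e1⟩
    have e2 : |v| * |w.im| ≤ ‖(v : ℂ)-w‖*‖w‖ := by
      apply abs_le_of_sq_le_sq' _ (by positivity) |>.2
      have e3 : ‖(v : ℂ)-w‖^2 = (v-w.re)^2+w.im^2 := by
        rw [← normSq_eq_norm_sq, normSq_apply]; simp; ring
      rw [mul_pow, mul_pow, e3, hn, sq_abs, sq_abs]
      nlinarith [sq_nonneg (v*w.re-(w.re^2+w.im^2))]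
    rw [hv] at e2
    have e4 : σ/18*|u| * ‖w‖ ≤ ‖(v : ℂ)-w‖*‖w‖ := by
      refine le_trans ?_ e2
      have := mul_le_mul_of_nonneg_left k1 (abs_nonneg u)
      linarith
    exact le_of_mul_le_mul_right e4 hwp
  have f1 := key u rfl
  have f2 := key (-u) (abs_neg u)
  have e5 : ‖(u : ℂ)^2-w^2‖ = ‖(u : ℂ)-w‖*‖((-u : ℝ) : ℂ)-w‖ := by
    rw [← norm_mul, ← norm_neg]; congr 1; push_cast; ring
  rw [e5]
  set M := max |u| ‖w‖ with hM
  have hM0 : 0 < M := lt_of_lt_of_le hwp (le_max_right _ _)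
  have g1 : σ/18*M ≤ ‖(u : ℂ)-w‖ := by
    rcases max_choice |u| ‖w‖ with h | h <;> rw [hM, h]
    exacts [f1.1, f1.2]
  have g2 : σ/18*M ≤ ‖((-u : ℝ) : ℂ)-w‖ := by
    rcases max_choice |u| ‖w‖ with h | h <;> rw [hM, h]
    exacts [f2.1, f2.2]
  have g3 : (σ/18*M)*(σ/18*M) ≤ ‖(u : ℂ)-w‖*‖((-u : ℝ) : ℂ)-w‖ := by gcongr
  refine le_trans ?_ g3
  have a1 : u^2 ≤ M^2 := by
    rw [← sq_abs]; gcongr; exact le_max_left _ _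
  have a2 : ‖w‖^2 ≤ M^2 := by gcongr; exact le_max_right _ _
  have a3 : 4*σ ≤ M := by linarith [le_max_right |u| ‖w‖]
  have a4 : σ^2*(1+u^2+‖w‖^2) ≤ M^2 := by
    have : σ^2 ≤ 9/25 := by nlinarith
    have : σ^2*(u^2+‖w‖^2) ≤ 9/25*(2*M^2) := by gcongr; linarith
    have : 16*σ^2 ≤ M^2 := by nlinarith
    nlinarith
  have : σ^4/324*(1+u^2+‖w‖^2) = σ^2/324*(σ^2*(1+u^2+‖w‖^2)) := by ring
  rw [this]
  have : σ^2/324*(σ^2*(1+u^2+‖w‖^2)) ≤ σ^2/324*M^2 := by gcongr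
  linarith
end
section
def Ex (t : ℝ) : ℝ := rexp (2*π*t)+rexp (2*π/t)
lemma Ex_pos (t : ℝ) : 0 < Ex t := by unfold Ex; positivity
structure Ker (ε : ℂ) where
  f : Fin 3 → ℂ → ℂ
  g : Fin 3 → ℂ → ℂ
  f_diff : ∀ i, ∀ Q ∈ HH, DifferentiableAt ℂ (f i) Q
  g_cont : ∀ i, ∀ Q ∈ HH, ContinuousAt (g i) Q
  f_S : ∀ i, ∀ Q ∈ HH, f i (-1/Q) = -ε*Q^4*f i Q
  f_T : ∀ i, ∀ Q ∈ HH, f i (Q+1+1) = 2*f i (Q+1)-f i Q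
  N0 : ∀ z ∈ HH, ∑ i, f i z*g i z = 0
  N1 : ∀ z ∈ HH, ∑ i, f i (z+1)*g i z = - tw z
  N2 : ∀ z ∈ HH, ∑ i, f i (-1/z+1)*g i z = 0
  bf : ∀ i, ∃ n, Gr (f i) 0 n
  bK2 : ∃ C : ℝ, ∃ N : ℕ, ∀ Q : ℂ, 1/2 ≤ Q.im → ∀ t : ℝ, 0 < t →
    ‖∑ i, f i (-1/Q+1)*g i (I*t)‖ ≤ C*(1+‖Q‖)^N*(1+t)*(Ex t+rexp (2*π*Q.im))
  bg : ∀ i, ∃ C : ℝ, ∀ t : ℝ, 0 < t → ‖g i (I*t)‖ ≤ C*(1+t)*rexp (2*π*t+π/t)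
  bg' : ∀ i, ∃ c0 c1 : ℂ, ∃ C : ℝ, ∀ t : ℝ, 1 ≤ t →
    ‖g i (I*t)*rexp (-(2*π*t))-(c0+c1*t)‖ ≤ C*rexp (-t)
lemma bg_of_gr {g : ℂ → ℂ} {C : ℝ} (h1 : ∀ t : ℝ, 1 ≤ t → ‖g (I*t)‖ ≤ C*(1+t)*rexp (2*π*t))
    {h : ℂ → ℂ} {n : ℕ} (h2 : Gr h (-1) n) (e : ∀ z ∈ HH, g (-1/z) = z⁻¹^n*h z) :
    ∃ C : ℝ, ∀ t : ℝ, 0 < t → ‖g (I*t)‖ ≤ C*(1+t)*rexp (2*π*t+π/t) := by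
  obtain ⟨K, hK, hh⟩ := h2 1 one_pos
  refine ⟨max C 0+K*2^n, fun t ht => ?_⟩
  rcases le_total 1 t with ht1 | ht1
  · refine (h1 t ht1).trans ?_
    have e1 : rexp (2*π*t) ≤ rexp (2*π*t+π/t) := by
      apply Real.exp_le_exp.2
      have : 0 ≤ π/t := by positivity
      linarith
    have e2 : C ≤ max C 0+K*2^n := by
      have := le_max_left C 0
      have : 0 ≤ K*2^n := by positivity
      linarith
    have e3 : 0 ≤ max C 0+K*2^n := by positivity
    gcongr
  · have hz : I*((1/t : ℝ) : ℂ) ∈ HH := HH_axis (by positivity)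
    have e1 := e _ hz
    rw [neg_inv_axis, one_div_one_div] at e1
    rw [e1, norm_mul, norm_pow, norm_inv]
    have hn : ‖I*((1/t : ℝ) : ℂ)‖ = 1/t := by
      rw [norm_mul, norm_I, one_mul, Complex.norm_real, Real.norm_of_nonneg (by positivity)]
    have h3 := hh (I*((1/t : ℝ) : ℂ)) (by
      simp only [mul_im, I_re, ofReal_im, I_im, ofReal_re, mul_zero, one_mul, zero_add]
      rw [le_div_iff₀ ht]; linarith)
    rw [hn] at h3 ⊢
    have him : (I*((1/t : ℝ) : ℂ)).im = 1/t := by simp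
    rw [him] at h3
    have e4 : -(-1*π*(1/t)) = π/t := by ring
    rw [e4] at h3
    calc (1/t)⁻¹^n*‖h (I*((1/t : ℝ) : ℂ))‖ ≤ (1/t)⁻¹^n*(K*rexp (π/t)*(1+1/t)^n) := by
          gcongr
      _ = K*(t+1)^n*rexp (π/t) := by
          have : (1/t)⁻¹^n*(1+1/t)^n = (t+1)^n := by
            rw [← mul_pow]; congr 1; field_simp
          rw [← this]; ring
      _ ≤ (K*2^n)*1*rexp (2*π*t+π/t) := by
          rw [mul_one]
          gcongr
          · linarith
          · have : 0 ≤ 2*π*t := by positivity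
            linarith
      _ ≤ (max C 0+K*2^n)*(1+t)*rexp (2*π*t+π/t) := by
          gcongr
          · have := le_max_right C 0
            linarith
          · linarith
lemma poly_le_exp (n : ℕ) : ∃ C : ℝ, 0 ≤ C ∧ ∀ t : ℝ, 0 ≤ t → (1+t)^n ≤ C*rexp t := by
  refine ⟨n.factorial*rexp 1, by positivity, fun t ht => ?_⟩
  have := Real.pow_div_factorial_le_exp (1+t) (by linarith) n
  rw [div_le_iff₀ (by positivity), Real.exp_add] at this
  linarith
lemma Gr.axis {φ : ℂ → ℂ} {a : ℝ} {n : ℕ} (h : Gr φ a n) : ∃ C : ℝ, 0 ≤ C ∧ ∀ t : ℝ, 1 ≤ t →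
    ‖φ (I*t)‖ ≤ C*rexp (-(a*π*t))*(1+t)^n := by
  obtain ⟨C, hC, h⟩ := h 1 one_pos
  refine ⟨C, hC, fun t ht => ?_⟩
  have := h (I*t) (by simpa using ht)
  have hn : ‖I*(t:ℂ)‖ = t := by
    rw [norm_mul, norm_I, one_mul, Complex.norm_real, Real.norm_of_nonneg (by linarith)]
  have him : (I*(t : ℂ)).im = t := by simp
  rwa [hn, him] at this
lemma bg'_of_gr {g : ℂ → ℂ} {c0 c1 : ℂ} {n : ℕ} {a : ℝ} (ha : 1 ≤ a)
    (h : Gr (fun z => g z-(c0+c1*z)*cexp (-(π*I*z))^2) (a-2) n) :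
    ∃ c0 c1 : ℂ, ∃ C : ℝ, ∀ t : ℝ, 1 ≤ t →
    ‖g (I*t)*rexp (-(2*π*t))-(c0+c1*t)‖ ≤ C*rexp (-t) := by
  obtain ⟨C, hC, hh⟩ := h.axis
  obtain ⟨K, hK, hk⟩ := poly_le_exp n
  refine ⟨c0, c1*I, C*K, fun t ht => ?_⟩
  have e : g (I*t)*rexp (-(2*π*t))-(c0+c1*I*t)
      = (g (I*t)-(c0+c1*(I*t))*cexp (-(π*I*(I*t)))^2)*rexp (-(2*π*t)) := by
    have : cexp (-(π*I*(I*t)))^2*(rexp (-(2*π*t)) : ℂ) = 1 := by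
      rw [← Complex.exp_nat_mul, ofReal_exp, ← Complex.exp_add, ← Complex.exp_zero]
      congr 1
      push_cast
      linear_combination (-2*π*t)*I_sq
    linear_combination (c0+c1*I*t)*this
  rw [e, norm_mul, Complex.norm_real, Real.norm_of_nonneg (Real.exp_pos _).le]
  calc _ ≤ (C*rexp (-((a-2)*π*t))*(1+t)^n)*rexp (-(2*π*t)) := by
        gcongr; exact hh t ht
    _ ≤ (C*rexp (-((a-2)*π*t))*(K*rexp t))*rexp (-(2*π*t)) := by
        gcongr; exact hk t (by linarith)
    _ = C*K*rexp (-((a-2)*π*t)+t + -(2*π*t)) := by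
        rw [Real.exp_add, Real.exp_add]; ring
    _ ≤ C*K*rexp (-t) := by
        gcongr
        have := Real.pi_gt_three
        have h1 : π*t ≤ a*π*t := by
          have : 0 ≤ (a-1)*(π*t) := mul_nonneg (by linarith) (by positivity)
          linarith
        nlinarith
lemma b1_of_gr {g : ℂ → ℂ} {c0 c1 : ℂ} {n : ℕ} {a : ℝ} (ha : 1 ≤ a)
    (h : Gr (fun z => g z-(c0+c1*z)*cexp (-(π*I*z))^2) (a-2) n) :
    ∃ C : ℝ, ∀ t : ℝ, 1 ≤ t → ‖g (I*t)‖ ≤ C*(1+t)*rexp (2*π*t) := by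
  obtain ⟨c0, c1, C, h⟩ := bg'_of_gr ha h
  refine ⟨|C|+‖c0‖+‖c1‖, fun t ht => ?_⟩
  have h1 := h t ht
  have h2 : ‖g (I*t)*rexp (-(2*π*t))‖ ≤ (|C|+‖c0‖+‖c1‖)*(1+t) := by
    have h3 := norm_sub_norm_le (g (I*t)*rexp (-(2*π*t))) (c0+c1*t)
    have h4 : ‖c0+c1*t‖ ≤ ‖c0‖+‖c1‖*t := by
      refine (norm_add_le _ _).trans ?_
      rw [norm_mul, Complex.norm_real, Real.norm_of_nonneg (by linarith)]
    have h5 : C*rexp (-t) ≤ |C| := by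
      calc C*rexp (-t) ≤ |C| * 1 := by
            gcongr
            · exact le_abs_self C
            · exact Real.exp_le_one_iff.2 (by linarith)
        _ = |C| := mul_one _
    have : 0 ≤ |C| * t := by positivity
    have : 0 ≤ ‖c0‖*t := by positivity
    nlinarith [norm_nonneg c1]
  rw [norm_mul, Complex.norm_real, Real.norm_of_nonneg (Real.exp_pos _).le] at h2
  rw [Real.exp_neg, ← div_eq_mul_inv, div_le_iff₀ (Real.exp_pos _)] at h2
  exact h2
lemma bg_of_gr' {g : ℂ → ℂ} {c0 c1 : ℂ} {m n : ℕ} {a : ℝ} (ha : 1 ≤ a)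
    (h : Gr (fun z => g z-(c0+c1*z)*cexp (-(π*I*z))^2) (a-2) m)
    {h' : ℂ → ℂ} (h2 : Gr h' (-1) n) (e : ∀ z ∈ HH, g (-1/z) = z⁻¹^n*h' z) :
    ∃ C : ℝ, ∀ t : ℝ, 0 < t → ‖g (I*t)‖ ≤ C*(1+t)*rexp (2*π*t+π/t) := by
  obtain ⟨C, h1⟩ := b1_of_gr ha h
  exact bg_of_gr h1 h2 e
lemma bK2_of_poly {F g : ℂ → ℂ} {n : ℕ} (hF : Gr F 0 n)
    (hg : ∃ C : ℝ, ∀ t : ℝ, 0 < t → ‖g (I*t)‖ ≤ C*(1+t)*rexp (2*π*t+π/t)) :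
    ∃ C : ℝ, ∃ N : ℕ, ∀ Q : ℂ, 1/2 ≤ Q.im → ∀ t : ℝ, 0 < t →
    ‖F Q*g (I*t)‖ ≤ C*(1+‖Q‖)^N*(1+t)*(Ex t+rexp (2*π*Q.im)) := by
  obtain ⟨K, hK, hF⟩ := hF (1/2) (by norm_num)
  obtain ⟨C, hg⟩ := hg
  refine ⟨K*|C| * rexp (2*π), n, fun Q hQ t ht => ?_⟩
  rw [norm_mul]
  have h1 := hF Q hQ
  simp only [zero_mul, neg_zero, Real.exp_zero, mul_one] at h1
  have h2 : rexp (2*π*t+π/t) ≤ rexp (2*π)*(Ex t+rexp (2*π*Q.im)) := by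
    have h3 : 0 < rexp (2*π*Q.im) := Real.exp_pos _
    have hpi := Real.pi_pos
    rcases le_total 1 t with h | h
    · calc rexp (2*π*t+π/t) ≤ rexp (2*π+2*π*t) := by
            apply Real.exp_le_exp.2
            have : π/t ≤ π := div_le_self hpi.le h
            linarith
        _ = rexp (2*π)*rexp (2*π*t) := Real.exp_add _ _
        _ ≤ _ := by
          gcongr
          have := Real.exp_pos (2*π/t)
          unfold Ex; linarith
    · calc rexp (2*π*t+π/t) ≤ rexp (2*π+2*π/t) := by
            apply Real.exp_le_exp.2
            have e1 : 2*π*t ≤ 2*π := by nlinarith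
            have e2 : 2*π/t = π/t+π/t := by ring
            have : 0 ≤ π/t := by positivity
            linarith
        _ = rexp (2*π)*rexp (2*π/t) := Real.exp_add _ _
        _ ≤ _ := by
          gcongr
          have := Real.exp_pos (2*π*t)
          unfold Ex; linarith
  calc ‖F Q‖*‖g (I*t)‖ ≤ (K*(1+‖Q‖)^n)*(|C| * (1+t)*(rexp (2*π)*(Ex t+rexp (2*π*Q.im)))) := by
        gcongr
        refine (hg t ht).trans ?_
        gcongr
        exact le_abs_self C
    _ = _ := by ring
lemma bK2_add {F1 F2 F3 : ℂ → ℝ → ℂ}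
    (h1 : ∃ C : ℝ, ∃ N : ℕ, ∀ Q : ℂ, 1/2 ≤ Q.im → ∀ t : ℝ, 0 < t →
      ‖F1 Q t‖ ≤ C*(1+‖Q‖)^N*(1+t)*(Ex t+rexp (2*π*Q.im)))
    (h2 : ∃ C : ℝ, ∃ N : ℕ, ∀ Q : ℂ, 1/2 ≤ Q.im → ∀ t : ℝ, 0 < t →
      ‖F2 Q t‖ ≤ C*(1+‖Q‖)^N*(1+t)*(Ex t+rexp (2*π*Q.im)))
    (h3 : ∃ C : ℝ, ∃ N : ℕ, ∀ Q : ℂ, 1/2 ≤ Q.im → ∀ t : ℝ, 0 < t →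
      ‖F3 Q t‖ ≤ C*(1+‖Q‖)^N*(1+t)*(Ex t+rexp (2*π*Q.im))) :
    ∃ C : ℝ, ∃ N : ℕ, ∀ Q : ℂ, 1/2 ≤ Q.im → ∀ t : ℝ, 0 < t →
      ‖F1 Q t+F2 Q t+F3 Q t‖ ≤ C*(1+‖Q‖)^N*(1+t)*(Ex t+rexp (2*π*Q.im)) := by
  obtain ⟨C1, n1, h1⟩ := h1
  obtain ⟨C2, n2, h2⟩ := h2
  obtain ⟨C3, n3, h3⟩ := h3
  refine ⟨|C1|+|C2|+|C3|, n1+n2+n3, fun Q hQ t ht => ?_⟩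
  have key : ∀ (C : ℝ) (n : ℕ), n ≤ n1+n2+n3 → C*(1+‖Q‖)^n*(1+t)*(Ex t+rexp (2*π*Q.im)) ≤
      |C| * ((1+‖Q‖)^(n1+n2+n3)*(1+t)*(Ex t+rexp (2*π*Q.im))) := by
    intro C n hn
    have := Ex_pos t
    have e : (1+‖Q‖)^n ≤ (1+‖Q‖)^(n1+n2+n3) :=
      pow_le_pow_right₀ (by linarith [norm_nonneg Q]) hn
    rw [mul_assoc, mul_assoc]
    refine mul_le_mul (le_abs_self C) ?_ (by positivity) (abs_nonneg C)
    rw [← mul_assoc]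
    gcongr
  refine norm_add₃_le.trans ?_
  have := (h1 Q hQ t ht).trans (key _ _ (by omega))
  have := (h2 Q hQ t ht).trans (key _ _ (by omega))
  have := (h3 Q hQ t ht).trans (key _ _ (by omega))
  linarith
def e0 : ℂ := -(π*I)/6
def pf0 (Q : ℂ) : ℂ := -Q*tE6 Q
def pf1 (Q : ℂ) : ℂ := -tE4 Q*(1-2*Q*te2 Q)
def pf2 (Q : ℂ) : ℂ := tw Q*te2 Q*(1-Q*te2 Q)+(e0^2*pf0 Q+e0*pf1 Q)*tj Q
def pg0 (z : ℂ) : ℂ := 256*tE4 z^2/thD z^2*(1-z*te2 z)^2-e0^2*z^2*tj z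
def pg1 (z : ℂ) : ℂ := -z*(256*tE4 z*tE6 z/thD z^2)*(1-z*te2 z)-e0*z^2*tj z
def pg2 (z : ℂ) : ℂ := z^2
lemma pf0_T (hQ : Q ∈ HH) : pf0 (Q+1) = pf0 Q-tE6 Q := by
  rw [pf0, pf0, tE6_T hQ]; ring
lemma pf1_T (hQ : Q ∈ HH) : pf1 (Q+1) = pf1 Q+2*tE4 Q*te2 Q := by
  rw [pf1, pf1, tE4_T hQ, te2_T hQ]; ring
lemma pf2_T (hQ : Q ∈ HH) : pf2 (Q+1) = pf2 Q +
    (-(tw Q*te2 Q^2)+(-(e0^2*tE6 Q)+2*e0*tE4 Q*te2 Q)*tj Q) := by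
  rw [pf2, pf0_T hQ, pf1_T hQ, te2_T hQ, tw_T hQ, tj_T hQ, pf2]; ring
lemma pf0_S (hQ : Q ∈ HH) : pf0 (-1/Q) = -1*Q^4*pf0 Q := by
  have := HH_ne_zero hQ
  rw [pf0, pf0, tE6_S hQ]; field_simp
lemma pf1_S (hQ : Q ∈ HH) : pf1 (-1/Q) = -1*Q^4*pf1 Q := by
  have := HH_ne_zero hQ
  rw [pf1, pf1, tE4_S hQ, te2_S hQ]; field_simp; ring
lemma pf2_S (hQ : Q ∈ HH) : pf2 (-1/Q) = -1*Q^4*pf2 Q := by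
  have := HH_ne_zero hQ
  rw [pf2, pf2, pf0_S hQ, pf1_S hQ, te2_S hQ, tw_S hQ, tj_S hQ]; field_simp; ring
lemma p_N0 {z : ℂ} (hz : z ∈ HH) : pf0 z*pg0 z+pf1 z*pg1 z+pf2 z*pg2 z = 0 := by
  have hD := thD_ne hz
  simp only [pf0, pf1, pf2, pg0, pg1, pg2, tw, tj]
  field_simp
  ring
lemma p_N1 {z : ℂ} (hz : z ∈ HH) : pf0 (z+1)*pg0 z+pf1 (z+1)*pg1 z+pf2 (z+1)*pg2 z = - tw z := by
  have hD := thD_ne hz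
  rw [pf0_T hz, pf1_T hz, pf2_T hz]
  simp only [pf0, pf1, pf2, pg0, pg1, pg2, tw, tj]
  field_simp
  ring
lemma p_N2 {z : ℂ} (hz : z ∈ HH) : pf0 (-1/z+1)*pg0 z+pf1 (-1/z+1)*pg1 z+pf2 (-1/z+1)*pg2 z = 0 := by
  have hD := thD_ne hz
  have h0 := HH_ne_zero hz
  have hz' := HH_neg_inv hz
  rw [pf0_T hz', pf1_T hz', pf2_T hz', pf0_S hz, pf1_S hz, pf2_S hz, tE4_S hz, tE6_S hz, te2_S hz, tw_S hz, tj_S hz]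
  simp only [pf0, pf1, pf2, pg0, pg1, pg2, tw, tj]
  field_simp
  ring
lemma gr_D2 : Gr (fun z => 256/thD z^2) (-2) 0 := by
  refine gr_invD2.congr fun z _ => ?_
  rw [inv_pow, div_eq_mul_inv]
lemma gr_jw : Gr (fun z => tj z-tw z) 0 0 := by
  have h := ((gr_D2.mul (gr_E4.pow 2)).mul (gr_E4'.sub gr_E6'))
  refine (gr_of_eq h (by norm_num)).congr fun z _ => ?_
  simp only [tj, tw]; ring
lemma gr_e22 : Gr (fun z => te2 z^2-e0^2) 2 0 := by
  refine (gr_of_eq (gr_e2'.mul (gr_e2.add (Gr.const e0))) (by norm_num)).congr fun z _ => ?_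
  simp only [e0]; ring
lemma gr_pf0 : Gr pf0 0 1 := (gr_of_eq (Gr.id.mul gr_E6) (by norm_num)).neg.congr fun z _ => by simp [pf0]
lemma gr_pf1 : Gr pf1 0 1 := by
  have h1 := (gr_E4.mono (m := 1) le_rfl (by norm_num)).neg
  have h2 := (gr_of_eq ((Gr.id.mul gr_E4).mul gr_e2) (by norm_num : (0:ℝ)+0+0 = 0)).const_mul 2
  exact (h1.add h2).congr fun z _ => by simp only [pf1]; ring
lemma gr_jE {φ : ℂ → ℂ} {n : ℕ} (h : Gr φ 2 n) : Gr (fun z => φ z*tj z) 0 n :=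
  gr_of_eq (h.mul gr_j) (by norm_num)
lemma gr_pf2_aux1 : Gr (fun z => tw z*te2 z-e0*tE4 z*tj z) 0 0 := by
  have h1 := (gr_of_eq (gr_jw.mul gr_e2) (by norm_num : (0:ℝ)+0=0)).neg
  have h2 := gr_jE gr_e2'
  have h3 := (gr_jE gr_E4').const_mul e0
  exact ((h1.add h2).sub h3).congr fun z _ => by simp only [e0]; ring
lemma gr_pf2_aux2 : Gr (fun z => -(tw z*te2 z^2)+(-(e0^2*tE6 z)+2*e0*tE4 z*te2 z)*tj z) 0 0 := by
  have h1 := (gr_of_eq (gr_jw.mul (gr_e2.pow 2)) (by norm_num : (0:ℝ)+((2:ℕ):ℝ)*0=0))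
  have h2 := (gr_jE gr_e22).neg
  have h3 := (gr_jE gr_E6').const_mul (-(e0^2))
  have h4 := (gr_of_eq ((gr_jE gr_e2').mul gr_E4) (by norm_num : (0:ℝ)+0=0)).const_mul (2*e0)
  have h5 := (gr_jE gr_E4').const_mul (2*e0^2)
  exact ((((h1.add h2).add h3).add h4).add h5).congr fun z _ => by simp only [e0]; ring
lemma gr_pf2 : Gr pf2 0 1 := by
  have h1 := gr_pf2_aux1.mono (m := 1) le_rfl (by norm_num)
  have h2 := gr_of_eq (Gr.id.mul gr_pf2_aux2) (by norm_num : (0:ℝ)+0=0)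
  exact (h1.add h2).congr fun z _ => by simp only [pf2, pf0, pf1]; ring
lemma pg0_S {z : ℂ} (hz : z ∈ HH) : pg0 (-1/z) = z⁻¹^2*(256/thD z^2*tE4 z^2*te2 z^2-e0^2*tj z) := by
  have hD := thD_ne hz
  have h0 := HH_ne_zero hz
  rw [pg0, tE4_S hz, te2_S hz, thD_S hz, tj_S hz]
  field_simp; ring
lemma pg1_S {z : ℂ} (hz : z ∈ HH) : pg1 (-1/z) = z⁻¹^2*(256/thD z^2*tE4 z*tE6 z*te2 z-e0*tj z) := by
  have hD := thD_ne hz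
  have h0 := HH_ne_zero hz
  rw [pg1, tE4_S hz, tE6_S hz, te2_S hz, thD_S hz, tj_S hz]
  field_simp; ring
lemma pg2_S {z : ℂ} : pg2 (-1/z) = z⁻¹^2*1 := by rw [pg2]; ring
lemma gr_q0 : Gr (fun z => 256/thD z^2*tE4 z^2*te2 z^2-e0^2*tj z) 0 0 := by
  have h1 := gr_of_eq ((gr_D2.mul (gr_E4.pow 2)).mul (gr_e22.sub (gr_E4'.const_mul (e0^2))))
    (by norm_num : (-2:ℝ)+((2:ℕ):ℝ)*0+2 = 0)
  exact h1.congr fun z _ => by simp only [tj]; ring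
lemma gr_q1 : Gr (fun z => 256/thD z^2*tE4 z*tE6 z*te2 z-e0*tj z) 0 0 := by
  have h1 := gr_of_eq (((gr_D2.mul gr_E4).mul gr_E6).mul gr_e2') (by norm_num : (-2:ℝ)+0+0+2 = 0)
  have h2 := (gr_of_eq ((gr_D2.mul gr_E4).mul (gr_E4'.sub gr_E6'))
    (by norm_num : (-2:ℝ)+0+2 = 0)).const_mul e0
  have h3 := (gr_of_eq ((gr_D2.mul gr_E4).mul ((gr_of_eq (gr_E4'.mul gr_E4) (by norm_num : (2:ℝ)+0=2))))
    (by norm_num : (-2:ℝ)+0+2 = 0)).const_mul e0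
  exact ((h1.sub h2).sub h3).congr fun z _ => by simp only [tj, e0]; ring
lemma gr_D2' : Gr (fun z => 256/thD z^2-cexp (-(π*I*z))^2) (-1) 0 := by
  have hX : Gr (fun z => cexp (-(π*I*z))*thD z-16) 1 0 := by
    have h1 := gr_of_eq (gr_thA0.mul (gr_B.mul gr_B)) (by norm_num : (2:ℝ)+(0+0) = 2)
    have h2 := gr_of_eq (gr_B1.mul (gr_B.add (Gr.const 1))) (by norm_num : (1:ℝ)+0 = 1)
    have h3 : Gr (fun z => thA0 z) 0 0 := gr_thA0.of_sub (by norm_num)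
    have h4 := gr_of_eq (h3.mul (gr_A.mul gr_B)) (by norm_num : (0:ℝ)+(1+0) = 1)
    refine (((h1.mono (by norm_num : (1:ℝ) ≤ 2) le_rfl).add (h2.const_mul 16)).add h4).congr fun z _ => ?_
    rw [thD, thA0_eq]; ring
  have hX0 : Gr (fun z => cexp (-(π*I*z))*thD z) 0 0 := hX.of_sub (by norm_num)
  have h5 := gr_of_eq ((hX.mul (hX0.add (Gr.const 16))).mul gr_invD2) (by norm_num : (1:ℝ)+0+(-2) = -1)
  refine ((h5.const_mul (-(1/256))).congr fun z hz => ?_)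
  have hD := thD_ne hz
  field_simp
  ring
lemma gr_D2φ {φ : ℂ → ℂ} {L : ℂ} (h : Gr (fun z => φ z-L) 1 0) :
    Gr (fun z => 256/thD z^2*φ z-L*cexp (-(π*I*z))^2) (-1) 0 := by
  have h1 := gr_of_eq (gr_D2.mul h) (by norm_num : (-2:ℝ)+1=-1)
  exact (h1.add (gr_D2'.const_mul L)).congr fun z _ => by ring
lemma Gr.mul1 {φ ψ : ℂ → ℂ} {L M : ℂ} (h : Gr (fun z => φ z-L) 1 0) (h' : Gr (fun z => ψ z-M) 1 0) :
    Gr (fun z => φ z*ψ z-L*M) 1 0 := by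
  have h1 := gr_of_eq (h.mul (h'.of_sub (by norm_num))) (by norm_num : (1:ℝ)+0=1)
  exact (h1.add (h'.const_mul L)).congr fun z _ => by ring
lemma gr_E41 : Gr (fun z => tE4 z-1) 1 0 := gr_E4'.mono (by norm_num) le_rfl
lemma gr_E61 : Gr (fun z => tE6 z-1) 1 0 := gr_E6'.mono (by norm_num) le_rfl
lemma gr_e21 : Gr (fun z => te2 z-e0) 1 0 := (gr_e2'.mono (by norm_num) le_rfl).congr fun z _ => by simp only [e0]
lemma gr_pg0 : Gr (fun z => pg0 z-(1+(-2*e0)*z)*cexp (-(π*I*z))^2) (1-2) 2 := by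
  rw [show (1:ℝ)-2 = -1 by norm_num]
  have h1 := (gr_D2φ (gr_E41.mul1 gr_E41)).mono (m := 2) le_rfl (by norm_num)
  have h2 := (gr_of_eq (Gr.id.mul (gr_D2φ ((gr_E41.mul1 gr_E41).mul1 gr_e21))) (by norm_num : (0:ℝ)+-1=-1)).mono (m := 2) le_rfl (by norm_num)
  have h3 := (gr_of_eq ((Gr.id.pow 2).mul gr_q0) (by norm_num : ((2:ℕ):ℝ)*0+0=0)).mono (b := -1) (m := 2) (by norm_num) (by norm_num)
  exact ((h1.add (h2.const_mul (-2))).add h3).congr fun z _ => by simp only [pg0]; ring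
lemma gr_pg1 : Gr (fun z => pg1 z-(0+(-1)*z)*cexp (-(π*I*z))^2) (1-2) 2 := by
  rw [show (1:ℝ)-2 = -1 by norm_num]
  have h2 := (gr_of_eq (Gr.id.mul (gr_D2φ ((gr_E41.mul1 gr_E61)))) (by norm_num : (0:ℝ)+-1=-1)).mono (m := 2) le_rfl (by norm_num)
  have h3 := (gr_of_eq ((Gr.id.pow 2).mul gr_q1) (by norm_num : ((2:ℕ):ℝ)*0+0=0)).mono (b := -1) (m := 2) (by norm_num) (by norm_num)
  exact ((h2.const_mul (-1)).add h3).congr fun z _ => by simp only [pg1]; ring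
lemma gr_pg2 : Gr (fun z => pg2 z-(0+0*z)*cexp (-(π*I*z))^2) (2-2) 2 := by
  exact (gr_of_eq (Gr.id.pow 2) (by norm_num)).congr fun z _ => by simp only [pg2]; ring
lemma bK2_p3 : ∃ C : ℝ, ∃ N : ℕ, ∀ Q : ℂ, 1/2 ≤ Q.im → ∀ t : ℝ, 0 < t →
    ‖pf2 (-1/Q+1)*pg2 (I*t)‖ ≤ C*(1+‖Q‖)^N*(1+t)*(Ex t+rexp (2*π*Q.im)) := by
  have hG : Gr (fun Q => pf2 (-1/Q+1)) (-2) 7 := by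
    have hw := gr_w
    have h1 := ((gr_of_eq ((Gr.id.pow 4).mul gr_pf2) (by norm_num : ((4:ℕ):ℝ)*0+0=0)).mono (b := -2) (m := 7)
      (by norm_num) (by norm_num)).neg
    have hS := gr_of_eq (((Gr.id.pow 2).mul gr_e2).sub (Gr.id.mono (m := 2*1+0) le_rfl (by norm_num) |> fun h => gr_of_eq h (by norm_num : (0:ℝ) = ((2:ℕ):ℝ)*0+0))) (by norm_num : ((2:ℕ):ℝ)*0+0=0)
    have h2 := ((gr_of_eq (((Gr.id.pow 2).mul gr_w).mul (hS.pow 2)) (by norm_num : ((2:ℕ):ℝ)*0+-2+((2:ℕ):ℝ)*0=-2)).mono (m := 7)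
      le_rfl (by norm_num)).neg
    have h3 := ((gr_of_eq (((Gr.id.pow 6).mul gr_E6).mul gr_j) (by norm_num : ((6:ℕ):ℝ)*0+0+-2=-2)).mono (m := 7)
      le_rfl (by norm_num)).const_mul (-(e0^2))
    have h4 := ((gr_of_eq ((((Gr.id.pow 4).mul gr_E4).mul hS).mul gr_j) (by norm_num : ((4:ℕ):ℝ)*0+0+0+-2=-2)).mono (m := 7)
      le_rfl (by norm_num)).const_mul (2*e0)
    refine (((h1.add h2).add h3).add h4).congr fun z hz => ?_
    rw [pf2_T (HH_neg_inv hz), pf2_S hz, tE4_S hz, tE6_S hz, te2_S hz, tw_S hz, tj_S hz]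
    ring
  obtain ⟨C, hC, h⟩ := hG (1/2) (by norm_num)
  refine ⟨C, 8, fun Q hQ t ht => ?_⟩
  have h1 := h Q hQ
  have h2 : ‖pg2 (I*t)‖ = t^2 := by
    rw [pg2, norm_pow, norm_mul, norm_I, one_mul, Complex.norm_real, Real.norm_of_nonneg ht.le]
  rw [norm_mul, h2]
  rw [show -(-2*π*Q.im) = 2*π*Q.im by ring] at h1
  set y := Q.im
  have hy : y ≤ ‖Q‖ := (le_abs_self _).trans (abs_im_le_norm Q)
  have hpi := Real.pi_gt_three
  have key : t^2*rexp (2*π*y) ≤ (1+‖Q‖)*(1+t)*(Ex t+rexp (2*π*y)) := by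
    have h3 : t*rexp (2*π*y) ≤ (1+‖Q‖)*(Ex t+rexp (2*π*y)) := by
      have hE : rexp (2*π*t) ≤ Ex t := by
        have := Real.exp_pos (2*π/t)
        unfold Ex; linarith
      have h4 : (1+(t-y))*rexp (2*π*y) ≤ Ex t+rexp (2*π*y) := by
        rcases le_total t y with h | h
        · have := Ex_pos t
          have := Real.exp_pos (2*π*y)
          nlinarith
        · have h5 : 1+(t-y) ≤ rexp (2*π*(t-y)) := by
            refine le_trans ?_ (Real.add_one_le_exp _)
            nlinarith
          calc (1+(t-y))*rexp (2*π*y) ≤ rexp (2*π*(t-y))*rexp (2*π*y) := by gcongr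
            _ = rexp (2*π*t) := by rw [← Real.exp_add]; congr 1; ring
            _ ≤ _ := by have := Real.exp_pos (2*π*y); linarith
      have h6 : y*rexp (2*π*y) ≤ ‖Q‖*(Ex t+rexp (2*π*y)) := by
        gcongr
        have := Ex_pos t
        linarith
      have := Real.exp_pos (2*π*y)
      linarith
    calc t^2*rexp (2*π*y) = t*(t*rexp (2*π*y)) := by ring
      _ ≤ (1+t)*((1+‖Q‖)*(Ex t+rexp (2*π*y))) := by
        gcongr
        linarith
      _ = _ := by ring
  calc _ ≤ (C*rexp (2*π*y)*(1+‖Q‖)^7)*t^2 := by gcongr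
    _ = C*(1+‖Q‖)^7*(t^2*rexp (2*π*y)) := by ring
    _ ≤ C*(1+‖Q‖)^7*((1+‖Q‖)*(1+t)*(Ex t+rexp (2*π*y))) := by gcongr
    _ = _ := by ring
lemma gr_pf0TS : Gr (fun Q => pf0 (-1/Q+1)) 0 6 := by
  have h1 := ((gr_of_eq ((Gr.id.pow 4).mul gr_pf0) (by norm_num : ((4:ℕ):ℝ)*0+0=0)).mono (m := 6) le_rfl (by norm_num)).neg
  have h2 := (gr_of_eq ((Gr.id.pow 6).mul gr_E6) (by norm_num : ((6:ℕ):ℝ)*0+0=0))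
  refine (h1.sub h2).congr fun z hz => ?_
  rw [pf0_T (HH_neg_inv hz), pf0_S hz, tE6_S hz]; ring
lemma gr_pf1TS : Gr (fun Q => pf1 (-1/Q+1)) 0 6 := by
  have h1 := ((gr_of_eq ((Gr.id.pow 4).mul gr_pf1) (by norm_num : ((4:ℕ):ℝ)*0+0=0)).mono (m := 6) le_rfl (by norm_num)).neg
  have h2 := (gr_of_eq (((Gr.id.pow 6).mul gr_E4).mul gr_e2) (by norm_num : ((6:ℕ):ℝ)*0+0+0=0)).const_mul 2
  have h3 := ((gr_of_eq ((Gr.id.pow 5).mul gr_E4) (by norm_num : ((5:ℕ):ℝ)*0+0=0)).mono (m := 6) le_rfl (by norm_num)).const_mul 2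
  refine ((h1.add h2).sub h3).congr fun z hz => ?_
  rw [pf1_T (HH_neg_inv hz), pf1_S hz, tE4_S hz, te2_S hz]; ring
lemma pbg0 : ∃ C : ℝ, ∀ t : ℝ, 0 < t → ‖pg0 (I*t)‖ ≤ C*(1+t)*rexp (2*π*t+π/t) :=
   bg_of_gr' le_rfl gr_pg0 ((gr_q0.mono (b := -1) (m := 2) (by norm_num) (by norm_num))) (fun z hz => pg0_S hz)
lemma pbg1 : ∃ C : ℝ, ∀ t : ℝ, 0 < t → ‖pg1 (I*t)‖ ≤ C*(1+t)*rexp (2*π*t+π/t) :=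
   bg_of_gr' le_rfl gr_pg1 ((gr_q1.mono (b := -1) (m := 2) (by norm_num) (by norm_num))) (fun z hz => pg1_S hz)
lemma pbg2 : ∃ C : ℝ, ∀ t : ℝ, 0 < t → ‖pg2 (I*t)‖ ≤ C*(1+t)*rexp (2*π*t+π/t) :=
   bg_of_gr' (by norm_num) gr_pg2 (((Gr.const 1).mono (b := -1) (m := 2) (by norm_num) (by norm_num))) (fun _ _ => pg2_S)
lemma pf0_diffAt (hQ : Q ∈ HH) : DifferentiableAt ℂ pf0 Q := by
  have := tE6_diffAt hQ
  unfold pf0; fun_prop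
lemma pf1_diffAt (hQ : Q ∈ HH) : DifferentiableAt ℂ pf1 Q := by
  have := tE4_diffAt hQ
  have := te2_diffAt hQ
  unfold pf1; fun_prop
lemma pf2_diffAt (hQ : Q ∈ HH) : DifferentiableAt ℂ pf2 Q := by
  have := pf0_diffAt hQ
  have := pf1_diffAt hQ
  have := te2_diffAt hQ
  have := tw_diffAt hQ
  have := tj_diffAt hQ
  unfold pf2; fun_prop
lemma D2_diffAt (hQ : Q ∈ HH) : DifferentiableAt ℂ (fun z => 256/thD z^2) Q :=
  (differentiableAt_const _).div ((thD_diffAt hQ).pow 2) (pow_ne_zero 2 (thD_ne hQ))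
lemma pg0_diffAt (hQ : Q ∈ HH) : DifferentiableAt ℂ pg0 Q := by
  have := tE4_diffAt hQ
  have := te2_diffAt hQ
  have := tj_diffAt hQ
  have := D2_diffAt hQ
  have e : pg0 = fun z => 256/thD z^2*(tE4 z^2)*(1-z*te2 z)^2-e0^2*z^2*tj z := by
    funext z; rw [pg0]; ring
  rw [e]; fun_prop
lemma pg1_diffAt (hQ : Q ∈ HH) : DifferentiableAt ℂ pg1 Q := by
  have := tE4_diffAt hQ
  have := tE6_diffAt hQ
  have := te2_diffAt hQ
  have := tj_diffAt hQ
  have := D2_diffAt hQ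
  have e : pg1 = fun z => -z*(256/thD z^2*(tE4 z*tE6 z))*(1-z*te2 z)-e0*z^2*tj z := by
    funext z; rw [pg1]; ring
  rw [e]; fun_prop
def kerP : Ker 1 where
  f := ![pf0, pf1, pf2]
  g := ![pg0, pg1, pg2]
  f_diff := by
    intro i Q hQ
    fin_cases i
    exacts [pf0_diffAt hQ, pf1_diffAt hQ, pf2_diffAt hQ]
  g_cont := by
    intro i Q hQ
    fin_cases i
    exacts [(pg0_diffAt hQ).continuousAt, (pg1_diffAt hQ).continuousAt, (continuous_pow 2).continuousAt]
  f_S := by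
    intro i Q hQ
    fin_cases i
    exacts [pf0_S hQ, pf1_S hQ, pf2_S hQ]
  f_T := by
    intro i Q hQ
    have h1 := HH_add_one hQ
    fin_cases i
    · change pf0 _ = 2*pf0 _-pf0 _
      rw [pf0_T h1, pf0_T hQ, tE6_T hQ]; ring
    · change pf1 _ = 2*pf1 _-pf1 _
      rw [pf1_T h1, pf1_T hQ, tE4_T hQ, te2_T hQ]; ring
    · change pf2 _ = 2*pf2 _-pf2 _
      rw [pf2_T h1, pf2_T hQ, tE4_T hQ, tE6_T hQ, te2_T hQ, tw_T hQ, tj_T hQ]; ring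
  N0 := fun z hz => by rw [Fin.sum_univ_three]; exact p_N0 hz
  N1 := fun z hz => by rw [Fin.sum_univ_three]; exact p_N1 hz
  N2 := fun z hz => by rw [Fin.sum_univ_three]; exact p_N2 hz
  bf := by
    intro i
    fin_cases i
    exacts [⟨_, gr_pf0⟩, ⟨_, gr_pf1⟩, ⟨_, gr_pf2⟩]
  bK2 := by
    simp only [Fin.sum_univ_three]
    exact bK2_add (bK2_of_poly gr_pf0TS pbg0) (bK2_of_poly gr_pf1TS pbg1) bK2_p3
  bg := by
    intro i
    fin_cases i
    exacts [pbg0, pbg1, pbg2]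
  bg' := by
    intro i
    fin_cases i
    exacts [bg'_of_gr le_rfl gr_pg0, bg'_of_gr le_rfl gr_pg1, bg'_of_gr (by norm_num) gr_pg2]
def tP (Q : ℂ) : ℂ := thA Q+2*thB Q
def tP' (Q : ℂ) : ℂ := -(2*thA Q+thB Q)
def tQ (Q : ℂ) : ℂ := thA Q^2-2*thA Q*thB Q-2*thB Q^2
def tQ' (Q : ℂ) : ℂ := thB Q^2-2*thA Q*thB Q-2*thA Q^2
def tL2 (Q : ℂ) : ℂ := tP Q*ll Q+tP' Q*lm Q
def tL4 (Q : ℂ) : ℂ := tQ Q*ll Q+tQ' Q*lm Q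
def rr : ℂ := (2*π*I)⁻¹
lemma rr_pi : rr*(π*I) = 1/2 := by
  have : (π : ℂ) ≠ 0 := ofReal_ne_zero.2 Real.pi_ne_zero
  rw [rr]; field_simp
def mf0 (Q : ℂ) : ℂ := 2*rr*tE4 Q
def mf1 (Q : ℂ) : ℂ := -(2/9)*rr*tL4 Q
def mf2 (Q : ℂ) : ℂ := 2/9*rr*(tL4 Q*tj Q+tw Q*tL2 Q)
def mg0 (z : ℂ) : ℂ := 256*tE4 z*tE6 z/thD z^2*ll z
def mg1 (z : ℂ) : ℂ := (tQ' z*tj z+tw z*tP' z)/thD z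
def mg2 (z : ℂ) : ℂ := tQ' z/thD z
lemma tP_T (hQ : Q ∈ HH) : tP (Q+1) = tP Q := by
  simp only [tP, thA_add_one, thB_add_one' hQ]; ring
lemma tQ_T (hQ : Q ∈ HH) : tQ (Q+1) = tQ Q := by
  simp only [tQ, thA_add_one, thB_add_one' hQ]; ring
lemma tP_S (hQ : Q ∈ HH) : tP (-1/Q) = Q^2*tP' Q := by
  simp only [tP, tP', thA_S hQ, thB_S hQ]; ring
lemma tP'_S (hQ : Q ∈ HH) : tP' (-1/Q) = Q^2*tP Q := by
  simp only [tP, tP', thA_S hQ, thB_S hQ]; ring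
lemma tQ_S (hQ : Q ∈ HH) : tQ (-1/Q) = Q^4*tQ' Q := by
  simp only [tQ, tQ', thA_S hQ, thB_S hQ]; ring
lemma tQ'_S (hQ : Q ∈ HH) : tQ' (-1/Q) = Q^4*tQ Q := by
  simp only [tQ, tQ', thA_S hQ, thB_S hQ]; ring
lemma tL2_T (hQ : Q ∈ HH) : tL2 (Q+1) = tL2 Q+π*I*tP Q := by
  rw [tL2, tP_T hQ, ll_T hQ, lm_T]
  simp only [tL2, tP, tP', thA_add_one, thB_add_one' hQ]; ring
lemma tL4_T (hQ : Q ∈ HH) : tL4 (Q+1) = tL4 Q+π*I*tQ Q := by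
  rw [tL4, tQ_T hQ, ll_T hQ, lm_T]
  simp only [tL4, tQ, tQ', thA_add_one, thB_add_one' hQ]; ring
lemma tL2_S (hQ : Q ∈ HH) : tL2 (-1/Q) = Q^2*tL2 Q := by
  simp only [tL2, tP_S hQ, tP'_S hQ, ll_S hQ, lm_S]; ring
lemma tL4_S (hQ : Q ∈ HH) : tL4 (-1/Q) = Q^4*tL4 Q := by
  simp only [tL4, tQ_S hQ, tQ'_S hQ, ll_S hQ, lm_S]; ring
lemma mf0_T (hQ : Q ∈ HH) : mf0 (Q+1) = mf0 Q := by rw [mf0, mf0, tE4_T hQ]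
lemma mf1_T (hQ : Q ∈ HH) : mf1 (Q+1) = mf1 Q-1/9*tQ Q := by
  rw [mf1, mf1, tL4_T hQ]; linear_combination (-(2/9)*tQ Q)*rr_pi
lemma mf2_T (hQ : Q ∈ HH) : mf2 (Q+1) = mf2 Q+1/9*(tQ Q*tj Q+tw Q*tP Q) := by
  rw [mf2, mf2, tL4_T hQ, tL2_T hQ, tj_T hQ, tw_T hQ]
  linear_combination (2/9*(tQ Q*tj Q+tw Q*tP Q))*rr_pi
lemma mf0_S (hQ : Q ∈ HH) : mf0 (-1/Q) = -(-1)*Q^4*mf0 Q := by rw [mf0, mf0, tE4_S hQ]; ring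
lemma mf1_S (hQ : Q ∈ HH) : mf1 (-1/Q) = -(-1)*Q^4*mf1 Q := by rw [mf1, mf1, tL4_S hQ]; ring
lemma mf2_S (hQ : Q ∈ HH) : mf2 (-1/Q) = -(-1)*Q^4*mf2 Q := by
  rw [mf2, mf2, tL4_S hQ, tL2_S hQ, tj_S hQ, tw_S hQ]; ring
lemma m_N0 {z : ℂ} (hz : z ∈ HH) : mf0 z*mg0 z+mf1 z*mg1 z+mf2 z*mg2 z = 0 := by
  have hA := thA_ne hz
  have hB := thB_ne hz
  have hC := thAB_ne hz
  simp only [mf0, mf1, mf2, mg0, mg1, mg2, tw, tj, tL2, tL4, tE4, tE6, thD, tQ, tQ', tP, tP']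
  field_simp
  ring
lemma m_N1 {z : ℂ} (hz : z ∈ HH) : mf0 (z+1)*mg0 z+mf1 (z+1)*mg1 z+mf2 (z+1)*mg2 z = - tw z := by
  have h := m_N0 hz
  rw [mf0_T hz, mf1_T hz, mf2_T hz]
  have : - (1/9*tQ z)*mg1 z+1/9*(tQ z*tj z+tw z*tP z)*mg2 z = - tw z := by
    have hA := thA_ne hz
    have hB := thB_ne hz
    have hC := thAB_ne hz
    simp only [mg1, mg2, thD, tQ, tQ', tP, tP']
    field_simp
    ring
  linear_combination h+this
lemma m_N2 {z : ℂ} (hz : z ∈ HH) : mf0 (-1/z+1)*mg0 z+mf1 (-1/z+1)*mg1 z+mf2 (-1/z+1)*mg2 z = 0 := by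
  have h := m_N0 hz
  have hz' := HH_neg_inv hz
  have h0 := HH_ne_zero hz
  rw [mf0_T hz', mf1_T hz', mf2_T hz', mf0_S hz, mf1_S hz, mf2_S hz, tQ_S hz, tj_S hz, tw_S hz, tP_S hz]
  have : - (1/9*tQ' z)*mg1 z+1/9*(tQ' z*tj z+tw z*tP' z)*mg2 z = 0 := by
    simp only [mg1, mg2]; ring
  linear_combination z^4*h+z^4*this
lemma gr_ll : Gr ll 0 1 := by
  intro c hc
  obtain ⟨K, hK, hB⟩ := gr_B c hc
  refine ⟨‖ll (I*c)‖+π*K*(1+c), by positivity, fun Q hQ => ?_⟩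
  have hconv : Convex ℝ {w : ℂ | c ≤ w.im} := convex_halfSpace_im_ge c
  have h1 := hconv.norm_image_sub_le_of_norm_hasDerivWithin_le (f := ll) (f' := fun w => π*I*thB w)
    (C := π*K) (x := I*c) (y := Q)
    (fun w hw => (ll_hasDeriv (show 0 < w.im from lt_of_lt_of_le hc hw)).hasDerivWithinAt)
    (fun w hw => by
      have := hB w hw
      simp only [zero_mul, neg_zero, Real.exp_zero, mul_one, pow_zero] at this
      rw [norm_mul, norm_mul, norm_I, mul_one, Complex.norm_real, Real.norm_of_nonneg Real.pi_pos.le]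
      gcongr) (show c ≤ (I*(c:ℂ)).im by simp) hQ
  have h2 : ‖ll Q‖ ≤ ‖ll (I*c)‖+π*K*(‖Q‖+c) := by
    have h3 := norm_le_norm_add_norm_sub' (ll Q) (ll (I*c))
    have h4 : ‖Q-I*c‖ ≤ ‖Q‖+c := by
      refine (norm_sub_le _ _).trans ?_
      rw [norm_mul, norm_I, one_mul, Complex.norm_real, Real.norm_of_nonneg hc.le]
    have : π*K*‖Q-I*c‖ ≤ π*K*(‖Q‖+c) := by
      have := Real.pi_pos
      gcongr
    linarith
  refine h2.trans ?_
  simp only [zero_mul, neg_zero, Real.exp_zero, mul_one, pow_one]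
  have hn := norm_nonneg Q
  have h5 : 0 ≤ ‖ll (I*c)‖*‖Q‖ := by positivity
  have h6 : 0 ≤ π*K := by have := Real.pi_pos; positivity
  have h7 : 0 ≤ π*K*(1+c*‖Q‖) := by positivity
  linarith
lemma gr_P' : Gr (fun Q => tP Q-2) 2 0 := by
  have := Gr.of_periodic (h := 1) one_pos (φ := tP) (L := 2) (fun Q h => (thA_diffAt h).add ((thB_diffAt h).const_mul 2))
    (fun Q h => by simpa using tP_T h) (by
      have := tendsto_thA.add (tendsto_thB.const_mul 2)
      norm_num at this
      exact this)
  simpa using this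
lemma tQ_diffAt (h : Q ∈ HH) : DifferentiableAt ℂ tQ Q := by
  have := thA_diffAt h
  have := thB_diffAt h
  unfold tQ; fun_prop
lemma tQ'_diffAt (h : Q ∈ HH) : DifferentiableAt ℂ tQ' Q := by
  have := thA_diffAt h
  have := thB_diffAt h
  unfold tQ'; fun_prop
lemma tP'_diffAt (h : Q ∈ HH) : DifferentiableAt ℂ tP' Q := by
  have := thA_diffAt h
  have := thB_diffAt h
  unfold tP'; fun_prop
lemma tP_diffAt (h : Q ∈ HH) : DifferentiableAt ℂ tP Q := by
  have := thA_diffAt h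
  have := thB_diffAt h
  unfold tP; fun_prop
lemma gr_Q2 : Gr (fun Q => tQ Q-(-2)) 2 0 := by
  have := Gr.of_periodic (h := 1) one_pos (φ := tQ) (L := -2) (fun Q h => tQ_diffAt h)
    (fun Q h => by simpa using tQ_T h) (by
      have := ((tendsto_thA.pow 2).sub ((tendsto_thA.const_mul 2).mul tendsto_thB)).sub ((tendsto_thB.pow 2).const_mul 2)
      norm_num at this
      exact this)
  simpa using this
lemma gr_A0 : Gr thA 0 0 := gr_A.mono (by norm_num) le_rfl
lemma gr_Q : Gr tQ 0 0 := gr_Q2.of_sub (by norm_num)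
lemma gr_Q' : Gr tQ' 0 0 := by
  have h1 := gr_of_eq (gr_B.mul gr_B) (by norm_num : (0:ℝ)+0=0)
  have h2 := gr_of_eq (gr_A0.mul gr_B) (by norm_num : (0:ℝ)+0=0)
  have h3 := gr_of_eq (gr_A0.mul gr_A0) (by norm_num : (0:ℝ)+0=0)
  exact ((h1.sub (h2.const_mul 2)).sub (h3.const_mul 2)).congr fun z _ => by simp only [tQ']; ring
lemma gr_A2 : Gr (fun z => thA z*thA z) 2 0 := gr_of_eq (gr_A.mul gr_A) (by norm_num)
lemma gr_AB1 : Gr (fun z => thA z*(thB z-1)) 2 0 := gr_of_eq (gr_A.mul gr_B1) (by norm_num)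
lemma gr_B12 : Gr (fun z => (thB z-1)*(thB z-1)) 2 0 := gr_of_eq (gr_B1.mul gr_B1) (by norm_num)
lemma gr_QP' : Gr (fun z => tQ' z+tP' z+9/2*thA z) 2 0 := by
  have h := ((gr_P'.const_mul (1/2)).add gr_B12).sub ((gr_AB1.const_mul 2).add (gr_A2.const_mul 2))
  exact h.congr fun z _ => by simp only [tQ', tP', tP]; ring
lemma gr_N : Gr (fun z => tQ z*tj z+tw z*tP z) 0 0 := by
  have h1 := gr_of_eq (gr_Q.mul gr_jw) (by norm_num : (0:ℝ)+0=0)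
  have h2 := gr_of_eq (gr_w.mul (gr_Q2.add gr_P')) (by norm_num : (-2:ℝ)+2=0)
  exact (h1.add h2).congr fun z _ => by ring
lemma gr_N'2 : Gr (fun z => tQ' z*tj z+tw z*tP' z+9/2*tw z*thA z) 0 0 := by
  have h1 := gr_of_eq (gr_Q'.mul gr_jw) (by norm_num : (0:ℝ)+0=0)
  have h2 := gr_of_eq (gr_w.mul gr_QP') (by norm_num : (-2:ℝ)+2=0)
  exact (h1.add h2).congr fun z _ => by ring
lemma gr_N' : Gr (fun z => tQ' z*tj z+tw z*tP' z) (-1) 0 := by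
  have h1 := (gr_of_eq (gr_w.mul gr_A) (by norm_num : (-2:ℝ)+1=-1)).const_mul (9/2)
  exact ((gr_N'2.mono (by norm_num : (-1:ℝ) ≤ 0) le_rfl).sub h1).congr fun z _ => by ring
lemma gr_L4 : Gr tL4 0 1 := by
  have h1 := gr_of_eq (gr_Q.mul gr_ll) (by norm_num : (0:ℝ)+0=0)
  have h2 := (gr_of_eq (gr_Q'.mul gr_lm) (by norm_num : (0:ℝ)+1=1)).mono (b := 0) (m := 1) (by norm_num) (by norm_num)
  exact (h1.add h2).congr fun z _ => rfl
lemma gr_mf0 : Gr mf0 0 0 := (gr_E4.const_mul (2*rr))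
lemma gr_mf1 : Gr mf1 0 1 := (gr_L4.const_mul (-(2/9)*rr))
lemma gr_mf2 : Gr mf2 0 1 := by
  have h1 := gr_of_eq (gr_N.mul gr_ll) (by norm_num : (0:ℝ)+0=0)
  have h2 := (gr_of_eq (gr_N'.mul gr_lm) (by norm_num : (-1:ℝ)+1=0)).mono (m := 1) le_rfl (by norm_num)
  exact ((h1.add h2).const_mul (2/9*rr)).congr fun z _ => by simp only [mf2, tL4, tL2]; ring
lemma mg0_S {z : ℂ} (hz : z ∈ HH) : mg0 (-1/z) = z⁻¹^2*(256/thD z^2*(tE4 z*tE6 z)*lm z) := by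
  have hD := thD_ne hz
  have h0 := HH_ne_zero hz
  rw [mg0, tE4_S hz, tE6_S hz, thD_S hz, ll_S hz]; field_simp
lemma mg1_S {z : ℂ} (hz : z ∈ HH) : mg1 (-1/z) = z⁻¹^2*(-((tQ z*tj z+tw z*tP z)*(thD z)⁻¹)) := by
  have hD := thD_ne hz
  have h0 := HH_ne_zero hz
  rw [mg1, tQ'_S hz, tP'_S hz, tw_S hz, tj_S hz, thD_S hz]; field_simp
lemma mg2_S {z : ℂ} (hz : z ∈ HH) : mg2 (-1/z) = z⁻¹^2*(-(tQ z*(thD z)⁻¹)) := by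
  have hD := thD_ne hz
  have h0 := HH_ne_zero hz
  rw [mg2, tQ'_S hz, thD_S hz]; field_simp
lemma tendsto_llz : ∃ c : ℂ, Tendsto (fun z => ll z-π*I*z) imInf (𝓝 c) := by
  have hexp : ∀ z ∈ HH, cexp (ll z-π*I*z) = thA0 z/(thA z+thB z) := by
    intro z hz
    rw [sub_eq_add_neg, Complex.exp_add, exp_ll hz, thA0_eq]; ring
  have ht : Tendsto (fun z => thA0 z/(thA z+thB z)/16) imInf (𝓝 1) := by
    have h := (tendsto_thA0.div (tendsto_thA.add tendsto_thB) (by norm_num)).div_const 16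
    have e : (16:ℂ)/(0+1)/16 = 1 := by norm_num
    rwa [e] at h
  have hev : ∀ᶠ z in imInf, thA0 z/(thA z+thB z)/16 ∈ Complex.slitPlane :=
    ht.eventually (Complex.isOpen_slitPlane.mem_nhds (by simp))
  obtain ⟨Y, hY⟩ : ∃ Y : ℝ, ∀ z : ℂ, Y < z.im → thA0 z/(thA z+thB z)/16 ∈ Complex.slitPlane := by
    obtain ⟨s, hs, hs2⟩ := mem_comap.1 hev
    obtain ⟨Y, hY⟩ := mem_atTop_sets.1 hs
    exact ⟨Y, fun z hz => hs2 (hY _ hz.le)⟩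
  set Y1 := max Y 0
  set V : Set ℂ := {z | Y1 < z.im}
  have hVc : Convex ℝ V := convex_halfSpace_im_gt Y1
  have hVo : IsOpen V := isOpen_im_gt Y1
  have hVH : ∀ z ∈ V, z ∈ HH := fun z hz => lt_of_le_of_lt (le_max_right Y 0) hz
  set φ : ℂ → ℂ := fun z => ll z-π*I*z
  have hφ : ∀ z ∈ V, HasDerivAt φ (π*I*thB z-π*I) z := fun z hz => by
    exact ((ll_hasDeriv (hVH z hz)).sub ((hasDerivAt_id z).const_mul (π*I))).congr_deriv (by rw [mul_one])
  have hsl : ∀ z ∈ V, cexp (φ z)/16 ∈ Complex.slitPlane := fun z hz => by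
    rw [hexp z (hVH z hz)]
    exact hY z (lt_of_le_of_lt (le_max_left _ _) hz)
  set ψ : ℂ → ℂ := fun z => φ z-Complex.log (cexp (φ z)/16)
  have hψ : ∀ z ∈ V, HasDerivAt ψ 0 z := fun z hz => by
    have h1 := hφ z hz
    have h2 := (h1.cexp.div_const 16).clog (hsl z hz)
    refine (h1.sub h2).congr_deriv ?_
    have := Complex.exp_ne_zero (φ z)
    field_simp
    ring
  have hconst : ∀ z ∈ V, ∀ w ∈ V, ψ z = ψ w := fun z hz w hw =>
    hVc.is_const_of_fderivWithin_eq_zero (𝕜 := ℂ)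
      (fun x hx => (hψ x hx).differentiableAt.differentiableWithinAt)
      (fun x hx => by
        rw [fderivWithin_of_isOpen hVo hx, (hψ x hx).hasFDerivAt.fderiv]; ext; simp) hz hw
  have hw : I*((Y1+1 : ℝ) : ℂ) ∈ V := by simp [V]
  refine ⟨ψ (I*((Y1+1 : ℝ) : ℂ))+0, ?_⟩
  have hlog : Tendsto (fun z => Complex.log (thA0 z/(thA z+thB z)/16)) imInf (𝓝 0) := by
    have := (continuousAt_clog (x := 1) (by simp)).tendsto.comp ht
    rw [Complex.log_one] at this
    exact this
  refine (tendsto_const_nhds.add hlog).congr' ?_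
  filter_upwards [eventually_imInf Y1] with z hz
  rw [hconst _ hw z hz, ← hexp z (hVH z hz)]
  simp [ψ, φ]
lemma gr_llz : ∃ c : ℂ, Gr (fun z => ll z-π*I*z-c) 1 0 := by
  obtain ⟨c, hc⟩ := tendsto_llz
  refine ⟨c, ?_⟩
  have := Gr.of_periodic (h := 2) two_pos (φ := fun z => ll z-π*I*z) (L := c)
    (fun Q h => (ll_hasDeriv h).differentiableAt.sub (by fun_prop))
    (fun Q h => by
      have e : Q+((2:ℝ):ℂ) = Q+1+1 := by push_cast; ring
      rw [e, ll_T (HH_add_one h), ll_T h, lm_T]; ring) hc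
  exact gr_of_eq this (by norm_num)
lemma gr_mg0 : ∃ c0 c1, Gr (fun z => mg0 z-(c0+c1*z)*cexp (-(π*I*z))^2) (1-2) 1 := by
  obtain ⟨c, hc⟩ := gr_llz
  refine ⟨c, π*I, ?_⟩
  rw [show (1:ℝ)-2 = -1 by norm_num]
  have h1 := gr_of_eq ((gr_D2φ (gr_E41.mul1 gr_E61)).mul gr_ll) (by norm_num : (-1:ℝ)+0=-1)
  have h2 := (gr_of_eq ((gr_exp_neg.pow 2).mul hc) (by norm_num : ((2:ℕ):ℝ)*(-1)+1=-1)).mono (m := 1) le_rfl (by norm_num)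
  exact (h1.add h2).congr fun z _ => by simp only [mg0]; ring
lemma gr_mg1 : Gr (fun z => mg1 z-(-(9/2)+0*z)*cexp (-(π*I*z))^2) (1-2) 0 := by
  rw [show (1:ℝ)-2 = -1 by norm_num]
  have h1 := gr_of_eq (gr_N'2.mul gr_invD) (by norm_num : (0:ℝ)+-1=-1)
  have hAD : Gr (fun z => thA z*(thD z)⁻¹) 0 0 := gr_of_eq (gr_A.mul gr_invD) (by norm_num)
  have hBC : Gr (fun z => thB z*thA z+(thB z-1)*(thB z+1)) 1 0 := by
    have a := gr_of_eq (gr_B.mul gr_A) (by norm_num : (0:ℝ)+1=1)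
    have b := gr_of_eq (gr_B1.mul (gr_B.add (Gr.const 1))) (by norm_num : (1:ℝ)+0=1)
    exact a.add b
  have hAD1 : Gr (fun z => thA z*(thD z)⁻¹-1) 1 0 := by
    refine (gr_of_eq (hAD.mul hBC) (by norm_num : (0:ℝ)+1=1)).neg.congr fun z hz => ?_
    have hA := thA_ne hz
    have hB := thB_ne hz
    have hC := thAB_ne hz
    rw [thD]; field_simp; ring
  have h2 := gr_D2φ ((((gr_E41.mul1 gr_E41).mul1 gr_E61)).mul1 hAD1)
  exact (h1.sub (h2.const_mul (9/2))).congr fun z _ => by simp only [mg1, tw]; ring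
lemma gr_mg2 : Gr (fun z => mg2 z-(0+0*z)*cexp (-(π*I*z))^2) (1-2) 0 := by
  exact (gr_of_eq (gr_Q'.mul gr_invD) (by norm_num)).congr fun z _ => by simp only [mg2]; ring
lemma mbg0 : ∃ C : ℝ, ∀ t : ℝ, 0 < t → ‖mg0 (I*t)‖ ≤ C*(1+t)*rexp (2*π*t+π/t) := by
  obtain ⟨c0, c1, h⟩ := gr_mg0
  have h2 := (gr_of_eq ((gr_D2.mul (gr_E4.mul gr_E6)).mul gr_lm) (by norm_num : (-2:ℝ)+(0+0)+1=-1)).mono (m := 2) le_rfl (by norm_num)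
  exact bg_of_gr' le_rfl h h2 (fun z hz => mg0_S hz)
lemma mbg1 : ∃ C : ℝ, ∀ t : ℝ, 0 < t → ‖mg1 (I*t)‖ ≤ C*(1+t)*rexp (2*π*t+π/t) := by
  have h2 := (gr_of_eq (gr_N.mul gr_invD) (by norm_num : (0:ℝ)+-1=-1)).neg.mono (m := 2) le_rfl (by norm_num)
  exact bg_of_gr' le_rfl gr_mg1 h2 (fun z hz => mg1_S hz)
lemma gr_QD : Gr (fun z => -(tQ z*(thD z)⁻¹)) (-1) 2 :=
  (gr_of_eq (gr_Q.mul gr_invD) (by norm_num : (0:ℝ)+-1=-1)).neg.mono le_rfl (by norm_num)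
lemma mbg2 : ∃ C : ℝ, ∀ t : ℝ, 0 < t → ‖mg2 (I*t)‖ ≤ C*(1+t)*rexp (2*π*t+π/t) :=
  bg_of_gr' le_rfl gr_mg2 gr_QD (fun z hz => mg2_S hz)
lemma mg2_bound : ∃ C : ℝ, 0 ≤ C ∧ ∀ t : ℝ, 0 < t → ‖mg2 (I*t)‖ ≤ C*(rexp (π*t)+rexp (π/t)) := by
  obtain ⟨C1, hC1, h1⟩ := (gr_of_eq (gr_Q'.mul gr_invD) (by norm_num : (0:ℝ)+-1=-1)).axis
  obtain ⟨C2, hC2, h2⟩ := (gr_of_eq (gr_Q.mul gr_invD) (by norm_num : (0:ℝ)+-1=-1)).axis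
  refine ⟨C1+C2, by positivity, fun t ht => ?_⟩
  have p1 := Real.exp_pos (π*t)
  have p2 := Real.exp_pos (π/t)
  rcases le_total 1 t with h | h
  · have := h1 t h
    simp only [pow_zero, mul_one, add_zero] at this
    rw [show -(-1*π*t) = π*t by ring, ← div_eq_mul_inv] at this
    refine this.trans ?_
    calc C1*rexp (π*t) ≤ (C1+C2)*rexp (π*t) := by gcongr; linarith
      _ ≤ _ := by gcongr; linarith
  · have h3 : 1 ≤ 1/t := by rw [le_div_iff₀ ht]; linarith
    have := h2 (1/t) h3
    simp only [pow_zero, mul_one, add_zero] at this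
    rw [show -(-1*π*(1/t)) = π/t by ring] at this
    have e1 := mg2_S (HH_axis (t := 1/t) (by positivity))
    rw [neg_inv_axis, one_div_one_div] at e1
    rw [e1, norm_mul, norm_neg, norm_pow, norm_inv]
    have hn : ‖I*((1/t : ℝ) : ℂ)‖ = 1/t := by
      rw [norm_mul, norm_I, one_mul, Complex.norm_real, Real.norm_of_nonneg (by positivity)]
    rw [hn, one_div, inv_inv]
    rw [one_div] at this
    calc t^2*_ ≤ 1^2*(C2*rexp (π/t)) := by gcongr
      _ = C2*rexp (π/t) := by ring
      _ ≤ (C1+C2)*rexp (π/t) := by gcongr; linarith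
      _ ≤ _ := by gcongr; linarith
lemma bK2_m3 : ∃ C : ℝ, ∃ N : ℕ, ∀ Q : ℂ, 1/2 ≤ Q.im → ∀ t : ℝ, 0 < t →
    ‖mf2 (-1/Q+1)*mg2 (I*t)‖ ≤ C*(1+‖Q‖)^N*(1+t)*(Ex t+rexp (2*π*Q.im)) := by
  have hG : Gr (fun Q => mf2 (-1/Q+1)) (-1) 5 := by
    have h1 := ((gr_of_eq ((Gr.id.pow 4).mul gr_mf2) (by norm_num : ((4:ℕ):ℝ)*0+0=0)).mono (b := -1) (m := 5)
      (by norm_num) (by norm_num))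
    have h2 := ((gr_of_eq ((Gr.id.pow 4).mul gr_N') (by norm_num : ((4:ℕ):ℝ)*0+-1=-1)).mono (m := 5)
      le_rfl (by norm_num)).const_mul (1/9)
    refine (h1.add h2).congr fun z hz => ?_
    rw [mf2_T (HH_neg_inv hz), mf2_S hz, tQ_S hz, tP_S hz, tw_S hz, tj_S hz]
    ring
  obtain ⟨C, hC, h⟩ := hG (1/2) (by norm_num)
  obtain ⟨K, hK, hg⟩ := mg2_bound
  refine ⟨C*K*2, 5, fun Q hQ t ht => ?_⟩
  have h1 := h Q hQ
  rw [norm_mul]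
  rw [show -(-1*π*Q.im) = π*Q.im by ring] at h1
  set y := Q.im
  have key : rexp (π*y)*(rexp (π*t)+rexp (π/t)) ≤ 2*(Ex t+rexp (2*π*y)) := by
    have e1 : rexp (2*π*y) = rexp (π*y)^2 := by rw [← Real.exp_nat_mul]; congr 1; push_cast; ring
    have e2 : rexp (2*π*t) = rexp (π*t)^2 := by rw [← Real.exp_nat_mul]; congr 1; push_cast; ring
    have e3 : rexp (2*π/t) = rexp (π/t)^2 := by rw [← Real.exp_nat_mul]; congr 1; push_cast; ring
    rw [Ex, e1, e2, e3]
    nlinarith [sq_nonneg (rexp (π*y)-rexp (π*t)), sq_nonneg (rexp (π*y)-rexp (π/t)),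
      sq_nonneg (rexp (π*y)), sq_nonneg (rexp (π*t)), sq_nonneg (rexp (π/t))]
  have := Ex_pos t
  calc _ ≤ (C*rexp (π*y)*(1+‖Q‖)^5)*(K*(rexp (π*t)+rexp (π/t))) := by
        gcongr; exact hg t ht
    _ = C*K*(1+‖Q‖)^5*(rexp (π*y)*(rexp (π*t)+rexp (π/t))) := by ring
    _ ≤ C*K*(1+‖Q‖)^5*(2*(Ex t+rexp (2*π*y))) := by gcongr
    _ = C*K*2*(1+‖Q‖)^5*1*(Ex t+rexp (2*π*y)) := by ring
    _ ≤ _ := by gcongr; linarith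
lemma gr_mf0TS : Gr (fun Q => mf0 (-1/Q+1)) 0 4 := by
  refine (gr_of_eq ((Gr.id.pow 4).mul gr_mf0) (by norm_num : ((4:ℕ):ℝ)*0+0=0)).congr fun z hz => ?_
  rw [mf0_T (HH_neg_inv hz), mf0_S hz]; ring
lemma gr_mf1TS : Gr (fun Q => mf1 (-1/Q+1)) 0 5 := by
  have h1 := (gr_of_eq ((Gr.id.pow 4).mul gr_mf1) (by norm_num : ((4:ℕ):ℝ)*0+0=0))
  have h2 := ((gr_of_eq ((Gr.id.pow 4).mul gr_Q') (by norm_num : ((4:ℕ):ℝ)*0+0=0)).mono (m := 5) le_rfl (by norm_num)).const_mul (1/9)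
  refine (h1.sub h2).congr fun z hz => ?_
  rw [mf1_T (HH_neg_inv hz), mf1_S hz, tQ_S hz]; ring
lemma ll_diffAt (h : Q ∈ HH) : DifferentiableAt ℂ ll Q := (ll_hasDeriv h).differentiableAt
lemma lm_diffAt (h : Q ∈ HH) : DifferentiableAt ℂ lm Q := (lm_hasDeriv h).differentiableAt
lemma tL4_diffAt (h : Q ∈ HH) : DifferentiableAt ℂ tL4 Q :=
  ((tQ_diffAt h).mul (ll_diffAt h)).add ((tQ'_diffAt h).mul (lm_diffAt h))
lemma tL2_diffAt (h : Q ∈ HH) : DifferentiableAt ℂ tL2 Q :=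
  ((tP_diffAt h).mul (ll_diffAt h)).add ((tP'_diffAt h).mul (lm_diffAt h))
def kerM : Ker (-1) where
  f := ![mf0, mf1, mf2]
  g := ![mg0, mg1, mg2]
  f_diff := by
    intro i Q hQ
    fin_cases i
    exacts [(tE4_diffAt hQ).const_mul _, (tL4_diffAt hQ).const_mul _,
      (((tL4_diffAt hQ).mul (tj_diffAt hQ)).add ((tw_diffAt hQ).mul (tL2_diffAt hQ))).const_mul _]
  g_cont := by
    intro i Q hQ
    fin_cases i
    · exact ((((tE4_diffAt hQ).const_mul 256).mul (tE6_diffAt hQ)).div ((thD_diffAt hQ).pow 2)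
        (pow_ne_zero 2 (thD_ne hQ))).mul (ll_diffAt hQ) |>.continuousAt
    · exact ((((tQ'_diffAt hQ).mul (tj_diffAt hQ)).add ((tw_diffAt hQ).mul (tP'_diffAt hQ))).div
        (thD_diffAt hQ) (thD_ne hQ)).continuousAt
    · exact ((tQ'_diffAt hQ).div (thD_diffAt hQ) (thD_ne hQ)).continuousAt
  f_S := by
    intro i Q hQ
    fin_cases i
    exacts [mf0_S hQ, mf1_S hQ, mf2_S hQ]
  f_T := by
    intro i Q hQ
    have h1 := HH_add_one hQ
    fin_cases i
    · change mf0 _ = 2*mf0 _-mf0 _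
      rw [mf0_T h1, mf0_T hQ]; ring
    · change mf1 _ = 2*mf1 _-mf1 _
      rw [mf1_T h1, mf1_T hQ, tQ_T hQ]; ring
    · change mf2 _ = 2*mf2 _-mf2 _
      rw [mf2_T h1, mf2_T hQ, tQ_T hQ, tP_T hQ, tw_T hQ, tj_T hQ]; ring
  N0 := fun z hz => by rw [Fin.sum_univ_three]; exact m_N0 hz
  N1 := fun z hz => by rw [Fin.sum_univ_three]; exact m_N1 hz
  N2 := fun z hz => by rw [Fin.sum_univ_three]; exact m_N2 hz
  bf := by
    intro i
    fin_cases i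
    exacts [⟨_, gr_mf0⟩, ⟨_, gr_mf1⟩, ⟨_, gr_mf2⟩]
  bK2 := by
    simp only [Fin.sum_univ_three]
    exact bK2_add (bK2_of_poly gr_mf0TS mbg0) (bK2_of_poly gr_mf1TS mbg1) bK2_m3
  bg := by
    intro i
    fin_cases i
    exacts [mbg0, mbg1, mbg2]
  bg' := by
    intro i
    fin_cases i
    · obtain ⟨c0, c1, h⟩ := gr_mg0
      exact bg'_of_gr le_rfl h
    · exact bg'_of_gr le_rfl gr_mg1
    · exact bg'_of_gr le_rfl gr_mg2
end
section
open MeasureTheory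
lemma removable_one {U : Set ℂ} {p : ℂ} (hU : IsOpen U) {h : ℂ → ℂ}
    (hd : DifferentiableOn ℂ h (U \ {p}))
    (hl : p ∈ U → Tendsto (fun Q => (Q-p)*h Q) (𝓝[≠] p) (𝓝 0)) :
    ∃ g : ℂ → ℂ, DifferentiableOn ℂ g U ∧ ∀ Q, Q ≠ p → g Q = h Q := by
  by_cases hp : p ∈ U
  · refine ⟨_, Complex.differentiableOn_update_limUnder_of_isLittleO (hU.mem_nhds hp) hd ?_, ?_⟩
    · rw [Asymptotics.isLittleO_iff_tendsto']
      · have h1 : Tendsto (fun Q : ℂ => (Q-p)*h p) (𝓝[≠] p) (𝓝 0) := by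
          have : Tendsto (fun Q : ℂ => (Q-p)*h p) (𝓝 p) (𝓝 ((p-p)*h p)) :=
            Continuous.tendsto (by fun_prop) p
          rw [sub_self, zero_mul] at this
          exact this.mono_left nhdsWithin_le_nhds
        have h2 := (hl hp).sub h1
        rw [sub_zero] at h2
        refine h2.congr' ?_
        filter_upwards [self_mem_nhdsWithin] with Q hQ
        rw [div_inv_eq_mul]; ring
      · filter_upwards [self_mem_nhdsWithin] with Q hQ h0
        exact absurd (inv_eq_zero.1 h0) (sub_ne_zero.2 hQ)
    · intro Q hQ
      rw [Function.update_of_ne hQ]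
  · refine ⟨h, ?_, fun _ _ => rfl⟩
    rwa [sdiff_singleton_eq_self hp] at hd
lemma removable_two {U : Set ℂ} {p q : ℂ} (hpq : p ≠ q) (hU : IsOpen U) {h : ℂ → ℂ}
    (hd : ∀ Q ∈ U, Q ≠ p → Q ≠ q → DifferentiableAt ℂ h Q)
    (hp : p ∈ U → Tendsto (fun Q => (Q-p)*h Q) (𝓝[≠] p) (𝓝 0))
    (hq : q ∈ U → Tendsto (fun Q => (Q-q)*h Q) (𝓝[≠] q) (𝓝 0)) :
    ∃ g : ℂ → ℂ, DifferentiableOn ℂ g U ∧ ∀ Q, Q ≠ p → Q ≠ q → g Q = h Q := by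
  obtain ⟨g1, hg1, e1⟩ := removable_one (U := U \ {q}) (p := p) (h := h)
    (hU.sdiff isClosed_singleton)
    (fun Q hQ => (hd Q hQ.1.1 hQ.2 hQ.1.2).differentiableWithinAt) (fun h => hp h.1)
  obtain ⟨g, hg, e2⟩ := removable_one (U := U) (p := q) hU hg1 (fun h' => by
    refine (hq h').congr' ?_
    have : ∀ᶠ Q in 𝓝[≠] q, Q ≠ p :=
      nhdsWithin_le_nhds (isOpen_ne.mem_nhds (Ne.symm hpq))
    filter_upwards [this] with Q hQ
    rw [e1 Q hQ])
  exact ⟨g, hg, fun Q h1 h2 => (e2 Q h2).trans (e1 Q h1)⟩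
lemma pole_limit {N D : ℂ → ℂ} {p d : ℂ} (hD : HasDerivAt D d p) (hd : d ≠ 0) (h0 : D p = 0)
    (hN : ContinuousAt N p) :
    Tendsto (fun Q => (Q-p)*(N Q/D Q)) (𝓝[≠] p) (𝓝 (N p/d)) := by
  have h1 := hD.tendsto_slope
  have h2 := (hN.tendsto.mono_left nhdsWithin_le_nhds : Tendsto N (𝓝[≠] p) _).mul (h1.inv₀ hd)
  refine h2.congr' ?_
  filter_upwards [self_mem_nhdsWithin] with Q hQ
  rw [slope_def_field, h0, sub_zero, inv_div]
  ring
def U0 : Set ℂ := {Q | |Q.re| < 3/5 ∧ 18/25 < Q.im}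
def U1 : Set ℂ := {Q | |Q.re| < 3/5 ∧ 3/4 < Q.im}
lemma isOpen_U0 : IsOpen U0 :=
  (isOpen_lt (continuous_abs.comp continuous_re) continuous_const).inter
    (isOpen_lt continuous_const continuous_im)
lemma isOpen_U1 : IsOpen U1 :=
  (isOpen_lt (continuous_abs.comp continuous_re) continuous_const).inter
    (isOpen_lt continuous_const continuous_im)
lemma U1_sub : U1 ⊆ U0 := fun Q h => ⟨h.1, by have := h.2; linarith⟩
def KK : ℝ := 80^8
lemma disc_bound {h : ℂ → ℂ} (hd : DifferentiableOn ℂ h U0) {y β : ℝ} (hy : 3/4 < y)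
    (hb : ∀ w ∈ U0, |w.im-y| ≤ 1/40 → w.re ≠ 0 → ‖h w‖*|w.re|^4 ≤ β)
    {Q : ℂ} (h1 : Q.im = y) (h2 : |Q.re| < 3/5) : ‖h Q‖ ≤ KK*β := by
  have hQ : Q ∈ U0 := ⟨h2, by rw [h1]; linarith⟩
  have hβ : 0 ≤ β := by
    have := hb (⟨1/10, y⟩ : ℂ) ⟨by simp; norm_num [abs_of_pos], by simp; linarith⟩ (by simp) (by simp)
    exact le_trans (by positivity) this
  rcases le_or_gt (1/80) |Q.re| with hr | hr
  · have h0 : Q.re ≠ 0 := by intro h; rw [h] at hr; norm_num at hr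
    have := hb Q hQ (by rw [h1]; simp) h0
    have h3 : (1/80 : ℝ)^4 ≤ |Q.re|^4 := by gcongr
    have h4 : ‖h Q‖*(1/80)^4 ≤ β := (mul_le_mul_of_nonneg_left h3 (norm_nonneg _)).trans this
    unfold KK
    linarith
  · set c : ℂ := I*y with hc
    obtain ⟨ρ, hρ⟩ : ∃ ρ : ℝ, ρ = 1/40 := ⟨_, rfl⟩
    have hcb : Metric.closedBall c ρ ⊆ U0 := by
      intro w hw
      rw [Metric.mem_closedBall, dist_eq_norm] at hw
      have a1 := (abs_re_le_norm (w-c)).trans hw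
      have a2 := (abs_im_le_norm (w-c)).trans hw
      simp [hc] at a1 a2
      rw [abs_le] at a2
      exact ⟨by rw [hρ] at a1; linarith, by rw [hρ] at a2; linarith [a2.1]⟩
    have key : ‖h Q*((Q-c)^2+ρ^2)^4‖ ≤ β*(2*ρ)^4 := by
      refine Complex.norm_le_of_forall_mem_frontier_norm_le (U := Metric.ball c ρ)
        (f := fun w => h w*((w-c)^2+ρ^2)^4) Metric.isBounded_ball ?_ ?_ ?_
      · apply DifferentiableOn.diffContOnCl
        rw [closure_ball c (by rw [hρ]; norm_num)]
        refine (hd.mono hcb).mul ?_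
        fun_prop
      · intro w hw
        rw [frontier_ball c (by rw [hρ]; norm_num)] at hw
        have hw0 := hcb (Metric.sphere_subset_closedBall hw)
        rw [mem_sphere_iff_norm] at hw
        have e1 : ‖(w-c)^2+ρ^2‖ = 2*ρ*|w.re| := by
          have e2 : ‖w-c‖^2 = ρ^2 := by rw [hw]
          rw [← Complex.normSq_eq_norm_sq, normSq_apply] at e2
          have e3 : ‖(w-c)^2+ρ^2‖^2 = (2*ρ*|w.re|)^2 := by
            have e4 : (w-c)^2+ρ^2 = ⟨2*w.re^2, 2*w.re*(w.im-y)⟩ := by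
              apply Complex.ext
              · simp [pow_two, hc] at e2 ⊢
                linarith
              · simp [pow_two, hc]
                ring
            simp [hc] at e2
            rw [← Complex.normSq_eq_norm_sq, normSq_apply, e4, mul_pow, sq_abs]
            simp only
            linear_combination (4*w.re^2)*e2
          have := abs_eq_abs.2 (sq_eq_sq_iff_eq_or_eq_neg.1 e3)
          rwa [abs_of_nonneg (norm_nonneg _), abs_of_nonneg (by positivity)] at this
        show ‖h w*((w-c)^2+ρ^2)^4‖ ≤ _
        rw [norm_mul, norm_pow, e1, mul_pow]
        by_cases hw1 : w.re = 0
        · rw [hw1]; simp; positivity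
        · have a2 := (abs_im_le_norm (w-c)).trans hw.le
          simp [hc] at a2
          have := hb w hw0 (by rw [← hρ]; exact a2) hw1
          calc _ = (‖h w‖*|w.re|^4)*(2*ρ)^4 := by ring
            _ ≤ _ := by gcongr
      · apply subset_closure
        rw [Metric.mem_ball, dist_eq_norm]
        have : Q-c = (Q.re : ℂ) := by
          apply Complex.ext <;> simp [hc, h1]
        rw [this, Complex.norm_real, Real.norm_eq_abs, hρ]
        linarith
    have e4 : (Q-c)^2+ρ^2 = ((Q.re^2+ρ^2 : ℝ) : ℂ) := by
      have : Q-c = (Q.re : ℂ) := by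
        apply Complex.ext <;> simp [hc, h1]
      rw [this]; push_cast; ring
    rw [norm_mul, norm_pow, e4, Complex.norm_real, Real.norm_of_nonneg (by positivity)] at key
    have e5 : (ρ^2)^4 ≤ (Q.re^2+ρ^2)^4 := by
      gcongr; nlinarith [sq_nonneg Q.re]
    have e6 := (mul_le_mul_of_nonneg_left e5 (norm_nonneg (h Q))).trans key
    rw [hρ] at e6
    unfold KK
    norm_num at e6 ⊢
    linarith
open Classical in
lemma AX {H : ℂ → ℝ → ℂ} {m : ℝ → ℝ} {B : ℝ} {N : ℕ} (hB : 0 ≤ B)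
    (hm : IntegrableOn m (Ioi 0)) (hm0 : ∀ t, 0 < t → 0 ≤ m t)
    (ha : ∀ᵐ t ∂(volume.restrict (Ioi (0:ℝ))), ∃ h : ℂ → ℂ, DifferentiableOn ℂ h U0 ∧
      ∀ Q ∈ U0, Q.re ≠ 0 → h Q = H Q t)
    (hb : ∀ Q ∈ U0, Q.re ≠ 0 → ∀ t : ℝ, 0 < t → ‖H Q t‖*|Q.re|^4 ≤ B*(1+Q.im)^N*m t)
    (hc : ∀ Q ∈ U0, Q.re ≠ 0 → AEStronglyMeasurable (H Q) (volume.restrict (Ioi (0:ℝ)))) :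
    ∃ Y : ℂ → ℂ, DifferentiableOn ℂ Y U1 ∧
      (∀ Q ∈ U1, Q.re ≠ 0 → Y Q = ∫ t in Ioi (0:ℝ), H Q t) ∧
      ∀ Q ∈ U1, ‖Y Q‖ ≤ KK*(B*(2+Q.im)^N*∫ t in Ioi (0:ℝ), m t) := by
  set μ := volume.restrict (Ioi (0:ℝ)) with hμ
  set G : ℂ → ℝ → ℂ := fun Q t => if hh : ∃ h : ℂ → ℂ, DifferentiableOn ℂ h U0 ∧
      ∀ Q ∈ U0, Q.re ≠ 0 → h Q = H Q t then (Classical.choose hh) Q else 0 with hG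
  have hGd : ∀ᵐ t ∂μ, DifferentiableOn ℂ (fun Q => G Q t) U0 ∧ ∀ Q ∈ U0, Q.re ≠ 0 → G Q t = H Q t := by
    filter_upwards [ha] with t ht
    have e : ∀ Q, G Q t = Classical.choose ht Q := fun Q => by simp only [hG]; rw [dif_pos ht]
    simp_rw [e]
    exact Classical.choose_spec ht
  have hpos : ∀ᵐ t ∂μ, 0 < t := ae_restrict_mem measurableSet_Ioi
  have hGm : ∀ Q ∈ U0, AEStronglyMeasurable (G Q) μ := by
    have h1 : ∀ Q ∈ U0, Q.re ≠ 0 → AEStronglyMeasurable (G Q) μ := by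
      intro Q hQ h0
      refine (hc Q hQ h0).congr ?_
      filter_upwards [hGd] with t ht
      exact (ht.2 Q hQ h0).symm
    intro Q hQ
    by_cases h0 : Q.re = 0
    · have hQn : ∀ n : ℕ, Q+((1/10/((n:ℝ)+1) : ℝ) : ℂ) ∈ U0 ∧ (Q+((1/10/((n:ℝ)+1) : ℝ) : ℂ)).re ≠ 0 := by
        intro n
        have hp : 0 < 1/10/((n:ℝ)+1) := by positivity
        have hle : 1/10/((n:ℝ)+1) ≤ 1/10 := div_le_self (by norm_num) (by linarith [n.cast_nonneg (α := ℝ)])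
        refine ⟨⟨?_, ?_⟩, ?_⟩
        · rw [add_re, ofReal_re, h0, zero_add, abs_of_pos hp]; linarith
        · rw [add_im, ofReal_im, add_zero]; exact hQ.2
        · rw [add_re, ofReal_re, h0, zero_add]; exact hp.ne'
      refine aestronglyMeasurable_of_tendsto_ae atTop
        (f := fun n : ℕ => G (Q+((1/10/((n:ℝ)+1) : ℝ) : ℂ))) (fun n => h1 _ (hQn n).1 (hQn n).2) ?_
      filter_upwards [hGd] with t ht
      have hcon : ContinuousAt (fun Q => G Q t) Q := (ht.1.differentiableAt (isOpen_U0.mem_nhds hQ)).continuousAt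
      refine Tendsto.comp (f := fun n : ℕ => Q+((1/10/((n:ℝ)+1) : ℝ) : ℂ)) (g := fun Q => G Q t) hcon ?_
      have h3 : Tendsto (fun n : ℕ => (1/10)/((n:ℝ)+1)) atTop (𝓝 0) :=
        tendsto_const_nhds.div_atTop (tendsto_natCast_atTop_atTop.atTop_add tendsto_const_nhds)
      have h4 := ((Complex.continuous_ofReal.tendsto 0).comp h3).const_add Q
      rw [Complex.ofReal_zero, add_zero] at h4
      exact h4
    · exact h1 Q hQ h0
  have hGb : ∀ᵐ t ∂μ, ∀ Q ∈ U1, ‖G Q t‖ ≤ KK*(B*(2+Q.im)^N*m t) := by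
    filter_upwards [hGd, hpos] with t ht ht0 Q hQ
    refine disc_bound ht.1 hQ.2 ?_ rfl hQ.1
    intro w hw h1 h2
    rw [ht.2 w hw h2]
    refine (hb w hw h2 t ht0).trans ?_
    have hw2 := hw.2
    have := hm0 t ht0
    rw [abs_le] at h1
    have h4 : 1+w.im ≤ 2+Q.im := by linarith [h1.2]
    have h5 : 0 ≤ 1+w.im := by linarith
    have h6 : (1+w.im)^N ≤ (2+Q.im)^N := pow_le_pow_left₀ h5 h4 N
    gcongr
  refine ⟨fun Q => ∫ t, G Q t ∂μ, ?_, ?_, ?_⟩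
  · intro Q hQ
    have hop : IsOpen (U1 ∩ {w : ℂ | w.im < Q.im+1}) :=
      isOpen_U1.inter (isOpen_lt continuous_im continuous_const)
    refine DifferentiableAt.differentiableWithinAt ?_
    refine DifferentiableOn.differentiableAt (s := U1 ∩ {w : ℂ | w.im < Q.im+1}) ?_
      (hop.mem_nhds ⟨hQ, by simp⟩)
    refine hol_integral hop (bound := fun t => KK*(B*(2+(Q.im+1))^N*m t))
      ((hm.const_mul _).const_mul _) ?_ ?_ ?_
    · exact fun w hw => hGm w (U1_sub hw.1)
    · filter_upwards [hGd] with t ht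
      exact ht.1.mono (fun w hw => U1_sub hw.1)
    · filter_upwards [hGb, hpos] with t ht ht0 w hw
      refine (ht w hw.1).trans ?_
      have := hm0 t ht0
      have h2 : w.im < Q.im+1 := hw.2
      have h3 := hw.1.2
      have : 0 ≤ KK := by unfold KK; norm_num
      gcongr
  · intro Q hQ h0
    refine integral_congr_ae ?_
    filter_upwards [hGd] with t ht
    exact ht.2 Q (U1_sub hQ) h0
  · intro Q hQ
    calc ‖∫ t, G Q t ∂μ‖ ≤ ∫ t, KK*(B*(2+Q.im)^N*m t) ∂μ := by
          refine norm_integral_le_of_norm_le ((hm.const_mul _).const_mul _) ?_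
          filter_upwards [hGb] with t ht using ht Q hQ
      _ = _ := by rw [integral_const_mul, integral_const_mul]
def den (Q : ℂ) (t : ℝ) : ℂ := (sr t : ℂ)^2-ts Q^2
lemma gr_D : Gr thD 1 0 := by
  have h1 : Gr (fun Q => thA Q+thB Q) 0 0 := (gr_A.mono (by norm_num) le_rfl).add gr_B
  have := (gr_A.mul gr_B).mul h1
  simpa [thD] using! this
lemma ts_lower : ∃ c : ℝ, 0 < c ∧ ∀ Q : ℂ, 1/2 ≤ Q.im → c*rexp (2*π*Q.im) ≤ 1+‖ts Q‖^2 := by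
  obtain ⟨C, hC, hD⟩ := gr_D (1/2) (by norm_num)
  have h6 : ∀ᶠ Q in imInf, 1/2 < ‖tE6 Q‖ := by
    have := tendsto_tE6.norm
    rw [norm_one] at this
    exact this.eventually (lt_mem_nhds (by norm_num))
  obtain ⟨M, hM⟩ : ∃ M : ℝ, ∀ Q : ℂ, M ≤ Q.im → 1/2 < ‖tE6 Q‖ := by
    rw [imInf, eventually_comap] at h6
    obtain ⟨M, hM⟩ := eventually_atTop.1 h6
    exact ⟨M, fun Q h => hM Q.im h Q rfl⟩
  refine ⟨min (rexp (-(2*π*M))) (64/(C+1)^2), by positivity, fun Q hQ => ?_⟩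
  have hH : Q ∈ HH := by rw [mem_HH]; linarith
  rcases le_total M Q.im with h | h
  · have a := hM Q h
    have b := hD Q hQ
    have e : ts Q*thD Q = 16*tE6 Q := by rw [ts, div_mul_cancel₀ _ (thD_ne hH)]
    have e2 : ‖ts Q‖*‖thD Q‖ = 16*‖tE6 Q‖ := by rw [← norm_mul, e, norm_mul]; simp
    have e3 : 8 ≤ ‖ts Q‖*((C+1)*rexp (-(π*Q.im))) := by
      have : ‖thD Q‖ ≤ (C+1)*rexp (-(π*Q.im)) := by
        refine b.trans ?_
        rw [pow_zero, mul_one, one_mul]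
        gcongr; linarith
      have := mul_le_mul_of_nonneg_left this (norm_nonneg (ts Q))
      linarith
    have e4 : 8*rexp (π*Q.im) ≤ ‖ts Q‖*(C+1) := by
      have h5 := mul_le_mul_of_nonneg_right e3 (Real.exp_pos (π*Q.im)).le
      have h6 : rexp (-(π*Q.im))*rexp (π*Q.im) = 1 := by rw [← Real.exp_add]; simp
      calc _ ≤ _ := h5
        _ = ‖ts Q‖*(C+1)*(rexp (-(π*Q.im))*rexp (π*Q.im)) := by ring
        _ = _ := by rw [h6, mul_one]
    have e5 : 64*rexp (2*π*Q.im) ≤ ‖ts Q‖^2*(C+1)^2 := by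
      have h7 : rexp (2*π*Q.im) = rexp (π*Q.im)^2 := by rw [← Real.exp_nat_mul]; congr 1; push_cast; ring
      rw [h7, ← mul_pow]
      calc 64*rexp (π*Q.im)^2 = (8*rexp (π*Q.im))^2 := by ring
        _ ≤ _ := by gcongr
    calc _ ≤ 64/(C+1)^2*rexp (2*π*Q.im) := by gcongr; exact min_le_right _ _
      _ = 64*rexp (2*π*Q.im)/(C+1)^2 := by ring
      _ ≤ ‖ts Q‖^2 := by rw [div_le_iff₀ (by positivity)]; exact e5
      _ ≤ _ := by linarith
  · calc _ ≤ rexp (-(2*π*M))*rexp (2*π*Q.im) := by gcongr; exact min_le_left _ _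
      _ ≤ 1 := by
        rw [← Real.exp_add, ← Real.exp_zero]
        apply Real.exp_le_exp.2
        have := Real.pi_pos
        nlinarith
      _ ≤ _ := by nlinarith [sq_nonneg ‖ts Q‖]
lemma sr_lower : ∃ c : ℝ, 0 < c ∧ ∀ t : ℝ, 0 < t → c*Ex t ≤ 1+sr t^2 := by
  obtain ⟨c, hc, h⟩ := ts_lower
  have key : ∀ t : ℝ, 1 ≤ t → c/2*Ex t ≤ 1+sr t^2 := by
    intro t ht
    have h0 : 0 < t := by linarith
    have h1 := h (I*t) (by simp; linarith)
    rw [ts_axis h0, Complex.norm_real, Real.norm_eq_abs, sq_abs] at h1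
    have h2 : (I*(t : ℂ)).im = t := by simp
    rw [h2] at h1
    have h3 : rexp (2*π/t) ≤ rexp (2*π*t) := by
      apply Real.exp_le_exp.2
      rw [div_le_iff₀ h0]
      have := Real.pi_pos
      have : 1 ≤ t*t := by nlinarith
      nlinarith
    unfold Ex
    nlinarith
  refine ⟨c/2, by positivity, fun t ht => ?_⟩
  rcases le_total 1 t with h1 | h1
  · exact key t h1
  · have := key (1/t) (by rw [le_div_iff₀ ht]; linarith)
    rw [sr_inv ht, neg_sq] at this
    convert this using 2
    unfold Ex
    rw [add_comm]
    congr 2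
    · ring
    · field_simp
lemma den_lower : ∃ c : ℝ, 0 < c ∧ ∀ Q : ℂ, 18/25 ≤ Q.im → |Q.re| ≤ 3/5 → ∀ t : ℝ, 0 < t →
    c*|Q.re|^4*(Ex t+rexp (2*π*Q.im)) ≤ ‖den Q t‖ := by
  obtain ⟨c1, hc1, h1⟩ := ts_lower
  obtain ⟨c2, hc2, h2⟩ := sr_lower
  refine ⟨min c1 c2/648, by positivity, fun Q hQ hr t ht => ?_⟩
  refine le_trans ?_ (lower_bound hQ hr (sr t))
  have a := h1 Q (by linarith)
  have b := h2 t ht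
  have d : min c1 c2*(Ex t+rexp (2*π*Q.im)) ≤ 2*(1+sr t^2+‖ts Q‖^2) := by
    have p1 : min c1 c2*rexp (2*π*Q.im) ≤ c1*rexp (2*π*Q.im) := by
      gcongr; exact min_le_left _ _
    have p2 : min c1 c2*Ex t ≤ c2*Ex t := by
      have := (Ex_pos t).le
      gcongr; exact min_le_right _ _
    nlinarith [sq_nonneg (sr t), sq_nonneg ‖ts Q‖]
  calc _ = |Q.re|^4/648*(min c1 c2*(Ex t+rexp (2*π*Q.im))) := by ring
    _ ≤ |Q.re|^4/648*(2*(1+sr t^2+‖ts Q‖^2)) := by gcongr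
    _ = _ := by ring
lemma U0_HH (h : Q ∈ U0) : Q ∈ HH := by rw [mem_HH]; linarith [h.2]
lemma den_ne_off (h : Q ∈ U0) (h0 : Q.re ≠ 0) {t : ℝ} (ht : 0 < t) : den Q t ≠ 0 := by
  obtain ⟨c, hc, hd⟩ := den_lower
  have := hd Q h.2.le h.1.le t ht
  rw [← norm_pos_iff]
  refine lt_of_lt_of_le ?_ this
  have := Ex_pos t
  positivity
lemma den_ne (h : Q ∈ U0) {t : ℝ} (ht : 0 < t) (h1 : Q ≠ I*t) (h2 : Q ≠ I*(1/t : ℝ)) :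
    den Q t ≠ 0 := by
  by_cases h0 : Q.re = 0
  · have hy : 0 < Q.im := U0_HH h
    have e : Q = I*Q.im := by apply Complex.ext <;> simp [h0]
    intro h3
    rw [e, den, ts_axis hy] at h3
    have h4 : sr t^2 = sr Q.im^2 := by
      have := sub_eq_zero.1 h3
      exact_mod_cast this
    rcases sr_sq_eq ht hy h4 with h5 | h5
    · exact h1 (by rw [e, h5])
    · exact h2 (by rw [e, h5])
  · exact den_ne_off h h0 ht
lemma den_T (h : Q ∈ HH) (t : ℝ) : den (Q+1) t = den Q t := by
  rw [den, den, ts_T h, neg_sq]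
lemma den_S (h : Q ∈ HH) (t : ℝ) : den (-1/Q) t = den Q t := by
  rw [den, den, ts_S h, neg_sq]
lemma den_hasDeriv (h : Q ∈ HH) (t : ℝ) : HasDerivAt (fun Q => den Q t) (2*π*I*tw Q) Q := by
  have h1 := ((deriv_ts h).fun_pow 2).const_sub ((sr t : ℂ)^2)
  refine h1.congr_deriv ?_
  have := thD_ne h
  rw [show (2-1 : ℕ) = 1 from rfl, pow_one, tw, ts]
  push_cast
  field_simp
  ring
lemma tw_axis_ne {t : ℝ} (ht : 0 < t) (h1 : t ≠ 1) : tw (I*t) ≠ 0 := by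
  have h2 := sr_ne ht h1
  obtain ⟨a, ha, hE⟩ := tE4_axis ht
  have hD := thD_ne (HH_axis ht)
  have e : tw (I*t) = ts (I*t)*(16*tE4 (I*t)^2/thD (I*t)) := by
    rw [tw, ts]; field_simp; ring
  rw [e, ts_axis ht, hE]
  have h3 : (a : ℂ) ≠ 0 := by exact_mod_cast ha.ne'
  have h4 : (sr t : ℂ) ≠ 0 := by exact_mod_cast h2
  exact mul_ne_zero h4 (div_ne_zero (by simp [h3]) hD)
lemma two_pi_I_ne : 2*(π:ℂ)*I ≠ 0 := by
  simp [Real.pi_ne_zero]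
lemma den_zero1 {t : ℝ} (ht : 0 < t) : den (I*t) t = 0 := by rw [den, ts_axis ht, sub_self]
lemma den_zero2 {t : ℝ} (ht : 0 < t) : den (I*(1/t : ℝ)) t = 0 := by
  rw [← neg_inv_axis, den_S (HH_axis ht), den_zero1 ht]
def ee (s : ℝ) (z : ℂ) : ℂ := cexp (π*I*s*z)
def S4 (s : ℝ) : ℝ := 4*Real.sin (π*s/2)^2
def Es (s : ℝ) (z : ℂ) : ℂ := (S4 s : ℂ)*ee s z
lemma S4_nonneg (s : ℝ) : 0 ≤ S4 s := by unfold S4; positivity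
lemma S4_le (s : ℝ) : S4 s ≤ 4 := by
  unfold S4; nlinarith [Real.sin_sq_le_one (π*s/2)]
lemma norm_ee (s : ℝ) (z : ℂ) : ‖ee s z‖ = rexp (-(π*s*z.im)) := by
  rw [ee, Complex.norm_exp]
  congr 1
  simp
lemma ee_diff (s : ℝ) : Differentiable ℂ (ee s) := by unfold ee; fun_prop
lemma Es_diff (s : ℝ) : Differentiable ℂ (Es s) := by
  unfold Es; exact (ee_diff s).const_mul _
lemma norm_Es (s : ℝ) (z : ℂ) : ‖Es s z‖ = S4 s*rexp (-(π*s*z.im)) := by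
  rw [Es, norm_mul, norm_ee, Complex.norm_real, Real.norm_of_nonneg (S4_nonneg s)]
lemma norm_Es_le {s : ℝ} (hs : 0 ≤ s) {z : ℂ} (hz : z ∈ HH) : ‖Es s z‖ ≤ 4 := by
  rw [norm_Es]
  have : rexp (-(π*s*z.im)) ≤ 1 := by
    rw [Real.exp_le_one_iff]
    have : 0 < z.im := hz
    have : 0 ≤ π*s*z.im := by positivity
    linarith
  calc _ ≤ 4*(1:ℝ) := mul_le_mul (S4_le s) this (Real.exp_pos _).le (by norm_num)
    _ = 4 := by norm_num
lemma Es_eq (s : ℝ) (z : ℂ) : Es s z = -(ee s (z+1)-2*ee s z+ee s (z-1)) := by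
  have h1 : ee s (z+1) = ee s z*cexp (π*s*I) := by
    rw [ee, ee, ← Complex.exp_add]; congr 1; ring
  have h2 : ee s (z-1) = ee s z*cexp (-(π*s*I)) := by
    rw [ee, ee, ← Complex.exp_add]; congr 1; ring
  have h3 : (S4 s : ℂ) = 2-2*Complex.cos (π*s) := by
    have : Complex.cos (π*s) = 1-2*(Complex.sin (π*s/2))^2 := by
      have := Complex.cos_two_mul (π*s/2)
      rw [show 2*((π:ℂ)*s/2) = π*s by ring] at this
      rw [this, Complex.cos_sq']; ring
    rw [this, S4]; push_cast; ring
  have h4 : 2*Complex.cos (π*s) = cexp (π*s*I)+cexp (-(π*s*I)) := by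
    rw [Complex.two_cos]; congr 2; ring
  rw [h1, h2, Es, h3, h4]; ring
def mm (s t : ℝ) : ℝ := (1+t)*(S4 s*rexp (-(π*s*t)))+1/(1+t)^2
lemma mm_nonneg {s t : ℝ} (ht : 0 < t) : 0 ≤ mm s t := by
  unfold mm; have := S4_nonneg s; positivity
lemma int_poly_exp {a : ℝ} (ha : 0 < a) : IntegrableOn (fun t : ℝ => (1+t)*rexp (-(a*t))) (Ioi 0) ∧
    ∫ t in Ioi (0:ℝ), (1+t)*rexp (-(a*t)) = 1/a+1/a^2 := by
  have hd : ∀ t ∈ Ici (0:ℝ), HasDerivAt (fun t : ℝ => -(rexp (-(a*t))*((1+t)/a+1/a^2)))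
      ((1+t)*rexp (-(a*t))) t := by
    intro t _
    have h1 : HasDerivAt (fun t : ℝ => rexp (-(a*t))) (rexp (-(a*t))*(-(a*1))) t :=
      (((hasDerivAt_id t).const_mul a).neg).exp
    have h2 : HasDerivAt (fun t : ℝ => (1+t)/a+1/a^2) (1/a) t :=
      (((hasDerivAt_id t).const_add 1).div_const a).add_const _
    refine ((h1.mul h2).neg).congr_deriv ?_
    field_simp
    ring
  have hpos : ∀ t ∈ Ioi (0:ℝ), 0 ≤ (1+t)*rexp (-(a*t)) := fun t ht => by
    have : (0:ℝ) < t := ht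
    positivity
  have hl : Tendsto (fun t : ℝ => -(rexp (-(a*t))*((1+t)/a+1/a^2))) atTop (𝓝 0) := by
    have h1 : Tendsto (fun t : ℝ => t*rexp (-(a*t))) atTop (𝓝 0) := by
      have := Real.tendsto_pow_mul_exp_neg_atTop_nhds_zero 1
      have h3 := this.comp (tendsto_id.const_mul_atTop ha)
      have h4 := h3.const_mul (1/a)
      rw [mul_zero] at h4
      refine h4.congr fun t => ?_
      simp only [Function.comp, id]
      rw [pow_one]
      field_simp
    have h2 : Tendsto (fun t : ℝ => rexp (-(a*t))) atTop (𝓝 0) :=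
      Real.tendsto_exp_neg_atTop_nhds_zero.comp (tendsto_id.const_mul_atTop ha)
    have h5 := ((h1.const_mul (1/a)).add (h2.const_mul (1/a+1/a^2))).neg
    simp only [mul_zero, add_zero, neg_zero] at h5
    refine h5.congr fun t => ?_
    ring
  refine ⟨integrableOn_Ioi_deriv_of_nonneg' hd hpos hl, ?_⟩
  rw [integral_Ioi_of_hasDerivAt_of_nonneg' hd hpos hl]
  simp
lemma int_inv_sq : IntegrableOn (fun t : ℝ => 1/(1+t)^2) (Ioi 0) ∧
    ∫ t in Ioi (0:ℝ), 1/(1+t)^2 = 1 := by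
  have hd : ∀ t ∈ Ici (0:ℝ), HasDerivAt (fun t : ℝ => -(1+t)⁻¹) (1/(1+t)^2) t := by
    intro t ht
    have h0 : (1+t) ≠ 0 := by have : (0:ℝ) ≤ t := ht; positivity
    refine (((hasDerivAt_id t).const_add 1).fun_inv h0).neg.congr_deriv ?_
    simp; ring
  have hpos : ∀ t ∈ Ioi (0:ℝ), 0 ≤ 1/(1+t)^2 := fun t ht => by positivity
  have hl : Tendsto (fun t : ℝ => -(1+t)⁻¹) atTop (𝓝 0) := by
    rw [← neg_zero]
    exact (tendsto_inv_atTop_zero.comp (tendsto_atTop_add_const_left _ _ tendsto_id)).neg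
  refine ⟨integrableOn_Ioi_deriv_of_nonneg' hd hpos hl, ?_⟩
  rw [integral_Ioi_of_hasDerivAt_of_nonneg' hd hpos hl]
  simp
lemma mm_int {s : ℝ} (hs : 0 < s) : IntegrableOn (mm s) (Ioi 0) ∧ ∫ t in Ioi (0:ℝ), mm s t ≤ 4 := by
  have ha : 0 < π*s := by positivity
  obtain ⟨i1, e1⟩ := int_poly_exp ha
  obtain ⟨i2, e2⟩ := int_inv_sq
  have e : mm s = fun t => S4 s*((1+t)*rexp (-(π*s*t)))+1/(1+t)^2 := by
    funext t; unfold mm; ring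
  rw [e]
  refine ⟨(i1.const_mul _).add i2, ?_⟩
  rw [integral_add (i1.const_mul _) i2, e2, integral_const_mul, e1]
  have h1 : |Real.sin (π*s/2)| ≤ π*s/2 := by
    have := Real.abs_sin_le_abs (x := π*s/2)
    rwa [abs_of_pos (by positivity : 0 < π*s/2)] at this
  have h2 := Real.abs_sin_le_one (π*s/2)
  have h3 : S4 s ≤ (π*s)^2 := by
    unfold S4
    rw [← sq_abs]
    nlinarith [abs_nonneg (Real.sin (π*s/2))]
  have h4 : S4 s ≤ 2*(π*s) := by
    unfold S4
    rw [← sq_abs]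
    nlinarith [abs_nonneg (Real.sin (π*s/2))]
  have h5 : S4 s*(1/(π*s)) ≤ 2 := by
    rw [mul_one_div, div_le_iff₀ ha]; exact h4
  have h6 : S4 s*(1/(π*s)^2) ≤ 1 := by
    rw [mul_one_div, div_le_iff₀ (by positivity)]; linarith
  rw [mul_add]
  linarith
def X1 (Q : ℂ) (t : ℝ) : ℂ := 2*Q/(-(t:ℂ)^2-Q^2)
lemma X1_den {t : ℝ} : -(t:ℂ)^2-Q^2 = -((Q-I*t)*(Q+I*t)) := by
  linear_combination (-(t:ℂ)^2)*I_sq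
lemma axis_dist (hr : |Q.re| ≤ 1) (hQ : Q ∈ HH) {t : ℝ} : |Q.re| * (1+t) ≤ (2+Q.im)*‖Q-I*t‖ := by
  have h1 : |Q.re| ≤ ‖Q-I*t‖ := by simpa using abs_re_le_norm (Q-I*t)
  have h2 : |Q.im-t| ≤ ‖Q-I*t‖ := by simpa using abs_im_le_norm (Q-I*t)
  have h3 : 0 < Q.im := hQ
  have h4 := (abs_le.1 h2).1
  have h5 := abs_nonneg Q.re
  have h6 := norm_nonneg (Q-I*t)
  nlinarith
lemma axis_dist' (hQ : 18/25 ≤ Q.im) {t : ℝ} : 18/25*(1+t) ≤ ‖Q+I*t‖ ∨ t < 0 := by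
  rcases lt_or_ge t 0 with h | h
  · exact Or.inr h
  · left
    have h2 : |Q.im+t| ≤ ‖Q+I*t‖ := by simpa using abs_im_le_norm (Q+I*t)
    have := le_abs_self (Q.im+t)
    nlinarith
lemma X1_ne (hQ : Q ∈ HH) {t : ℝ} (ht : 0 < t) (h : Q ≠ I*t) : -(t:ℂ)^2-Q^2 ≠ 0 := by
  rw [X1_den]
  refine neg_ne_zero.2 (mul_ne_zero (sub_ne_zero.2 h) ?_)
  intro h0
  have : (Q+I*t).im = 0 := by rw [h0]; simp
  simp at this
  have : 0 < Q.im := hQ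
  linarith
lemma X1_bound (hQ : Q ∈ U0) {t : ℝ} (ht : 0 < t) (hr : Q.re ≠ 0) :
    ‖X1 Q t‖*|Q.re| ≤ 12*(1+Q.im)^2*(1/(1+t)^2) := by
  have h1 := axis_dist (t := t) (by linarith [hQ.1]) (U0_HH hQ)
  have h2 : 18/25*(1+t) ≤ ‖Q+I*t‖ := by
    rcases axis_dist' (t := t) hQ.2.le with h | h
    · exact h
    · linarith
  have h3 := hQ.2
  have h4 : ‖Q‖ ≤ 3/5+Q.im := by
    have := norm_le_abs_re_add_abs_im Q
    rw [abs_of_pos (by linarith : 0 < Q.im)] at this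
    linarith [hQ.1]
  have hr0 : 0 < |Q.re| := abs_pos.2 hr
  have hA : 0 < ‖Q-I*t‖ := by
    have : 0 < |Q.re| * (1+t) := by positivity
    by_contra hh
    have : ‖Q-I*t‖ = 0 := le_antisymm (not_lt.1 hh) (norm_nonneg _)
    rw [this] at h1; linarith
  have hB : 0 < ‖Q+I*t‖ := by
    have : 0 < 18/25*(1+t) := by positivity
    linarith
  rw [X1, X1_den, norm_div, norm_neg, norm_mul, norm_mul, RCLike.norm_ofNat, div_mul_eq_mul_div, div_le_iff₀ (by positivity)]
  have h5 : |Q.re| * (18/25)*(1+t)^2 ≤ (2+Q.im)*(‖Q-I*t‖*‖Q+I*t‖) := by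
    calc _ = (|Q.re| * (1+t))*(18/25*(1+t)) := by ring
      _ ≤ ((2+Q.im)*‖Q-I*t‖)*‖Q+I*t‖ := by gcongr
      _ = _ := by ring
  have h6 : |Q.re| ≤ (2+Q.im)*(‖Q-I*t‖*‖Q+I*t‖)*(25/18)/(1+t)^2 := by
    rw [le_div_iff₀ (by positivity)]; nlinarith
  calc 2*‖Q‖*|Q.re| ≤ 2*(3/5+Q.im)*((2+Q.im)*(‖Q-I*t‖*‖Q+I*t‖)*(25/18)/(1+t)^2) := by
        gcongr
    _ = ((25/9)*((3/5+Q.im)*(2+Q.im)))*(1/(1+t)^2)*(‖Q-I*t‖*‖Q+I*t‖) := by ring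
    _ ≤ _ := by
        have : (25/9)*((3/5+Q.im)*(2+Q.im)) ≤ 12*(1+Q.im)^2 := by nlinarith
        gcongr ?_*_*_
def X2 (Q : ℂ) (t : ℝ) : ℂ := 2*Q/((t:ℂ)^2*Q^2+1)
lemma X2_eq (Q : ℂ) {t : ℝ} (ht : 0 < t) : X2 Q t = -(1/(t : ℂ)^2)*X1 Q (1/t) := by
  have : (t : ℂ) ≠ 0 := by exact_mod_cast ht.ne'
  rw [X1, X2]
  have e : -(((1/t : ℝ) : ℂ))^2-Q^2 = -(1/(t:ℂ)^2)*((t:ℂ)^2*Q^2+1) := by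
    push_cast; field_simp; ring
  rw [e, mul_div_assoc', mul_div_mul_left]
  exact neg_ne_zero.2 (by simp [this])
lemma X2_eq' (hQ : Q ≠ 0) {t : ℝ} : X2 Q t = X1 (-1/Q) t := by
  rw [X1, X2]
  have e : -(t : ℂ)^2-(-1/Q)^2 = -(1/Q^2)*((t:ℂ)^2*Q^2+1) := by
    field_simp; ring
  rw [e, show 2*(-1/Q) = -(1/Q^2)*(2*Q) by field_simp, mul_div_mul_left]
  exact neg_ne_zero.2 (by simp [hQ])
lemma X2_bound (hQ : Q ∈ U0) {t : ℝ} (ht : 0 < t) (hr : Q.re ≠ 0) :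
    ‖X2 Q t‖*|Q.re| ≤ 12*(1+Q.im)^2*(1/(1+t)^2) := by
  have h := X1_bound hQ (one_div_pos.2 ht) hr
  rw [X2_eq Q ht, norm_mul, norm_neg, norm_div, norm_pow, Complex.norm_real, Real.norm_of_nonneg ht.le, norm_one]
  calc _ = 1/t^2*(‖X1 Q (1/t)‖*|Q.re|) := by ring
    _ ≤ 1/t^2*(12*(1+Q.im)^2*(1/(1+1/t)^2)) := by gcongr
    _ = _ := by field_simp; ring
lemma X2_ne (hQ : Q ∈ HH) {t : ℝ} (ht : 0 < t) (h : Q ≠ I*(1/t : ℝ)) : (t:ℂ)^2*Q^2+1 ≠ 0 := by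
  have h1 := X1_ne hQ (one_div_pos.2 ht) h
  have : (t : ℂ) ≠ 0 := by exact_mod_cast ht.ne'
  intro h0
  apply h1
  push_cast
  field_simp
  linear_combination (-1:ℂ)*h0
end
section
open MeasureTheory
variable {ε : ℂ}
def Nm (K : Ker ε) (κ : ℂ) (t : ℝ) : ℂ := ∑ i, K.f i κ*K.g i (I*t)
lemma Nm_bound (K : Ker ε) : ∃ C : ℝ, 0 ≤ C ∧ ∃ N : ℕ, ∀ κ : ℂ, 1/2 ≤ κ.im → ∀ t : ℝ, 0 < t →
    ‖Nm K κ t‖ ≤ C*(1+‖κ‖)^N*(1+t)*rexp (2*π*t+π/t) := by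
  choose n hn using K.bf
  choose C hC using K.bg
  have hn' : ∀ i, ∃ c : ℝ, 0 ≤ c ∧ ∀ Q : ℂ, 1/2 ≤ Q.im → ‖K.f i Q‖ ≤ c*(1+‖Q‖)^(∑ j, n j) := by
    intro i
    obtain ⟨c, hc, h⟩ := (hn i).mono le_rfl (Finset.single_le_sum (f := n) (fun _ _ => Nat.zero_le _) (Finset.mem_univ i)) (1/2) (by norm_num)
    refine ⟨c, hc, fun Q hQ => ?_⟩
    have := h Q hQ
    simpa using this
  choose c hc h using hn'
  refine ⟨∑ i, c i*|C i|, Finset.sum_nonneg fun i _ => mul_nonneg (hc i) (abs_nonneg _), ∑ j, n j, fun κ hκ t ht => ?_⟩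
  rw [Nm]
  refine (norm_sum_le _ _).trans ?_
  rw [Finset.sum_mul, Finset.sum_mul, Finset.sum_mul]
  refine Finset.sum_le_sum fun i _ => ?_
  rw [norm_mul]
  have h1 : ‖K.g i (I*t)‖ ≤ |C i| * (1+t)*rexp (2*π*t+π/t) := by
    refine (hC i t ht).trans ?_
    have := le_abs_self (C i)
    gcongr
  calc _ ≤ (c i*(1+‖κ‖)^(∑ j, n j))*(|C i| * (1+t)*rexp (2*π*t+π/t)) := by
        have := hc i
        exact mul_le_mul (h i κ hκ) h1 (norm_nonneg _) (by positivity)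
    _ = _ := by ring
lemma exp_le_Ex {t : ℝ} (ht : 0 < t) : rexp (2*π*t+π/t) ≤ rexp (2*π)*Ex t := by
  unfold Ex
  rw [mul_add, ← Real.exp_add, ← Real.exp_add]
  have hp := Real.pi_pos
  rcases le_total 1 t with h | h
  · refine le_trans (Real.exp_le_exp.2 ?_) (le_add_of_nonneg_right (Real.exp_pos _).le)
    have : π/t ≤ π := div_le_self hp.le h
    linarith
  · refine le_trans (Real.exp_le_exp.2 ?_) (le_add_of_nonneg_left (Real.exp_pos _).le)
    have h1 : 2*π*t ≤ 2*π := by nlinarith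
    have h2 : π/t ≤ 2*π/t := by gcongr; linarith
    linarith
def KB (K : Ker ε) (κ : ℂ → ℂ) : Prop := ∃ C : ℝ, 0 ≤ C ∧ ∃ N : ℕ, ∀ Q ∈ U0, ∀ t : ℝ, 0 < t →
  ‖Nm K (κ Q) t‖ ≤ C*(1+Q.im)^N*(1+t)*(Ex t+rexp (2*π*Q.im))
lemma U0_norm (hQ : Q ∈ U0) : 1+‖Q‖ ≤ 2*(1+Q.im) := by
  have h3 := hQ.2
  have := norm_le_abs_re_add_abs_im Q
  rw [abs_of_pos (by linarith : 0 < Q.im)] at this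
  linarith [hQ.1]
lemma KB_of {K : Ker ε} {κ : ℂ → ℂ} (h1 : ∀ Q ∈ U0, 1/2 ≤ (κ Q).im) (h2 : ∀ Q ∈ U0, ‖κ Q‖ ≤ 1+‖Q‖) : KB K κ := by
  obtain ⟨C, hC, N, h⟩ := Nm_bound K
  refine ⟨C*3^N*rexp (2*π), by positivity, N, fun Q hQ t ht => ?_⟩
  have hi := hQ.2
  calc _ ≤ C*(1+‖κ Q‖)^N*(1+t)*rexp (2*π*t+π/t) := h _ (h1 Q hQ) t ht
    _ ≤ C*(3*(1+Q.im))^N*(1+t)*(rexp (2*π)*Ex t) := by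
        have := U0_norm hQ
        have := h2 Q hQ
        have h5 : (1+‖κ Q‖)^N ≤ (3*(1+Q.im))^N := pow_le_pow_left₀ (by positivity) (by linarith) N
        have := exp_le_Ex ht
        have h6 : 0 ≤ 1+Q.im := by linarith
        gcongr
    _ = C*3^N*rexp (2*π)*(1+Q.im)^N*(1+t)*Ex t := by rw [mul_pow]; ring
    _ ≤ _ := by
        have h6 : 0 ≤ 1+Q.im := by linarith
        gcongr
        linarith [Real.exp_pos (2*π*Q.im)]
lemma KB0 (K : Ker ε) : KB K (fun Q => Q) :=
  KB_of (fun Q hQ => by linarith [hQ.2]) (fun Q _ => by linarith)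
lemma KB1 (K : Ker ε) : KB K (fun Q => Q+1) :=
  KB_of (fun Q hQ => by have := hQ.2; simp; linarith) (fun Q _ => by
    have := norm_add_le Q 1
    rw [norm_one] at this; linarith)
lemma KB2 (K : Ker ε) : KB K (fun Q => -1/Q+1) := by
  obtain ⟨C, N, h⟩ := K.bK2
  refine ⟨|C| * 2^N, by positivity, N, fun Q hQ t ht => ?_⟩
  have hi := hQ.2
  have hE := Ex_pos t
  calc _ ≤ C*(1+‖Q‖)^N*(1+t)*(Ex t+rexp (2*π*Q.im)) := h Q (by linarith) t ht
    _ ≤ |C| * (2*(1+Q.im))^N*(1+t)*(Ex t+rexp (2*π*Q.im)) := by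
        have := U0_norm hQ
        have := le_abs_self C
        gcongr
    _ = _ := by rw [mul_pow]; ring
lemma quot_bound {K : Ker ε} {κ : ℂ → ℂ} (hκ : KB K κ) : ∃ C : ℝ, 0 ≤ C ∧ ∃ N : ℕ, ∀ Q ∈ U0, Q.re ≠ 0 →
    ∀ t : ℝ, 0 < t → ‖Nm K (κ Q) t/den Q t‖*|Q.re|^4 ≤ C*(1+Q.im)^N*(1+t) := by
  obtain ⟨C, hC, N, h⟩ := hκ
  obtain ⟨c, hc, hd⟩ := den_lower
  refine ⟨C/c, by positivity, N, fun Q hQ h0 t ht => ?_⟩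
  have h1 := h Q hQ t ht
  have h2 := hd Q hQ.2.le hQ.1.le t ht
  have h3 : 0 < ‖den Q t‖ := norm_pos_iff.2 (den_ne_off hQ h0 ht)
  have hi := hQ.2
  have hi' : 0 ≤ 1+Q.im := by linarith
  rw [norm_div, div_mul_eq_mul_div, div_le_iff₀ h3]
  calc _ ≤ (C*(1+Q.im)^N*(1+t)*(Ex t+rexp (2*π*Q.im)))*|Q.re|^4 := by gcongr
    _ = C/c*(1+Q.im)^N*(1+t)*(c*|Q.re|^4*(Ex t+rexp (2*π*Q.im))) := by
        field_simp
    _ ≤ _ := by gcongr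
lemma Nm_cont (K : Ker ε) (κ : ℂ) : ContinuousOn (Nm K κ) (Ioi 0) := by
  unfold Nm
  refine continuousOn_finsetSum _ fun i _ => continuousOn_const.mul ?_
  intro t ht
  have h1 : ContinuousAt (K.g i) (I*t) := K.g_cont i _ (HH_axis ht)
  have h2 : ContinuousAt (fun t : ℝ => I*(t:ℂ)) t := by fun_prop
  exact (ContinuousAt.comp (f := fun t : ℝ => I*(t:ℂ)) (g := K.g i) h1 h2).continuousWithinAt
lemma den_cont (Q : ℂ) : ContinuousOn (den Q) (Ioi 0) := by
  unfold den
  exact ((Complex.continuous_ofReal.comp_continuousOn sr_cont).pow 2).sub continuousOn_const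
def HG (K : Ker ε) (s : ℝ) (κ c w : ℂ → ℂ) (X : ℂ → ℝ → ℂ) (Q : ℂ) (t : ℝ) : ℂ :=
  I*(c Q*(Nm K (κ Q) t*Es s (I*t)/den Q t-rr*w Q*X Q t))
lemma norm_rr_le : ‖rr‖ ≤ 1 := by
  rw [rr, norm_inv]
  apply inv_le_one_of_one_le₀
  simp
  rw [abs_of_pos Real.pi_pos]
  linarith [Real.pi_gt_three]
lemma genY {K : Ker ε} {κ : ℂ → ℂ} (hκ : KB K κ) : ∃ B : ℝ, 0 ≤ B ∧ ∃ N : ℕ, ∀ s : ℝ, 0 < s →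
    ∀ c w : ℂ → ℂ, ∀ X : ℂ → ℝ → ℂ, (∀ Q ∈ U0, ‖c Q‖ ≤ 4) → (∀ Q ∈ U0, ‖w Q‖ ≤ 4) →
    (∀ Q ∈ U0, Q.re ≠ 0 → ∀ t : ℝ, 0 < t → ‖X Q t‖*|Q.re| ≤ 12*(1+Q.im)^2*(1/(1+t)^2)) →
    (∀ Q ∈ U0, Q.re ≠ 0 → ContinuousOn (X Q) (Ioi 0)) →
    (∀ t : ℝ, 0 < t → t ≠ 1 → ∃ h : ℂ → ℂ, DifferentiableOn ℂ h U0 ∧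
      ∀ Q ∈ U0, Q.re ≠ 0 → h Q = HG K s κ c w X Q t) →
    ∃ Y : ℂ → ℂ, DifferentiableOn ℂ Y U1 ∧
      (∀ Q ∈ U1, Q.re ≠ 0 → Y Q = ∫ t in Ioi (0:ℝ), HG K s κ c w X Q t) ∧
      ∀ Q ∈ U1, ‖Y Q‖ ≤ B*(2+Q.im)^N := by
  obtain ⟨C, hC, N, hq⟩ := quot_bound hκ
  refine ⟨KK*((4*C+192)*4), by unfold KK; positivity, N+2, ?_⟩
  intro s hs c w X hc hw hX hXc hrem
  obtain ⟨i1, i2⟩ := mm_int hs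
  have hbd : ∀ Q ∈ U0, Q.re ≠ 0 → ∀ t : ℝ, 0 < t →
      ‖HG K s κ c w X Q t‖*|Q.re|^4 ≤ (4*C+192)*(1+Q.im)^(N+2)*mm s t := by
    intro Q hQ h0 t ht
    have hi := hQ.2
    have hr0 : 0 < |Q.re| := abs_pos.2 h0
    have hr1 : |Q.re| ≤ 1 := by linarith [hQ.1]
    have hi1 : 1 ≤ 1+Q.im := by linarith
    have a1 : ‖Nm K (κ Q) t*Es s (I*t)/den Q t‖*|Q.re|^4 ≤
        C*(1+Q.im)^(N+2)*((1+t)*(S4 s*rexp (-(π*s*t)))) := by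
      have e : Nm K (κ Q) t*Es s (I*t)/den Q t = (Nm K (κ Q) t/den Q t)*Es s (I*t) := by ring
      have e2 : (I*(t:ℂ)).im = t := by simp
      rw [e, norm_mul, norm_Es, e2]
      have h4 := S4_nonneg s
      calc _ = (‖Nm K (κ Q) t/den Q t‖*|Q.re|^4)*(S4 s*rexp (-(π*s*t))) := by ring
        _ ≤ (C*(1+Q.im)^N*(1+t))*(S4 s*rexp (-(π*s*t))) := by
            exact mul_le_mul_of_nonneg_right (hq Q hQ h0 t ht) (by positivity)
        _ ≤ (C*(1+Q.im)^(N+2)*(1+t))*(S4 s*rexp (-(π*s*t))) := by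
            gcongr
            omega
        _ = _ := by ring
    have a2 : ‖rr*w Q*X Q t‖*|Q.re|^4 ≤ 48*(1+Q.im)^(N+2)*(1/(1+t)^2) := by
      rw [norm_mul, norm_mul]
      calc ‖rr‖*‖w Q‖*‖X Q t‖*|Q.re|^4 = (‖rr‖*‖w Q‖)*(‖X Q t‖*|Q.re|)*|Q.re|^3 := by ring
        _ ≤ (1*4)*(12*(1+Q.im)^2*(1/(1+t)^2))*1 := by
            have := hw Q hQ
            have := norm_rr_le
            have := hX Q hQ h0 t ht
            have : |Q.re|^3 ≤ 1 := pow_le_one₀ hr0.le hr1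
            gcongr
        _ = 48*(1+Q.im)^2*(1/(1+t)^2) := by ring
        _ ≤ _ := by
            gcongr
            omega
    have a3 := hc Q hQ
    have a4 : ‖HG K s κ c w X Q t‖ ≤ 4*(‖Nm K (κ Q) t*Es s (I*t)/den Q t‖+‖rr*w Q*X Q t‖) := by
      rw [HG, norm_mul, norm_I, one_mul, norm_mul]
      have := norm_sub_le (Nm K (κ Q) t*Es s (I*t)/den Q t) (rr*w Q*X Q t)
      gcongr
    have h4 := S4_nonneg s
    calc _ ≤ 4*(‖Nm K (κ Q) t*Es s (I*t)/den Q t‖+‖rr*w Q*X Q t‖)*|Q.re|^4 := by gcongr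
      _ = 4*(‖Nm K (κ Q) t*Es s (I*t)/den Q t‖*|Q.re|^4)+4*(‖rr*w Q*X Q t‖*|Q.re|^4) := by ring
      _ ≤ 4*(C*(1+Q.im)^(N+2)*((1+t)*(S4 s*rexp (-(π*s*t))))) +
          4*(48*(1+Q.im)^(N+2)*(1/(1+t)^2)) := by gcongr
      _ ≤ _ := by
          unfold mm
          have p1 : 0 ≤ (1+Q.im)^(N+2)*((1+t)*(S4 s*rexp (-(π*s*t)))) := by positivity
          have p2 : 0 ≤ C*((1+Q.im)^(N+2)*(1/(1+t)^2)) := by positivity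
          linarith
  have ha : ∀ᵐ t ∂(volume.restrict (Ioi (0:ℝ))), ∃ h : ℂ → ℂ, DifferentiableOn ℂ h U0 ∧
      ∀ Q ∈ U0, Q.re ≠ 0 → h Q = HG K s κ c w X Q t := by
    have h1 : ∀ᵐ t ∂(volume.restrict (Ioi (0:ℝ))), t ≠ 1 := by
      refine ae_restrict_of_ae ?_
      simp [ae_iff]
    filter_upwards [h1, ae_restrict_mem measurableSet_Ioi] with t ht ht0
    exact hrem t ht0 ht
  have hcm : ∀ Q ∈ U0, Q.re ≠ 0 → AEStronglyMeasurable (HG K s κ c w X Q) (volume.restrict (Ioi (0:ℝ))) := by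
    intro Q hQ h0
    refine ContinuousOn.aestronglyMeasurable ?_ measurableSet_Ioi
    unfold HG
    refine continuousOn_const.mul (continuousOn_const.mul (ContinuousOn.sub ?_ ?_))
    · refine ContinuousOn.div ((Nm_cont K _).mul ?_) (den_cont Q) (fun t ht => den_ne_off hQ h0 ht)
      exact ((Es_diff s).continuous.comp (by fun_prop : Continuous fun t : ℝ => I*(t:ℂ))).continuousOn
    · exact continuousOn_const.mul (hXc Q hQ h0)
  obtain ⟨Y, y1, y2, y3⟩ := AX (H := HG K s κ c w X) (m := mm s) (B := 4*C+192) (N := N+2) (by positivity)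
    i1 (fun t ht => mm_nonneg ht) ha hbd hcm
  refine ⟨Y, y1, y2, fun Q hQ => (y3 Q hQ).trans ?_⟩
  have : 0 ≤ KK := by unfold KK; norm_num
  have hi := hQ.2
  have hi1 : 0 ≤ 2+Q.im := by linarith
  calc _ ≤ KK*((4*C+192)*(2+Q.im)^(N+2)*4) := by gcongr
    _ = _ := by ring
lemma Nm_diff (K : Ker ε) {κ : ℂ → ℂ} {Q : ℂ} (t : ℝ) (h1 : DifferentiableAt ℂ κ Q) (h2 : κ Q ∈ HH) :
    DifferentiableAt ℂ (fun Q => Nm K (κ Q) t) Q := by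
  unfold Nm
  refine DifferentiableAt.fun_sum fun i _ => DifferentiableAt.mul_const ?_ _
  exact DifferentiableAt.comp (g := K.f i) Q (K.f_diff i _ h2) h1
lemma rr_two : rr*(2*π*I) = 1 := by
  have := rr_pi
  linear_combination 2*this
lemma HG_limit {K : Ker ε} {s : ℝ} {κ c w : ℂ → ℂ} {X : ℂ → ℝ → ℂ} {t : ℝ} {p L : ℂ} (hp : p ∈ HH)
    (h1 : DifferentiableAt ℂ κ p) (h2 : κ p ∈ HH) (hc : ContinuousAt c p) (hw : ContinuousAt w p)
    (hD : den p t = 0) (htw : tw p ≠ 0)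
    (hL : Tendsto (fun Q => (Q-p)*X Q t) (𝓝[≠] p) (𝓝 L))
    (e : Nm K (κ p) t*Es s (I*t) = tw p*(w p*L)) :
    Tendsto (fun Q => (Q-p)*HG K s κ c w X Q t) (𝓝[≠] p) (𝓝 0) := by
  have hN : ContinuousAt (fun Q => Nm K (κ Q) t*Es s (I*t)) p :=
    (Nm_diff K t h1 h2).continuousAt.mul continuousAt_const
  have a := pole_limit (den_hasDeriv hp t) (mul_ne_zero two_pi_I_ne htw) hD hN
  have b : Tendsto (fun Q => rr*w Q*((Q-p)*X Q t)) (𝓝[≠] p) (𝓝 (rr*w p*L)) :=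
    ((hw.tendsto.mono_left nhdsWithin_le_nhds).const_mul rr).mul hL
  have d := ((hc.tendsto.mono_left nhdsWithin_le_nhds : Tendsto c (𝓝[≠] p) _).mul (a.sub b)).const_mul I
  have e2 : Nm K (κ p) t*Es s (I*t)/(2*π*I*tw p)-rr*w p*L = 0 := by
    rw [e, sub_eq_zero, div_eq_iff (mul_ne_zero two_pi_I_ne htw)]
    linear_combination (-w p*L*tw p)*rr_two
  rw [e2, mul_zero, mul_zero] at d
  refine d.congr fun Q => ?_
  rw [HG]; ring
lemma zero_limit {X : ℂ → ℂ} {q : ℂ} (h : ContinuousAt X q) :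
    Tendsto (fun Q => (Q-q)*X Q) (𝓝[≠] q) (𝓝 0) := by
  have : ContinuousAt (fun Q => (Q-q)*X Q) q := (by fun_prop : ContinuousAt (fun Q => Q-q) q).mul h
  have := this.tendsto
  rw [sub_self, zero_mul] at this
  exact this.mono_left nhdsWithin_le_nhds
lemma X1_diff (hQ : Q ∈ HH) {t : ℝ} (ht : 0 < t) (h : Q ≠ I*t) : DifferentiableAt ℂ (fun Q => X1 Q t) Q := by
  unfold X1
  exact DifferentiableAt.fun_div (by fun_prop) (by fun_prop) (X1_ne hQ ht h)
lemma X2_diff (hQ : Q ∈ HH) {t : ℝ} (ht : 0 < t) (h : Q ≠ I*(1/t : ℝ)) : DifferentiableAt ℂ (fun Q => X2 Q t) Q := by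
  unfold X2
  exact DifferentiableAt.fun_div (by fun_prop) (by fun_prop) (X2_ne hQ ht h)
lemma X1_limit {t : ℝ} (ht : 0 < t) : Tendsto (fun Q => (Q-I*t)*X1 Q t) (𝓝[≠] (I*t)) (𝓝 (-1)) := by
  have hne : I*(t:ℂ)+I*t ≠ 0 := by
    rw [← two_mul]; exact mul_ne_zero two_ne_zero (HH_ne_zero (HH_axis ht))
  have h1 : ContinuousAt (fun Q : ℂ => -(2*Q/(Q+I*t))) (I*t) := by
    refine ContinuousAt.neg (ContinuousAt.div₀ (by fun_prop) (by fun_prop) hne)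
  have h2 := h1.tendsto
  rw [show -(2*(I*(t:ℂ))/(I*t+I*t)) = -1 by rw [← two_mul, div_self (by rw [two_mul]; exact hne)]] at h2
  refine (h2.mono_left nhdsWithin_le_nhds).congr' ?_
  filter_upwards [self_mem_nhdsWithin] with Q hQ
  have h3 : Q-I*t ≠ 0 := sub_ne_zero.2 hQ
  rw [X1, X1_den]
  field_simp
lemma HG_rem {K : Ker ε} {s : ℝ} {κ c w : ℂ → ℂ} {X : ℂ → ℝ → ℂ} {t : ℝ} (ht : 0 < t) (ht1 : t ≠ 1)
    {L L' : ℂ}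
    (h1 : ∀ Q ∈ HH, DifferentiableAt ℂ κ Q) (h2 : ∀ Q ∈ HH, κ Q ∈ HH)
    (hc : ∀ Q ∈ HH, DifferentiableAt ℂ c Q) (hw : ∀ Q ∈ HH, DifferentiableAt ℂ w Q)
    (hX : ∀ Q ∈ HH, Q ≠ I*t → Q ≠ I*(1/t : ℝ) → DifferentiableAt ℂ (fun Q => X Q t) Q)
    (hL : Tendsto (fun Q => (Q-I*t)*X Q t) (𝓝[≠] (I*t)) (𝓝 L))
    (hL' : Tendsto (fun Q => (Q-I*(1/t : ℝ))*X Q t) (𝓝[≠] (I*(1/t : ℝ))) (𝓝 L'))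
    (e : Nm K (κ (I*t)) t*Es s (I*t) = tw (I*t)*(w (I*t)*L))
    (e' : Nm K (κ (I*(1/t : ℝ))) t*Es s (I*t) = tw (I*(1/t : ℝ))*(w (I*(1/t : ℝ))*L')) :
    ∃ h : ℂ → ℂ, DifferentiableOn ℂ h U0 ∧ ∀ Q ∈ U0, Q.re ≠ 0 → h Q = HG K s κ c w X Q t := by
  have ht' : 0 < 1/t := by positivity
  have ht1' : 1/t ≠ 1 := by
    intro h; rw [div_eq_one_iff_eq ht.ne'] at h; exact ht1 h.symm
  have hpq : I*(t:ℂ) ≠ I*(1/t : ℝ) := by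
    intro h
    have := mul_left_cancel₀ I_ne_zero h
    have h3 : t = 1/t := by exact_mod_cast this
    rw [eq_div_iff ht.ne'] at h3
    have : t = 1 := by nlinarith
    exact ht1 this
  have key := removable_two (U := U0) (h := fun Q => HG K s κ c w X Q t) hpq isOpen_U0 ?_ ?_ ?_
  · obtain ⟨g, hg, eg⟩ := key
    refine ⟨g, hg, fun Q _ h0 => eg Q ?_ ?_⟩
    · rintro rfl; simp at h0
    · rintro rfl; simp at h0
  · intro Q hQ n1 n2
    have hH := U0_HH hQ
    unfold HG
    refine DifferentiableAt.const_mul ((hc Q hH).fun_mul (DifferentiableAt.fun_sub ?_ ?_)) I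
    · exact ((Nm_diff K t (h1 Q hH) (h2 Q hH)).mul_const _).fun_div (den_hasDeriv hH t).differentiableAt
        (den_ne hQ ht n1 n2)
    · exact ((hw Q hH).const_mul rr).fun_mul (hX Q hH n1 n2)
  · intro _
    have hH := HH_axis ht
    exact HG_limit hH (h1 _ hH) (h2 _ hH) (hc _ hH).continuousAt (hw _ hH).continuousAt (den_zero1 ht)
      (tw_axis_ne ht ht1) hL e
  · intro _
    have hH := HH_axis ht'
    exact HG_limit hH (h1 _ hH) (h2 _ hH) (hc _ hH).continuousAt (hw _ hH).continuousAt (den_zero2 ht)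
      (tw_axis_ne ht' ht1') hL' e'
lemma axis_ne {t : ℝ} (ht : 0 < t) (ht1 : t ≠ 1) : I*((1/t : ℝ):ℂ) ≠ I*t := by
  intro h
  have := mul_left_cancel₀ I_ne_zero h
  have h3 : 1/t = t := by exact_mod_cast this
  rw [div_eq_iff ht.ne'] at h3
  have : t = 1 := by nlinarith
  exact ht1 this
lemma rem0 (K : Ker ε) (s : ℝ) {t : ℝ} (ht : 0 < t) (ht1 : t ≠ 1) :
    ∃ h : ℂ → ℂ, DifferentiableOn ℂ h U0 ∧ ∀ Q ∈ U0, Q.re ≠ 0 →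
      h Q = HG K s (fun Q => Q) (fun _ => 1) (fun _ => 0) (fun _ _ => 0) Q t := by
  have hz := K.N0 _ (HH_axis ht)
  refine HG_rem ht ht1 (L := 0) (L' := 0) (fun _ _ => by fun_prop) (fun _ h => h) (fun _ _ => by fun_prop)
    (fun _ _ => by fun_prop) (fun _ _ _ _ => by fun_prop) (by simp) (by simp) ?_ ?_
  · rw [Nm, hz]; simp
  · have : Nm K (I*(1/t : ℝ)) t = 0 := by
      rw [Nm, ← neg_inv_axis]
      simp_rw [K.f_S _ _ (HH_axis ht), mul_assoc]
      rw [← Finset.mul_sum, ← Finset.mul_sum, hz]; simp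
    rw [this]; simp
lemma rem1 (K : Ker ε) (s : ℝ) {t : ℝ} (ht : 0 < t) (ht1 : t ≠ 1) :
    ∃ h : ℂ → ℂ, DifferentiableOn ℂ h U0 ∧ ∀ Q ∈ U0, Q.re ≠ 0 →
      h Q = HG K s (fun Q => Q+1) (fun _ => 1) (Es s) X1 Q t := by
  refine HG_rem ht ht1 (L := -1) (L' := 0) (fun _ _ => by fun_prop) (fun _ h => HH_add_one h) (fun _ _ => by fun_prop)
    (fun Q _ => (Es_diff s) Q) (fun Q h n1 _ => X1_diff h ht n1) (X1_limit ht)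
    (zero_limit (X1_diff (HH_axis (by positivity)) ht (axis_ne ht ht1)).continuousAt) ?_ ?_
  · rw [Nm, K.N1 _ (HH_axis ht)]; ring
  · rw [Nm, ← neg_inv_axis, K.N2 _ (HH_axis ht)]; ring
lemma rem2 (K : Ker ε) (s : ℝ) {t : ℝ} (ht : 0 < t) (ht1 : t ≠ 1) :
    ∃ h : ℂ → ℂ, DifferentiableOn ℂ h U0 ∧ ∀ Q ∈ U0, Q.re ≠ 0 →
      h Q = HG K s (fun Q => -1/Q+1) (fun Q => Q⁻¹^4) (fun Q => Es s (-1/Q)) X2 Q t := by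
  have hd : ∀ Q ∈ HH, DifferentiableAt ℂ (fun Q : ℂ => -1/Q) Q := fun Q hQ =>
    (hasDerivAt_neg_inv (HH_ne_zero hQ)).differentiableAt
  have htc : (t:ℂ) ≠ 0 := by exact_mod_cast ht.ne'
  refine HG_rem ht ht1 (L := 0) (L' := 1/(t:ℂ)^2) (fun Q h => (hd Q h).add_const 1)
    (fun _ h => HH_add_one (HH_neg_inv h))
    (fun Q h => (differentiableAt_inv (HH_ne_zero h)).fun_pow 4)
    (fun Q h => DifferentiableAt.comp (g := Es s) Q ((Es_diff s) _) (hd Q h))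
    (fun Q h _ n2 => X2_diff h ht n2)
    (zero_limit (X2_diff (HH_axis ht) ht (axis_ne ht ht1).symm).continuousAt) ?_ ?_ ?_
  · have h1 := (X1_limit (one_div_pos.2 ht)).const_mul (-(1/(t:ℂ)^2))
    rw [show -(1/(t:ℂ)^2)*-1 = 1/(t:ℂ)^2 by ring] at h1
    refine h1.congr fun Q => ?_
    rw [X2_eq Q ht]; ring
  · rw [Nm, K.N2 _ (HH_axis ht)]; ring
  · have e1 : -1/(I*((1/t : ℝ):ℂ)) = I*t := by rw [neg_inv_axis, one_div_one_div]
    rw [Nm, e1, K.N1 _ (HH_axis ht), ← neg_inv_axis, tw_S (HH_axis ht)]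
    field_simp
    linear_combination (-(tw (I*t)))*Es s (I*t)*I_sq
lemma int_X1 (hQ : Q ∈ HH) (hi : IntegrableOn (X1 Q) (Ioi 0)) :
    (Q.re < 0 → ∫ t in Ioi (0:ℝ), I*X1 Q t = π*I) ∧
    (0 < Q.re → ∫ t in Ioi (0:ℝ), I*X1 Q t = -(π*I)) := by
  have him : 0 < Q.im := hQ
  have hlim : Tendsto (fun t : ℝ => Q/t) atTop (𝓝 0) := by
    have : Tendsto (fun t : ℝ => ((t⁻¹ : ℝ) : ℂ)) atTop (𝓝 ((0:ℝ):ℂ)) :=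
      (Complex.continuous_ofReal.tendsto 0).comp tendsto_inv_atTop_zero
    have h2 := this.const_mul Q
    rw [ofReal_zero, mul_zero] at h2
    refine h2.congr fun t => ?_
    push_cast; rfl
  have hsl : ∀ t : ℝ, 0 ≤ t → Q+I*t ∈ slitPlane := fun t ht => Or.inr (by simp; positivity)
  have hder : ∀ t : ℝ, HasDerivAt (fun t : ℝ => Q+I*(t:ℂ)) I t := fun t => by
    simpa using ((hasDerivAt_id t).ofReal_comp.const_mul I).const_add Q
  constructor
  · intro hr
    have hsl' : ∀ t : ℝ, I*t-Q ∈ slitPlane := fun t => Or.inl (by simp; exact hr)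
    have hder' : ∀ t : ℝ, HasDerivAt (fun t : ℝ => I*(t:ℂ)-Q) I t := fun t => by
      simpa using ((hasDerivAt_id t).ofReal_comp.const_mul I).sub_const Q
    have hd : ∀ t ∈ Ici (0:ℝ), HasDerivAt (fun t : ℝ => Complex.log (I*t-Q)-Complex.log (Q+I*t))
        (I*X1 Q t) t := by
      intro t ht
      refine ((hder' t).clog_real (hsl' t)).sub ((hder t).clog_real (hsl t ht)) |>.congr_deriv ?_
      have n1 := slitPlane_ne_zero (hsl' t)
      have n2 := slitPlane_ne_zero (hsl t ht)
      have n3 : Q-I*t ≠ 0 := by intro h; apply n1; linear_combination -h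
      rw [X1, X1_den]
      field_simp
      ring
    have hl : Tendsto (fun t : ℝ => Complex.log (I*t-Q)-Complex.log (Q+I*t)) atTop (𝓝 0) := by
      have c1 : Tendsto (fun t : ℝ => Complex.log (I-Q/t)-Complex.log (I+Q/t)) atTop (𝓝 (Complex.log (I-0)-Complex.log (I+0))) := by
        refine Tendsto.sub ?_ ?_
        · exact (continuousAt_clog (by simp [slitPlane])).tendsto.comp (hlim.const_sub I)
        · exact (continuousAt_clog (by simp [slitPlane])).tendsto.comp (hlim.const_add I)
      rw [sub_zero, add_zero, sub_self] at c1
      refine c1.congr' ?_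
      filter_upwards [eventually_gt_atTop 0] with t ht
      have htc : (t:ℂ) ≠ 0 := by exact_mod_cast ht.ne'
      have e1 : I*t-Q = (t:ℝ)*(I-Q/t) := by field_simp
      have e2 : Q+I*t = (t:ℝ)*(I+Q/t) := by field_simp; ring
      have n1 := slitPlane_ne_zero (hsl' t)
      have n2 := slitPlane_ne_zero (hsl t ht.le)
      rw [e1] at n1 ⊢; rw [e2] at n2 ⊢
      rw [log_ofReal_mul ht (right_ne_zero_of_mul n1), log_ofReal_mul ht (right_ne_zero_of_mul n2)]
      ring
    rw [integral_Ioi_of_hasDerivAt_of_tendsto' hd (hi.const_mul I) hl]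
    simp only [ofReal_zero, mul_zero, zero_sub, add_zero]
    have : Complex.log (-Q) = Complex.log Q-π*I := by
      rw [Complex.log, Complex.log, norm_neg, arg_neg_eq_arg_sub_pi_of_im_pos him]
      push_cast; ring
    rw [this]; ring
  · intro hr
    have hsl' : ∀ t : ℝ, Q-I*t ∈ slitPlane := fun t => Or.inl (by simp; exact hr)
    have hder' : ∀ t : ℝ, HasDerivAt (fun t : ℝ => Q-I*(t:ℂ)) (-I) t := fun t => by
      simpa using ((hasDerivAt_id t).ofReal_comp.const_mul I).const_sub Q
    have hd : ∀ t ∈ Ici (0:ℝ), HasDerivAt (fun t : ℝ => Complex.log (Q-I*t)-Complex.log (Q+I*t))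
        (I*X1 Q t) t := by
      intro t ht
      refine ((hder' t).clog_real (hsl' t)).sub ((hder t).clog_real (hsl t ht)) |>.congr_deriv ?_
      have n1 := slitPlane_ne_zero (hsl' t)
      have n2 := slitPlane_ne_zero (hsl t ht)
      rw [X1, X1_den]
      field_simp
      ring
    have hl : Tendsto (fun t : ℝ => Complex.log (Q-I*t)-Complex.log (Q+I*t)) atTop (𝓝 (-(π*I))) := by
      have c1 : Tendsto (fun t : ℝ => Complex.log (-I+Q/t)-Complex.log (I+Q/t)) atTop (𝓝 (Complex.log (-I+0)-Complex.log (I+0))) := by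
        refine Tendsto.sub ?_ ?_
        · exact (continuousAt_clog (by simp [slitPlane])).tendsto.comp (hlim.const_add (-I))
        · exact (continuousAt_clog (by simp [slitPlane])).tendsto.comp (hlim.const_add I)
      rw [add_zero, add_zero, log_I, log_neg_I] at c1
      rw [show -(π/2 : ℂ)*I-π/2*I = -(π*I) by ring] at c1
      refine c1.congr' ?_
      filter_upwards [eventually_gt_atTop 0] with t ht
      have htc : (t:ℂ) ≠ 0 := by exact_mod_cast ht.ne'
      have e1 : Q-I*t = (t:ℝ)*(-I+Q/t) := by field_simp; ring
      have e2 : Q+I*t = (t:ℝ)*(I+Q/t) := by field_simp; ring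
      have n1 := slitPlane_ne_zero (hsl' t)
      have n2 := slitPlane_ne_zero (hsl t ht.le)
      rw [e1] at n1 ⊢; rw [e2] at n2 ⊢
      rw [log_ofReal_mul ht (right_ne_zero_of_mul n1), log_ofReal_mul ht (right_ne_zero_of_mul n2)]
      ring
    rw [integral_Ioi_of_hasDerivAt_of_tendsto' hd (hi.const_mul I) hl]
    simp
def QQ (K : Ker ε) (s : ℝ) (κ Q : ℂ) (t : ℝ) : ℂ := I*(Nm K κ t*Es s (I*t)/den Q t)
def Ph (K : Ker ε) (s : ℝ) (κ Q : ℂ) : ℂ := ∫ t in Ioi (0:ℝ), QQ K s κ Q t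
lemma QQ_int {K : Ker ε} {κ : ℂ → ℂ} (hκ : KB K κ) {s : ℝ} (hs : 0 < s) {Q : ℂ} (hQ : Q ∈ U0) (h0 : Q.re ≠ 0) :
    IntegrableOn (QQ K s (κ Q) Q) (Ioi 0) := by
  obtain ⟨C, hC, N, hq⟩ := quot_bound hκ
  obtain ⟨i1, -⟩ := mm_int hs
  have hr0 : 0 < |Q.re| := abs_pos.2 h0
  have hi := hQ.2
  refine Integrable.mono' (i1.const_mul (C*(1+Q.im)^N/|Q.re|^4)) ?_ ?_
  · refine ContinuousOn.aestronglyMeasurable ?_ measurableSet_Ioi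
    refine continuousOn_const.mul ((ContinuousOn.mul (Nm_cont K _) ?_).div₀ (den_cont Q) fun t ht => den_ne_off hQ h0 ht)
    exact ((Es_diff s).continuous.comp (by fun_prop : Continuous fun t : ℝ => I*(t:ℂ))).continuousOn
  · filter_upwards [ae_restrict_mem measurableSet_Ioi] with t ht
    have ht : 0 < t := ht
    have e : Nm K (κ Q) t*Es s (I*t)/den Q t = (Nm K (κ Q) t/den Q t)*Es s (I*t) := by ring
    have e2 : (I*(t:ℂ)).im = t := by simp
    rw [QQ, norm_mul, norm_I, one_mul, e, norm_mul, norm_Es, e2]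
    have h4 := S4_nonneg s
    have h5 : ‖Nm K (κ Q) t/den Q t‖ ≤ C*(1+Q.im)^N*(1+t)/|Q.re|^4 := by
      rw [le_div_iff₀ (by positivity)]; exact hq Q hQ h0 t ht
    calc _ ≤ (C*(1+Q.im)^N*(1+t)/|Q.re|^4)*(S4 s*rexp (-(π*s*t))) :=
          mul_le_mul_of_nonneg_right h5 (by positivity)
      _ = C*(1+Q.im)^N/|Q.re|^4*((1+t)*(S4 s*rexp (-(π*s*t)))) := by ring
      _ ≤ _ := by
        refine mul_le_mul_of_nonneg_left ?_ (by positivity)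
        unfold mm
        have : 0 ≤ 1/(1+t)^2 := by positivity
        linarith
lemma Xint {X : ℝ → ℂ} {Q : ℂ} (h0 : Q.re ≠ 0) (hc : ContinuousOn X (Ioi 0))
    (h : ∀ t : ℝ, 0 < t → ‖X t‖*|Q.re| ≤ 12*(1+Q.im)^2*(1/(1+t)^2)) : IntegrableOn X (Ioi 0) := by
  have hr0 : 0 < |Q.re| := abs_pos.2 h0
  refine Integrable.mono' (int_inv_sq.1.const_mul (12*(1+Q.im)^2/|Q.re|))
    (hc.aestronglyMeasurable measurableSet_Ioi) ?_
  filter_upwards [ae_restrict_mem measurableSet_Ioi] with t ht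
  have := h t ht
  rw [← le_div_iff₀ hr0] at this
  calc _ ≤ _ := this
    _ = _ := by ring
lemma ne_axis (h0 : Q.re ≠ 0) (t : ℝ) : Q ≠ I*t := by
  rintro rfl; exact h0 (by simp)
lemma X1_contOn (hQ : Q ∈ HH) (h0 : Q.re ≠ 0) : ContinuousOn (X1 Q) (Ioi 0) := by
  unfold X1
  exact ContinuousOn.div₀ (by fun_prop) (by fun_prop) fun t ht => X1_ne hQ ht (ne_axis h0 t)
lemma X2_contOn (hQ : Q ∈ HH) (h0 : Q.re ≠ 0) : ContinuousOn (X2 Q) (Ioi 0) := by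
  unfold X2
  exact ContinuousOn.div₀ (by fun_prop) (by fun_prop) fun t ht => X2_ne hQ ht (ne_axis h0 _)
lemma U0_inv_le (hQ : Q ∈ U0) : ‖Q⁻¹^4‖ ≤ 4 := by
  have h : 18/25 ≤ ‖Q‖ := hQ.2.le.trans ((le_abs_self _).trans (abs_im_le_norm Q))
  rw [norm_pow, norm_inv]
  have : ‖Q‖⁻¹ ≤ 25/18 := by
    rw [inv_le_comm₀ (by linarith) (by norm_num)]; norm_num; linarith
  calc _ ≤ (25/18 : ℝ)^4 := pow_le_pow_left₀ (by positivity) this 4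
    _ ≤ 4 := by norm_num
def Mf (ε : ℂ) (v : Fin 3 → ℂ) : Fin 3 → ℂ := ![v 1, 2*v 1-v 0, 2*v 0+ε*v 2]
def Nf (ε : ℂ) (v : Fin 3 → ℂ) : Fin 3 → ℂ := ![-ε*v 0, v 2, v 1]
def hf (ε : ℂ) (s : ℝ) (Q : ℂ) : Fin 3 → ℂ := ![0, Es s (Q+1), -ε*(Q⁻¹^4*Es s (-1/Q))]
structure Base (K : Ker ε) (s B : ℝ) (N : ℕ) (Y : ℂ → Fin 3 → ℂ) : Prop where
  diff : DifferentiableOn ℂ Y U1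
  bd : ∀ Q ∈ U1, ‖Y Q‖ ≤ B*(2+Q.im)^N
  psi : ∀ Q ∈ U1, Q.re ≠ 0 → Y Q 0 = Ph K s Q Q
  G1n : ∀ Q ∈ U1, Q.re < 0 → Y Q 1 = Ph K s (Q+1) Q
  G1p : ∀ Q ∈ U1, 0 < Q.re → Y Q 1 = Ph K s (Q+1) Q+Es s Q
  G2n : ∀ Q ∈ U1, Q.re < 0 → Y Q 2 = Q⁻¹^4*(Ph K s (-1/Q+1) Q+Es s (-1/Q))
  G2p : ∀ Q ∈ U1, 0 < Q.re → Y Q 2 = Q⁻¹^4*Ph K s (-1/Q+1) Q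
lemma HG_split {K : Ker ε} {s : ℝ} (hs : 0 < s) {κ c w : ℂ → ℂ} (hκ : KB K κ) {X : ℂ → ℝ → ℂ} {Q : ℂ} (hQ : Q ∈ U0)
    (h0 : Q.re ≠ 0) (hX : IntegrableOn (X Q) (Ioi 0)) :
    ∫ t in Ioi (0:ℝ), HG K s κ c w X Q t = c Q*(Ph K s (κ Q) Q-rr*w Q*∫ t in Ioi (0:ℝ), I*X Q t) := by
  have i2 : IntegrableOn (fun t => rr*w Q*(I*X Q t)) (Ioi 0) := (hX.const_mul I).const_mul _
  rw [Ph, ← integral_const_mul, ← integral_sub (QQ_int hκ hs hQ h0) i2, ← integral_const_mul]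
  congr 1; funext t
  rw [HG, QQ]; ring
lemma base_exists (K : Ker ε) : ∃ B : ℝ, 0 ≤ B ∧ ∃ N : ℕ, ∀ s : ℝ, 0 < s → ∃ Y, Base K s B N Y := by
  obtain ⟨B0, hB0, N0, h0⟩ := genY (KB0 K)
  obtain ⟨B1, hB1, N1, h1⟩ := genY (KB1 K)
  obtain ⟨B2, hB2, N2, h2⟩ := genY (KB2 K)
  refine ⟨B0+B1+B2+8, by positivity, N0+N1+N2, fun s hs => ?_⟩
  obtain ⟨y0, d0, f0, b0⟩ := h0 s hs (fun _ => 1) (fun _ => 0) (fun _ _ => 0) (fun _ _ => by norm_num)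
    (fun _ _ => by norm_num) (fun Q h _ t _ => by have := h.2; simp; positivity) (fun _ _ _ => continuousOn_const)
    (fun t ht ht1 => rem0 K s ht ht1)
  obtain ⟨y1, d1, f1, b1⟩ := h1 s hs (fun _ => 1) (Es s) X1 (fun _ _ => by norm_num)
    (fun Q h => norm_Es_le hs.le (U0_HH h)) (fun Q h hr t ht => X1_bound h ht hr)
    (fun Q h hr => X1_contOn (U0_HH h) hr) (fun t ht ht1 => rem1 K s ht ht1)
  obtain ⟨y2, d2, f2, b2⟩ := h2 s hs (fun Q => Q⁻¹^4) (fun Q => Es s (-1/Q)) X2 (fun Q h => U0_inv_le h)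
    (fun Q h => norm_Es_le hs.le (HH_neg_inv (U0_HH h))) (fun Q h hr t ht => X2_bound h ht hr)
    (fun Q h hr => X2_contOn (U0_HH h) hr) (fun t ht ht1 => rem2 K s ht ht1)
  have hN : ∀ {Q : ℂ}, Q ∈ U1 → ∀ {B : ℝ} {n : ℕ}, 0 ≤ B → n ≤ N0+N1+N2 → B*(2+Q.im)^n ≤ B*(2+Q.im)^(N0+N1+N2) := by
    intro Q h B n hB hn
    have := h.2
    exact mul_le_mul_of_nonneg_left (pow_le_pow_right₀ (by linarith) hn) hB
  have hP : ∀ {Q : ℂ}, Q ∈ U1 → 1 ≤ (2+Q.im)^(N0+N1+N2) := by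
    intro Q h
    have := h.2
    exact one_le_pow₀ (by linarith)
  have ix1 : ∀ Q ∈ U1, Q.re ≠ 0 → IntegrableOn (X1 Q) (Ioi 0) := fun Q h hr =>
    Xint hr (X1_contOn (U0_HH (U1_sub h)) hr) fun t ht => X1_bound (U1_sub h) ht hr
  have ix2 : ∀ Q ∈ U1, Q.re ≠ 0 → IntegrableOn (X2 Q) (Ioi 0) := fun Q h hr =>
    Xint hr (X2_contOn (U0_HH (U1_sub h)) hr) fun t ht => X2_bound (U1_sub h) ht hr
  have x2e : ∀ Q ∈ U1, X2 Q = X1 (-1/Q) := fun Q h => by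
    funext t; exact X2_eq' (HH_ne_zero (U0_HH (U1_sub h)))
  have hrr := rr_pi
  refine ⟨fun Q => ![y0 Q, y1 Q+Es s Q/2, y2 Q+Q⁻¹^4*Es s (-1/Q)/2], ?_, ?_, ?_, ?_, ?_, ?_, ?_⟩
  · refine differentiableOn_pi.2 fun i => ?_
    fin_cases i
    · exact d0
    · exact d1.add (((Es_diff s).div_const 2).differentiableOn)
    · refine d2.add fun Q h => DifferentiableAt.differentiableWithinAt ?_
      have hn := HH_ne_zero (U0_HH (U1_sub h))
      exact (((differentiableAt_inv hn).fun_pow 4).fun_mul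
        (DifferentiableAt.comp (g := Es s) Q ((Es_diff s) _) (hasDerivAt_neg_inv hn).differentiableAt)).div_const 2
  · intro Q h
    have hh := U0_HH (U1_sub h)
    have p := hP h
    have q0 := hN h hB0 (show N0 ≤ N0+N1+N2 by omega)
    have q1 := hN h hB1 (show N1 ≤ N0+N1+N2 by omega)
    have q2 := hN h hB2 (show N2 ≤ N0+N1+N2 by omega)
    have r0 := b0 Q h
    have r1 := b1 Q h
    have r2 := b2 Q h
    have m0 : 0 ≤ B0*(2+Q.im)^(N0+N1+N2) := by positivity
    have m1 : 0 ≤ B1*(2+Q.im)^(N0+N1+N2) := by positivity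
    have m2 : 0 ≤ B2*(2+Q.im)^(N0+N1+N2) := by positivity
    have e1 := norm_Es_le hs.le hh
    have e2 := norm_Es_le hs.le (HH_neg_inv hh)
    have e3 := U0_inv_le (U1_sub h)
    have e4 : ‖Q⁻¹^4*Es s (-1/Q)/2‖ ≤ 8 := by
      rw [norm_div, norm_mul, Complex.norm_ofNat]
      have := mul_le_mul e3 e2 (norm_nonneg _) (by norm_num)
      linarith
    have e5 : ‖Es s Q/2‖ ≤ 8 := by
      rw [norm_div, Complex.norm_ofNat]; linarith
    have n1 := norm_add_le (y1 Q) (Es s Q/2)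
    have n2 := norm_add_le (y2 Q) (Q⁻¹^4*Es s (-1/Q)/2)
    refine (pi_norm_le_iff_of_nonneg (by positivity)).2 fun i => ?_
    rw [add_mul, add_mul, add_mul]
    fin_cases i <;> simp only [Fin.zero_eta, Fin.mk_one, Fin.reduceFinMk, Matrix.cons_val] <;> linarith
  · intro Q h hr
    have := f0 Q h hr
    rw [HG_split hs (KB0 K) (U1_sub h) hr (by simp [integrableOn_zero])] at this
    simpa using this
  all_goals intro Q h hr
  · have := f1 Q h hr.ne
    rw [HG_split hs (KB1 K) (U1_sub h) hr.ne (ix1 Q h hr.ne), (int_X1 (U0_HH (U1_sub h)) (ix1 Q h hr.ne)).1 hr] at this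
    simp only [Matrix.cons_val, this]
    linear_combination (-Es s Q)*hrr
  · have := f1 Q h hr.ne'
    rw [HG_split hs (KB1 K) (U1_sub h) hr.ne' (ix1 Q h hr.ne'), (int_X1 (U0_HH (U1_sub h)) (ix1 Q h hr.ne')).2 hr] at this
    simp only [Matrix.cons_val, this]
    linear_combination (Es s Q)*hrr
  · have := f2 Q h hr.ne
    have hx := ix2 Q h hr.ne
    have hr' : 0 < (-1/Q).re := by
      rw [re_neg_inv]; exact div_pos (by linarith) (normSq_pos.2 (HH_ne_zero (U0_HH (U1_sub h))))
    rw [HG_split hs (KB2 K) (U1_sub h) hr.ne hx] at this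
    rw [x2e Q h] at this hx
    rw [(int_X1 (HH_neg_inv (U0_HH (U1_sub h))) hx).2 hr'] at this
    simp only [Matrix.cons_val, this]
    linear_combination (Q⁻¹^4*Es s (-1/Q))*hrr
  · have := f2 Q h hr.ne'
    have hx := ix2 Q h hr.ne'
    have hr' : (-1/Q).re < 0 := by
      rw [re_neg_inv]; exact div_neg_of_neg_of_pos (by linarith) (normSq_pos.2 (HH_ne_zero (U0_HH (U1_sub h))))
    rw [HG_split hs (KB2 K) (U1_sub h) hr.ne' hx] at this
    rw [x2e Q h] at this hx
    rw [(int_X1 (HH_neg_inv (U0_HH (U1_sub h))) hx).1 hr'] at this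
    simp only [Matrix.cons_val, this]
    linear_combination (-Q⁻¹^4*Es s (-1/Q))*hrr
lemma Ph_T {K : Ker ε} {s : ℝ} {κ Q : ℂ} (h : Q ∈ HH) : Ph K s κ (Q+1) = Ph K s κ Q := by
  unfold Ph QQ; simp_rw [den_T h]
lemma Ph_S {K : Ker ε} {s : ℝ} {κ Q : ℂ} (h : Q ∈ HH) : Ph K s κ (-1/Q) = Ph K s κ Q := by
  unfold Ph QQ; simp_rw [den_S h]
lemma Nm_S (K : Ker ε) {κ : ℂ} (h : κ ∈ HH) (t : ℝ) : Nm K (-1/κ) t = -ε*κ^4*Nm K κ t := by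
  unfold Nm
  rw [Finset.mul_sum]
  refine Finset.sum_congr rfl fun i _ => ?_
  rw [K.f_S i κ h]; ring
lemma Nm_T (K : Ker ε) {κ : ℂ} (h : κ ∈ HH) (t : ℝ) : Nm K (κ+1+1) t = 2*Nm K (κ+1) t-Nm K κ t := by
  unfold Nm
  rw [Finset.mul_sum, ← Finset.sum_sub_distrib]
  refine Finset.sum_congr rfl fun i _ => ?_
  rw [K.f_T i κ h]; ring
lemma Ph_mul {K : Ker ε} {s : ℝ} {κ κ' Q a : ℂ} (h : ∀ t, Nm K κ' t = a*Nm K κ t) : Ph K s κ' Q = a*Ph K s κ Q := by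
  unfold Ph
  rw [← integral_const_mul]
  congr 1; funext t
  rw [QQ, QQ, h]; ring
lemma Ph_add {K : Ker ε} {s : ℝ} {κ κ' κ'' Q a b : ℂ} (h : ∀ t, Nm K κ'' t = a*Nm K κ t+b*Nm K κ' t)
    (i1 : IntegrableOn (QQ K s κ Q) (Ioi 0)) (i2 : IntegrableOn (QQ K s κ' Q) (Ioi 0)) :
    Ph K s κ'' Q = a*Ph K s κ Q+b*Ph K s κ' Q := by
  unfold Ph
  rw [← integral_const_mul, ← integral_const_mul, ← integral_add (i1.const_mul a) (i2.const_mul b)]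
  congr 1; funext t
  rw [QQ, QQ, QQ, h]; ring
lemma Nm_ST (K : Ker ε) (hε : ε^2 = 1) {Q : ℂ} (h : Q ∈ HH) (t : ℝ) :
    Nm K (-1/(Q+1)+1) t = (Q+1)^4*2*Nm K Q t+(Q+1)^4*ε*Q⁻¹^4*Nm K (-1/Q+1) t := by
  have h0 := HH_ne_zero h
  have h1 := HH_ne_zero (HH_add_one h)
  have hw : -1/Q-1 ∈ HH := by
    have : 0 < (-1/Q).im := HH_neg_inv h
    rw [mem_HH]; simpa using this
  have hz := HH_ne_zero hw
  have e1 : -1/(-1/Q-1) = -1/(Q+1)+1 := by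
    have : -1/Q-1 = -(Q+1)/Q := by field_simp; ring
    rw [this]; field_simp; ring
  have a := Nm_S K hw t
  have b := Nm_T K hw t
  have c := Nm_S K h t
  rw [sub_add_cancel] at b
  rw [e1] at a
  have e2 : (-1/Q-1)^4*Q^4 = (Q+1)^4 := by
    rw [← mul_pow]
    have : (-1/Q-1)*Q = -(Q+1) := by field_simp; ring
    rw [this]; ring
  have e3 : (-1/Q-1)^4 = (Q+1)^4*Q⁻¹^4 := by
    rw [← e2]; field_simp
  have e4 : Q⁻¹^4*Q^4 = 1 := by field_simp
  have b' : Nm K (-1/Q-1) t = 2*Nm K (-1/Q) t-Nm K (-1/Q+1) t := by rw [b]; ring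
  rw [a, b', c, e3]
  linear_combination (2*(Q+1)^4*Nm K Q t*Q^4*Q⁻¹^4)*hε+(2*(Q+1)^4*Nm K Q t)*e4
lemma Base.T {K : Ker ε} (hε : ε^2 = 1) {s B : ℝ} {N : ℕ} {Y} (hs : 0 < s) (hY : Base K s B N Y) {Q : ℂ} (h : Q ∈ U1)
    (h' : Q+1 ∈ U1) : Y (Q+1) = Mf ε (Y Q)+hf ε s Q := by
  have hh := U0_HH (U1_sub h)
  have r1 : Q.re < 0 := by
    have := h'.1; simp at this; have := (abs_lt.1 this).2; linarith
  have r2 : 0 < (Q+1).re := by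
    have := h.1; have := (abs_lt.1 this).1; simp; linarith
  have i0 := QQ_int (KB0 K) hs (U1_sub h) r1.ne
  have i1 := QQ_int (KB1 K) hs (U1_sub h) r1.ne
  have i2 := QQ_int (KB2 K) hs (U1_sub h) r1.ne
  funext i
  fin_cases i
  · simp only [Fin.zero_eta, Fin.mk_one, Fin.reduceFinMk, Matrix.cons_val, Mf, hf, Pi.add_apply]
    rw [hY.psi _ h' r2.ne', hY.G1n _ h r1, Ph_T hh, add_zero]
  · simp only [Fin.zero_eta, Fin.mk_one, Fin.reduceFinMk, Matrix.cons_val, Mf, hf, Pi.add_apply]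
    rw [hY.G1p _ h' r2, hY.G1n _ h r1, hY.psi _ h r1.ne, Ph_T hh,
      Ph_add (a := 2) (b := -1) (fun t => by rw [Nm_T K hh]; ring) i1 i0]
    ring
  · simp only [Fin.zero_eta, Fin.mk_one, Fin.reduceFinMk, Matrix.cons_val, Mf, hf, Pi.add_apply]
    rw [hY.G2p _ h' r2, hY.G2n _ h r1, hY.psi _ h r1.ne, Ph_T hh, Ph_add (Nm_ST K hε hh) i0 i2]
    have h1 := HH_ne_zero (HH_add_one hh)
    field_simp; ring
lemma Base.S {K : Ker ε} {s B : ℝ} {N : ℕ} {Y} (hY : Base K s B N Y) {Q : ℂ} (h : Q ∈ U1)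
    (h' : -1/Q ∈ U1) (hr : 0 < Q.re) : Y (-1/Q) = Q^4 • Nf ε (Y Q) := by
  have hh := U0_HH (U1_sub h)
  have h0 := HH_ne_zero hh
  have hr' : (-1/Q).re < 0 := by
    rw [re_neg_inv]; exact div_neg_of_neg_of_pos (by linarith) (normSq_pos.2 h0)
  funext i
  fin_cases i
  · simp only [Fin.zero_eta, Fin.mk_one, Fin.reduceFinMk, Matrix.cons_val, Nf, Pi.smul_apply, smul_eq_mul]
    rw [hY.psi _ h' hr'.ne, hY.psi _ h hr.ne', Ph_S hh, Ph_mul (Nm_S K hh)]; ring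
  · simp only [Fin.zero_eta, Fin.mk_one, Fin.reduceFinMk, Matrix.cons_val, Nf, Pi.smul_apply, smul_eq_mul]
    rw [hY.G1n _ h' hr', hY.G2p _ h hr, Ph_S hh]
    field_simp
  · simp only [Fin.zero_eta, Fin.mk_one, Fin.reduceFinMk, Matrix.cons_val, Nf, Pi.smul_apply, smul_eq_mul]
    rw [hY.G2n _ h' hr', hY.G1p _ h hr, Ph_S hh]
    have : -1/(-1/Q) = Q := by field_simp
    rw [this]
    field_simp
lemma ident {f g : ℂ → Fin 3 → ℂ} {U O : Set ℂ} (hU : IsOpen U) (hc : Convex ℝ U) (hf : DifferentiableOn ℂ f U)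
    (hg : DifferentiableOn ℂ g U) (hO : IsOpen O) {z : ℂ} (h1 : z ∈ U) (h2 : z ∈ O) (h : ∀ w ∈ O, f w = g w) :
    ∀ w ∈ U, f w = g w := by
  have a : EqOn f g U := AnalyticOnNhd.eqOn_of_preconnected_of_eventuallyEq (hf.analyticOnNhd hU) (hg.analyticOnNhd hU)
    hc.isPreconnected h1 (by filter_upwards [hO.mem_nhds h2] with w hw using h w hw)
  exact a
def Mi (ε : ℂ) (w : Fin 3 → ℂ) : Fin 3 → ℂ := ![2*w 0-w 1, w 0, ε*(w 2-2*(2*w 0-w 1))]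
lemma Mi_Mf (hε : ε^2 = 1) (v) : Mi ε (Mf ε v) = v := by
  funext i; fin_cases i <;> simp [Mi, Mf]
  linear_combination v 2*hε
lemma Mf_Mi (hε : ε^2 = 1) (v) : Mf ε (Mi ε v) = v := by
  funext i; fin_cases i <;> simp [Mi, Mf]
  linear_combination (v 2-2*(2*v 0-v 1))*hε
lemma Mf_diff (ε : ℂ) : Differentiable ℂ (Mf ε) := by
  refine differentiable_pi.2 fun i => ?_
  fin_cases i <;> simp [Mf] <;> fun_prop
lemma Mi_diff (ε : ℂ) : Differentiable ℂ (Mi ε) := by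
  refine differentiable_pi.2 fun i => ?_
  fin_cases i <;> simp [Mi] <;> fun_prop
lemma Nf_diff (ε : ℂ) : Differentiable ℂ (Nf ε) := by
  refine differentiable_pi.2 fun i => ?_
  fin_cases i <;> simp [Nf] <;> fun_prop
lemma hf_diff (ε : ℂ) (s : ℝ) : DifferentiableOn ℂ (hf ε s) HH := by
  refine differentiableOn_pi.2 fun i => ?_
  fin_cases i
  · simp [hf]
  · exact ((Es_diff s).comp (by fun_prop : Differentiable ℂ fun Q : ℂ => Q+1)).differentiableOn
  · intro Q h
    have hn := HH_ne_zero h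
    exact (((((differentiableAt_inv hn).fun_pow 4).fun_mul
        (DifferentiableAt.comp (g := Es s) Q ((Es_diff s) _) (hasDerivAt_neg_inv hn).differentiableAt))).const_mul _).differentiableWithinAt
def PT (hε : ε^2 = 1) (s : ℝ) : Equiv.Perm (ℂ × (Fin 3 → ℂ)) where
  toFun p := (p.1+1, Mf ε p.2+hf ε s p.1)
  invFun p := (p.1-1, Mi ε (p.2-hf ε s (p.1-1)))
  left_inv p := by ext1 <;> simp [Mi_Mf hε]
  right_inv p := by ext1 <;> simp [Mf_Mi hε]
lemma PT_apply (hε : ε^2 = 1) (s : ℝ) (p) : PT hε s p = (p.1+1, Mf ε p.2+hf ε s p.1) := rfl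
lemma PT_inv_apply (hε : ε^2 = 1) (s : ℝ) (p) : (PT hε s)⁻¹ p = (p.1-1, Mi ε (p.2-hf ε s (p.1-1))) := rfl
lemma PT_fst (hε : ε^2 = 1) (s : ℝ) (n : ℤ) (p) : ((PT hε s^n) p).1 = p.1+n := by
  induction n with
  | zero => simp
  | succ n ih => rw [add_comm, zpow_one_add, Equiv.Perm.mul_apply, PT_apply, ih]; push_cast; ring
  | pred n ih => rw [show (-(n:ℤ)-1) = -1 + -(n:ℤ) by ring, zpow_add, zpow_neg_one, Equiv.Perm.mul_apply, PT_inv_apply, ih]; push_cast; ring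
lemma PT_diff (hε : ε^2 = 1) (s : ℝ) (n : ℤ) {U : Set ℂ} {w : ℂ → ℂ × (Fin 3 → ℂ)} (hw : DifferentiableOn ℂ w U)
    (hH : ∀ Q ∈ U, (w Q).1 ∈ HH) : DifferentiableOn ℂ (fun Q => (PT hε s^n) (w Q)) U := by
  have hi : ∀ n : ℤ, ∀ Q ∈ U, ((PT hε s^n) (w Q)).1 ∈ HH := fun n Q h => by
    have h1 : 0 < (w Q).1.im := hH Q h
    rw [PT_fst, mem_HH]; simpa using h1
  induction n with
  | zero => simpa using hw
  | succ n ih =>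
    simp_rw [add_comm (n:ℤ) 1, zpow_one_add, Equiv.Perm.mul_apply, PT_apply]
    refine DifferentiableOn.prodMk (ih.fst.add_const 1) (DifferentiableOn.add ?_ ?_)
    · exact (Mf_diff ε).comp_differentiableOn ih.snd
    · exact (hf_diff ε s).comp ih.fst (hi n)
  | pred n ih =>
    simp_rw [show (-(n:ℤ)-1) = -1 + -(n:ℤ) by ring, zpow_add, zpow_neg_one, Equiv.Perm.mul_apply, PT_inv_apply]
    refine DifferentiableOn.prodMk (ih.fst.sub_const 1) ?_
    refine (Mi_diff ε).comp_differentiableOn (DifferentiableOn.sub ih.snd ?_)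
    refine (hf_diff ε s).comp (ih.fst.sub_const 1) fun Q h => ?_
    have := hi (-n) Q h
    rw [mem_HH] at this ⊢; simpa using this
structure BaseRel (ε : ℂ) (s : ℝ) (Y : ℂ → Fin 3 → ℂ) : Prop where
  diff : DifferentiableOn ℂ Y U1
  T : ∀ Q ∈ U1, Q+1 ∈ U1 → Y (Q+1) = Mf ε (Y Q)+hf ε s Q
  S : ∀ Q ∈ U1, -1/Q ∈ U1 → 0 < Q.re → Y (-1/Q) = Q^4 • Nf ε (Y Q)
structure Ext (ε : ℂ) (s : ℝ) (Y : ℂ → Fin 3 → ℂ) (c : ℝ) (W : ℂ → Fin 3 → ℂ) : Prop where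
  diff : DifferentiableOn ℂ W {Q | c < Q.im}
  eq : ∀ Q ∈ U1, W Q = Y Q
  T : ∀ Q, c < Q.im → W (Q+1) = Mf ε (W Q)+hf ε s Q
  S : ∀ Q, c < Q.im → c < (-1/Q).im → W (-1/Q) = Q^4 • Nf ε (W Q)
def stripc (c : ℝ) : Set ℂ := {Q | |Q.re| < 3/5 ∧ c < Q.im}
lemma isOpen_stripc (c : ℝ) : IsOpen (stripc c) :=
  (isOpen_lt (continuous_abs.comp continuous_re) continuous_const).inter (isOpen_lt continuous_const continuous_im)
lemma convex_im_gt (c : ℝ) : Convex ℝ {Q : ℂ | c < Q.im} := convex_halfSpace_im_gt c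
lemma convex_stripc (c : ℝ) : Convex ℝ (stripc c) := by
  have : stripc c = ({Q : ℂ | -(3/5) < Q.re} ∩ {Q : ℂ | Q.re < 3/5}) ∩ {Q : ℂ | c < Q.im} := by
    ext Q; simp [stripc, abs_lt]
  rw [this]
  exact ((convex_halfSpace_re_gt _).inter (convex_halfSpace_re_lt _)).inter (convex_im_gt c)
lemma Ext.unique {s : ℝ} {Y : ℂ → Fin 3 → ℂ} {c c' : ℝ} {W W' : ℂ → Fin 3 → ℂ} (h : Ext ε s Y c W) (h' : Ext ε s Y c' W')
    {Q : ℂ} (h1 : c < Q.im) (h2 : c' < Q.im) : W Q = W' Q := by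
  have hm : max c c' < Q.im := max_lt h1 h2
  refine ident (U := {Q | max c c' < Q.im}) (O := U1 ) (z := I*(max (max c c') 0+1 : ℝ)) (isOpen_im_gt _) (convex_im_gt _)
    (h.diff.mono fun Q h => lt_of_le_of_lt (le_max_left c c') h) (h'.diff.mono fun Q h => lt_of_le_of_lt (le_max_right c c') h)
    isOpen_U1 ?_ ?_ (fun w hw => (h.eq w hw).trans (h'.eq w hw).symm) Q hm
  · simp
    have := le_max_left (max c c') 0
    have := le_max_left c c'
    have := le_max_right c c'
    constructor <;> linarith
  · have := le_max_right (max c c') 0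
    constructor <;> simp <;> norm_num <;> linarith
lemma normSq_eq (Q : ℂ) : normSq Q = Q.re^2+Q.im^2 := by rw [normSq_apply]; ring
lemma convex_lens (c : ℝ) (hc : 0 < c) : Convex ℝ {Q : ℂ | c < Q.im ∧ c < (-1/Q).im} := by
  have : {Q : ℂ | c < Q.im ∧ c < (-1/Q).im} = {Q : ℂ | c < Q.im} ∩ Metric.ball (I*(1/(2*c) : ℝ)) (1/(2*c)) := by
    ext Q
    simp only [mem_inter_iff, mem_ofPred_eq, Metric.mem_ball]
    refine and_congr_right fun h => ?_
    have h0 : 0 < Q.im := hc.trans h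
    have hn : 0 < normSq Q := normSq_pos.2 (HH_ne_zero h0)
    rw [im_neg_inv, lt_div_iff₀ hn, dist_eq, ← sq_lt_sq₀ (norm_nonneg _) (by positivity), ← normSq_eq_norm_sq, normSq_eq, normSq_eq]
    simp only [sub_re, mul_re, I_re, ofReal_re, ofReal_im, I_im, sub_im, mul_im]
    have e : c*(1/(2*c)) = 1/2 := by field_simp
    generalize 1/(2*c) = r at *
    constructor
    · intro h
      have : c*(Q.re^2+(Q.im-r)^2) < c*r^2 := by nlinarith
      have := lt_of_mul_lt_mul_left this hc.le
      nlinarith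
    · intro h
      have : c*((Q.re-(0*r-1*0))^2+(Q.im-(0*0+1*r))^2) < c*r^2 := mul_lt_mul_of_pos_left h hc
      nlinarith
  rw [this]
  exact (convex_im_gt c).inter (convex_ball _ _)
lemma neg_inv_cont (h : Q ∈ HH) : DifferentiableAt ℂ (fun Q : ℂ => -1/Q) Q :=
  (hasDerivAt_neg_inv (HH_ne_zero h)).differentiableAt
lemma isOpen_inv_im {c : ℝ} : IsOpen {Q : ℂ | Q ∈ HH ∧ c < (-1/Q).im} := by
  have : ContinuousOn (fun Q : ℂ => (-1/Q).im) HH := fun Q h =>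
    (continuous_im.continuousAt.comp (f := fun Q : ℂ => -1/Q) (neg_inv_cont h).continuousAt).continuousWithinAt
  exact this.isOpen_inter_preimage isOpen_HH isOpen_Ioi
lemma isOpen_lens {c : ℝ} (hc : 0 < c) : IsOpen {Q : ℂ | c < Q.im ∧ c < (-1/Q).im} := by
  have : {Q : ℂ | c < Q.im ∧ c < (-1/Q).im} = {Q | c < Q.im} ∩ {Q : ℂ | Q ∈ HH ∧ c < (-1/Q).im} := by
    ext Q
    simp only [mem_inter_iff, mem_ofPred_eq, mem_HH]
    constructor
    · exact fun h => ⟨h.1, hc.trans h.1, h.2⟩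
    · exact fun h => ⟨h.1, h.2.2⟩
  rw [this]
  exact (isOpen_im_gt c).inter isOpen_inv_im
lemma isOpen_base : IsOpen {Q : ℂ | Q ∈ U1 ∧ -1/Q ∈ U1 ∧ 0 < Q.re} := by
  have h1 : ContinuousOn (fun Q : ℂ => -1/Q) HH := fun Q h => (neg_inv_cont h).continuousAt.continuousWithinAt
  have h2 := h1.isOpen_inter_preimage isOpen_HH isOpen_U1
  have : {Q : ℂ | Q ∈ U1 ∧ -1/Q ∈ U1 ∧ 0 < Q.re} = (HH ∩ (fun Q : ℂ => -1/Q) ⁻¹' U1) ∩ (U1 ∩ {Q | 0 < Q.re}) := by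
    ext Q
    simp only [mem_inter_iff, mem_ofPred_eq, mem_preimage]
    constructor
    · exact fun h => ⟨⟨U0_HH (U1_sub h.1), h.2.1⟩, h.1, h.2.2⟩
    · exact fun h => ⟨h.2.1, h.1.2, h.2.2⟩
  rw [this]
  exact h2.inter (isOpen_U1.inter (isOpen_lt continuous_const continuous_re))
lemma pt_mem : (⟨1/10, 1⟩ : ℂ) ∈ {Q : ℂ | Q ∈ U1 ∧ -1/Q ∈ U1 ∧ 0 < Q.re} := by
  refine ⟨⟨?_, ?_⟩, ⟨?_, ?_⟩, ?_⟩
  · rw [abs_lt]; constructor <;> norm_num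
  · norm_num
  · rw [re_neg_inv, normSq_eq, abs_lt]; constructor <;> norm_num
  · rw [im_neg_inv, normSq_eq]; norm_num
  · norm_num
lemma strip_ext (hε : ε^2 = 1) {s : ℝ} {Y : ℂ → Fin 3 → ℂ} (hY : BaseRel ε s Y) {c : ℝ} (hc : 0 < c) (hc1 : c ≤ 3/4)
    {V : ℂ → Fin 3 → ℂ} (hV : DifferentiableOn ℂ V (stripc c)) (hVY : ∀ Q ∈ U1, V Q = Y Q) : ∃ W, Ext ε s Y c W := by
  have sub : ∀ Q ∈ U1, Q ∈ stripc c := fun Q h => ⟨h.1, hc1.trans_lt h.2⟩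
  have hHH : ∀ Q : ℂ, c < Q.im → Q ∈ HH := fun Q h => hc.trans h
  have hT : ∀ Q, Q ∈ stripc c → Q+1 ∈ stripc c → V (Q+1) = Mf ε (V Q)+hf ε s Q := by
    have := ident (U := stripc c ∩ (fun Q => Q+1) ⁻¹' stripc c) (O := U1 ∩ (fun Q => Q+1) ⁻¹' U1)
      (f := fun Q => V (Q+1)) (g := fun Q => Mf ε (V Q)+hf ε s Q) (z := ⟨-1/2, 1⟩)
      ((isOpen_stripc c).inter ((isOpen_stripc c).preimage (by fun_prop)))
      ((convex_stripc c).inter (by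
        have := (convex_stripc c).translate_preimage_left (1:ℂ)
        exact this))
      (hV.comp (by fun_prop) fun Q h => h.2)
      (((Mf_diff ε).comp_differentiableOn (hV.mono fun Q h => h.1)).add ((hf_diff ε s).mono fun Q h => hHH Q h.1.2))
      (isOpen_U1.inter (isOpen_U1.preimage (by fun_prop)))
      (by refine ⟨⟨?_, ?_⟩, ⟨?_, ?_⟩⟩
          · norm_num [abs_lt]
          · simp; linarith
          · norm_num [abs_lt]
          · simp; linarith)
      (by refine ⟨⟨?_, ?_⟩, ⟨?_, ?_⟩⟩ <;> norm_num [abs_lt])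
      (fun w hw => by
        show V (w+1) = Mf ε (V w)+hf ε s w
        rw [hVY _ hw.2, hVY _ hw.1]; exact hY.T w hw.1 hw.2)
    exact fun Q h1 h2 => this Q ⟨h1, h2⟩
  let p : ℂ → ℤ → ℂ × (Fin 3 → ℂ) := fun Q n => (Q-n, V (Q-n))
  let W : ℂ → Fin 3 → ℂ := fun Q => ((PT hε s^(round Q.re)) (p Q (round Q.re))).2
  have key1 : ∀ Q : ℂ, ∀ n : ℤ, Q-n ∈ stripc c → Q-(n+1 : ℤ) ∈ stripc c →
      (PT hε s^n) (p Q n) = (PT hε s^(n+1)) (p Q (n+1)) := by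
    intro Q n h1 h2
    rw [zpow_add_one, Equiv.Perm.mul_apply, PT_apply]
    congr 1
    have e : Q-(n+1 : ℤ)+1 = Q-n := by push_cast; ring
    have := hT _ h2 (by rw [e]; exact h1)
    rw [e] at this
    simp only [p]
    rw [this, e]
  have memr : ∀ Q : ℂ, c < Q.im → Q-(round Q.re : ℤ) ∈ stripc c := by
    intro Q h
    refine ⟨?_, by simpa using h⟩
    have := abs_sub_round Q.re
    simp; linarith
  have key2 : ∀ Q : ℂ, ∀ n : ℤ, Q-n ∈ stripc c → W Q = ((PT hε s^n) (p Q n)).2 := by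
    intro Q n h
    have hi : c < Q.im := by simpa using h.2
    have h1 := memr Q hi
    have h2 : |Q.re-n| < 3/5 := by simpa using h.1
    have h3 := abs_sub_round Q.re
    simp only [W]
    generalize round Q.re = m at *
    rw [abs_lt] at h2; rw [abs_le] at h3
    have l1 : (m:ℝ) < n+2 := by linarith
    have l2 : (n:ℝ) < m+2 := by linarith
    have l1' : m < n+2 := by exact_mod_cast l1
    have l2' : n < m+2 := by exact_mod_cast l2
    have : m = n ∨ m = n+1 ∨ n = m+1 := by omega
    rcases this with rfl | rfl | rfl
    · rfl
    · rw [key1 Q n h h1]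
    · rw [key1 Q m h1 h]
  have hWd : DifferentiableOn ℂ W {Q | c < Q.im} := by
    intro Q0 h0
    set n := round Q0.re with hn
    have ho : IsOpen ((fun Q : ℂ => Q-n) ⁻¹' stripc c) := (isOpen_stripc c).preimage (by fun_prop)
    have hm : Q0 ∈ (fun Q : ℂ => Q-n) ⁻¹' stripc c := memr Q0 h0
    have hd : DifferentiableOn ℂ (fun Q => (PT hε s^n) (p Q n)) ((fun Q : ℂ => Q-n) ⁻¹' stripc c) := by
      refine PT_diff hε s n (DifferentiableOn.prodMk (by fun_prop) (hV.comp (by fun_prop) fun Q h => h)) ?_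
      intro Q h
      exact hHH _ h.2
    have := (hd.snd.differentiableAt (ho.mem_nhds hm))
    refine (this.congr_of_eventuallyEq ?_).differentiableWithinAt
    filter_upwards [ho.mem_nhds hm] with Q h
    exact key2 Q n h
  have hWY : ∀ Q ∈ U1, W Q = Y Q := by
    intro Q h
    rw [key2 Q 0 (by simpa using sub Q h)]
    simp only [p, zpow_zero, Equiv.Perm.coe_one, id, Int.cast_zero, sub_zero]
    exact hVY Q h
  have hWT : ∀ Q, c < Q.im → W (Q+1) = Mf ε (W Q)+hf ε s Q := by
    intro Q h
    have e : round (Q+1).re = round Q.re+1 := by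
      rw [add_re, one_re]; exact_mod_cast round_add_one Q.re
    have e2 : p (Q+1) (round Q.re+1) = p Q (round Q.re) := by
      simp only [p]; push_cast; rw [show Q+1-(round Q.re+1 : ℂ) = Q-round Q.re by ring]
    simp only [W]
    rw [e, e2, add_comm, zpow_one_add, Equiv.Perm.mul_apply, PT_apply]
    rw [PT_fst]
    simp [p]
  refine ⟨W, hWd, hWY, hWT, ?_⟩
  have := ident (U := {Q : ℂ | c < Q.im ∧ c < (-1/Q).im}) (f := fun Q => W (-1/Q)) (g := fun Q => Q^4 • Nf ε (W Q))
    (isOpen_lens hc) (convex_lens c hc)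
    (fun Q h => ((hWd.differentiableAt ((isOpen_im_gt c).mem_nhds h.2)).comp Q (neg_inv_cont (hHH Q h.1))).differentiableWithinAt)
    (fun Q h => (DifferentiableAt.fun_smul (by fun_prop : DifferentiableAt ℂ (fun Q : ℂ => Q^4) Q)
      (((Nf_diff ε) _).comp Q (hWd.differentiableAt ((isOpen_im_gt c).mem_nhds h.1)))).differentiableWithinAt)
    isOpen_base (z := ⟨1/10, 1⟩) ⟨(sub _ pt_mem.1).2, (sub _ pt_mem.2.1).2⟩ pt_mem
    (fun w hw => by
      show W (-1/w) = w^4 • Nf ε (W w)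
      rw [hWY _ hw.1, hWY _ hw.2.1]; exact hY.S w hw.1 hw.2.1 hw.2.2)
  exact fun Q h1 h2 => this Q ⟨h1, h2⟩
lemma Nf_Nf (hε : ε^2 = 1) (v) : Nf ε (Nf ε v) = v := by
  funext i; fin_cases i <;> simp [Nf]
  linear_combination v 0*hε
lemma Nf_smul (ε a : ℂ) (v) : Nf ε (a • v) = a • Nf ε v := by
  funext i; fin_cases i <;> simp [Nf]
  ring
lemma ext_step (hε : ε^2 = 1) {s : ℝ} {Y : ℂ → Fin 3 → ℂ} (hY : BaseRel ε s Y) {c : ℝ} (hc : 0 < c) (hc1 : c ≤ 3/4)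
    {W : ℂ → Fin 3 → ℂ} (h : Ext ε s Y c W) : ∃ W', Ext ε s Y (93/100*c) W' := by
  classical
  let B : ℂ → Fin 3 → ℂ := fun Q => Q⁻¹^4 • Nf ε (W (-1/Q))
  let V : ℂ → Fin 3 → ℂ := fun Q => if c < Q.im then W Q else B Q
  have hB : ∀ Q ∈ HH, c < (-1/Q).im → DifferentiableAt ℂ B Q := by
    intro Q h1 h2
    have hn := HH_ne_zero h1
    refine DifferentiableAt.fun_smul ((differentiableAt_inv hn).fun_pow 4) ?_
    refine ((Nf_diff ε) _).comp Q ?_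
    exact (h.diff.differentiableAt ((isOpen_im_gt c).mem_nhds h2)).comp Q (neg_inv_cont h1)
  have e1 : ∀ Q : ℂ, c < Q.im → V Q = W Q := fun Q h => if_pos h
  have e2 : ∀ Q : ℂ, Q ∈ HH → c < (-1/Q).im → V Q = B Q := by
    intro Q h1 h2
    by_cases h3 : c < Q.im
    · rw [e1 Q h3]
      simp only [B]
      rw [h.S Q h3 h2, Nf_smul, Nf_Nf hε, smul_smul]
      have hn := HH_ne_zero h1
      have : Q⁻¹^4*Q^4 = 1 := by field_simp
      rw [this, one_smul]
    · exact if_neg h3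
  refine strip_ext hε hY (by positivity) (by linarith) (V := V) ?_ ?_
  · intro Q hQ
    refine DifferentiableAt.differentiableWithinAt ?_
    have hH : Q ∈ HH := lt_trans (by positivity : (0:ℝ) < 93/100*c) hQ.2
    by_cases h3 : c < Q.im
    · refine (h.diff.differentiableAt ((isOpen_im_gt c).mem_nhds h3)).congr_of_eventuallyEq ?_
      filter_upwards [(isOpen_im_gt c).mem_nhds h3] with Q h using e1 Q h
    · have h4 : c < (-1/Q).im := by
        rw [im_neg_inv, lt_div_iff₀ (normSq_pos.2 (HH_ne_zero hH)), normSq_eq]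
        have a1 := hQ.2
        have a2 := hQ.1
        have a3 : Q.re^2 ≤ (3/5)^2 := by rw [sq_le_sq, abs_of_pos (by norm_num : (0:ℝ) < 3/5)]; exact a2.le
        have a4 : 0 < Q.im := hH
        have a5 : Q.im^2 ≤ (3/4)^2 := by
          apply pow_le_pow_left₀ a4.le; linarith
        nlinarith
      refine (hB Q hH h4).congr_of_eventuallyEq ?_
      filter_upwards [isOpen_inv_im.mem_nhds (show Q ∈ {Q : ℂ | Q ∈ HH ∧ c < (-1/Q).im} from ⟨hH, h4⟩)] with Q h using e2 Q h.1 h.2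
  · intro Q hQ
    rw [e1 Q (hc1.trans_lt hQ.2), h.eq Q hQ]
lemma ext_all (hε : ε^2 = 1) {s : ℝ} {Y : ℂ → Fin 3 → ℂ} (hY : BaseRel ε s Y) (k : ℕ) :
    ∃ W, Ext ε s Y ((93/100)^k*(3/4)) W := by
  induction k with
  | zero =>
    refine strip_ext hε hY (by norm_num) (by norm_num) (V := Y) ?_ fun _ _ => rfl
    norm_num
    exact hY.diff
  | succ k ih =>
    obtain ⟨W, h⟩ := ih
    have := ext_step hε hY (by positivity) (by
      have : (93/100 : ℝ)^k ≤ 1 := pow_le_one₀ (by norm_num) (by norm_num)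
      linarith) h
    rw [pow_succ']; rwa [← mul_assoc] at this
structure Glob (ε : ℂ) (s : ℝ) (W : ℂ → Fin 3 → ℂ) : Prop where
  diff : DifferentiableOn ℂ W HH
  T : ∀ Q ∈ HH, W (Q+1) = Mf ε (W Q)+hf ε s Q
  S : ∀ Q ∈ HH, W (-1/Q) = Q^4 • Nf ε (W Q)
lemma glob_exists (hε : ε^2 = 1) {s : ℝ} {Y : ℂ → Fin 3 → ℂ} (hY : BaseRel ε s Y) :
    ∃ W, Glob ε s W ∧ ∀ Q ∈ U1, W Q = Y Q := by
  choose V hV using ext_all hε hY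
  have hk : ∀ c : ℝ, 0 < c → ∃ k : ℕ, ((93/100)^k*(3/4) : ℝ) < c := by
    intro c hc
    obtain ⟨k, hk⟩ := exists_pow_lt_of_lt_one hc (by norm_num : (93/100 : ℝ) < 1)
    refine ⟨k, ?_⟩
    have : (0:ℝ) < (93/100)^k := by positivity
    linarith
  choose! κ hκ using hk
  let W : ℂ → Fin 3 → ℂ := fun Q => V (κ Q.im) Q
  have key : ∀ k : ℕ, ∀ Q : ℂ, Q ∈ HH → ((93/100)^k*(3/4) : ℝ) < Q.im → W Q = V k Q := fun k Q h1 h2 =>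
    (hV _).unique (hV k) (hκ _ h1) h2
  refine ⟨W, ⟨?_, ?_, ?_⟩, ?_⟩
  · intro Q h
    refine DifferentiableAt.differentiableWithinAt ?_
    have h1 := hκ _ h
    refine ((hV (κ Q.im)).diff.differentiableAt ((isOpen_im_gt _).mem_nhds h1)).congr_of_eventuallyEq ?_
    filter_upwards [(isOpen_im_gt _).mem_nhds h1, HH_mem_nhds h] with z hz hz2 using key _ z hz2 hz
  · intro Q h
    have h1 := hκ _ h
    rw [key _ Q h h1, key (κ Q.im) (Q+1) (HH_add_one h) (by simpa using h1)]
    exact (hV _).T Q h1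
  · intro Q h
    have h1 := hκ (min Q.im (-1/Q).im) (lt_min h (HH_neg_inv h))
    have h2 := h1.trans_le (min_le_left _ _)
    have h3 := h1.trans_le (min_le_right _ _)
    rw [key _ Q h h2, key _ _ (HH_neg_inv h) h3]
    exact (hV _).S Q h2 h3
  · intro Q h
    exact (hV _).eq Q h
lemma HH_add_int (h : Q ∈ HH) (n : ℤ) : Q+n ∈ HH := by
  have : 0 < Q.im := h
  rw [mem_HH]; simpa using this
lemma norm_ee_le {s : ℝ} (hs : 0 ≤ s) {z : ℂ} (hz : z ∈ HH) : ‖ee s z‖ ≤ 1 := by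
  rw [norm_ee, Real.exp_le_one_iff]
  have : 0 < z.im := hz
  have : 0 ≤ π*s*z.im := by positivity
  linarith
lemma Glob.second {s : ℝ} {W} (h : Glob ε s W) {Q : ℂ} (hQ : Q ∈ HH) :
    W (Q+1+1) 0 = 2*W (Q+1) 0-W Q 0+Es s (Q+1) := by
  have h1 := h.T Q hQ
  have h2 := h.T _ (HH_add_one hQ)
  have a1 := congrFun h1 0
  have a2 := congrFun h1 1
  have a3 := congrFun h2 0
  simp only [Mf, hf, Pi.add_apply, Matrix.cons_val] at a1 a2 a3
  rw [a3, a2, a1]; ring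
def FF (s : ℝ) (W : ℂ → Fin 3 → ℂ) (Q : ℂ) : ℂ := W Q 0+ee s Q
lemma FF_second {s : ℝ} {W} (h : Glob ε s W) {Q : ℂ} (hQ : Q ∈ HH) :
    FF s W (Q+1+1) = 2*FF s W (Q+1)-FF s W Q := by
  have := Es_eq s (Q+1)
  rw [add_sub_cancel_right] at this
  rw [FF, FF, FF, h.second hQ, this]; ring
lemma FF_lin {s : ℝ} {W} (h : Glob ε s W) {Q : ℂ} (hQ : Q ∈ HH) (n : ℤ) :
    FF s W (Q+n) = FF s W Q+n*(FF s W (Q+1)-FF s W Q) ∧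
    FF s W (Q+n+1) = FF s W Q+(n+1)*(FF s W (Q+1)-FF s W Q) := by
  induction n with
  | zero => simp
  | succ n ih =>
    have := FF_second h (HH_add_int hQ n)
    push_cast
    rw [← add_assoc]
    refine ⟨by simpa using ih.2, ?_⟩
    rw [Int.cast_natCast] at *
    rw [this, ih.1, ih.2]; ring
  | pred n ih =>
    have := FF_second h (HH_add_int hQ (-n-1))
    push_cast at *
    have e : Q+(-n-1)+1 = Q + -n := by ring
    rw [e] at this ⊢
    refine ⟨?_, by rw [ih.1]; ring⟩
    rw [ih.1, ih.2] at this
    linear_combination this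
lemma seq_bound {z : ℤ → ℝ} {a b c : ℝ} (h0 : |z 0| ≤ a) (hb : 0 ≤ b) (hc : 0 ≤ c)
    (h : ∀ k : ℤ, |z (k+1)-z k| ≤ b*(1+|(k:ℝ)|)+c) (n : ℤ) :
    |z n| ≤ a+|(n:ℝ)| * (b*(1+|(n:ℝ)|)+c) := by
  induction n with
  | zero => simpa using h0
  | succ n ih =>
    have h1 := h n
    rw [Int.cast_natCast, abs_of_nonneg (by positivity : (0:ℝ) ≤ n)] at *
    push_cast
    rw [abs_of_nonneg (by positivity : (0:ℝ) ≤ n+1)]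
    have h2 := abs_sub_abs_le_abs_sub (z (n+1)) (z n)
    have : 0 ≤ b*n := by positivity
    nlinarith
  | pred n ih =>
    have h1 := h (-n-1)
    rw [sub_add_cancel] at h1
    push_cast at *
    rw [abs_neg, abs_of_nonneg (by positivity : (0:ℝ) ≤ n)] at *
    rw [show (-(n:ℝ)-1) = -(n+1) by ring, abs_neg, abs_of_nonneg (by positivity : (0:ℝ) ≤ n+1)] at *
    have h2 := abs_sub_abs_le_abs_sub (z (-n-1)) (z (-n))
    rw [abs_sub_comm] at h2
    have : 0 ≤ b*n := by positivity
    nlinarith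
lemma norm_eps (hε : ε^2 = 1) : ‖ε‖ = 1 := by
  have : ‖ε‖^2 = 1 := by rw [← norm_pow, hε, norm_one]
  nlinarith [norm_nonneg ε]
lemma inv4_le (h : Q ∈ HH) : ‖Q⁻¹^4‖ ≤ Q.im⁻¹^4 := by
  rw [norm_pow, norm_inv]
  have h0 : 0 < Q.im := h
  have : Q.im ≤ ‖Q‖ := (le_abs_self _).trans (abs_im_le_norm Q)
  exact pow_le_pow_left₀ (by positivity) (inv_anti₀ h0 this) 4
lemma T_growth (hε : ε^2 = 1) {s : ℝ} (hs : 0 < s) {W} (h : Glob ε s W) {Q : ℂ} (hQ : Q ∈ HH) (n : ℤ) :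
    ‖W (Q+n)‖ ≤ 9*(2+|(n:ℝ)|)^2*(‖W Q‖+1+Q.im⁻¹^4) := by
  have him : 0 < Q.im := hQ
  set R := ‖W Q‖
  set Z := Q.im⁻¹^4
  have hZ : 0 < Z := by positivity
  have hR : 0 ≤ R := norm_nonneg _
  have c0 : ‖W Q 0‖ ≤ R := norm_le_pi_norm _ _
  have c1 : ‖W (Q+1) 0‖ ≤ R := by
    have a1 := congrFun (h.T Q hQ) 0
    simp only [Mf, hf, Pi.add_apply, Matrix.cons_val] at a1
    rw [a1, add_zero]; exact norm_le_pi_norm _ _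
  have c2 : ‖W Q 2‖ ≤ R := norm_le_pi_norm _ _
  have psi : ∀ k : ℤ, ‖W (Q+k) 0‖ ≤ 2*(1+|(k:ℝ)|)*(R+1) := by
    intro k
    have e := (FF_lin h hQ k).1
    have l0 : ‖FF s W Q‖ ≤ R+1 := (norm_add_le _ _).trans (add_le_add c0 (norm_ee_le hs.le hQ))
    have l1 : ‖FF s W (Q+1)‖ ≤ R+1 := (norm_add_le _ _).trans (add_le_add c1 (norm_ee_le hs.le (HH_add_one hQ)))
    have l2 := norm_ee_le hs.le (HH_add_int hQ k)
    have e2 : W (Q+k) 0 = FF s W Q+k*(FF s W (Q+1)-FF s W Q)-ee s (Q+k) := by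
      rw [← e, FF]; ring
    rw [e2]
    have l3 : ‖(k:ℂ)*(FF s W (Q+1)-FF s W Q)‖ ≤ |(k:ℝ)| * (2*(R+1)) := by
      rw [norm_mul, Complex.norm_intCast]
      exact mul_le_mul_of_nonneg_left ((norm_sub_le _ _).trans (by linarith)) (abs_nonneg _)
    have l4 := norm_sub_le (FF s W Q+k*(FF s W (Q+1)-FF s W Q)) (ee s (Q+k))
    have l5 := norm_add_le (FF s W Q) (k*(FF s W (Q+1)-FF s W Q))
    linarith
  have third : ∀ k : ℤ, |‖W (Q+(k+1 : ℤ)) 2‖-‖W (Q+k) 2‖| ≤ 4*(R+1)*(1+|(k:ℝ)|)+4*Z := by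
    intro k
    have hk := HH_add_int hQ k
    have a := congrFun (h.T _ hk) 2
    simp only [Mf, hf, Pi.add_apply, Matrix.cons_val] at a
    have e1 : Q+(k+1 : ℤ) = Q+k+1 := by push_cast; ring
    have e2 : ‖W (Q+k) 2‖ = ‖ε*W (Q+k) 2‖ := by rw [norm_mul, norm_eps hε, one_mul]
    rw [e1, e2]
    refine (abs_norm_sub_norm_le _ _).trans ?_
    have e3 : W (Q+k+1) 2-ε*W (Q+k) 2 = 2*W (Q+k) 0-ε*((Q+k)⁻¹^4*Es s (-1/(Q+k))) := by
      rw [a]; ring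
    rw [e3]
    refine (norm_sub_le _ _).trans ?_
    rw [norm_mul, norm_mul ε, norm_eps hε, one_mul, norm_mul, Complex.norm_ofNat]
    have b1 := psi k
    have b2 := inv4_le hk
    have b3 : (Q+k).im = Q.im := by simp
    rw [b3] at b2
    have b4 := norm_Es_le hs.le (HH_neg_inv hk)
    have b5 := mul_le_mul b2 b4 (norm_nonneg _) hZ.le
    linarith
  have c3 := seq_bound (z := fun k => ‖W (Q+k) 2‖) (a := R) (by simpa using c2) (by positivity) (by positivity) third n
  rw [abs_norm] at c3
  have c4 := psi n
  have c5 := psi (n+1)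
  have c6 : W (Q+n) 1 = W (Q+(n+1 : ℤ)) 0 := by
    have a := congrFun (h.T _ (HH_add_int hQ n)) 0
    simp only [Mf, hf, Pi.add_apply, Matrix.cons_val, add_zero] at a
    rw [← a]; push_cast; ring_nf
  have c7 : |((n+1 : ℤ):ℝ)| ≤ |(n:ℝ)|+1 := by
    push_cast
    exact (abs_add_le _ _).trans (by simp)
  set m := |(n:ℝ)|
  have hm : 0 ≤ m := abs_nonneg _
  have q1 : 0 ≤ m*R := by positivity
  have q2 : 0 ≤ m*Z := by positivity
  have q3 : 0 ≤ m^2*Z := by positivity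
  have q4 : 0 ≤ m^2*R := by positivity
  refine (pi_norm_le_iff_of_nonneg (by positivity)).2 fun i => ?_
  fin_cases i
  · exact c4.trans (by nlinarith)
  · show ‖W (Q+n) 1‖ ≤ _
    rw [c6]
    refine c5.trans ?_
    have : 2*(1+|((n+1 : ℤ):ℝ)|)*(R+1) ≤ 2*(2+m)*(R+1) :=
      mul_le_mul_of_nonneg_right (by linarith) (by positivity)
    refine this.trans ?_
    nlinarith
  · refine c3.trans ?_
    nlinarith
lemma norm_Nf (hε : ε^2 = 1) (v : Fin 3 → ℂ) : ‖Nf ε v‖ ≤ ‖v‖ := by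
  refine (pi_norm_le_iff_of_nonneg (norm_nonneg _)).2 fun i => ?_
  fin_cases i
  · show ‖-ε*v 0‖ ≤ _
    rw [norm_mul, norm_neg, norm_eps hε, one_mul]; exact norm_le_pi_norm _ _
  · exact norm_le_pi_norm v 2
  · exact norm_le_pi_norm v 1
lemma S_step (hε : ε^2 = 1) {s : ℝ} (hs : 0 < s) {W} (h : Glob ε s W) {Q : ℂ} (hQ : Q ∈ HH) (h1 : ‖Q‖ ≤ 1) :
    ∃ σ : ℂ, |σ.re| ≤ 1/2 ∧ σ.im = Q.im/‖Q‖^2 ∧ ‖W Q‖ ≤ 144*‖Q‖⁻¹^6*(‖W σ‖+1+σ.im⁻¹^4) := by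
  have h0 := HH_ne_zero hQ
  set σ := -1/Q with hσ
  have hσH : σ ∈ HH := HH_neg_inv hQ
  set n := round σ.re
  have hr0 : 0 < ‖Q‖ := norm_pos_iff.2 h0
  have e1 : σ-n+n = σ := by ring
  have hσ0 : σ-n ∈ HH := by
    have := HH_add_int hσH (-n)
    rwa [Int.cast_neg, ← sub_eq_add_neg] at this
  refine ⟨σ-n, by simpa using abs_sub_round σ.re, ?_, ?_⟩
  · rw [sub_im, intCast_im, sub_zero, hσ, im_neg_inv, normSq_eq_norm_sq]
  · have a := T_growth hε hs h hσ0 n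
    rw [e1] at a
    have b : W Q = σ^4 • Nf ε (W σ) := by
      rw [← h.S σ hσH, hσ]; congr 1; field_simp
    have c : ‖σ‖ = ‖Q‖⁻¹ := by rw [hσ, norm_div, norm_neg, norm_one, one_div]
    have hn : |(n:ℝ)| ≤ ‖Q‖⁻¹+1/2 := by
      have p1 := abs_sub_round σ.re
      have p2 := abs_re_le_norm σ
      rw [c] at p2
      have p3 : |(n:ℝ)| ≤ |σ.re|+|σ.re-n| := by
        have := abs_sub_abs_le_abs_sub (n:ℝ) σ.re
        rw [abs_sub_comm] at this; linarith
      linarith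
    have hinv : 1 ≤ ‖Q‖⁻¹ := (one_le_inv₀ hr0).2 h1
    have d : (2+|(n:ℝ)|)^2 ≤ (4*‖Q‖⁻¹)^2 := pow_le_pow_left₀ (by positivity) (by linarith) 2
    have him : 0 < (σ-n).im := hσ0
    rw [b, norm_smul, norm_pow, c]
    calc _ ≤ ‖Q‖⁻¹^4*‖W σ‖ := mul_le_mul_of_nonneg_left (norm_Nf hε _) (by positivity)
      _ ≤ ‖Q‖⁻¹^4*(9*(4*‖Q‖⁻¹)^2*(‖W (σ-n)‖+1+(σ-n).im⁻¹^4)) := by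
          refine mul_le_mul_of_nonneg_left (a.trans ?_) (by positivity)
          refine mul_le_mul_of_nonneg_right ?_ (by positivity)
          linarith
      _ = _ := by ring
lemma growth (hε : ε^2 = 1) {B : ℝ} (hB : 0 ≤ B) (N : ℕ) : ∃ D : ℝ, 1 ≤ D ∧ ∃ A : ℕ, 4 ≤ A ∧ ∀ s : ℝ, 0 < s → ∀ W,
    Glob ε s W → (∀ Q ∈ U1, ‖W Q‖ ≤ B*(2+Q.im)^N) → ∀ Q ∈ HH, |Q.re| ≤ 1/2 → Q.im < 4/5 →
    ‖W Q‖ ≤ D*Q.im⁻¹^A := by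
  have hD4 : 1 ≤ 144*(B*3^N+4) := by
    have : 0 ≤ B*3^N := by positivity
    linarith
  refine ⟨144*(B*3^N+4), hD4, N+50, by omega, ?_⟩
  intro s hs W h hb
  set D := 144*(B*3^N+4) with hD
  suffices H : ∀ k : ℕ, ∀ Q ∈ HH, |Q.re| ≤ 1/2 → Q.im < 4/5 → 4/5*(9/10)^k ≤ Q.im → ‖W Q‖ ≤ D*Q.im⁻¹^(N+50) by
    intro Q hQ h1 h2
    obtain ⟨k, hk⟩ := exists_pow_lt_of_lt_one (show 0 < Q.im from hQ) (by norm_num : (9/10 : ℝ) < 1)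
    refine H k Q hQ h1 h2 ?_
    have : (0:ℝ) < (9/10)^k := by positivity
    linarith
  intro k
  induction k with
  | zero => intro Q _ _ h1 h2; simp at h2; linarith
  | succ k ih =>
    intro Q hQ hr h1 h2
    have him : 0 < Q.im := hQ
    by_cases h3 : 39/50 ≤ Q.im
    · have h4 := hb Q ⟨by linarith, by linarith⟩
      have h5 : 1 ≤ Q.im⁻¹^(N+50) := one_le_pow₀ ((one_le_inv₀ him).2 (by linarith))
      have h6 : (2+Q.im)^N ≤ 3^N := pow_le_pow_left₀ (by linarith) (by linarith) N
      have h7 : B*(2+Q.im)^N ≤ B*3^N := mul_le_mul_of_nonneg_left h6 hB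
      have h8 : 0 ≤ B*3^N := by positivity
      nlinarith
    · push Not at h3
      have hr2 : ‖Q‖^2 ≤ 43/50 := by
        rw [← normSq_eq_norm_sq, normSq_eq]
        have : Q.re^2 ≤ (1/2)^2 := by rw [sq_le_sq, abs_of_pos (by norm_num : (0:ℝ) < 1/2)]; exact hr
        nlinarith
      have hr1 : ‖Q‖ ≤ 1 := by nlinarith [norm_nonneg Q]
      have hr0 : 0 < ‖Q‖ := norm_pos_iff.2 (HH_ne_zero hQ)
      obtain ⟨σ, s1, s2, s3⟩ := S_step hε hs h hQ hr1
      have hle : Q.im ≤ ‖Q‖ := (le_abs_self _).trans (abs_im_le_norm Q)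
      have hinv : ‖Q‖⁻¹ ≤ Q.im⁻¹ := inv_anti₀ him hle
      have hinv1 : 1 ≤ ‖Q‖⁻¹ := (one_le_inv₀ hr0).2 hr1
      have hσ0 : 0 < σ.im := by rw [s2]; positivity
      by_cases h4 : 4/5 ≤ σ.im
      · have b1 := hb σ ⟨by linarith, by linarith⟩
        have b2 : σ.im ≤ ‖Q‖⁻¹ := by
          rw [s2, div_le_iff₀ (by positivity)]
          have : ‖Q‖⁻¹*‖Q‖^2 = ‖Q‖ := by field_simp
          rw [this]; exact hle
        have b3 : (2+σ.im)^N ≤ (3*‖Q‖⁻¹)^N := pow_le_pow_left₀ (by linarith) (by linarith) N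
        have b4 : σ.im⁻¹^4 ≤ (5/4)^4 := by
          refine pow_le_pow_left₀ (by positivity) ?_ 4
          rw [inv_le_comm₀ hσ0 (by norm_num)]; norm_num; linarith
        have b5 : 1 ≤ ‖Q‖⁻¹^N := one_le_pow₀ hinv1
        calc ‖W Q‖ ≤ 144*‖Q‖⁻¹^6*(‖W σ‖+1+σ.im⁻¹^4) := s3
          _ ≤ 144*‖Q‖⁻¹^6*((B*3^N+4)*‖Q‖⁻¹^N) := by
              refine mul_le_mul_of_nonneg_left ?_ (by positivity)
              have : B*(2+σ.im)^N ≤ B*(3*‖Q‖⁻¹)^N := mul_le_mul_of_nonneg_left b3 hB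
              rw [mul_pow] at this
              have b4q : σ.im⁻¹^4 ≤ 3 := b4.trans (by norm_num)
              linarith
          _ = D*‖Q‖⁻¹^(N+6) := by rw [hD]; ring
          _ ≤ D*Q.im⁻¹^(N+6) := by
              refine mul_le_mul_of_nonneg_left (pow_le_pow_left₀ (by positivity) hinv _) (by linarith)
          _ ≤ _ := by
              refine mul_le_mul_of_nonneg_left (pow_le_pow_right₀ (hinv1.trans hinv) (by omega)) (by linarith)
      · push Not at h4
        have i1 := ih σ hσ0 s1 h4 (by
          rw [s2, le_div_iff₀ (by positivity)]
          rw [pow_succ] at h2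
          have : 0 < (9/10 : ℝ)^k := by positivity
          nlinarith)
        have hv : 1 ≤ σ.im⁻¹ := (one_le_inv₀ hσ0).2 (by linarith)
        have i2 : 1 ≤ σ.im⁻¹^(N+50) := one_le_pow₀ hv
        have i3 : σ.im⁻¹^4 ≤ σ.im⁻¹^(N+50) := pow_le_pow_right₀ hv (by omega)
        have i4 : σ.im⁻¹^(N+50) = Q.im⁻¹^(N+50)*(‖Q‖^2)^(N+50) := by
          rw [s2, ← mul_pow]; congr 1; field_simp
        have i5 : ‖Q‖⁻¹^6*(‖Q‖^2)^(N+50) ≤ 1/432 := by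
          have e : ‖Q‖⁻¹^6*(‖Q‖^2)^(N+50) = (‖Q‖^2)^N*(‖Q‖^2)^47 := by
            field_simp
            ring
          rw [e]
          have e1 : (‖Q‖^2)^N ≤ 1 := pow_le_one₀ (by positivity) (by linarith)
          have e2 : (‖Q‖^2)^47 ≤ (43/50)^47 := pow_le_pow_left₀ (by positivity) hr2 47
          calc _ ≤ 1*(43/50 : ℝ)^47 := mul_le_mul e1 e2 (by positivity) (by norm_num)
            _ ≤ _ := by norm_num
        calc ‖W Q‖ ≤ 144*‖Q‖⁻¹^6*(‖W σ‖+1+σ.im⁻¹^4) := s3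
          _ ≤ 144*‖Q‖⁻¹^6*(3*D*σ.im⁻¹^(N+50)) := by
              refine mul_le_mul_of_nonneg_left ?_ (by positivity)
              nlinarith
          _ = 432*D*Q.im⁻¹^(N+50)*(‖Q‖⁻¹^6*(‖Q‖^2)^(N+50)) := by rw [i4]; ring
          _ ≤ 432*D*Q.im⁻¹^(N+50)*(1/432) := by
              refine mul_le_mul_of_nonneg_left i5 (by positivity)
          _ = _ := by ring
lemma growth2 (hε : ε^2 = 1) {B : ℝ} (hB : 0 ≤ B) (N : ℕ) : ∃ C : ℝ, 0 ≤ C ∧ ∃ A : ℕ, ∀ s : ℝ, 0 < s → ∀ W,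
    Glob ε s W → (∀ Q ∈ U1, ‖W Q‖ ≤ B*(2+Q.im)^N) → ∀ Q ∈ HH, |Q.re| ≤ 3 →
    ‖W Q‖ ≤ C*(1+Q.im⁻¹)^A*(2+Q.im)^N := by
  obtain ⟨D, hD, A, hA, H⟩ := growth hε hB N
  refine ⟨9*36*(D+B+2), by positivity, A, ?_⟩
  intro s hs W h hb Q hQ hr
  have him : 0 < Q.im := hQ
  set n := round Q.re
  have e1 : Q-n+n = Q := by ring
  have e2 : (Q-n).im = Q.im := by simp
  have hσ0 : Q-n ∈ HH := by
    have := HH_add_int hQ (-n)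
    rwa [Int.cast_neg, ← sub_eq_add_neg] at this
  have r0 : |(Q-n).re| ≤ 1/2 := by simpa using abs_sub_round Q.re
  have hn : |(n:ℝ)| ≤ 4 := by
    have p1 := abs_sub_round Q.re
    have := abs_sub_abs_le_abs_sub (n:ℝ) Q.re
    rw [abs_sub_comm] at this; linarith
  have a := T_growth hε hs h hσ0 n
  rw [e1, e2] at a
  have p1 : 1 ≤ (1+Q.im⁻¹)^A := one_le_pow₀ (le_add_of_nonneg_right (by positivity))
  have p2 : 1 ≤ (2+Q.im)^N := one_le_pow₀ (by linarith)
  set X := (1+Q.im⁻¹)^A*(2+Q.im)^N with hX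
  have p3 : 1 ≤ X := one_le_mul_of_one_le_of_one_le p1 p2
  have p4 : Q.im⁻¹^4 ≤ X := by
    calc Q.im⁻¹^4 ≤ (1+Q.im⁻¹)^4 := pow_le_pow_left₀ (by positivity) (by linarith) 4
      _ ≤ (1+Q.im⁻¹)^A := pow_le_pow_right₀ (le_add_of_nonneg_right (by positivity)) hA
      _ ≤ X := le_mul_of_one_le_right (by positivity) p2
  have p5 : ‖W (Q-n)‖ ≤ (D+B)*X := by
    by_cases h4 : Q.im < 4/5
    · have := H s hs W h hb _ hσ0 r0 (by rw [e2]; exact h4)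
      rw [e2] at this
      have q : Q.im⁻¹^A ≤ X := by
        calc Q.im⁻¹^A ≤ (1+Q.im⁻¹)^A := pow_le_pow_left₀ (by positivity) (by linarith) A
          _ ≤ X := le_mul_of_one_le_right (by positivity) p2
      nlinarith
    · push Not at h4
      have := hb (Q-n) ⟨by linarith, by rw [e2]; linarith⟩
      rw [e2] at this
      have q : (2+Q.im)^N ≤ X := le_mul_of_one_le_left (by positivity) p1
      nlinarith
  have p6 : (2+|(n:ℝ)|)^2 ≤ 36 := by nlinarith [abs_nonneg (n:ℝ)]
  calc _ ≤ _ := a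
    _ ≤ 9*36*((D+B+2)*X) := by
        refine mul_le_mul (by linarith) (by linarith) (by positivity) (by norm_num)
    _ = _ := by rw [hX]; ring
lemma qexp {φ : ℂ → ℂ} (hφ : DifferentiableOn ℂ φ HH) (hper : ∀ Q ∈ HH, φ (Q+1) = φ Q) {C : ℝ} (hC : 0 ≤ C) {A N : ℕ}
    (hb : ∀ Q ∈ HH, ‖φ Q‖ ≤ C*(1+Q.im⁻¹)^A*(2+Q.im)^N) {a : ℝ}
    (h0 : Tendsto (fun y : ℝ => φ (a+I*y)) atTop (𝓝 0)) :
    ∃ c : ℕ → ℂ, c 0 = 0 ∧ (∀ n : ℕ, ‖c n‖ ≤ C*2^A*3^N*rexp (2*π)*(n+1)^A) ∧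
      ∀ Q ∈ HH, HasSum (fun n : ℕ => c n*cexp (2*π*I*n*Q)) (φ Q) := by
  classical
  have h1 : (0:ℝ) < 1 := one_pos
  set f : ℂ → ℂ := fun Q => if 0 < Q.im then φ Q*Function.Periodic.qParam 1 Q else 0 with hf
  have hq1 : ∀ Q, Function.Periodic.qParam 1 (Q+1) = Function.Periodic.qParam 1 Q := by
    intro Q
    simp only [Function.Periodic.qParam, ofReal_one, div_one]
    rw [mul_add, Complex.exp_add, mul_one, Complex.exp_two_pi_mul_I, mul_one]
  have hfper : Function.Periodic f ((1:ℝ) : ℂ) := by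
    intro Q
    rw [ofReal_one]
    by_cases h0 : 0 < Q.im
    · have h1 : 0 < (Q+1).im := by simpa using h0
      simp only [hf, h0, h1, if_true, hper Q h0, hq1]
    · have h1 : ¬ 0 < (Q+1).im := by simpa using h0
      simp only [hf, h0, h1, if_false]
  have hdiff : ∀ Q ∈ HH, DifferentiableAt ℂ f Q := by
    intro Q hQ
    have : f =ᶠ[𝓝 Q] fun w => φ w*Function.Periodic.qParam 1 w := by
      filter_upwards [HH_mem_nhds hQ] with w hw
      have : 0 < w.im := hw
      simp [hf, this]
    refine DifferentiableAt.congr_of_eventuallyEq ?_ this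
    exact (hφ.differentiableAt (HH_mem_nhds hQ)).mul Function.Periodic.differentiable_qParam.differentiableAt
  have hev : ∀ᶠ Q in imInf, DifferentiableAt ℂ f Q :=
    (eventually_imInf 0).mono fun Q hQ => hdiff Q hQ
  have hnq : ∀ Q : ℂ, ‖Function.Periodic.qParam 1 Q‖ = rexp (-(2*π*Q.im)) := by
    intro Q; rw [Function.Periodic.norm_qParam]; congr 1; ring
  have hz : ZeroAtFilter imInf f := by
    have t1 : Tendsto (fun y : ℝ => C*2^A*((2+y)^N*rexp (-(2+y))*rexp 2)) atTop (𝓝 0) := by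
      have := (Real.tendsto_pow_mul_exp_neg_atTop_nhds_zero N).comp (tendsto_atTop_add_const_left atTop 2 tendsto_id)
      simpa using ((this.mul_const (rexp 2)).const_mul (C*2^A))
    refine squeeze_zero_norm' ?_ (t1.comp tendsto_comap)
    filter_upwards [eventually_imInf 1] with Q hQ
    have hp : 0 < Q.im := by linarith
    have := hb Q hp
    simp only [hf, hp, if_true, norm_mul, hnq, Function.comp_apply]
    have e1 : Q.im⁻¹ ≤ 1 := inv_le_one_of_one_le₀ hQ.le
    have e2 : rexp (-(2*π*Q.im)) ≤ rexp (-(2+Q.im))*rexp 2 := by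
      rw [← Real.exp_add]; apply Real.exp_le_exp.2; nlinarith [Real.pi_gt_three]
    calc _ ≤ (C*(1+1)^A*(2+Q.im)^N)*(rexp (-(2+Q.im))*rexp 2) := by
          refine mul_le_mul (this.trans ?_) e2 (by positivity) (by positivity)
          have : (0:ℝ) ≤ Q.im⁻¹ := by positivity
          gcongr
      _ = _ := by norm_num; ring
  set H := Function.Periodic.cuspFunction 1 f with hH
  have hH0 : H 0 = 0 := Function.Periodic.cuspFunction_zero_of_zero_at_inf h1 hz
  have hHd0 : DifferentiableAt ℂ H 0 :=
    Function.Periodic.differentiableAt_cuspFunction_zero h1 hfper hev hz.boundedAtFilter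
  have himq : ∀ q : ℂ, q ≠ 0 → ‖q‖ < 1 → Function.Periodic.invQParam 1 q ∈ HH := by
    intro q hq0 hq
    rw [mem_HH, Function.Periodic.im_invQParam]
    have h1 : Real.log ‖q‖ < 0 := Real.log_neg (norm_pos_iff.2 hq0) hq
    have h2 : -1/(2*π) < 0 := div_neg_of_neg_of_pos (by linarith) (by positivity)
    exact mul_pos_of_neg_of_neg h2 h1
  have hHd : ∀ q ∈ Metric.ball (0:ℂ) 1, DifferentiableAt ℂ H q := by
    intro q hq
    rw [mem_ball_zero_iff] at hq
    by_cases hq0 : q = 0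
    · rw [hq0]; exact hHd0
    · have := Function.Periodic.differentiableAt_cuspFunction one_ne_zero hfper
        (z := Function.Periodic.invQParam 1 q) (hdiff _ (himq q hq0 hq))
      rwa [Function.Periodic.qParam_right_inv one_ne_zero hq0] at this
  have hHo : DifferentiableOn ℂ H (Metric.ball 0 1) := fun q hq => (hHd q hq).differentiableWithinAt
  have hHφ : ∀ Q ∈ HH, H (Function.Periodic.qParam 1 Q) = φ Q*Function.Periodic.qParam 1 Q := by
    intro Q hQ
    have h2 : 0 < Q.im := hQ
    rw [hH, Function.Periodic.eq_cuspFunction one_ne_zero hfper]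
    simp [hf, h2]
  have hd0 : deriv H 0 = 0 := by
    have hs := hasDerivAt_iff_tendsto_slope.1 hHd0.hasDerivAt
    have hq : Tendsto (fun y : ℝ => Function.Periodic.qParam 1 (a+I*y)) atTop (𝓝[≠] 0) := by
      refine (Function.Periodic.qParam_tendsto h1).comp ?_
      rw [tendsto_comap_iff]
      refine tendsto_id.congr fun y => ?_
      simp
    refine tendsto_nhds_unique ((hs.comp hq)) (h0.congr' ?_)
    filter_upwards [eventually_gt_atTop 0] with y hy
    have : (a:ℂ)+I*y ∈ HH := by rw [mem_HH]; simpa using hy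
    rw [Function.comp_apply, slope_def_field, hH0, hHφ _ this, sub_zero, sub_zero, mul_div_cancel_right₀]
    exact Function.Periodic.qParam_ne_zero _
  refine ⟨fun n => ((n+1).factorial : ℂ)⁻¹*iteratedDeriv (n+1) H 0, by simp [hd0], ?_, ?_⟩
  · intro n
    set y : ℝ := 1/(n+1) with hy
    have hy0 : 0 < y := by positivity
    have hy1 : y ≤ 1 := by rw [hy, div_le_one (by positivity)]; linarith [n.cast_nonneg (α := ℝ)]
    set r := rexp (-(2*π*y)) with hr
    have hr1 : r < 1 := by rw [hr, Real.exp_lt_one_iff]; have : 0 < 2*π*y := by positivity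
                           linarith
    have hcl : DiffContOnCl ℂ H (Metric.ball 0 r) := by
      refine DifferentiableOn.diffContOnCl fun q hq => (hHd q ?_).differentiableWithinAt
      rw [closure_ball _ (by positivity)] at hq
      exact Metric.closedBall_subset_ball hr1 hq
    have hsph : ∀ q ∈ Metric.sphere (0:ℂ) r, ‖H q‖ ≤ r*(C*(n+2)^A*3^N) := by
      intro q hq
      have hqr : ‖q‖ = r := by simpa using hq
      have hq0 : q ≠ 0 := by rw [← norm_pos_iff, hqr]; positivity
      have hm := himq q hq0 (by rw [hqr]; exact hr1)
      have := hHφ _ hm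
      rw [Function.Periodic.qParam_right_inv one_ne_zero hq0] at this
      rw [this, norm_mul, hqr, mul_comm]
      refine mul_le_mul_of_nonneg_left ?_ (by positivity)
      have him : (Function.Periodic.invQParam 1 q).im = y := by
        rw [Function.Periodic.im_invQParam, hqr, hr, Real.log_exp]; field_simp
      refine (hb _ hm).trans ?_
      rw [him]
      have : 1+y⁻¹ = n+2 := by rw [hy, one_div, inv_inv]; ring
      rw [this]
      gcongr; linarith
    have key := norm_iteratedDeriv_le_of_forall_mem_sphere_norm_le (n+1) (by positivity) hcl hsph
    rw [norm_mul, norm_inv, Complex.norm_natCast, inv_mul_le_iff₀ (by positivity)]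
    refine key.trans ?_
    rw [mul_div_assoc]
    refine mul_le_mul_of_nonneg_left ?_ (by positivity)
    rw [pow_succ', mul_div_mul_left _ _ (by positivity : r ≠ 0), div_le_iff₀ (by positivity)]
    have e1 : rexp (2*π)*r^n ≥ 1 := by
      rw [hr, ← Real.exp_nat_mul, ← Real.exp_add, ge_iff_le, Real.one_le_exp_iff]
      have : n*y ≤ 1 := by rw [hy, mul_one_div, div_le_one (by positivity)]; linarith
      nlinarith [Real.pi_pos]
    have e2 : ((n:ℝ)+2)^A ≤ 2^A*(n+1)^A := by
      rw [← mul_pow]; gcongr; linarith [n.cast_nonneg (α := ℝ)]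
    calc _ ≤ C*(2^A*(n+1)^A)*3^N*1 := by rw [mul_one]; gcongr
      _ ≤ C*(2^A*(n+1)^A)*3^N*(rexp (2*π)*r^n) := by gcongr
      _ = _ := by ring
  · intro Q hQ
    have h2 : 0 < Q.im := hQ
    have hqb : Function.Periodic.qParam 1 Q ∈ Metric.ball (0:ℂ) 1 := by
      rw [mem_ball_zero_iff]; exact Function.Periodic.norm_qParam_lt_one h1 h2
    have key := Complex.hasSum_taylorSeries_on_ball hHo hqb
    rw [hHφ Q hQ, ← hasSum_nat_add_iff' 1] at key
    have hqn : Function.Periodic.qParam 1 Q ≠ 0 := Function.Periodic.qParam_ne_zero _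
    simp only [Finset.range_one, Finset.sum_singleton, iteratedDeriv_zero, hH0, mul_zero, smul_zero, sub_zero, smul_eq_mul] at key
    have := key.div_const (Function.Periodic.qParam 1 Q)
    rw [mul_div_cancel_right₀ _ hqn] at this
    refine (funext fun n => ?_ : (fun n : ℕ => _) = _) ▸ this
    rw [pow_succ]
    have : cexp (2*π*I*n*Q) = Function.Periodic.qParam 1 Q^n := by
      rw [Function.Periodic.qParam, ← Complex.exp_nat_mul]; congr 1; simp; ring
    rw [this]
    field_simp
structure Pk (K : Ker ε) (s B : ℝ) (N : ℕ) (C : ℝ) (A : ℕ) (W : ℂ → Fin 3 → ℂ) : Prop where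
  base : Base K s B N W
  glob : Glob ε s W
  gr : ∀ Q ∈ HH, |Q.re| ≤ 3 → ‖W Q‖ ≤ C*(1+Q.im⁻¹)^A*(2+Q.im)^N
lemma pk_exists (K : Ker ε) (hε : ε^2 = 1) : ∃ B : ℝ, 0 ≤ B ∧ ∃ N : ℕ, ∃ C : ℝ, 0 ≤ C ∧ ∃ A : ℕ,
    ∀ s : ℝ, 0 < s → ∃ W, Pk K s B N C A W := by
  obtain ⟨B, hB, N, h⟩ := base_exists K
  obtain ⟨C, hC, A, hg⟩ := growth2 hε hB N
  refine ⟨B, hB, N, C, hC, A, fun s hs => ?_⟩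
  obtain ⟨Y, hY⟩ := h s hs
  obtain ⟨W, hW, he⟩ := glob_exists hε (Y := Y) ⟨hY.diff, fun Q h h' => hY.T hε hs h h', fun Q h h' hr => hY.S h h' hr⟩
  refine ⟨W, ⟨hY.diff.congr he, ?_, ?_, ?_, ?_, ?_, ?_⟩, hW, ?_⟩
  · intro Q h; rw [he Q h]; exact hY.bd Q h
  · intro Q h; rw [he Q h]; exact hY.psi Q h
  · intro Q h; rw [he Q h]; exact hY.G1n Q h
  · intro Q h; rw [he Q h]; exact hY.G1p Q h
  · intro Q h; rw [he Q h]; exact hY.G2n Q h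
  · intro Q h; rw [he Q h]; exact hY.G2p Q h
  · exact hg s hs W hW (fun Q h => by rw [he Q h]; exact hY.bd Q h)
lemma exp_split {t y l : ℝ} (ht : 0 < t) (hy : 0 < y) (hl : 0 ≤ l) (hl2 : l ≤ 1/2) :
    rexp (2*π*t+π/t)*rexp (2*π*l*(y-t)) ≤ rexp (2*π)*(Ex t+rexp (2*π*y)) := by
  have hp := Real.pi_pos
  have hb : Ex t+rexp (2*π*y) = rexp (2*π*t)+rexp (2*π/t)+rexp (2*π*y) := rfl
  have x1 := Real.exp_pos (2*π*t)
  have x2 := Real.exp_pos (2*π/t)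
  have x3 := Real.exp_pos (2*π*y)
  rw [hb, ← Real.exp_add]
  rcases le_total 1 t with h | h
  · have h1 : π/t ≤ 2*π := by rw [div_le_iff₀ ht]; nlinarith
    rcases le_total y t with h2 | h2
    · refine le_trans (b := rexp (2*π)*rexp (2*π*t)) ?_ (by gcongr; linarith)
      rw [← Real.exp_add]; apply Real.exp_le_exp.2
      have : 2*π*l*(y-t) ≤ 0 := mul_nonpos_of_nonneg_of_nonpos (by positivity) (by linarith)
      linarith
    · refine le_trans (b := rexp (2*π)*rexp (2*π*y)) ?_ (by gcongr; linarith)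
      rw [← Real.exp_add]; apply Real.exp_le_exp.2
      have : 2*π*l*(y-t) ≤ 2*π*(y-t) := by
        have := mul_nonneg hp.le (sub_nonneg.2 h2); nlinarith
      linarith
  · have h1 : 2*π*t ≤ 2*π := by nlinarith
    have h2 : 2*π*l*(y-t) ≤ π*y := by
      have : 0 ≤ π*l*t := by positivity
      nlinarith [mul_pos hp hy]
    have e : 2*π/t = 2*(π/t) := by ring
    rcases le_total (π/t) (π*y) with h3 | h3
    · refine le_trans (b := rexp (2*π)*rexp (2*π*y)) ?_ (by gcongr; linarith)
      rw [← Real.exp_add]; apply Real.exp_le_exp.2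
      linarith
    · refine le_trans (b := rexp (2*π)*rexp (2*π/t)) ?_ (by gcongr; linarith)
      rw [← Real.exp_add]; apply Real.exp_le_exp.2
      linarith
lemma Ph_decay (K : Ker ε) {s : ℝ} (hs : 0 < s) : ∃ C : ℝ, ∃ N : ℕ, ∃ l : ℝ, 0 < l ∧ ∀ Q : ℂ, 1 ≤ Q.im → |Q.re| = 1/2 →
    ‖Ph K s Q Q‖ ≤ C*(1+Q.im)^N*rexp (-(l*Q.im)) := by
  obtain ⟨C, hC, N, hN⟩ := Nm_bound K
  obtain ⟨c, hc, hd⟩ := den_lower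
  set l := min (1/2) (s/4) with hl
  have hl0 : 0 < l := by rw [hl]; positivity
  have hl1 : l ≤ 1/2 := min_le_left _ _
  have hl2 : l ≤ s/4 := min_le_right _ _
  have hp := Real.pi_pos
  have i1 := (int_poly_exp (a := π*s/2) (by positivity)).1
  set D := C*2^N*(rexp (2*π)*(16/c))*4 with hD
  refine ⟨D*∫ t in Ioi (0:ℝ), (1+t)*rexp (-(π*s/2*t)), N, 2*π*l, by positivity, fun Q hQ hr => ?_⟩
  have hU : Q ∈ U0 := ⟨by rw [hr]; norm_num, by linarith⟩
  have hn := U0_norm hU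
  rw [Ph]
  calc _ ≤ ∫ t in Ioi (0:ℝ), D*(1+Q.im)^N*rexp (-(2*π*l*Q.im))*((1+t)*rexp (-(π*s/2*t))) := by
        refine norm_integral_le_of_norm_le (i1.const_mul _) ?_
        refine (ae_restrict_iff' measurableSet_Ioi).2 (ae_of_all _ fun t (ht : 0 < t) => ?_)
        have h1 := hN Q (by linarith) t ht
        have h2 := hd Q (by linarith) hU.1.le t ht
        have h3 := exp_split ht (by linarith : 0 < Q.im) hl0.le hl1
        have hE := Ex_pos t
        have hden : 0 < ‖den Q t‖ := norm_pos_iff.2 (den_ne_off hU (by rintro h; rw [h] at hr; norm_num at hr) ht)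
        rw [hr] at h2
        set Z := Ex t+rexp (2*π*Q.im) with hZ
        have hZ0 : 0 < Z := by positivity
        have h4 : ‖Es s (I*t)‖ ≤ 4*rexp (-(π*s*t)) := by
          rw [norm_Es]
          simp only [mul_im, I_re, ofReal_im, I_im, ofReal_re, mul_zero, one_mul, zero_add]
          exact mul_le_mul_of_nonneg_right (S4_le s) (Real.exp_pos _).le
        rw [QQ, norm_mul, norm_I, one_mul, norm_div, norm_mul, div_le_iff₀ hden]
        have h5 : Z ≤ 16/c*‖den Q t‖ := by
          rw [div_mul_eq_mul_div, le_div_iff₀ hc]; nlinarith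
        have h6 : rexp (2*π*t+π/t) ≤ rexp (2*π)*Z*(rexp (-(2*π*l*Q.im))*rexp (2*π*l*t)) := by
          rw [← Real.exp_add, ← div_le_iff₀ (Real.exp_pos _), ← Real.exp_sub]
          refine le_trans (le_of_eq ?_) h3
          rw [← Real.exp_add]; congr 1; ring
        have h7 : rexp (2*π*l*t)*rexp (-(π*s*t)) ≤ rexp (-(π*s/2*t)) := by
          rw [← Real.exp_add]; apply Real.exp_le_exp.2
          have := mul_le_mul_of_nonneg_left hl2 (by positivity : 0 ≤ 2*π*t)
          linarith
        calc _ ≤ (C*(2*(1+Q.im))^N*(1+t)*(rexp (2*π)*(16/c*‖den Q t‖)*(rexp (-(2*π*l*Q.im))*rexp (2*π*l*t))))*(4*rexp (-(π*s*t))) := by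
              refine mul_le_mul (h1.trans ?_) h4 (norm_nonneg _) (by positivity)
              refine mul_le_mul ?_ (h6.trans ?_) (by positivity) (by positivity)
              · gcongr
              · gcongr
          _ = D*(1+Q.im)^N*rexp (-(2*π*l*Q.im))*((1+t)*(rexp (2*π*l*t)*rexp (-(π*s*t))))*‖den Q t‖ := by
              rw [hD, mul_pow]; ring
          _ ≤ _ := by gcongr
    _ = _ := by rw [integral_const_mul]; ring
lemma tendsto_poly_exp (N : ℕ) {l : ℝ} (hl : 0 < l) :
    Tendsto (fun y : ℝ => (1+y)^N*rexp (-(l*y))) atTop (𝓝 0) := by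
  have := (Real.tendsto_pow_mul_exp_neg_atTop_nhds_zero N).comp
    (tendsto_const_mul_atTop_of_pos hl |>.2 (tendsto_atTop_add_const_left atTop 1 tendsto_id))
  have := (this.const_mul (l⁻¹^N*rexp l))
  rw [mul_zero] at this
  refine this.congr fun y => ?_
  simp only [Function.comp_apply, id]
  rw [mul_pow, show -(l*(1+y)) = -l + -(l*y) by ring, Real.exp_add, Real.exp_neg l, inv_pow]
  field_simp
lemma FF_decay {K : Ker ε} {s B : ℝ} {N : ℕ} {C : ℝ} {A : ℕ} {W} (hs : 0 < s) (h : Pk K s B N C A W) {a : ℝ} (ha : |a| = 1/2) :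
    Tendsto (fun y : ℝ => (1+y)*‖FF s W (a+I*y)‖) atTop (𝓝 0) := by
  obtain ⟨D, M, l, hl, hD⟩ := Ph_decay K hs
  have t1 := ((tendsto_poly_exp (M+1) hl).const_mul D).add (tendsto_poly_exp 1 (by positivity : 0 < π*s))
  rw [mul_zero, add_zero] at t1
  refine squeeze_zero' ?_ ?_ t1
  · filter_upwards [eventually_gt_atTop 0] with y hy; positivity
  · filter_upwards [eventually_ge_atTop 1] with y hy
    have him : ((a:ℂ)+I*y).im = y := by simp
    have hre : ((a:ℂ)+I*y).re = a := by simp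
    have hU : (a:ℂ)+I*y ∈ U1 := ⟨by rw [hre, ha]; norm_num, by rw [him]; linarith⟩
    have h0 : ((a:ℂ)+I*y).re ≠ 0 := by
      rw [hre]; rintro rfl; norm_num at ha
    have := hD _ (by rw [him]; exact hy) (by rw [hre]; exact ha)
    rw [him] at this
    have h2 : ‖FF s W (a+I*y)‖ ≤ D*(1+y)^M*rexp (-(l*y))+rexp (-(π*s*y)) := by
      rw [FF, h.base.psi _ hU h0]
      refine (norm_add_le _ _).trans (add_le_add this ?_)
      rw [norm_ee, him]
    refine (mul_le_mul_of_nonneg_left h2 (by positivity)).trans (le_of_eq ?_)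
    ring
def bt (s : ℝ) (W : ℂ → Fin 3 → ℂ) (Q : ℂ) : ℂ := FF s W (Q+1)-FF s W Q
def at' (s : ℝ) (W : ℂ → Fin 3 → ℂ) (Q : ℂ) : ℂ := FF s W Q-Q*bt s W Q
lemma per_int {φ : ℂ → ℂ} (h : ∀ Q ∈ HH, φ (Q+1) = φ Q) {Q : ℂ} (hQ : Q ∈ HH) (n : ℤ) : φ (Q+n) = φ Q := by
  induction n with
  | zero => simp
  | succ n ih =>
    have := h _ (HH_add_int hQ n)
    push_cast at *
    rw [← add_assoc, this, ih]
  | pred n ih =>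
    have := h _ (HH_add_int hQ (-n-1))
    push_cast at *
    rw [← ih, ← this]; congr 1; ring
lemma per_bound {φ : ℂ → ℂ} (h : ∀ Q ∈ HH, φ (Q+1) = φ Q) {g : ℝ → ℝ} (hb : ∀ Q ∈ HH, |Q.re| ≤ 1 → ‖φ Q‖ ≤ g Q.im)
    {Q : ℂ} (hQ : Q ∈ HH) : ‖φ Q‖ ≤ g Q.im := by
  have h1 := hb _ (HH_add_int hQ (-⌊Q.re⌋)) (by
    have := Int.floor_le Q.re
    have := Int.lt_floor_add_one Q.re
    rw [abs_le]; simp; constructor <;> linarith)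
  rw [per_int h hQ] at h1
  simpa using h1
structure Cf (s : ℝ) (W : ℂ → Fin 3 → ℂ) (D : ℝ) (A : ℕ) (a b : ℕ → ℂ) : Prop where
  a0 : a 0 = 0
  b0 : b 0 = 0
  ba : ∀ n : ℕ, ‖a n‖ ≤ D*(n+1)^A
  bb : ∀ n : ℕ, ‖b n‖ ≤ D*(n+1)^A
  sa : ∀ Q ∈ HH, HasSum (fun n : ℕ => a n*cexp (2*π*I*n*Q)) (at' s W Q)
  sb : ∀ Q ∈ HH, HasSum (fun n : ℕ => b n*cexp (2*π*I*n*Q)) (bt s W Q)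
lemma cf_exists (K : Ker ε) (N : ℕ) {C : ℝ} (hC : 0 ≤ C) (A : ℕ) : ∃ D : ℝ, 0 ≤ D ∧
    ∀ s B : ℝ, 0 < s → ∀ W, Pk K s B N C A W → ∃ a b, Cf s W D A a b := by
  refine ⟨(5*(C+1))*2^A*3^(N+1)*rexp (2*π), by positivity, fun s B hs W h => ?_⟩
  have hFd : DifferentiableOn ℂ (FF s W) HH := by
    have := h.glob.diff
    rw [differentiableOn_pi] at this
    exact (this 0).add (ee_diff s).differentiableOn
  have hFb : ∀ Q ∈ HH, |Q.re| ≤ 3 → ‖FF s W Q‖ ≤ (C+1)*(1+Q.im⁻¹)^A*(2+Q.im)^N := by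
    intro Q hQ hr
    have h0 : 0 < Q.im := hQ
    have h1 := h.gr Q hQ hr
    have h2 := norm_le_pi_norm (W Q) 0
    have h3 := norm_ee_le hs.le hQ
    have h4 : 1 ≤ (1+Q.im⁻¹)^A := one_le_pow₀ (by have := inv_pos.2 h0; linarith)
    have h5 : 1 ≤ (2+Q.im)^N := one_le_pow₀ (by linarith)
    rw [FF]
    refine (norm_add_le _ _).trans ?_
    nlinarith
  have hbp : ∀ Q ∈ HH, bt s W (Q+1) = bt s W Q := by
    intro Q hQ
    rw [bt, bt, FF_second h.glob hQ]; ring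
  have hap : ∀ Q ∈ HH, at' s W (Q+1) = at' s W Q := by
    intro Q hQ
    rw [at', at', hbp Q hQ, bt]; ring
  have hbd : DifferentiableOn ℂ (bt s W) HH := by
    refine DifferentiableOn.fun_sub ?_ hFd
    exact hFd.comp (f := fun Q => Q+1) (by fun_prop) fun Q hQ => HH_add_one hQ
  have had : DifferentiableOn ℂ (at' s W) HH := hFd.fun_sub (differentiableOn_id.fun_mul hbd)
  have hbb0 : ∀ Q ∈ HH, |Q.re| ≤ 1 → ‖bt s W Q‖ ≤ 2*((C+1)*(1+Q.im⁻¹)^A*(2+Q.im)^N) := by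
    intro Q hQ hr
    have h1 := hFb Q hQ (by linarith)
    have h2 := hFb _ (HH_add_one hQ) (by
      rw [abs_le] at *; simp; constructor <;> linarith)
    rw [show (Q+1).im = Q.im by simp] at h2
    rw [bt]
    refine (norm_sub_le _ _).trans ?_
    linarith
  have hbb : ∀ Q ∈ HH, ‖bt s W Q‖ ≤ 5*(C+1)*(1+Q.im⁻¹)^A*(2+Q.im)^(N+1) := by
    intro Q hQ
    refine per_bound (g := fun y => 5*(C+1)*(1+y⁻¹)^A*(2+y)^(N+1)) hbp (fun Q hQ hr => ?_) hQ
    have h0 : 0 < Q.im := hQ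
    refine (hbb0 Q hQ hr).trans ?_
    rw [pow_succ]
    have : 0 ≤ (C+1)*(1+Q.im⁻¹)^A*(2+Q.im)^N := by positivity
    nlinarith
  have hab : ∀ Q ∈ HH, ‖at' s W Q‖ ≤ 5*(C+1)*(1+Q.im⁻¹)^A*(2+Q.im)^(N+1) := by
    intro Q hQ
    refine per_bound (g := fun y => 5*(C+1)*(1+y⁻¹)^A*(2+y)^(N+1)) hap (fun Q hQ hr => ?_) hQ
    have h0 : 0 < Q.im := hQ
    have h1 := hFb Q hQ (by linarith)
    have h2 := hbb0 Q hQ hr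
    have h3 := norm_le_abs_re_add_abs_im Q
    rw [abs_of_pos h0] at h3
    rw [at', pow_succ]
    refine (norm_sub_le _ _).trans ?_
    rw [norm_mul]
    have h4 : ‖Q‖*‖bt s W Q‖ ≤ (2+Q.im)*(2*((C+1)*(1+Q.im⁻¹)^A*(2+Q.im)^N)) := by
      refine mul_le_mul (by linarith) h2 (norm_nonneg _) (by positivity)
    have : 0 ≤ (C+1)*(1+Q.im⁻¹)^A*(2+Q.im)^N := by positivity
    nlinarith
  have t1 := FF_decay hs h (a := -1/2) (by norm_num [abs_of_neg])
  have t2 := FF_decay hs h (a := 1/2) (by norm_num [abs_of_pos])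
  have e1 : ∀ y : ℝ, (((-1/2 : ℝ) : ℂ)+I*y)+1 = ((1/2 : ℝ) : ℂ)+I*y := by
    intro y; push_cast; ring
  have t12 := t1.add t2
  have t112 := (t1.const_mul 2).add t2
  rw [mul_zero, add_zero] at t112
  rw [add_zero] at t12
  have t3 : Tendsto (fun y : ℝ => bt s W (((-1/2 : ℝ) : ℂ)+I*y)) atTop (𝓝 0) := by
    refine squeeze_zero_norm' ?_ t12
    filter_upwards [eventually_ge_atTop 0] with y hy
    rw [bt, e1]
    refine (norm_sub_le _ _).trans ?_
    nlinarith [norm_nonneg (FF s W (((1/2 : ℝ) : ℂ)+I*y)), norm_nonneg (FF s W (((-1/2 : ℝ) : ℂ)+I*y))]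
  have t4 : Tendsto (fun y : ℝ => at' s W (((-1/2 : ℝ) : ℂ)+I*y)) atTop (𝓝 0) := by
    refine squeeze_zero_norm' ?_ t112
    filter_upwards [eventually_ge_atTop 0] with y hy
    rw [at', bt, e1]
    have h3 := norm_le_abs_re_add_abs_im (((-1/2 : ℝ) : ℂ)+I*y)
    have h4 : ‖((-1/2 : ℝ) : ℂ)+I*y‖ ≤ 1+y := by
      refine h3.trans ?_
      rw [show (((-1/2 : ℝ) : ℂ)+I*y).re = -1/2 by simp, show (((-1/2 : ℝ) : ℂ)+I*y).im = y by simp,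
        abs_of_nonneg hy]
      norm_num [abs_of_neg]
    refine (norm_sub_le _ _).trans ?_
    rw [norm_mul]
    have h5 := mul_le_mul h4 (norm_sub_le (FF s W (((1/2 : ℝ) : ℂ)+I*y)) (FF s W (((-1/2 : ℝ) : ℂ)+I*y)))
      (norm_nonneg _) (by positivity)
    nlinarith [norm_nonneg (FF s W (((1/2 : ℝ) : ℂ)+I*y)), norm_nonneg (FF s W (((-1/2 : ℝ) : ℂ)+I*y))]
  obtain ⟨a, a0, a1, a2⟩ := qexp had hap (by positivity) hab t4
  obtain ⟨b, b0, b1, b2⟩ := qexp hbd hbp (by positivity) hbb t3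
  exact ⟨a, b, a0, b0, a1, b1, a2, b2⟩
end
section
open MeasureTheory
open scoped ContDiff SchwartzMap
lemma schwartz_of {P : (ℝ → ℂ) → Prop} (hd : ∀ h, P h → ∃ h', P h' ∧ ∀ s, HasDerivAt h (h' s) s)
    (hb : ∀ h, P h → ∀ k : ℕ, ∃ C : ℝ, ∀ s : ℝ, |s|^k*‖h s‖ ≤ C) {h : ℝ → ℂ} (hP : P h) :
    ∃ G : 𝓢(ℝ, ℂ), ∀ s, G s = h s := by
  have it : ∀ n : ℕ, P (iteratedDeriv n h) := by
    intro n
    induction n with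
    | zero => simpa using hP
    | succ n ih =>
      obtain ⟨h', p, q⟩ := hd _ ih
      rw [iteratedDeriv_succ, show deriv (iteratedDeriv n h) = h' from funext fun s => (q s).deriv]
      exact p
  have sm : ContDiff ℝ ∞ h := by
    refine contDiff_of_differentiable_iteratedDeriv fun m _ => ?_
    obtain ⟨h', p, q⟩ := hd _ (it m)
    exact fun s => (q s).differentiableAt
  refine ⟨⟨h, sm, fun k n => ?_⟩, fun s => rfl⟩
  obtain ⟨C, hC⟩ := hb _ (it n) k
  refine ⟨C, fun s => ?_⟩
  rw [norm_iteratedFDeriv_eq_norm_iteratedDeriv]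
  exact hC s
lemma theta_exists : ∃ θ : 𝓢(ℝ, ℂ), ∀ u : ℝ, 0 ≤ u → θ u = cexp (-(π*u)) := by
  set e : ℝ → ℂ := fun u => cexp (-(π*u)) with he
  set f : ℝ → ℂ := fun u => (Real.smoothTransition (u+1) : ℂ)*e u with hf
  have hsm : ContDiff ℝ ∞ f := by
    refine ContDiff.mul ?_ ((contDiff_const.mul ofRealCLM.contDiff).neg.cexp)
    exact ofRealCLM.contDiff.comp (Real.smoothTransition.contDiff.comp (by fun_prop))
  have heq : ∀ u : ℝ, 0 ≤ u → f u = e u := by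
    intro u hu
    simp only [hf, Real.smoothTransition.one_of_one_le (by linarith : 1 ≤ u+1), ofReal_one, one_mul]
  have hed : ∀ n : ℕ, iteratedDeriv n e = fun u => (-π : ℂ)^n*e u := by
    intro n
    induction n with
    | zero => simp
    | succ n ih =>
      rw [iteratedDeriv_succ, ih]
      funext u
      have h1 : HasDerivAt (fun u : ℝ => -((π : ℂ)*(u:ℂ))) (-(π : ℂ)) u := by
        simpa using ((ofRealCLM.hasDerivAt (x := u)).const_mul (π : ℂ)).fun_neg
      have := (h1.cexp.const_mul ((-π : ℂ)^n)).deriv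
      rw [he]
      simp only at this ⊢
      rw [this, pow_succ]; ring
  refine ⟨⟨f, hsm, fun k n => ?_⟩, heq⟩
  have hc : Continuous fun u : ℝ => ‖u‖^k*‖iteratedDeriv n f u‖ := by
    have := hsm.continuous_iteratedDeriv n (by exact_mod_cast le_top)
    fun_prop
  obtain ⟨C, hC⟩ := (isCompact_Icc (a := (-2:ℝ)) (b := 1)).exists_bound_of_continuousOn hc.continuousOn
  refine ⟨max C (π^n*k.factorial), fun u => ?_⟩
  rw [norm_iteratedFDeriv_eq_norm_iteratedDeriv]
  rcases lt_or_ge u (-2) with h | h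
  · have : f =ᶠ[𝓝 u] fun _ => 0 := by
      filter_upwards [Iio_mem_nhds (by linarith : u < -1)] with v hv
      simp only [hf, Real.smoothTransition.zero_of_nonpos (by simp at hv; linarith : v+1 ≤ 0), ofReal_zero, zero_mul]
    rw [this.iteratedDeriv_eq n]
    refine le_trans (le_of_eq ?_) (le_max_of_le_right (by positivity : (0:ℝ) ≤ π^n*k.factorial))
    simp
  rcases le_or_gt u 1 with h1 | h1
  · exact le_max_of_le_left ((le_abs_self _).trans (hC u ⟨h, h1⟩))
  · have : f =ᶠ[𝓝 u] e := by
      filter_upwards [Ioi_mem_nhds (by linarith : 0 < u)] with v hv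
      exact heq v (le_of_lt hv)
    rw [this.iteratedDeriv_eq n, hed]
    refine le_max_of_le_right ?_
    have hu : 0 ≤ u := by linarith
    have h2 : ‖e u‖ = rexp (-(π*u)) := by
      rw [he, Complex.norm_exp]; simp
    rw [norm_mul, h2, norm_pow, norm_neg, Complex.norm_real, Real.norm_of_nonneg Real.pi_pos.le, Real.norm_of_nonneg hu]
    have h3 : u^k*rexp (-(π*u)) ≤ k.factorial := by
      have := Real.pow_div_factorial_le_exp u hu k
      rw [div_le_iff₀ (by positivity)] at this
      rw [Real.exp_neg, ← div_eq_mul_inv, div_le_iff₀ (Real.exp_pos _)]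
      refine this.trans ?_
      rw [mul_comm]
      refine mul_le_mul_of_nonneg_left (Real.exp_le_exp.2 ?_) (by positivity)
      nlinarith [Real.pi_gt_three]
    have : (0:ℝ) < π^n := by positivity
    nlinarith
def SE (h : ℝ → ℂ) : Prop := ∃ G : 𝓢(ℝ, ℂ), ∀ s, 0 < s → G s = h s
lemma SE.congr {h h' : ℝ → ℂ} (H : SE h) (e : ∀ s, 0 < s → h' s = h s) : SE h' := by
  obtain ⟨G, hG⟩ := H
  exact ⟨G, fun s hs => by rw [hG s hs, e s hs]⟩
lemma SE.add {h h' : ℝ → ℂ} (H : SE h) (H' : SE h') : SE (fun s => h s+h' s) := by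
  obtain ⟨G, hG⟩ := H
  obtain ⟨G', hG'⟩ := H'
  exact ⟨G+G', fun s hs => by rw [SchwartzMap.add_apply, hG s hs, hG' s hs]⟩
lemma SE.smul {h : ℝ → ℂ} (c : ℂ) (H : SE h) : SE (fun s => c*h s) := by
  obtain ⟨G, hG⟩ := H
  exact ⟨c • G, fun s hs => by rw [SchwartzMap.smul_apply, hG s hs, smul_eq_mul]⟩
lemma SE.mul_id {h : ℝ → ℂ} (H : SE h) : SE (fun s => s*h s) := by
  obtain ⟨G, hG⟩ := H
  refine ⟨SchwartzMap.smulLeftCLM ℂ (fun s : ℝ => (s : ℂ)) G, fun s hs => ?_⟩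
  rw [SchwartzMap.smulLeftCLM_apply_apply (by fun_prop), hG s hs, smul_eq_mul]
section
variable {X : Type*} [MeasurableSpace X]
structure Adm (μ : Measure X) (z : X → ℂ) (κ : X → ℂ) : Prop where
  m : AEStronglyMeasurable κ μ
  i : ∀ j : ℕ, Integrable (fun p => ‖κ p‖*(1+‖z p‖+(z p).im⁻¹)^j) μ
def hK (μ : Measure X) (z : X → ℂ) (κ : X → ℂ) (θ : 𝓢(ℝ, ℂ)) (s : ℝ) : ℂ :=
  ∫ p, κ p*(cexp (π*I*s*(z p).re)*θ (s*(z p).im)) ∂μ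
inductive PK (μ : Measure X) (z : X → ℂ) : (ℝ → ℂ) → Prop
  | base (κ : X → ℂ) (θ : 𝓢(ℝ, ℂ)) (h : Adm μ z κ) : PK μ z (hK μ z κ θ)
  | add (h h' : ℝ → ℂ) (a : PK μ z h) (b : PK μ z h') : PK μ z (fun s => h s+h' s)
lemma Adm.mul {μ : Measure X} {z κ : X → ℂ} (h : Adm μ z κ) (hz : ∀ p, 0 < (z p).im) {u : X → ℂ} (hu : AEStronglyMeasurable u μ)
    {C : ℝ} {k : ℕ} (hb : ∀ p, ‖u p‖ ≤ C*(1+‖z p‖+(z p).im⁻¹)^k) : Adm μ z (fun p => κ p*u p) := by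
  refine ⟨h.m.mul hu, fun j => ?_⟩
  refine Integrable.mono' ((h.i (k+j)).const_mul C) ?_ (ae_of_all _ fun p => ?_)
  ·
    have hw := (h.i j).aestronglyMeasurable
    refine (hw.mul hu.norm).congr (ae_of_all _ fun p => ?_)
    simp only [Pi.mul_apply, norm_mul]; ring
  · have h2 : 0 < 1+‖z p‖+(z p).im⁻¹ := by
      have := inv_pos.2 (hz p); positivity
    rw [Real.norm_of_nonneg (by positivity), norm_mul, pow_add]
    have := mul_le_mul_of_nonneg_left (hb p) (by positivity : 0 ≤ ‖κ p‖*(1+‖z p‖+(z p).im⁻¹)^j)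
    nlinarith
lemma norm_osc (s a : ℝ) : ‖cexp (π*I*s*a)‖ = 1 := by
  rw [Complex.norm_exp]; simp
lemma PK_deriv {μ : Measure X} {z : X → ℂ} (hzm : Measurable z) (hz : ∀ p, 0 < (z p).im) (h) (hP : PK μ z h) :
    ∃ h', PK μ z h' ∧ ∀ s, HasDerivAt h (h' s) s := by
  induction hP with
  | add h h' a b ih ih' =>
    obtain ⟨g, p, q⟩ := ih
    obtain ⟨g', p', q'⟩ := ih'
    exact ⟨_, .add _ _ p p', fun s => (q s).add (q' s)⟩
  | base κ θ hκ =>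
    have w1 : ∀ p, 1 ≤ 1+‖z p‖+(z p).im⁻¹ := fun p => by
      have := inv_pos.2 (hz p); have := norm_nonneg (z p); linarith
    have mre : AEStronglyMeasurable (fun p => ((z p).re : ℂ)) μ := by fun_prop
    have mim : AEStronglyMeasurable (fun p => ((z p).im : ℂ)) μ := by fun_prop
    have a1 : Adm μ z (fun p => κ p*(π*I*(z p).re)) := by
      refine hκ.mul hz (mre.const_mul _) (C := π) (k := 1) fun p => ?_
      rw [norm_mul, norm_mul, norm_I, mul_one, Complex.norm_real, Complex.norm_real, Real.norm_of_nonneg Real.pi_pos.le, pow_one]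
      refine mul_le_mul_of_nonneg_left ?_ Real.pi_pos.le
      have := abs_re_le_norm (z p)
      have := inv_pos.2 (hz p)
      rw [Real.norm_eq_abs]; linarith
    have a2 : Adm μ z (fun p => κ p*(z p).im) := by
      refine hκ.mul hz mim (C := 1) (k := 1) fun p => ?_
      rw [Complex.norm_real, pow_one]
      have := abs_im_le_norm (z p)
      have := inv_pos.2 (hz p)
      rw [Real.norm_eq_abs]; linarith
    refine ⟨_, .add _ _ (.base _ θ a1) (.base _ (SchwartzMap.derivCLM ℝ ℂ θ) a2), fun s => ?_⟩
    obtain ⟨C0, -, hC0⟩ := θ.decay 0 0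
    obtain ⟨C1, -, hC1⟩ := (SchwartzMap.derivCLM ℝ ℂ θ).decay 0 0
    simp only [pow_zero, one_mul, norm_iteratedFDeriv_zero] at hC0 hC1
    have meas : ∀ (κ : X → ℂ) (θ : 𝓢(ℝ, ℂ)) (s : ℝ), AEStronglyMeasurable κ μ →
        AEStronglyMeasurable (fun p => κ p*(cexp (π*I*s*(z p).re)*θ (s*(z p).im))) μ := by
      intro κ θ s hm
      refine hm.mul (Measurable.aestronglyMeasurable ?_)
      have := θ.continuous.measurable
      fun_prop
    have int0 : ∀ (κ : X → ℂ) (θ : 𝓢(ℝ, ℂ)) (C : ℝ) (s : ℝ), Adm μ z κ → (∀ u, ‖θ u‖ ≤ C) →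
        Integrable (fun p => κ p*(cexp (π*I*s*(z p).re)*θ (s*(z p).im))) μ := by
      intro κ θ C s ha hC
      refine Integrable.mono' ((ha.i 0).mul_const C) (meas κ θ s ha.m) (ae_of_all _ fun p => ?_)
      rw [norm_mul, norm_mul, norm_osc, one_mul, pow_zero, mul_one]
      exact mul_le_mul_of_nonneg_left (hC _) (norm_nonneg _)
    have key := hasDerivAt_integral_of_dominated_loc_of_deriv_le (μ := μ)
      (F := fun (s : ℝ) p => κ p*(cexp (π*I*s*(z p).re)*θ (s*(z p).im)))
      (F' := fun (s : ℝ) p => κ p*(π*I*(z p).re)*(cexp (π*I*s*(z p).re)*θ (s*(z p).im))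
        + κ p*(z p).im*(cexp (π*I*s*(z p).re)*(SchwartzMap.derivCLM ℝ ℂ θ) (s*(z p).im)))
      (x₀ := s) (s := univ)
      (bound := fun p => ‖κ p*(π*I*(z p).re)‖*C0+‖κ p*(z p).im‖*C1) univ_mem
      (.of_forall fun s => meas κ θ s hκ.m) (int0 κ θ C0 s hκ hC0)
      ((meas _ θ s a1.m).add (meas _ _ s a2.m)) ?_ ?_ ?_
    · have := key.2
      rw [integral_add (int0 _ θ C0 s a1 hC0) (int0 _ _ C1 s a2 hC1)] at this
      exact this
    · refine ae_of_all _ fun p (s : ℝ) _ => (norm_add_le _ _).trans ?_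
      simp only [norm_mul _ (cexp _*_), norm_mul (cexp _) _, norm_osc, one_mul]
      exact add_le_add (mul_le_mul_of_nonneg_left (hC0 _) (norm_nonneg _)) (mul_le_mul_of_nonneg_left (hC1 _) (norm_nonneg _))
    · have i1 := (a1.i 0).mul_const C0
      have i2 := (a2.i 0).mul_const C1
      simp only [pow_zero, mul_one] at i1 i2
      exact i1.add i2
    · refine ae_of_all _ fun p (s : ℝ) _ => ?_
      have d1 : HasDerivAt (fun s : ℝ => (π*I*(s:ℂ)*((z p).re : ℂ))) (π*I*(z p).re) s := by
        have := ((ofRealCLM.hasDerivAt (x := s)).const_mul (π*I : ℂ)).mul_const ((z p).re : ℂ)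
        simpa using this
      have d2 : HasDerivAt (fun s : ℝ => θ (s*(z p).im)) ((z p).im • deriv θ (s*(z p).im)) s := by
        have h1 : HasDerivAt θ (deriv θ (s*(z p).im)) (s*(z p).im) := (θ.differentiable.differentiableAt).hasDerivAt
        have h2 : HasDerivAt (fun s : ℝ => s*(z p).im) (z p).im s := by
          simpa using (hasDerivAt_id s).mul_const (z p).im
        exact h1.scomp s h2
      have := (d1.cexp.mul d2).const_mul (κ p)
      refine this.congr_deriv ?_
      rw [SchwartzMap.derivCLM_apply, real_smul]; ring
lemma PK_decay {μ : Measure X} {z : X → ℂ} (hz : ∀ p, 0 < (z p).im) (h) (hP : PK μ z h) (k : ℕ) :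
    ∃ C : ℝ, ∀ s : ℝ, |s|^k*‖h s‖ ≤ C := by
  induction hP with
  | add h h' a b ih ih' =>
    obtain ⟨C, p⟩ := ih
    obtain ⟨C', p'⟩ := ih'
    refine ⟨C+C', fun s => ?_⟩
    have := mul_le_mul_of_nonneg_left (norm_add_le (h s) (h' s)) (by positivity : 0 ≤ |s|^k)
    linarith [p s, p' s]
  | base κ θ hκ =>
    obtain ⟨C, -, hC⟩ := θ.decay k 0
    simp only [norm_iteratedFDeriv_zero, Real.norm_eq_abs] at hC
    refine ⟨∫ p, C*(‖κ p‖*(1+‖z p‖+(z p).im⁻¹)^k) ∂μ, fun s => ?_⟩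
    have e : |s|^k*‖hK μ z κ θ s‖ = ‖((|s|^k : ℝ) : ℂ)*hK μ z κ θ s‖ := by
      rw [norm_mul, Complex.norm_real, Real.norm_of_nonneg (by positivity)]
    rw [e, hK, ← integral_const_mul]
    refine norm_integral_le_of_norm_le ((hκ.i k).const_mul C) (ae_of_all _ fun p => ?_)
    have ht := hz p
    rw [norm_mul, norm_mul, norm_mul, norm_osc, one_mul, Complex.norm_real, Real.norm_of_nonneg (by positivity)]
    have h1 := hC (s*(z p).im)
    rw [abs_mul, abs_of_pos ht, mul_pow] at h1
    have h2 : |s|^k*‖θ (s*(z p).im)‖ ≤ C*(z p).im⁻¹^k := by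
      rw [inv_pow, ← div_eq_mul_inv, le_div_iff₀ (by positivity)]; linarith
    have hC0 : 0 ≤ C := le_trans (by positivity) (hC 0)
    have h3 : (z p).im⁻¹^k ≤ (1+‖z p‖+(z p).im⁻¹)^k := by
      have := norm_nonneg (z p)
      gcongr; linarith
    have h4 := h2.trans (mul_le_mul_of_nonneg_left h3 hC0)
    have := mul_le_mul_of_nonneg_left h4 (norm_nonneg (κ p))
    linarith
lemma SE_int {μ : Measure X} {z κ : X → ℂ} (hzm : Measurable z) (hz : ∀ p, 0 < (z p).im) (h : Adm μ z κ) :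
    SE (fun s => ∫ p, κ p*ee s (z p) ∂μ) := by
  obtain ⟨θ, hθ⟩ := theta_exists
  obtain ⟨G, hG⟩ := schwartz_of (PK_deriv hzm hz) (PK_decay hz) (.base κ θ h)
  refine ⟨G, fun s hs => ?_⟩
  rw [hG, hK]
  congr 1; funext p
  rw [hθ _ (mul_nonneg hs.le (hz p).le), ← Complex.exp_add, ee]
  congr 2
  nth_rewrite 3 [← re_add_im (z p)]
  push_cast
  linear_combination (-(π*s*(z p).im) : ℂ)*I_sq
end
end
section
open MeasureTheory
open scoped ContDiff SchwartzMap
variable {ε : ℂ}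
lemma sr_asym : ∃ C : ℝ, 0 ≤ C ∧ ∀ t : ℝ, 1 ≤ t → |sr t^2*rexp (-(2*π*t))-1| ≤ C*rexp (-(2*π*t)) := by
  have hp : Tendsto (fun Q => 16*tE6 Q/(thA0 Q*thB Q*thC Q)) imInf (𝓝 (16*1/(16*1*1))) :=
    (tendsto_tE6.const_mul 16).div ((tendsto_thA0.mul tendsto_thB).mul tendsto_thC) (by norm_num)
  have hne : ∀ Q ∈ HH, thA0 Q*thB Q*thC Q ≠ 0 := by
    intro Q h
    have h2 := thA_ne h
    rw [thA_eq] at h2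
    refine mul_ne_zero (mul_ne_zero (right_ne_zero_of_mul h2) (thB_ne h)) ?_
    rw [jacobi_id h]; exact thAB_ne h
  have hg := Gr.of_periodic (φ := fun Q => 16*tE6 Q/(thA0 Q*thB Q*thC Q)) (h := 1) one_pos (fun Q h => (((tE6_diffAt h).const_mul 16).div
    (((thA0_diffAt h).mul (thB_diffAt h)).mul (thC_diffAt h)) (hne Q h))) (fun Q h => by
      push_cast
      rw [thA0_add_one, thB_add_one, thC_add_one, tE6_T h]; ring) hp
  obtain ⟨C, hC, h⟩ := hg 1 one_pos
  refine ⟨C^2+2*C, by positivity, fun t ht => ?_⟩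
  have h0 : 0 < t := by linarith
  have h1 : ‖16*tE6 (I*t)/(thA0 (I*t)*thB (I*t)*thC (I*t))-16*1/(16*1*1)‖ ≤ _ := h (I*t) (by simpa using ht)
  have e1 : 16*tE6 (I*t)/(thA0 (I*t)*thB (I*t)*thC (I*t)) = ((sr t*rexp (-(π*t)) : ℝ) : ℂ) := by
    rw [ofReal_mul, ← ts_axis h0, ts, thD, ← jacobi_id (HH_axis h0), thA_eq, ofReal_exp]
    rw [show (π*I*(I*t) : ℂ) = ((-(π*t) : ℝ) : ℂ) by push_cast; linear_combination (π*t : ℂ)*I_sq]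
    have := Complex.exp_ne_zero ((-(π*t) : ℝ) : ℂ)
    field_simp
  rw [e1, show (16*1/(16*1*1) : ℂ) = ((1:ℝ) : ℂ) by norm_num, ← ofReal_sub, Complex.norm_real, Real.norm_eq_abs] at h1
  have e2 : (I*(t:ℂ)).im = t := by simp
  rw [e2, pow_zero, mul_one, show (2/1*π*t : ℝ) = 2*π*t by ring] at h1
  have e3 : rexp (-(2*π*t)) = rexp (-(π*t))^2 := by rw [← Real.exp_nat_mul]; congr 1; push_cast; ring
  set x := sr t*rexp (-(π*t))
  have e4 : sr t^2*rexp (-(2*π*t))-1 = (x-1)*((x-1)+2) := by rw [e3]; ring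
  have hE : rexp (-(2*π*t)) ≤ 1 := Real.exp_le_one_iff.2 (by have := Real.pi_pos; nlinarith)
  have hE0 := Real.exp_pos (-(2*π*t))
  rw [e4, abs_mul]
  have h5 : |x-1+2| ≤ C+2 := (abs_add_le _ _).trans (by rw [abs_two]; nlinarith)
  calc _ ≤ (C*rexp (-(2*π*t)))*(C+2) := mul_le_mul h1 h5 (abs_nonneg _) (by positivity)
    _ = _ := by ring
def AA : Set ℝ := Ioc (-(1/2)) (1/2) \ {0}
def ln (σ : ℝ) : ℂ := (σ : ℂ)+I
lemma ln_re (σ : ℝ) : (ln σ).re = σ := by simp [ln]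
lemma ln_im (σ : ℝ) : (ln σ).im = 1 := by simp [ln]
lemma AA_meas : MeasurableSet AA := measurableSet_Ioc.diff (measurableSet_singleton 0)
lemma AA_abs {σ : ℝ} (h : σ ∈ AA) : |σ| ≤ 1/2 := abs_le.2 ⟨h.1.1.le, h.1.2⟩
lemma AA_U {σ : ℝ} (h : σ ∈ AA) : ln σ ∈ U1 ∧ ln σ ∈ U0 ∧ (ln σ).re ≠ 0 := by
  have h1 : |(ln σ).re| < 3/5 := by rw [ln_re]; linarith [AA_abs h]
  have h2 := ln_im σ
  refine ⟨⟨h1, by rw [h2]; norm_num⟩, ⟨h1, by rw [h2]; norm_num⟩, ?_⟩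
  rw [ln_re]; exact h.2
lemma AA_norm {σ : ℝ} (h : σ ∈ AA) {m : ℝ} (hm : |m| ≤ 1) : ‖ln σ+m‖ ≤ 3 := by
  have h1 : ‖ln σ+m‖ ≤ ‖(σ:ℂ)‖+‖I‖+‖(m:ℂ)‖ := (norm_add_le _ _).trans (by gcongr; exact norm_add_le _ _)
  rw [norm_I, Complex.norm_real, Complex.norm_real, Real.norm_eq_abs, Real.norm_eq_abs] at h1
  linarith [AA_abs h]
def kp (K : Ker ε) (m : ℝ) (u : ℝ → ℂ) (σ t : ℝ) : ℂ := u σ*(I*(Nm K (ln σ+m) t/den (ln σ) t))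
lemma rem_bound (K : Ker ε) {m : ℝ} (hm : |m| ≤ 1) {u : ℝ → ℂ} {U : ℝ} (hU : 0 ≤ U) (hu : ∀ σ ∈ AA, ‖u σ‖ ≤ U*|σ|^4) :
    ∃ c0 c1 : Fin 3 → ℂ, ∃ C : ℝ, ∀ σ ∈ AA, ∀ t : ℝ, 0 < t →
      ‖kp K m u σ t-if 1 ≤ t then u σ*(I*((∑ i, K.f i (ln σ+m)*c0 i)+(∑ i, K.f i (ln σ+m)*c1 i)*t)) else 0‖
        ≤ C*(1+t)*rexp (-(t+t⁻¹)) := by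
  choose c0 c1 D hD using K.bg'
  choose n hn using K.bf
  choose F hF0 hF using fun i => hn i 1 one_pos
  obtain ⟨S, hS, hs⟩ := sr_asym
  obtain ⟨c, hc, hd⟩ := den_lower
  obtain ⟨B, hB, N, hN⟩ := Nm_bound K
  obtain ⟨T, hT⟩ : ∃ T : ℝ, ∀ σ ∈ AA, ‖ts (ln σ)^2‖ ≤ T := by
    have hcont : ContinuousOn (fun σ : ℝ => ts (ln σ)^2) (Icc (-(1/2)) (1/2)) := by
      intro σ _
      have h1 : ContinuousAt ts (ln σ) := (ts_diffAt (by rw [mem_HH, ln_im]; exact one_pos)).continuousAt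
      have h2 : ContinuousAt ln σ := by unfold ln; fun_prop
      exact ((ContinuousAt.comp (f := ln) h1 h2).pow 2).continuousWithinAt
    obtain ⟨T, hT⟩ := isCompact_Icc.exists_bound_of_continuousOn hcont
    exact ⟨T, fun σ h => hT σ ⟨h.1.1.le, h.1.2⟩⟩
  have hf : ∀ i, ∀ σ ∈ AA, ‖K.f i (ln σ+m)‖ ≤ F i*4^n i := by
    intro i σ h
    have h1 := hF i (ln σ+m) (by simp [ln_im])
    rw [zero_mul, zero_mul, neg_zero, Real.exp_zero, mul_one] at h1
    refine h1.trans (mul_le_mul_of_nonneg_left (pow_le_pow_left₀ (by positivity) ?_ _) (hF0 i))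
    linarith [AA_norm h hm]
  have hD0 : ∀ i, 0 ≤ D i := fun i => by
    have := (norm_nonneg _).trans (hD i 1 le_rfl)
    exact nonneg_of_mul_nonneg_left this (Real.exp_pos _)
  set C1 := ∑ i, F i*4^n i*D i
  set C3 := ∑ i, F i*4^n i*(‖c0 i‖+‖c1 i‖)
  have hC1 : 0 ≤ C1 := Finset.sum_nonneg fun i _ => by have := hD0 i; have := hF0 i; positivity
  have hC3 : 0 ≤ C3 := Finset.sum_nonneg fun i _ => by have := hF0 i; positivity
  refine ⟨c0, c1, U/c*(C1+C3*(S+|T|))*rexp 1+U/c*B*4^N*rexp (2*π)*rexp 1, fun σ hσ t ht => ?_⟩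
  have hσ0 : 0 < |σ| := abs_pos.2 hσ.2
  have hdl := hd (ln σ) (by rw [ln_im]; norm_num) (by rw [ln_re]; linarith [AA_abs hσ]) t ht
  rw [ln_re] at hdl
  have hEx : 0 < Ex t := Ex_pos t
  have hyp := Real.exp_pos (2*π*(ln σ).im)
  have hden : den (ln σ) t ≠ 0 := den_ne_off (AA_U hσ).2.1 (AA_U hσ).2.2 ht
  have huq : ∀ E : ℝ, E ≤ Ex t → 0 < E → ‖u σ‖/‖den (ln σ) t‖ ≤ U/c/E := by
    intro E hE hE0
    rw [div_div, div_le_div_iff₀ (norm_pos_iff.2 hden) (by positivity)]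
    have h1 : c*|σ|^4*E ≤ ‖den (ln σ) t‖ := le_trans (mul_le_mul_of_nonneg_left (by linarith) (by positivity)) hdl
    calc _ ≤ U*|σ|^4*(c*E) := mul_le_mul_of_nonneg_right (hu σ hσ) (by positivity)
      _ = U*(c*|σ|^4*E) := by ring
      _ ≤ _ := mul_le_mul_of_nonneg_left h1 hU
  have hp3 := Real.pi_gt_three
  split_ifs with h1
  · have hti : t⁻¹ ≤ 1 := inv_le_one_of_one_le₀ h1
    set P0 := ∑ i, K.f i (ln σ+m)*c0 i
    set P1 := ∑ i, K.f i (ln σ+m)*c1 i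
    set e := rexp (-(2*π*t)) with he
    have he1 : e*rexp (2*π*t) = 1 := by rw [he, ← Real.exp_add]; simp
    have he0 : 0 < e := Real.exp_pos _
    have het : e ≤ rexp (-t) := Real.exp_le_exp.2 (by nlinarith)
    have hx : ‖Nm K (ln σ+m) t*e-(P0+P1*t)‖ ≤ C1*rexp (-t) := by
      have e1 : Nm K (ln σ+m) t*e-(P0+P1*t) = ∑ i, K.f i (ln σ+m)*(K.g i (I*t)*e-(c0 i+c1 i*t)) := by
        simp only [P0, P1, Nm, Finset.sum_mul, ← Finset.sum_add_distrib, ← Finset.sum_sub_distrib]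
        exact Finset.sum_congr rfl fun i _ => by ring
      rw [e1, Finset.sum_mul]
      refine norm_sum_le_of_le _ fun i _ => ?_
      rw [norm_mul]
      calc _ ≤ (F i*4^n i)*(D i*rexp (-t)) :=
            mul_le_mul (hf i σ hσ) (hD i t h1) (norm_nonneg _) (by have := hF0 i; positivity)
        _ = _ := by ring
    have hP : ‖P0+P1*t‖ ≤ C3*(1+t) := by
      have e1 : P0+P1*t = ∑ i, K.f i (ln σ+m)*(c0 i+c1 i*t) := by
        simp only [P0, P1, Finset.sum_mul, ← Finset.sum_add_distrib]
        exact Finset.sum_congr rfl fun i _ => by ring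
      rw [e1, Finset.sum_mul]
      refine norm_sum_le_of_le _ fun i _ => ?_
      rw [norm_mul]
      have h2 : ‖c0 i+c1 i*t‖ ≤ (‖c0 i‖+‖c1 i‖)*(1+t) := by
        refine (norm_add_le _ _).trans ?_
        rw [norm_mul, Complex.norm_real, Real.norm_of_nonneg ht.le]
        nlinarith [norm_nonneg (c0 i), norm_nonneg (c1 i)]
      calc _ ≤ (F i*4^n i)*((‖c0 i‖+‖c1 i‖)*(1+t)) :=
            mul_le_mul (hf i σ hσ) h2 (norm_nonneg _) (by have := hF0 i; positivity)
        _ = _ := by ring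
    have hy : ‖1-den (ln σ) t*e‖ ≤ (S+|T|)*e := by
      have e1 : 1-den (ln σ) t*e = -(((sr t^2*e-1 : ℝ)) : ℂ)+ts (ln σ)^2*e := by
        rw [den]; push_cast; ring
      rw [e1]
      refine (norm_add_le _ _).trans ?_
      rw [norm_neg, Complex.norm_real, Real.norm_eq_abs, norm_mul, Complex.norm_real, Real.norm_of_nonneg he0.le, add_mul]
      exact add_le_add (hs t h1) (mul_le_mul_of_nonneg_right ((hT σ hσ).trans (le_abs_self T)) he0.le)
    have hq := huq (rexp (2*π*t)) (by unfold Ex; have := Real.exp_pos (2*π/t); linarith) (Real.exp_pos _)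
    have e3 : kp K m u σ t-u σ*(I*(P0+P1*t)) = u σ/den (ln σ) t*(I*(((Nm K (ln σ+m) t*e-(P0+P1*t))+(P0+P1*t)*(1-den (ln σ) t*e))*rexp (2*π*t))) := by
      have he1' : (e : ℂ)*rexp (2*π*t) = 1 := by rw [← ofReal_mul, he1, ofReal_one]
      rw [kp]
      field_simp
      linear_combination (-u σ*(Nm K (ln σ+m) t-(P0+P1*t)*den (ln σ) t))*he1'
    have hE : rexp (-t) ≤ rexp 1*rexp (-(t+t⁻¹)) := by
      rw [← Real.exp_add]; exact Real.exp_le_exp.2 (by linarith)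
    rw [e3, norm_mul, norm_mul, norm_I, one_mul, norm_mul, norm_div, Complex.norm_real, Real.norm_of_nonneg (Real.exp_pos _).le]
    have hsum : ‖(Nm K (ln σ+m) t*e-(P0+P1*t))+(P0+P1*t)*(1-den (ln σ) t*e)‖ ≤
        (C1+C3*(S+|T|))*(1+t)*rexp (-t) := by
      refine (norm_add_le _ _).trans ?_
      rw [norm_mul]
      have := mul_le_mul hP hy (norm_nonneg _) (by positivity)
      have h5 : C3*(1+t)*((S+|T|)*e) ≤ C3*(1+t)*((S+|T|)*rexp (-t)) :=
        mul_le_mul_of_nonneg_left (mul_le_mul_of_nonneg_left het (by positivity)) (by positivity)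
      have h6 : 0 ≤ C1*rexp (-t)*t := by positivity
      linarith
    calc _ ≤ (U/c/rexp (2*π*t))*(((C1+C3*(S+|T|))*(1+t)*rexp (-t))*rexp (2*π*t)) :=
          mul_le_mul hq (mul_le_mul_of_nonneg_right hsum (Real.exp_pos _).le) (by positivity) (by positivity)
      _ = U/c*(C1+C3*(S+|T|))*(1+t)*rexp (-t) := by field_simp
      _ ≤ U/c*(C1+C3*(S+|T|))*(1+t)*(rexp 1*rexp (-(t+t⁻¹))) :=
          mul_le_mul_of_nonneg_left hE (by positivity)
      _ ≤ _ := by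
        have : 0 ≤ U/c*B*4^N*rexp (2*π)*rexp 1*(1+t)*rexp (-(t+t⁻¹)) := by positivity
        linarith
  · push Not at h1
    have hq := huq (rexp (2*π/t)) (by unfold Ex; have := Real.exp_pos (2*π*t); linarith) (Real.exp_pos _)
    have hNb := hN (ln σ+m) (by simp [ln_im]; norm_num) t ht
    have hti : 1 ≤ t⁻¹ := (one_le_inv₀ ht).2 h1.le
    have h2 : ‖Nm K (ln σ+m) t‖ ≤ B*4^N*(1+t)*rexp (2*π*t+π/t) := by
      refine hNb.trans (mul_le_mul_of_nonneg_right (mul_le_mul_of_nonneg_right (mul_le_mul_of_nonneg_left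
        (pow_le_pow_left₀ (by positivity) ?_ _) hB) (by linarith)) (Real.exp_pos _).le)
      linarith [AA_norm hσ hm]
    have h3 : rexp (2*π*t+π/t)/rexp (2*π/t) ≤ rexp (2*π)*rexp 1*rexp (-(t+t⁻¹)) := by
      rw [← Real.exp_sub, ← Real.exp_add, ← Real.exp_add]
      refine Real.exp_le_exp.2 ?_
      rw [div_eq_mul_inv, div_eq_mul_inv]
      nlinarith
    have e1 : kp K m u σ t = u σ/den (ln σ) t*(I*Nm K (ln σ+m) t) := by rw [kp]; ring
    rw [sub_zero, e1, norm_mul, norm_mul, norm_I, one_mul, norm_div]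
    calc _ ≤ (U/c/rexp (2*π/t))*(B*4^N*(1+t)*rexp (2*π*t+π/t)) :=
          mul_le_mul hq h2 (norm_nonneg _) (by positivity)
      _ = U/c*B*4^N*(1+t)*(rexp (2*π*t+π/t)/rexp (2*π/t)) := by ring
      _ ≤ U/c*B*4^N*(1+t)*(rexp (2*π)*rexp 1*rexp (-(t+t⁻¹))) :=
          mul_le_mul_of_nonneg_left h3 (by positivity)
      _ ≤ _ := by
        have : 0 ≤ U/c*(C1+C3*(S+|T|))*rexp 1*(1+t)*rexp (-(t+t⁻¹)) := by positivity
        linarith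
lemma SE.mul {h h' : ℝ → ℂ} (H : SE h) (H' : SE h') : SE (fun s => h s*h' s) := by
  obtain ⟨G, hG⟩ := H
  obtain ⟨G', hG'⟩ := H'
  refine ⟨SchwartzMap.smulLeftCLM ℂ G G', fun s hs => ?_⟩
  rw [SchwartzMap.smulLeftCLM_apply_apply G.hasTemperateGrowth, hG s hs, hG' s hs, smul_eq_mul]
lemma SE_bd {S : Set ℝ} (hS : MeasurableSet S) (hS' : volume S ≠ ⊤) {z v : ℝ → ℂ} (hzm : Measurable z) (hz : ∀ σ, 0 < (z σ).im)
    (hv : Measurable v) {V Z : ℝ} (hV : ∀ σ ∈ S, ‖v σ‖ ≤ V) (hZ : ∀ σ ∈ S, 1+‖z σ‖+(z σ).im⁻¹ ≤ Z) :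
    SE (fun s => ∫ σ in S, v σ*ee s (z σ)) ∧ ∀ s, 0 < s → IntegrableOn (fun σ => v σ*ee s (z σ)) S := by
  refine ⟨SE_int hzm hz ⟨hv.aestronglyMeasurable, fun j => ?_⟩, fun s hs => ?_⟩
  · refine Measure.integrableOn_of_bounded (M := V*Z^j) hS' (Measurable.aestronglyMeasurable (by fun_prop)) ?_
    filter_upwards [ae_restrict_mem hS] with σ h
    have h0 : 0 ≤ 1+‖z σ‖+(z σ).im⁻¹ := by have := inv_pos.2 (hz σ); positivity
    rw [Real.norm_of_nonneg (by positivity)]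
    exact mul_le_mul (hV σ h) (pow_le_pow_left₀ h0 (hZ σ h) j) (by positivity) ((norm_nonneg _).trans (hV σ h))
  · have := (ee_diff s).continuous.measurable
    refine Measure.integrableOn_of_bounded (M := V) hS' (Measurable.aestronglyMeasurable (by fun_prop)) ?_
    filter_upwards [ae_restrict_mem hS] with σ h
    rw [norm_mul]
    have := norm_ee_le hs.le (hz σ : z σ ∈ HH)
    exact (mul_le_of_le_one_right (norm_nonneg _) this).trans (hV σ h)
lemma SE_J (e : ℝ) (he : |e| = 1) : SE (fun s => (cexp (π*I*s*e)-1)/(π*I*s*e)*cexp (-(π*s/2))) := by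
  refine (SE_bd (S := Ioc 0 1) measurableSet_Ioc (by simp) (z := fun σ => e*σ+I/2) (v := fun _ => 1) (by fun_prop)
    (fun σ => by simp) (by fun_prop) (V := 1) (Z := 5) (by simp) ?_).1.congr fun s hs => ?_
  · intro σ h
    have h1 : ‖(e*σ+I/2 : ℂ)‖ ≤ ‖(e*σ : ℂ)‖+‖(I/2 : ℂ)‖ := norm_add_le _ _
    have h2 : ‖(e*σ : ℂ)‖ ≤ 1 := by
      rw [norm_mul, Complex.norm_real, Complex.norm_real, Real.norm_eq_abs, he, one_mul, Real.norm_of_nonneg h.1.le]; exact h.2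
    have h3 : ‖(I/2 : ℂ)‖ = 1/2 := by simp
    have h4 : ((e*σ+I/2 : ℂ)).im = 1/2 := by simp
    rw [h4]; linarith
  · have he0 : e ≠ 0 := by rintro rfl; simp at he
    have hc : (π*I*s*e : ℂ) ≠ 0 := by
      have : (s:ℂ) ≠ 0 := by exact_mod_cast hs.ne'
      have : (e:ℂ) ≠ 0 := by exact_mod_cast he0
      simp [Real.pi_ne_zero, *]
    have := integral_exp_mul_complex (a := 0) (b := 1) hc
    simp only [ofReal_one, mul_one, ofReal_zero, mul_zero, Complex.exp_zero] at this
    rw [← this, intervalIntegral.integral_of_le zero_le_one, ← integral_mul_const]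
    congr 1; funext σ
    rw [one_mul, ee, ← Complex.exp_add]; congr 1
    linear_combination (-(π*s/2) : ℂ)*I_sq
lemma S4_exp (s : ℝ) : (S4 s : ℂ) = -((cexp (π*I*s)-1)*(cexp (π*I*s*(-1 : ℝ))-1))*(-1) := by
  have h := Es_eq s 0
  rw [Es] at h
  simp only [ee, mul_zero, Complex.exp_zero, mul_one, zero_add, zero_sub] at h
  have h2 : cexp (π*I*s)*cexp (π*I*s*-1) = 1 := by rw [← Complex.exp_add]; simp
  push_cast
  rw [h]
  linear_combination -h2
lemma SE_Q : SE (fun s => S4 s*cexp (-(π*s))/(π*s)^2) := by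
  refine ((SE_J 1 (by simp)).mul (SE_J (-1) (by simp))).congr fun s hs => ?_
  have h0 : (s:ℂ) ≠ 0 := by exact_mod_cast hs.ne'
  have h1 : (π:ℂ) ≠ 0 := by exact_mod_cast Real.pi_ne_zero
  have h2 : cexp (-(π*s)) = cexp (-(π*s/2))*cexp (-(π*s/2)) := by rw [← Complex.exp_add]; congr 1; ring
  rw [S4_exp, h2]
  push_cast
  simp only [mul_one]
  have := I_ne_zero
  field_simp
  rw [I_sq]; ring
lemma ee_axis (s t : ℝ) : ee s (I*t) = (rexp (-(π*s*t)) : ℝ) := by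
  rw [ee, ofReal_exp]; congr 1; push_cast; linear_combination (π*s*t : ℂ)*I_sq
def TT (j : ℕ) (s : ℝ) : ℂ := ∫ t in Ioi (0:ℝ), (if 1 ≤ t then (t:ℂ)^j else 0)*Es s (I*t)
lemma TT_int {j : ℕ} (hj : j ≤ 1) {s : ℝ} (hs : 0 < s) :
    IntegrableOn (fun t : ℝ => (if 1 ≤ t then (t:ℂ)^j else 0)*Es s (I*t)) (Ioi 0) := by
  refine Integrable.mono' ((int_poly_exp (by positivity : 0 < π*s)).1.const_mul 4) (Measurable.aestronglyMeasurable ?_) ?_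
  · have := (Es_diff s).continuous.measurable
    exact (Measurable.ite measurableSet_Ici (by fun_prop) (by fun_prop)).mul (by fun_prop)
  · filter_upwards [ae_restrict_mem measurableSet_Ioi] with t ht
    have ht : 0 < t := ht
    have e2 : (I*(t:ℂ)).im = t := by simp
    rw [norm_mul, norm_Es, e2]
    have h1 : ‖(if 1 ≤ t then (t:ℂ)^j else 0)‖ ≤ 1+t := by
      split_ifs with h
      · rw [norm_pow, Complex.norm_real, Real.norm_of_nonneg ht.le]
        interval_cases j <;> simp <;> linarith
      · simp; linarith
    calc _ ≤ (1+t)*(4*rexp (-(π*s*t))) := mul_le_mul h1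
          (mul_le_mul_of_nonneg_right (S4_le s) (Real.exp_pos _).le) (by have := S4_nonneg s; positivity) (by linarith)
      _ = _ := by ring
lemma TT_eq (j : ℕ) (s : ℝ) : TT j s = S4 s*((∫ t in Ioi (1:ℝ), t^j*rexp (-(π*s*t)) : ℝ) : ℂ) := by
  have e1 : (fun t : ℝ => (if 1 ≤ t then (t:ℂ)^j else 0)*Es s (I*t)) =
      (Ici 1).indicator fun t : ℝ => S4 s*((t^j*rexp (-(π*s*t)) : ℝ) : ℂ) := by
    funext t
    rw [Es, ee_axis]
    by_cases h : 1 ≤ t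
    · rw [indicator_of_mem (show t ∈ Ici 1 from h), if_pos h]; push_cast; ring
    · rw [indicator_of_notMem (show t ∉ Ici 1 from h), if_neg h, zero_mul]
  rw [TT, e1, setIntegral_indicator measurableSet_Ici, show Ioi (0:ℝ) ∩ Ici 1 = Ici 1 from
    inter_eq_right.2 (fun t (ht : 1 ≤ t) => show 0 < t by linarith), integral_Ici_eq_integral_Ioi, integral_const_mul, integral_complex_ofReal]
lemma SE_TT {j : ℕ} (hj : j ≤ 1) : SE (TT j) := by
  have h0 : SE (fun s => π*(s*(S4 s*cexp (-(π*s))/(π*s)^2))) := SE_Q.mul_id.smul π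
  have c0 : ∀ s : ℝ, 0 < s → (s:ℂ) ≠ 0 := fun s hs => by exact_mod_cast hs.ne'
  have c1 : (π:ℂ) ≠ 0 := by exact_mod_cast Real.pi_ne_zero
  interval_cases j
  · refine h0.congr fun s hs => ?_
    have := integral_exp_mul_Ioi (a := -(π*s)) (by have := Real.pi_pos; nlinarith) 1
    rw [TT_eq]
    simp only [neg_mul] at this
    simp only [pow_zero, one_mul]
    rw [this]
    have := c0 s hs
    push_cast
    field_simp
  · refine (h0.add SE_Q).congr fun s hs => ?_
    have := (measurePreserving_add_right volume (1:ℝ)).setIntegral_preimage_emb (measurableEmbedding_addRight 1)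
      (fun t : ℝ => t^1*rexp (-(π*s*t))) (Ioi 1)
    rw [TT_eq, ← this, preimage_add_const_Ioi, sub_self]
    have e : (fun t : ℝ => (t+1)^1*rexp (-(π*s*(t+1)))) = fun t => rexp (-(π*s))*((1+t)*rexp (-(π*s*t))) := by
      funext t
      rw [show -(π*s*(t+1)) = -(π*s) + -(π*s*t) by ring, Real.exp_add]; ring
    rw [e, integral_const_mul, (int_poly_exp (by have := Real.pi_pos; positivity : 0 < π*s)).2]
    have := c0 s hs
    push_cast
    field_simp
lemma wt_int (j : ℕ) : IntegrableOn (fun t : ℝ => (1+t)*rexp (-(t+t⁻¹))*(2+t+t⁻¹)^j) (Ioi 0) := by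
  refine Integrable.mono' (((integrableOn_exp_mul_Ioi (a := -(1/2)) (by norm_num) 0)).const_mul
    (2^(j+1)*(j+1).factorial*rexp 1)) (Measurable.aestronglyMeasurable (by fun_prop)) ?_
  filter_upwards [ae_restrict_mem measurableSet_Ioi] with t ht
  have ht : 0 < t := ht
  have hi := inv_pos.2 ht
  rw [Real.norm_of_nonneg (by positivity)]
  have h1 := Real.pow_div_factorial_le_exp ((2+t+t⁻¹)/2) (by positivity) (j+1)
  rw [div_le_iff₀ (by positivity), div_pow, div_le_iff₀ (by positivity)] at h1
  have h2 : (1+t)*(2+t+t⁻¹)^j ≤ (2+t+t⁻¹)^(j+1) := by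
    rw [pow_succ']; exact mul_le_mul_of_nonneg_right (by linarith) (by positivity)
  calc _ = ((1+t)*(2+t+t⁻¹)^j)*rexp (-(t+t⁻¹)) := by ring
    _ ≤ (rexp ((2+t+t⁻¹)/2)*(j+1).factorial*2^(j+1))*rexp (-(t+t⁻¹)) :=
        mul_le_mul_of_nonneg_right (h2.trans h1) (Real.exp_pos _).le
    _ = 2^(j+1)*(j+1).factorial*rexp ((2+t+t⁻¹)/2 + -(t+t⁻¹)) := by rw [Real.exp_add]; ring
    _ ≤ 2^(j+1)*(j+1).factorial*rexp (1 + -(1/2)*t) :=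
        mul_le_mul_of_nonneg_left (Real.exp_le_exp.2 (by linarith)) (by positivity)
    _ = _ := by rw [Real.exp_add]; ring
lemma AA_vol : volume AA ≠ ⊤ := ne_top_of_le_ne_top (by simp) (measure_mono (sdiff_subset : AA ⊆ Ioc (-(1/2)) (1/2)))
lemma ln_cont : Continuous ln := by unfold ln; fun_prop
lemma ln_HH (σ : ℝ) : ln σ ∈ HH := by rw [mem_HH, ln_im]; exact one_pos
lemma f_cont (K : Ker ε) (i : Fin 3) (m : ℝ) : Continuous fun σ => K.f i (ln σ+m) := by
  refine continuous_iff_continuousAt.2 fun σ => ?_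
  have h1 : ContinuousAt (K.f i) (ln σ+m) := (K.f_diff i _ (by rw [mem_HH]; simp [ln_im])).continuousAt
  exact ContinuousAt.comp (f := fun σ => ln σ+m) h1 (ln_cont.add continuous_const).continuousAt
lemma SE_Ph (K : Ker ε) {m : ℝ} (hm : |m| ≤ 1) (hκ : KB K (fun Q => Q+m)) {u : ℝ → ℂ} (huc : Continuous u) {U : ℝ} (hU : 0 ≤ U)
    (hu : ∀ σ ∈ AA, ‖u σ‖ ≤ U*|σ|^4) : SE (fun s => ∫ σ in AA, u σ*Ph K s (ln σ+m) (ln σ)) ∧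
    ∀ s, 0 < s → IntegrableOn (fun σ => u σ*Ph K s (ln σ+m) (ln σ)) AA := by
  obtain ⟨c0, c1, C, hC⟩ := rem_bound K hm hU hu
  set P0 : ℝ → ℂ := fun σ => ∑ i, K.f i (ln σ+m)*c0 i with hP0
  set P1 : ℝ → ℂ := fun σ => ∑ i, K.f i (ln σ+m)*c1 i with hP1
  have cP0 : Continuous P0 := continuous_finsetSum _ fun i _ => (f_cont K i m).mul continuous_const
  have cP1 : Continuous P1 := continuous_finsetSum _ fun i _ => (f_cont K i m).mul continuous_const
  set lin : ℝ × ℝ → ℂ := fun p => u p.1*(I*(P0 p.1+P1 p.1*p.2)) with hlin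
  set R : ℝ × ℝ → ℂ := fun p => kp K m u p.1 p.2-if 1 ≤ p.2 then lin p else 0 with hR
  set μ := (volume.restrict AA).prod (volume.restrict (Ioi (0:ℝ))) with hμ
  have hfin : IsFiniteMeasure (volume.restrict AA) := isFiniteMeasure_restrict.2 AA_vol
  have hμ' : μ = (volume : Measure (ℝ × ℝ)).restrict (AA ×ˢ Ioi 0) := by rw [hμ, Measure.prod_restrict]; rfl
  have hSm : MeasurableSet (AA ×ˢ Ioi (0:ℝ)) := AA_meas.prod measurableSet_Ioi
  have hae : ∀ᵐ p ∂μ, p.1 ∈ AA ∧ 0 < p.2 := by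
    rw [hμ']
    filter_upwards [ae_restrict_mem hSm] with p hp
    exact hp
  have mR : AEStronglyMeasurable R μ := by
    refine AEStronglyMeasurable.sub ?_ ?_
    · rw [hμ']
      refine ContinuousOn.aestronglyMeasurable ?_ hSm
      refine (huc.comp continuous_fst).continuousOn.mul (continuousOn_const.mul (ContinuousOn.div₀ ?_ ?_ ?_))
      · refine continuousOn_finsetSum _ fun i _ => ((f_cont K i m).comp continuous_fst).continuousOn.mul ?_
        intro p hp
        have h1 : ContinuousAt (K.g i) (I*p.2) := K.g_cont i _ (HH_axis hp.2)
        exact (ContinuousAt.comp (f := fun p : ℝ × ℝ => I*(p.2:ℂ)) h1 (by fun_prop)).continuousWithinAt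
      · refine ContinuousOn.sub (ContinuousOn.pow (Complex.continuous_ofReal.comp_continuousOn
          (sr_cont.comp continuous_snd.continuousOn fun p hp => hp.2)) 2) (ContinuousOn.pow ?_ 2)
        intro p hp
        have h1 : ContinuousAt ts (ln p.1) := (ts_diffAt (ln_HH _)).continuousAt
        exact (ContinuousAt.comp (f := fun p : ℝ × ℝ => ln p.1) h1 (ln_cont.comp continuous_fst).continuousAt).continuousWithinAt
      · exact fun p hp => den_ne_off (AA_U hp.1).2.1 (AA_U hp.1).2.2 hp.2
    · refine Measurable.aestronglyMeasurable (Measurable.ite (measurableSet_le measurable_const measurable_snd) ?_ measurable_const)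
      exact (by fun_prop : Continuous lin).measurable
  set z : ℝ → ℝ × ℝ → ℂ := fun k p => I*((if 0 < p.2 then p.2 else 1 : ℝ) : ℂ)+k with hz
  have mz : ∀ k, Measurable (z k) := by
    intro k
    have : Measurable fun p : ℝ × ℝ => (if 0 < p.2 then p.2 else 1 : ℝ) :=
      Measurable.ite (measurableSet_lt measurable_const measurable_snd) measurable_snd measurable_const
    fun_prop
  have him : ∀ k p, (z k p).im = if 0 < p.2 then p.2 else 1 := fun k p => by simp [hz]
  have pz : ∀ k p, 0 < (z k p).im := fun k p => by rw [him]; split_ifs with h <;> [exact h; exact one_pos]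
  have adm : ∀ k : ℝ, |k| ≤ 1 → Adm μ (z k) R := by
    refine fun k hk => ⟨mR, fun j => ?_⟩
    refine Integrable.mono' (((wt_int j).const_mul C).comp_snd (volume.restrict AA)) ?_ ?_
    · have := mz k
      exact mR.norm.mul (Measurable.aestronglyMeasurable (by fun_prop))
    · filter_upwards [hae] with p hp
      have h1 := hC p.1 hp.1 p.2 hp.2
      have h2 : 1+‖z k p‖+(z k p).im⁻¹ ≤ 2+p.2+p.2⁻¹ := by
        rw [him, if_pos hp.2]
        have : ‖z k p‖ ≤ p.2+1 := by
          simp only [hz, if_pos hp.2]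
          refine (norm_add_le _ _).trans ?_
          rw [norm_mul, norm_I, one_mul, Complex.norm_real, Complex.norm_real, Real.norm_of_nonneg hp.2.le, Real.norm_eq_abs]
          linarith
        linarith
      have h3 : 0 ≤ 1+‖z k p‖+(z k p).im⁻¹ := by have := inv_pos.2 (pz k p); positivity
      rw [Real.norm_of_nonneg (by positivity)]
      calc _ ≤ (C*(1+p.2)*rexp (-(p.2+p.2⁻¹)))*(2+p.2+p.2⁻¹)^j :=
            mul_le_mul h1 (pow_le_pow_left₀ h3 h2 j) (by positivity) ((norm_nonneg _).trans h1)
        _ = _ := by ring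
  have iE : ∀ k : ℝ, |k| ≤ 1 → ∀ s, 0 < s → Integrable (fun p => R p*ee s (z k p)) μ := by
    intro k hk s hs
    have := mz k
    have := (ee_diff s).continuous.measurable
    refine Integrable.mono' ((adm k hk).i 0) (mR.mul (Measurable.aestronglyMeasurable (by fun_prop))) (ae_of_all _ fun p => ?_)
    rw [norm_mul, pow_zero]
    exact mul_le_mul_of_nonneg_left (norm_ee_le hs.le (pz k p)) (norm_nonneg _)
  have k1 : |(1:ℝ)| ≤ 1 := by simp
  have k0 : |(0:ℝ)| ≤ 1 := by simp
  have k2 : |(-1:ℝ)| ≤ 1 := by simp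
  have eE : ∀ s : ℝ, (fun p : ℝ × ℝ => R p*Es s (I*p.2)) =ᵐ[μ]
      fun p => -1*(R p*ee s (z 1 p))+(2*(R p*ee s (z 0 p)) + -1*(R p*ee s (z (-1) p))) := by
    intro s
    filter_upwards [hae] with p hp
    simp only [hz, if_pos hp.2]
    rw [Es_eq]; push_cast; rw [add_zero, ← sub_eq_add_neg (I*(p.2:ℂ))]; ring
  have iR : ∀ s, 0 < s → Integrable (fun p : ℝ × ℝ => R p*Es s (I*p.2)) μ := fun s hs =>
    (((iE 1 k1 s hs).const_mul _).add (((iE 0 k0 s hs).const_mul _).add ((iE (-1) k2 s hs).const_mul _))).congr (eE s).symm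
  have SR : SE (fun s => ∫ p, R p*Es s (I*p.2) ∂μ) := by
    refine (((SE_int (mz 1) (pz 1) (adm 1 k1)).smul (-1)).add (((SE_int (mz 0) (pz 0) (adm 0 k0)).smul 2).add
      ((SE_int (mz (-1)) (pz (-1)) (adm (-1) k2)).smul (-1)))).congr fun s hs => ?_
    rw [integral_congr_ae (eE s), integral_add, integral_add, integral_const_mul, integral_const_mul, integral_const_mul]
    · exact (iE 0 k0 s hs).const_mul _
    · exact (iE (-1) k2 s hs).const_mul _
    · exact (iE 1 k1 s hs).const_mul _
    · exact ((iE 0 k0 s hs).const_mul _).add ((iE (-1) k2 s hs).const_mul _)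
  have inner : ∀ s, 0 < s → ∀ σ ∈ AA, u σ*Ph K s (ln σ+m) (ln σ) =
      (∫ t in Ioi (0:ℝ), R (σ, t)*Es s (I*t))+(TT 0 s*(u σ*(I*P0 σ))+TT 1 s*(u σ*(I*P1 σ))) := by
    intro s hs σ hσ
    have i1 := (QQ_int hκ hs (AA_U hσ).2.1 (AA_U hσ).2.2).const_mul (u σ)
    have i2 : IntegrableOn (fun t : ℝ => u σ*(I*P0 σ)*((if 1 ≤ t then (t:ℂ)^0 else 0)*Es s (I*t)) +
          u σ*(I*P1 σ)*((if 1 ≤ t then (t:ℂ)^1 else 0)*Es s (I*t))) (Ioi 0) :=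
      ((TT_int zero_le_one hs).const_mul (u σ*(I*P0 σ))).add ((TT_int le_rfl hs).const_mul (u σ*(I*P1 σ)))
    have e1 : (fun t : ℝ => R (σ, t)*Es s (I*t)) = fun t => u σ*QQ K s (ln σ+m) (ln σ) t -
        (u σ*(I*P0 σ)*((if 1 ≤ t then (t:ℂ)^0 else 0)*Es s (I*t)) +
          u σ*(I*P1 σ)*((if 1 ≤ t then (t:ℂ)^1 else 0)*Es s (I*t))) := by
      funext t
      simp only [hR, hlin, kp, QQ]
      split_ifs <;> ring
    rw [e1, integral_sub i1 i2, integral_add ((TT_int zero_le_one hs).const_mul _) ((TT_int le_rfl hs).const_mul _),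
      integral_const_mul, integral_const_mul, integral_const_mul, Ph, TT, TT]
    ring
  have cint : ∀ v : ℝ → ℂ, Continuous v → IntegrableOn v AA := fun v hv =>
    (hv.integrableOn_Icc (a := -(1/2)) (b := 1/2)).mono_set fun σ h => ⟨h.1.1.le, h.1.2⟩
  have i3 : ∀ s : ℝ, IntegrableOn (fun σ => TT 0 s*(u σ*(I*P0 σ))) AA := fun s => cint _ (by fun_prop)
  have i4 : ∀ s : ℝ, IntegrableOn (fun σ => TT 1 s*(u σ*(I*P1 σ))) AA := fun s => cint _ (by fun_prop)
  refine ⟨(SR.add (((SE_TT zero_le_one).smul (∫ σ in AA, u σ*(I*P0 σ))).add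
    ((SE_TT le_rfl).smul (∫ σ in AA, u σ*(I*P1 σ))))).congr fun s hs => ?_, fun s hs => ?_⟩
  · have i5 : IntegrableOn (fun σ => ∫ t in Ioi (0:ℝ), R (σ, t)*Es s (I*t)) AA := (iR s hs).integral_prod_left
    have i6 : IntegrableOn (fun σ => TT 0 s*(u σ*(I*P0 σ))+TT 1 s*(u σ*(I*P1 σ))) AA := (i3 s).add (i4 s)
    rw [setIntegral_congr_fun AA_meas (inner s hs), integral_add i5 i6,
      integral_add (i3 s) (i4 s), integral_const_mul, integral_const_mul, hμ, integral_prod _ (iR s hs)]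
    ring
  · exact IntegrableOn.congr_fun ((iR s hs).integral_prod_left.add ((i3 s).add (i4 s))) (fun σ hσ => (inner s hs σ hσ).symm) AA_meas
def wn (n : ℕ) (σ : ℝ) : ℂ := (1-cexp (2*π*I*n*σ))^4*cexp (-(2*π*I*n*ln σ))
lemma orth (k : ℤ) : ∫ σ in (-(1/2) : ℝ)..(1/2), cexp ((2*π*I*k)*σ) = if k = 0 then 1 else 0 := by
  split_ifs with h
  · simp [h]; norm_num
  · have h0 : (2*π*I*k : ℂ) ≠ 0 := by simp [h, Real.pi_ne_zero]
    rw [integral_exp_mul_complex h0]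
    have e : cexp (2*π*I*k*((1/2 : ℝ) : ℂ)) = cexp (2*π*I*k*((-(1/2) : ℝ) : ℂ)) := by
      rw [Complex.exp_eq_exp_iff_exists_int]
      exact ⟨k, by push_cast; ring⟩
    rw [e, sub_self, zero_div]
lemma wn_cont (n : ℕ) : Continuous (wn n) := by have := ln_cont; unfold wn; fun_prop
lemma wn_bound (n : ℕ) (σ : ℝ) : ‖wn n σ‖ ≤ ((2*π*n)^4*rexp (2*π*n))*|σ|^4 := by
  have h1 : ‖1-cexp (2*π*I*n*σ)‖ ≤ 2*π*n*|σ| := by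
    have := Real.norm_exp_I_mul_ofReal_sub_one_le (x := 2*π*n*σ)
    rw [norm_sub_rev]
    rw [Real.norm_eq_abs, abs_mul, abs_of_nonneg (by positivity : 0 ≤ 2*π*n)] at this
    refine le_trans (le_of_eq ?_) this
    congr 3; push_cast; ring
  have h2 : ‖cexp (-(2*π*I*n*ln σ))‖ = rexp (2*π*n) := by
    rw [Complex.norm_exp]; congr 1; simp [ln]
  rw [wn, norm_mul, norm_pow, h2]
  have := pow_le_pow_left₀ (norm_nonneg _) h1 4
  have h3 := mul_le_mul_of_nonneg_right this (Real.exp_pos (2*π*n)).le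
  linarith [show (2*π*n*|σ|)^4*rexp (2*π*n) = ((2*π*n)^4*rexp (2*π*n))*|σ|^4 by ring]
lemma extract {c : ℕ → ℂ} (h0 : c 0 = 0) {φ : ℂ → ℂ} (h : ∀ Q ∈ HH, HasSum (fun m : ℕ => c m*cexp (2*π*I*m*Q)) (φ Q))
    {n : ℕ} (hn : 1 ≤ n) : c n = ∫ σ in AA, wn n σ*φ (ln σ) := by
  have e0 : ∫ σ in AA, wn n σ*φ (ln σ) = ∫ σ in (-(1/2) : ℝ)..(1/2), wn n σ*φ (ln σ) := by
    rw [intervalIntegral.integral_of_le (by norm_num)]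
    exact setIntegral_congr_set (sdiff_null_ae_eq_self (by simp))
  set x : ℤ → ℝ → ℂ := fun k σ => cexp ((2*π*I*k)*σ) with hx
  set F : ℕ → ℝ → ℂ := fun m σ => wn n σ*(c m*cexp (2*π*I*m*ln σ)) with hF
  have eF : ∀ m σ, F m σ = (c m*cexp (2*π*(n-m)))*(x (m-n) σ-4*x m σ+6*x (m+n) σ-4*x (m+2*n) σ
      + x (m+3*n) σ) := by
    intro m σ
    set y := cexp (2*π*I*n*σ) with hy
    set w := cexp (2*π*I*m*σ) with hw
    have e1 : cexp (2*π*I*m*ln σ) = w*cexp (-(2*π*m)) := by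
      rw [hw, ← Complex.exp_add, ln]; congr 1; linear_combination (2*π*m)*I_sq
    have e2 : cexp (-(2*π*I*n*ln σ)) = cexp (-(2*π*I*n*σ))*cexp (2*π*n) := by
      rw [← Complex.exp_add, ln]; congr 1; linear_combination (-2*π*n)*I_sq
    have e3 : cexp (2*π*(n-m)) = cexp (2*π*n)*cexp (-(2*π*m)) := by
      rw [← Complex.exp_add]; congr 1; ring
    have e4 : x (m-n) σ = w*cexp (-(2*π*I*n*σ)) := by rw [hw, hx, ← Complex.exp_add]; push_cast; congr 1; ring
    have e5 : x m σ = w := by simp [hx, hw]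
    have e6 : x (m+n) σ = w*y := by rw [hw, hy, hx, ← Complex.exp_add]; push_cast; congr 1; ring
    have e7 : x (m+2*n) σ = w*y^2 := by
      rw [hw, hy, hx, ← Complex.exp_nat_mul, ← Complex.exp_add]; push_cast; congr 1; ring
    have e8 : x (m+3*n) σ = w*y^3 := by
      rw [hw, hy, hx, ← Complex.exp_nat_mul, ← Complex.exp_add]; push_cast; congr 1; ring
    have e9 : y*cexp (-(2*π*I*n*σ)) = 1 := by rw [hy, ← Complex.exp_add]; simp
    simp only [hF, wn]
    rw [e1, e2, e3, e4, e5, e6, e7, e8, ← hy]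
    linear_combination (c m*cexp (2*π*n)*cexp (-(2*π*m))*w*(-4+6*y-4*y^2+y^3))*e9
  have cx : ∀ k, Continuous (x k) := fun k => by simp only [hx]; fun_prop
  have ix : ∀ k, IntervalIntegrable (x k) volume (-(1/2)) (1/2) := fun k => (cx k).intervalIntegrable _ _
  have ox : ∀ k : ℤ, ∫ σ in (-(1/2) : ℝ)..(1/2), x k σ = if k = 0 then 1 else 0 := orth
  have iF : ∀ m, ∫ σ in (-(1/2) : ℝ)..(1/2), F m σ = if m = n then c n else 0 := by
    intro m
    rw [intervalIntegral.integral_congr (fun σ _ => eF m σ), intervalIntegral.integral_const_mul,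
      intervalIntegral.integral_add ((((ix _).sub ((ix _).const_mul _)).add ((ix _).const_mul _)).sub ((ix _).const_mul _)) (ix _),
      intervalIntegral.integral_sub (((ix _).sub ((ix _).const_mul _)).add ((ix _).const_mul _)) ((ix _).const_mul _),
      intervalIntegral.integral_add ((ix _).sub ((ix _).const_mul _)) ((ix _).const_mul _),
      intervalIntegral.integral_sub (ix _) ((ix _).const_mul _),
      intervalIntegral.integral_const_mul, intervalIntegral.integral_const_mul, intervalIntegral.integral_const_mul,
      ox, ox, ox, ox, ox]
    rcases Nat.eq_zero_or_pos m with rfl | hm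
    · rw [h0, if_neg (by omega : ¬ 0 = n)]; simp
    · rw [if_neg (by omega : ¬ (m:ℤ) = 0), if_neg (by omega : ¬ (m+n : ℤ) = 0), if_neg (by omega : ¬ (m+2*n : ℤ) = 0),
        if_neg (by omega : ¬ (m+3*n : ℤ) = 0)]
      by_cases hmn : m = n
      · rw [if_pos (by omega), if_pos hmn, hmn]; simp
      · rw [if_neg (by omega), if_neg hmn]; simp
  have hs : Summable fun m : ℕ => ‖c m*cexp (2*π*I*m*ln 0)‖ := (h _ (ln_HH 0)).summable.norm
  have key := intervalIntegral.hasSum_integral_of_dominated_convergence (F := F) (f := fun σ => wn n σ*φ (ln σ)) (μ := volume)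
    (a := -(1/2)) (b := 1/2)
    (fun m _ => ((2*π*n)^4*rexp (2*π*n))*‖c m*cexp (2*π*I*m*ln 0)‖) ?_ ?_ ?_ ?_ ?_
  · simp only [iF] at key
    rw [e0]
    exact (hasSum_ite_eq n (c n)).unique key
  · intro m
    have := ln_cont
    have := wn_cont n
    exact (by fun_prop : Continuous (F m)).aestronglyMeasurable
  · intro m
    refine ae_of_all _ fun σ hσ => ?_
    rw [uIoc_of_le (by norm_num)] at hσ
    have h1 : |σ|^4 ≤ 1 := pow_le_one₀ (abs_nonneg _) ((abs_le.2 ⟨hσ.1.le, hσ.2⟩).trans (by norm_num))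
    have h2 : ‖c m*cexp (2*π*I*m*ln σ)‖ = ‖c m*cexp (2*π*I*m*ln 0)‖ := by
      rw [norm_mul, norm_mul, Complex.norm_exp, Complex.norm_exp]; congr 2; simp [ln]
    rw [norm_mul, h2]
    refine mul_le_mul_of_nonneg_right ((wn_bound n σ).trans ?_) (norm_nonneg _)
    exact mul_le_of_le_one_right (by positivity) h1
  · exact ae_of_all _ fun σ _ => hs.mul_left _
  · exact intervalIntegrable_const
  · exact ae_of_all _ fun σ _ => (h _ (ln_HH σ)).mul_left _
def SI (g : ℝ → ℝ → ℂ) : Prop := SE (fun s => ∫ σ in AA, g s σ) ∧ ∀ s, 0 < s → IntegrableOn (g s) AA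
lemma SI.add {g h : ℝ → ℝ → ℂ} (G : SI g) (H : SI h) : SI (fun s σ => g s σ+h s σ) :=
  ⟨(G.1.add H.1).congr fun s hs => integral_add (G.2 s hs) (H.2 s hs), fun s hs => (G.2 s hs).add (H.2 s hs)⟩
lemma SI.smul {g : ℝ → ℝ → ℂ} (c : ℂ) (G : SI g) : SI (fun s σ => c*g s σ) :=
  ⟨(G.1.smul c).congr fun s _ => integral_const_mul _ _, fun s hs => (G.2 s hs).const_mul c⟩
lemma SI.congr {g h : ℝ → ℝ → ℂ} (G : SI g) (e : ∀ s, 0 < s → ∀ σ ∈ AA, h s σ = g s σ) : SI h :=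
  ⟨G.1.congr fun s hs => setIntegral_congr_fun AA_meas (e s hs),
    fun s hs => (G.2 s hs).congr_fun (fun σ hσ => (e s hs σ hσ).symm) AA_meas⟩
structure Wt (u : ℝ → ℂ) (U : ℝ) : Prop where
  c : Continuous u
  p : 0 ≤ U
  b : ∀ σ ∈ AA, ‖u σ‖ ≤ U*|σ|^4
lemma Wt.mul_ln {u : ℝ → ℂ} {U : ℝ} (h : Wt u U) : Wt (fun σ => u σ*ln σ) (U*3) := by
  refine ⟨h.c.mul ln_cont, by linarith [h.p], fun σ hσ => ?_⟩
  have := AA_norm hσ (m := 0) (by simp)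
  rw [Complex.ofReal_zero, add_zero] at this
  rw [norm_mul]
  exact (mul_le_mul (h.b σ hσ) this (norm_nonneg _) (by have := h.p; positivity)).trans (le_of_eq (by ring))
lemma SI_ee {v : ℝ → ℂ} (hv : Measurable v) {U : ℝ} (hU : 0 ≤ U) (hb : ∀ σ ∈ AA, ‖v σ‖ ≤ U*|σ|^4) {k : ℝ} (hk : |k| ≤ 1) :
    SI fun s σ => v σ*ee s (ln σ+k) := by
  have := ln_cont.measurable
  refine SE_bd AA_meas AA_vol (by fun_prop) (fun σ => by simp [ln_im]) hv (V := U) (Z := 5) (fun σ hσ => ?_) fun σ hσ => ?_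
  · refine (hb σ hσ).trans (mul_le_of_le_one_right hU (pow_le_one₀ (abs_nonneg _) ((AA_abs hσ).trans (by norm_num))))
  · have h1 := AA_norm hσ hk
    have h2 : (ln σ+(k:ℂ)).im = 1 := by simp [ln_im]
    rw [h2]; linarith
section
variable {K : Ker ε} {W : ℝ → ℂ → Fin 3 → ℂ} {B : ℝ} {N : ℕ} {C : ℝ} {A : ℕ} {u : ℝ → ℂ} {U : ℝ}
lemma SI_W0 (hW : ∀ s, 0 < s → Pk K s B N C A (W s)) (hu : Wt u U) : SI fun s σ => u σ*W s (ln σ) 0 := by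
  have h : SI _ := SE_Ph K (m := 0) (by simp) (by simpa using KB0 K) hu.c hu.p hu.b
  refine h.congr fun s hs σ hσ => ?_
  rw [(hW s hs).base.psi _ (AA_U hσ).1 (AA_U hσ).2.2, Complex.ofReal_zero, add_zero]
lemma SI_W1 (hW : ∀ s, 0 < s → Pk K s B N C A (W s)) (hu : Wt u U) : SI fun s σ => u σ*W s (ln σ) 1 := by
  have h : SI _ := SE_Ph K (m := 1) (by simp) (by simpa using KB1 K) hu.c hu.p hu.b
  set v : ℝ → ℂ := fun σ => if 0 < σ then u σ else 0 with hv
  have mv : Measurable v := Measurable.ite measurableSet_Ioi hu.c.measurable measurable_const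
  have bv : ∀ σ ∈ AA, ‖v σ‖ ≤ U*|σ|^4 := by
    intro σ hσ
    simp only [hv]
    split_ifs
    · exact hu.b σ hσ
    · rw [norm_zero]; have := hu.p; positivity
  have g : ∀ k : ℝ, |k| ≤ 1 → SI fun s σ => v σ*ee s (ln σ+k) := fun k hk => SI_ee mv hu.p bv hk
  refine (h.add (((g 1 (by simp)).smul (-1)).add (((g 0 (by simp)).smul 2).add ((g (-1) (by simp)).smul (-1))))).congr
    fun s hs σ hσ => ?_
  have h0 := (AA_U hσ).2.2
  rw [ln_re] at h0
  push_cast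
  simp only [hv]
  rcases lt_or_gt_of_ne h0 with h1 | h1
  · rw [(hW s hs).base.G1n _ (AA_U hσ).1 (by rwa [ln_re]), if_neg h1.not_gt]; ring
  · rw [(hW s hs).base.G1p _ (AA_U hσ).1 (by rwa [ln_re]), if_pos h1, Es_eq]; ring_nf
lemma Glob.T0 {s : ℝ} {W : ℂ → Fin 3 → ℂ} (h : Glob ε s W) {Q : ℂ} (hQ : Q ∈ HH) : W (Q+1) 0 = W Q 1 := by
  rw [h.T Q hQ]; simp [Mf, hf]
lemma Glob.S0 {s : ℝ} {W : ℂ → Fin 3 → ℂ} (h : Glob ε s W) {Q : ℂ} (hQ : Q ∈ HH) : W (-1/Q) 0 = -ε*Q^4*W Q 0 := by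
  rw [h.S Q hQ]; simp [Nf]; ring
lemma SI_FF (hW : ∀ s, 0 < s → Pk K s B N C A (W s)) (hu : Wt u U) : SI fun s σ => u σ*FF s (W s) (ln σ) :=
  ((SI_W0 hW hu).add (SI_ee hu.c.measurable hu.p hu.b (k := 0) (by simp))).congr fun s hs σ hσ => by
    rw [FF, Complex.ofReal_zero, add_zero]; ring
lemma SI_bt (hW : ∀ s, 0 < s → Pk K s B N C A (W s)) (hu : Wt u U) : SI fun s σ => u σ*bt s (W s) (ln σ) :=
  ((SI_W1 hW hu).add ((SI_ee hu.c.measurable hu.p hu.b (k := 1) (by simp)).add ((SI_FF hW hu).smul (-1)))).congr fun s hs σ hσ => by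
    rw [bt, FF, (hW s hs).glob.T0 (ln_HH σ), Complex.ofReal_one]; ring
lemma coef_SE (hW : ∀ s, 0 < s → Pk K s B N C A (W s)) {D : ℝ} {A' : ℕ} {a b : ℝ → ℕ → ℂ}
    (hc : ∀ s, 0 < s → Cf s (W s) D A' (a s) (b s)) (n : ℕ) : SE (fun s => a s n) ∧ SE (fun s => b s n) := by
  rcases Nat.eq_zero_or_pos n with rfl | hn
  · exact ⟨⟨0, fun s hs => by simp [(hc s hs).a0]⟩, ⟨0, fun s hs => by simp [(hc s hs).b0]⟩⟩
  have hw : Wt (wn n) ((2*π*n)^4*rexp (2*π*n)) := ⟨wn_cont n, by positivity, fun σ _ => wn_bound n σ⟩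
  have h2 := SI_bt hW hw
  have h1 : SI fun s σ => wn n σ*at' s (W s) (ln σ) :=
    ((SI_FF hW hw).add ((SI_bt hW hw.mul_ln).smul (-1))).congr fun s hs σ hσ => by rw [at']; ring
  exact ⟨h1.1.congr fun s hs => extract (hc s hs).a0 (hc s hs).sa hn, h2.1.congr fun s hs => extract (hc s hs).b0 (hc s hs).sb hn⟩
end
lemma npow_exp (n k : ℕ) {y : ℝ} (hy : 0 < y) :
    ((n:ℝ)+1)^k*rexp (-(2*π*n*y)) ≤ (k.factorial*rexp 1)*(1+y⁻¹)^k := by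
  have h1 : (n:ℝ)+1 ≤ (1+n*y)*(1+y⁻¹) := by
    have : (1+n*y)*(1+y⁻¹) = n+1+y⁻¹+n*y := by field_simp; ring
    rw [this]; have := inv_pos.2 hy; nlinarith [mul_nonneg (Nat.cast_nonneg (α := ℝ) n) hy.le]
  have h2 : (1+n*y)^k/k.factorial ≤ rexp (1+n*y) := Real.pow_div_factorial_le_exp _ (by positivity) k
  have h3 : rexp (1+n*y)*rexp (-(2*π*n*y)) ≤ rexp 1 := by
    rw [← Real.exp_add]
    refine Real.exp_le_exp.2 ?_
    nlinarith [mul_nonneg (Nat.cast_nonneg (α := ℝ) n) hy.le, Real.pi_gt_three]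
  have h4 := pow_le_pow_left₀ (by positivity) h1 k
  rw [div_le_iff₀ (by positivity)] at h2
  have h5 : 0 ≤ (1+y⁻¹)^k := by positivity
  calc _ ≤ ((1+n*y)*(1+y⁻¹))^k*rexp (-(2*π*n*y)) := mul_le_mul_of_nonneg_right h4 (Real.exp_pos _).le
    _ = (1+n*y)^k*(rexp (-(2*π*n*y))*(1+y⁻¹)^k) := by rw [mul_pow]; ring
    _ ≤ (rexp (1+n*y)*k.factorial)*(rexp (-(2*π*n*y))*(1+y⁻¹)^k) :=
        mul_le_mul_of_nonneg_right h2 (by positivity)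
    _ = (rexp (1+n*y)*rexp (-(2*π*n*y)))*(k.factorial*(1+y⁻¹)^k) := by ring
    _ ≤ rexp 1*(k.factorial*(1+y⁻¹)^k) := mul_le_mul_of_nonneg_right h3 (by positivity)
    _ = _ := by ring
lemma norm_q (n : ℕ) (Q : ℂ) : ‖cexp (2*π*I*n*Q)‖ = rexp (-(2*π*n*Q.im)) := by
  rw [Complex.norm_exp]; congr 1; simp
lemma sum_inv2 : Summable fun n : ℕ => ((n:ℝ)+1)⁻¹^2 := by
  have := (summable_nat_add_iff 1).2 (Real.summable_nat_pow_inv.2 (by norm_num : 1 < 2))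
  simpa using this
lemma coef_q {c : ℂ} {D : ℝ} {A n : ℕ} (hD : 0 ≤ D) (h : ‖c‖ ≤ D*(n+1)^A) {Q : ℂ} (hQ : Q ∈ HH) :
    ‖c*cexp (2*π*I*n*Q)‖ ≤ (D*((A+2).factorial*rexp 1)*(1+Q.im⁻¹)^(A+2))*((n:ℝ)+1)⁻¹^2 := by
  have hn : (0:ℝ) < n+1 := by positivity
  have h1 := npow_exp n (A+2) (y := Q.im) hQ
  rw [norm_mul, norm_q]
  calc _ ≤ D*(n+1)^A*rexp (-(2*π*n*Q.im)) := mul_le_mul_of_nonneg_right h (Real.exp_pos _).le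
    _ = D*(((n:ℝ)+1)^(A+2)*rexp (-(2*π*n*Q.im)))*((n:ℝ)+1)⁻¹^2 := by field_simp; ring
    _ ≤ D*((A+2).factorial*rexp 1*(1+Q.im⁻¹)^(A+2))*((n:ℝ)+1)⁻¹^2 :=
      mul_le_mul_of_nonneg_right (mul_le_mul_of_nonneg_left h1 hD) (by positivity)
    _ = _ := by ring
lemma fam (K : Ker ε) (hε : ε^2 = 1) : ∃ (a b : ℕ → 𝓢(ℝ, ℂ)) (D : ℝ) (A : ℕ), 0 ≤ D ∧
    ∀ s, 0 < s → ∃ W, Glob ε s W ∧ Cf s W D A (fun n => a n s) (fun n => b n s) := by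
  obtain ⟨B, hB, N, C, hC, A, h⟩ := pk_exists K hε
  obtain ⟨D, hD, h'⟩ := cf_exists K N hC A
  choose! W hW using h
  have h2 : ∀ s, 0 < s → ∃ a b, Cf s (W s) D A a b := fun s hs => h' s B hs (W s) (hW s hs)
  choose! a b hab using h2
  have h3 := coef_SE hW hab
  choose G hG using fun n => (h3 n).1
  choose H hH using fun n => (h3 n).2
  refine ⟨G, H, D, A, hD, fun s hs => ⟨W s, (hW s hs).glob, ?_⟩⟩
  have e1 : (fun n => G n s) = a s := funext fun n => hG n s hs
  have e2 : (fun n => H n s) = b s := funext fun n => hH n s hs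
  rw [e1, e2]; exact hab s hs
lemma Cf.F {s : ℝ} {W : ℂ → Fin 3 → ℂ} {D : ℝ} {A : ℕ} {a b : ℕ → ℂ} (h : Cf s W D A a b) {Q : ℂ} (hQ : Q ∈ HH) :
    HasSum (fun n : ℕ => a n*cexp (2*π*I*n*Q)+Q*(b n*cexp (2*π*I*n*Q))) (W Q 0+ee s Q) := by
  have := (h.sa Q hQ).add ((h.sb Q hQ).mul_left Q)
  rwa [at', sub_add_cancel, FF] at this
structure GI (a b c d : ℕ → 𝓢(ℝ, ℂ)) (D : ℝ) (A : ℕ) : Prop where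
  D0 : 0 ≤ D
  ba : ∀ n : ℕ, ∀ s : ℝ, 0 ≤ s → ‖a n s‖ ≤ D*(n+1)^A
  bb : ∀ n : ℕ, ∀ s : ℝ, 0 ≤ s → ‖b n s‖ ≤ D*(n+1)^A
  bc : ∀ n : ℕ, ∀ s : ℝ, 0 ≤ s → ‖c n s‖ ≤ D*(n+1)^A
  bd : ∀ n : ℕ, ∀ s : ℝ, 0 ≤ s → ‖d n s‖ ≤ D*(n+1)^A
  z : ∀ s : ℝ, 0 ≤ s → a 0 s = 0 ∧ b 0 s = 0 ∧ c 0 s = 0 ∧ d 0 s = 0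
  h : ∀ s : ℝ, 0 ≤ s → ∀ Q ∈ HH, HasSum (fun n : ℕ => (a n s*cexp (2*π*I*n*Q)+Q*(b n s*cexp (2*π*I*n*Q)))
    + Q⁻¹^4*(c n s*cexp (2*π*I*n*(-1/Q))+(-1/Q)*(d n s*cexp (2*π*I*n*(-1/Q))))) (ee s Q)
lemma ext0 {P : ℝ → Prop} (hP : IsClosed {s | P s}) (h : ∀ s, 0 < s → P s) : ∀ s, 0 ≤ s → P s := by
  have h1 : closure (Ioi (0:ℝ)) ⊆ {s | P s} := closure_minimal h hP
  rw [closure_Ioi] at h1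
  exact h1
lemma gi_exists : ∃ a b c d D A, GI a b c d D A := by
  obtain ⟨a, b, D, A, hD, h⟩ := fam kerP (by norm_num)
  obtain ⟨a', b', D', A', hD', h'⟩ := fam kerM (by norm_num)
  have bdd : ∀ n : ℕ, ∀ x y : ℂ, ‖x‖ ≤ D*(n+1)^A → ‖y‖ ≤ D'*(n+1)^A' →
      ‖(1/2 : ℂ)*x+(1/2 : ℂ)*y‖ ≤ (D+D')*(n+1)^(A+A') ∧ ‖(1/2 : ℂ)*x+(-1/2 : ℂ)*y‖ ≤ (D+D')*(n+1)^(A+A') := by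
    intro n x y hx hy
    have h1 : (1:ℝ) ≤ n+1 := by linarith [Nat.cast_nonneg (α := ℝ) n]
    have h2 := mul_le_mul_of_nonneg_left (pow_le_pow_right₀ h1 (Nat.le_add_right A A')) hD
    have h3 := mul_le_mul_of_nonneg_left (pow_le_pow_right₀ h1 (Nat.le_add_left A' A)) hD'
    have h4 := norm_nonneg x
    have h5 := norm_nonneg y
    constructor <;> refine (norm_add_le _ _).trans ?_ <;> rw [norm_mul, norm_mul] <;> norm_num <;> linarith
  set p : ℕ → 𝓢(ℝ, ℂ) := fun n => (1/2 : ℂ) • a n+(1/2 : ℂ) • a' n with hp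
  set q : ℕ → 𝓢(ℝ, ℂ) := fun n => (1/2 : ℂ) • b n+(1/2 : ℂ) • b' n with hq
  set r : ℕ → 𝓢(ℝ, ℂ) := fun n => (1/2 : ℂ) • a n+(-1/2 : ℂ) • a' n with hr
  set t : ℕ → 𝓢(ℝ, ℂ) := fun n => (1/2 : ℂ) • b n+(-1/2 : ℂ) • b' n with ht
  have ep : ∀ n s, p n s = (1/2 : ℂ)*a n s+(1/2 : ℂ)*a' n s := fun n s => rfl
  have eq : ∀ n s, q n s = (1/2 : ℂ)*b n s+(1/2 : ℂ)*b' n s := fun n s => rfl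
  have er : ∀ n s, r n s = (1/2 : ℂ)*a n s+(-1/2 : ℂ)*a' n s := fun n s => rfl
  have et : ∀ n s, t n s = (1/2 : ℂ)*b n s+(-1/2 : ℂ)*b' n s := fun n s => rfl
  have cl : ∀ (G : 𝓢(ℝ, ℂ)) (M : ℝ), IsClosed {s | ‖G s‖ ≤ M} := fun G M => isClosed_le G.continuous.norm continuous_const
  have cz : ∀ (G : 𝓢(ℝ, ℂ)), IsClosed {s | G s = 0} := fun G => isClosed_eq G.continuous continuous_const
  have h1 : ∀ n : ℕ, ∀ s : ℝ, 0 ≤ s → ‖p n s‖ ≤ (D+D')*(n+1)^(A+A') := fun n => ext0 (cl _ _) fun s hs => by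
    obtain ⟨W, -, hc⟩ := h s hs
    obtain ⟨W', -, hc'⟩ := h' s hs
    rw [ep]; exact (bdd n _ _ (hc.ba n) (hc'.ba n)).1
  have h2 : ∀ n : ℕ, ∀ s : ℝ, 0 ≤ s → ‖q n s‖ ≤ (D+D')*(n+1)^(A+A') := fun n => ext0 (cl _ _) fun s hs => by
    obtain ⟨W, -, hc⟩ := h s hs
    obtain ⟨W', -, hc'⟩ := h' s hs
    rw [eq]; exact (bdd n _ _ (hc.bb n) (hc'.bb n)).1
  have h3 : ∀ n : ℕ, ∀ s : ℝ, 0 ≤ s → ‖r n s‖ ≤ (D+D')*(n+1)^(A+A') := fun n => ext0 (cl _ _) fun s hs => by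
    obtain ⟨W, -, hc⟩ := h s hs
    obtain ⟨W', -, hc'⟩ := h' s hs
    rw [er]; exact (bdd n _ _ (hc.ba n) (hc'.ba n)).2
  have h4 : ∀ n : ℕ, ∀ s : ℝ, 0 ≤ s → ‖t n s‖ ≤ (D+D')*(n+1)^(A+A') := fun n => ext0 (cl _ _) fun s hs => by
    obtain ⟨W, -, hc⟩ := h s hs
    obtain ⟨W', -, hc'⟩ := h' s hs
    rw [et]; exact (bdd n _ _ (hc.bb n) (hc'.bb n)).2
  have D0 : 0 ≤ D+D' := by linarith
  refine ⟨p, q, r, t, D+D', A+A', D0, h1, h2, h3, h4, ?_, ?_⟩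
  · have z0 : ∀ s : ℝ, 0 < s → (a 0 s = 0 ∧ b 0 s = 0) ∧ a' 0 s = 0 ∧ b' 0 s = 0 := fun s hs => by
      obtain ⟨W, -, hc⟩ := h s hs
      obtain ⟨W', -, hc'⟩ := h' s hs
      exact ⟨⟨hc.a0, hc.b0⟩, hc'.a0, hc'.b0⟩
    exact fun s hs => ⟨ext0 (cz _) (fun s hs => by rw [ep, (z0 s hs).1.1, (z0 s hs).2.1]; ring) s hs,
      ext0 (cz _) (fun s hs => by rw [eq, (z0 s hs).1.2, (z0 s hs).2.2]; ring) s hs,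
      ext0 (cz _) (fun s hs => by rw [er, (z0 s hs).1.1, (z0 s hs).2.1]; ring) s hs,
      ext0 (cz _) (fun s hs => by rw [et, (z0 s hs).1.2, (z0 s hs).2.2]; ring) s hs⟩
  intro s hs Q hQ
  have hQ0 := HH_ne_zero hQ
  have hQ' := HH_neg_inv hQ
  have pos : ∀ s : ℝ, 0 < s → HasSum (fun n : ℕ => (p n s*cexp (2*π*I*n*Q)+Q*(q n s*cexp (2*π*I*n*Q)))
    + Q⁻¹^4*(r n s*cexp (2*π*I*n*(-1/Q))+(-1/Q)*(t n s*cexp (2*π*I*n*(-1/Q))))) (ee s Q) := by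
    intro s hs
    obtain ⟨W, hg, hc⟩ := h s hs
    obtain ⟨W', hg', hc'⟩ := h' s hs
    have k1 := ((hc.F hQ).mul_left (1/2)).add ((hc'.F hQ).mul_left (1/2))
    have k2 := (((hc.F hQ').mul_left (1/2)).add ((hc'.F hQ').mul_left (-1/2))).mul_left (Q⁻¹^4)
    have k3 := k1.add k2
    rw [hg.S0 hQ, hg'.S0 hQ] at k3
    have e : 1/2*(W Q 0+ee s Q)+1/2*(W' Q 0+ee s Q)+Q⁻¹^4*(1/2*(-1*Q^4*W Q 0+ee s (-1/Q))
        + -1/2*(- -1*Q^4*W' Q 0+ee s (-1/Q))) = ee s Q := by field_simp; ring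
    rw [e] at k3
    refine (funext fun n => ?_ : (fun n : ℕ => _) = _) ▸ k3
    rw [ep, eq, er, et]; ring
  set T : ℕ → ℝ → ℂ := fun n s => (p n s*cexp (2*π*I*n*Q)+Q*(q n s*cexp (2*π*I*n*Q)))
    + Q⁻¹^4*(r n s*cexp (2*π*I*n*(-1/Q))+(-1/Q)*(t n s*cexp (2*π*I*n*(-1/Q)))) with hT
  set M1 := (D+D')*((A+A'+2).factorial*rexp 1)*(1+Q.im⁻¹)^(A+A'+2) with hM1
  set M2 := (D+D')*((A+A'+2).factorial*rexp 1)*(1+(-1/Q).im⁻¹)^(A+A'+2) with hM2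
  have bT : ∀ n, ∀ s ∈ Ici (0:ℝ), ‖T n s‖ ≤ (M1+‖Q‖*M1+‖Q⁻¹^4‖*(M2+‖-1/Q‖*M2))*((n:ℝ)+1)⁻¹^2 := by
    intro n s hs
    have j1 := coef_q D0 (h1 n s hs) hQ
    have j2 := coef_q D0 (h2 n s hs) hQ
    have j3 := coef_q D0 (h3 n s hs) hQ'
    have j4 := coef_q D0 (h4 n s hs) hQ'
    rw [← hM1] at j1 j2
    rw [← hM2] at j3 j4
    refine (norm_add_le _ _).trans ?_
    rw [norm_mul (Q⁻¹^4)]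
    have i1 := norm_add_le (p n s*cexp (2*π*I*n*Q)) (Q*(q n s*cexp (2*π*I*n*Q)))
    have i2 := norm_add_le (r n s*cexp (2*π*I*n*(-1/Q))) ((-1/Q)*(t n s*cexp (2*π*I*n*(-1/Q))))
    rw [norm_mul Q] at i1
    rw [norm_mul (-1/Q)] at i2
    have i3 := mul_le_mul_of_nonneg_left j2 (norm_nonneg Q)
    have i4 := mul_le_mul_of_nonneg_left j4 (norm_nonneg (-1/Q))
    have i5 := mul_le_mul_of_nonneg_left (i2.trans (add_le_add j3 i4)) (norm_nonneg (Q⁻¹^4))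
    linarith
  have sM := sum_inv2.mul_left (M1+‖Q‖*M1+‖Q⁻¹^4‖*(M2+‖-1/Q‖*M2))
  have cT : ContinuousOn (fun s => ∑' n, T n s) (Ici 0) := by
    refine continuousOn_tsum (fun n => ?_) sM bT
    have c1 := (p n).continuous
    have c2 := (q n).continuous
    have c3 := (r n).continuous
    have c4 := (t n).continuous
    exact (by fun_prop : Continuous (T n)).continuousOn
  have cE : ContinuousOn (fun s : ℝ => ee s Q) (Ici 0) := by unfold ee; fun_prop
  have eqv : ∑' n, T n s = ee s Q := by
    have hcl : EqOn (fun s => ∑' n, T n s) (fun s : ℝ => ee s Q) (Ici 0) :=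
      EqOn.of_subset_closure (s := Ioi 0) (fun s hs => (pos s hs).tsum_eq) cT cE Ioi_subset_Ici_self (by rw [closure_Ioi])
    exact hcl hs
  rw [← eqv]
  exact (Summable.of_norm_bounded sM fun n => bT n s hs).hasSum
def MM (Q : ℂ) : ℝ := 1+‖Q‖+Q.im⁻¹
lemma MM_facts (h : Q ∈ HH) : 1 ≤ MM Q ∧ ‖Q‖ ≤ MM Q ∧ Q.im⁻¹ ≤ MM Q ∧ ‖Q⁻¹‖ ≤ MM Q ∧ MM (-1/Q) ≤ MM Q^3 := by
  have h0 : 0 < Q.im := h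
  have h1 := inv_pos.2 h0
  have h2 := norm_nonneg Q
  have h3 : ‖Q⁻¹‖ ≤ Q.im⁻¹ := by
    rw [norm_inv]; exact inv_anti₀ h0 ((le_abs_self _).trans (Complex.abs_im_le_norm Q))
  have h4 : (-1/Q).im⁻¹ = ‖Q‖^2*Q.im⁻¹ := by
    rw [im_neg_inv, Complex.normSq_eq_norm_sq, inv_div, div_eq_mul_inv]
  have h5 : ‖-1/Q‖ = ‖Q⁻¹‖ := by rw [neg_div, norm_neg, one_div]
  refine ⟨by unfold MM; linarith, by unfold MM; linarith, by unfold MM; linarith, by unfold MM; linarith, ?_⟩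
  unfold MM
  rw [h4, h5]
  refine (add_le_add_left (add_le_add_right h3 1) _).trans ?_
  have := mul_nonneg h2 h1.le
  have := mul_nonneg (sq_nonneg ‖Q‖) h1.le
  have : (1+‖Q‖+Q.im⁻¹)^3 = 1+Q.im⁻¹+‖Q‖^2*Q.im⁻¹+(3*‖Q‖+2*Q.im⁻¹+3*‖Q‖^2+3*Q.im⁻¹^2
    + 6*‖Q‖*Q.im⁻¹+‖Q‖^3+Q.im⁻¹^3+2*‖Q‖^2*Q.im⁻¹+3*‖Q‖*Q.im⁻¹^2) := by ring
  rw [this]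
  exact le_add_of_nonneg_right (by positivity)
variable {μ : Measure (ℝ × ℝ)} {w Q : ℝ × ℝ → ℂ} {J : ℕ}
structure AJ (μ : Measure (ℝ × ℝ)) (w Q : ℝ × ℝ → ℂ) (J : ℕ) : Prop where
  mw : AEStronglyMeasurable w μ
  mt : Measurable Q
  pos : ∀ p, Q p ∈ HH
  i : Integrable (fun p => ‖w p‖*MM (Q p)^J) μ
lemma MM_meas : Measurable MM := by unfold MM; fun_prop
lemma AJ.of (h : AJ μ w Q J) {Q' v : ℝ × ℝ → ℂ} (mt : Measurable Q') (hp : ∀ p, Q' p ∈ HH) (mv : Measurable v) {j : ℕ}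
    (hb : ∀ p, ‖v p‖*MM (Q' p)^j ≤ MM (Q p)^J) : AJ μ (fun p => w p*v p) Q' j := by
  have m := MM_meas
  refine ⟨h.mw.mul mv.aestronglyMeasurable, mt, hp, h.i.mono' ?_ (ae_of_all _ fun p => ?_)⟩
  · exact (h.mw.mul mv.aestronglyMeasurable).norm.mul (Measurable.aestronglyMeasurable (by fun_prop))
  · have := (MM_facts (hp p)).1
    rw [Real.norm_of_nonneg (by positivity), norm_mul, mul_assoc]
    exact mul_le_mul_of_nonneg_left (hb p) (norm_nonneg _)
lemma AJ.mono (h : AJ μ w Q J) {j : ℕ} (hj : j ≤ J) : AJ μ w Q j := by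
  have := h.of h.mt h.pos (v := fun _ => 1) (by fun_prop) (j := j) fun p => by
    rw [norm_one, one_mul]; exact pow_le_pow_right₀ (MM_facts (h.pos p)).1 hj
  simpa using this
lemma AJ.mul_tau (h : AJ μ w Q (J+1)) : AJ μ (fun p => w p*Q p) Q J :=
  h.of h.mt h.pos h.mt fun p => by
    have h1 := MM_facts (h.pos p)
    have := pow_nonneg (zero_le_one.trans h1.1) J
    rw [pow_succ']; exact mul_le_mul_of_nonneg_right h1.2.1 this
lemma AJ.inv (h : AJ μ w Q (3*J+4)) : AJ μ (fun p => w p*(Q p)⁻¹^4) (fun p => -1/Q p) J :=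
  h.of (by have := h.mt; fun_prop) (fun p => HH_neg_inv (h.pos p)) (by have := h.mt; fun_prop) fun p => by
    have h1 := MM_facts (h.pos p)
    have h2 := MM_facts (HH_neg_inv (h.pos p))
    have h3 := pow_le_pow_left₀ (norm_nonneg _) h1.2.2.2.1 4
    have h4 := pow_le_pow_left₀ (zero_le_one.trans h2.1) h1.2.2.2.2 J
    rw [norm_pow, pow_add, pow_mul, mul_comm]
    have := zero_le_one.trans h1.1
    exact mul_le_mul h4 h3 (by positivity) (by positivity)
lemma AJ.int (h : AJ μ w Q J) {v : ℝ × ℝ → ℂ} (mv : Measurable v) {C : ℝ} (hb : ∀ p, ‖v p‖ ≤ C*MM (Q p)^J) :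
    Integrable (fun p => w p*v p) μ := by
  refine (h.i.const_mul C).mono' (h.mw.mul mv.aestronglyMeasurable) (ae_of_all _ fun p => ?_)
  rw [norm_mul]
  exact (mul_le_mul_of_nonneg_left (hb p) (norm_nonneg _)).trans (le_of_eq (by ring))
lemma qs {c : ℕ → ℂ} {D : ℝ} {A : ℕ} (h : AJ μ w Q (A+2)) (hD : 0 ≤ D) (hc : ∀ n : ℕ, ‖c n‖ ≤ D*(n+1)^A) :
    (∀ n : ℕ, Integrable (fun p => c n*(w p*cexp (2*π*I*n*Q p))) μ) ∧
    Summable (fun n : ℕ => ∫ p, ‖c n*(w p*cexp (2*π*I*n*Q p))‖ ∂μ) ∧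
    Summable (fun n : ℕ => ‖c n*∫ p, w p*cexp (2*π*I*n*Q p) ∂μ‖) := by
  have b : ∀ (n : ℕ) p, ‖c n*cexp (2*π*I*n*Q p)‖ ≤
      (D*((A+2).factorial*rexp 1)*((n:ℝ)+1)⁻¹^2)*MM (Q p)^(A+2) := by
    intro n p
    have h0 : 0 < (Q p).im := h.pos p
    refine (coef_q hD (hc n) (h.pos p)).trans ?_
    have : (1+(Q p).im⁻¹)^(A+2) ≤ MM (Q p)^(A+2) :=
      pow_le_pow_left₀ (by positivity) (by unfold MM; linarith [norm_nonneg (Q p)]) _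
    calc _ = (D*((A+2).factorial*rexp 1)*((n:ℝ)+1)⁻¹^2)*(1+(Q p).im⁻¹)^(A+2) := by ring
      _ ≤ _ := mul_le_mul_of_nonneg_left this (by positivity)
  have e : ∀ (n : ℕ) p, c n*(w p*cexp (2*π*I*n*Q p)) = w p*(c n*cexp (2*π*I*n*Q p)) := fun n p => by ring
  have i1 : ∀ n : ℕ, Integrable (fun p => c n*(w p*cexp (2*π*I*n*Q p))) μ := by
    intro n
    simp only [e]
    exact h.int (by have := h.mt; fun_prop) (b n)
  have s1 : Summable (fun n : ℕ => ∫ p, ‖c n*(w p*cexp (2*π*I*n*Q p))‖ ∂μ) := by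
    refine Summable.of_nonneg_of_le (fun n => integral_nonneg fun p => norm_nonneg _) (fun n => ?_)
      (sum_inv2.mul_left (D*((A+2).factorial*rexp 1)*∫ p, ‖w p‖*MM (Q p)^(A+2) ∂μ))
    rw [show ∀ a b c : ℝ, a*b*c = (a*c)*b by intros; ring, ← integral_const_mul]
    refine integral_mono (i1 n).norm (h.i.const_mul _) fun p => ?_
    simp only
    rw [e, norm_mul]
    exact (mul_le_mul_of_nonneg_left (b n p) (norm_nonneg _)).trans (le_of_eq (by ring))
  refine ⟨i1, s1, Summable.of_nonneg_of_le (fun n => norm_nonneg _) (fun n => ?_) s1⟩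
  rw [← integral_const_mul]
  exact norm_integral_le_integral_norm _
abbrev E8 := EuclideanSpace ℝ (Fin 8)
lemma sup_deriv (h : AJ μ w Q 1) (n : ℕ) : HasDerivAt (fun t : ℝ => ∫ p, w p*ee (t^2) (Q p) ∂μ)
    (2*π*I*(√(2*n) : ℝ)*∫ p, (w p*Q p)*cexp (2*π*I*n*Q p) ∂μ) (√(2*n)) := by
  have mt := h.mt
  have hee : ∀ (t : ℝ) p, ‖ee (t^2) (Q p)‖ ≤ 1 := fun t p => norm_ee_le (sq_nonneg t) (h.pos p)
  set r := √(2*n) with hr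
  have me : ∀ t : ℝ, Measurable fun p => ee (t^2) (Q p) := fun t => by unfold ee; fun_prop
  have key := hasDerivAt_integral_of_dominated_loc_of_deriv_le (μ := μ) (F := fun (t : ℝ) p => w p*ee (t^2) (Q p))
    (F' := fun (t : ℝ) p => w p*(2*π*I*t*Q p*ee (t^2) (Q p)))
    (bound := fun p => (2*π*(|r|+1))*(‖w p‖*MM (Q p)^1)) (Metric.ball_mem_nhds r one_pos)
    (Eventually.of_forall fun t => h.mw.mul (me t).aestronglyMeasurable) ?_
    (h.mw.mul (Measurable.aestronglyMeasurable (by have := me r; fun_prop))) ?_ (h.i.const_mul _) ?_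
  · convert! key.2 using 1
    rw [← integral_const_mul]
    congr 1; funext p
    rw [ee, show (((r^2 : ℝ)) : ℂ) = 2*n by rw [hr, Real.sq_sqrt (by positivity)]; push_cast; ring]
    rw [show π*I*(2*n)*Q p = 2*π*I*n*Q p by ring]; ring
  · refine h.int (C := 1) (me r) fun p => ?_
    rw [one_mul, pow_one]; exact (hee r p).trans (MM_facts (h.pos p)).1
  · refine ae_of_all _ fun p t ht => ?_
    rw [norm_mul, norm_mul, norm_mul, norm_mul, norm_mul, norm_mul, norm_I, Complex.norm_real, Complex.norm_real, Real.norm_of_nonneg Real.pi_pos.le]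
    norm_num
    rw [Metric.mem_ball, Real.dist_eq] at ht
    have h1 : |t| ≤ |r|+1 := by have := abs_sub_abs_le_abs_sub t r; linarith
    have h2 := (MM_facts (h.pos p)).2.1
    have h4 : |t| * ‖Q p‖*‖ee (t^2) (Q p)‖ ≤ (|r|+1)*MM (Q p)*1 :=
      mul_le_mul (mul_le_mul h1 h2 (norm_nonneg _) (by positivity)) (hee t p) (norm_nonneg _)
        (mul_nonneg (by positivity) ((norm_nonneg _).trans h2))
    have h5 := mul_le_mul_of_nonneg_left h4 (mul_nonneg (norm_nonneg (w p)) Real.two_pi_pos.le)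
    linarith
  · refine ae_of_all _ fun p t ht => ?_
    have h1 : HasDerivAt (fun t : ℝ => ((t^2 : ℝ) : ℂ)) ((2*t : ℝ) : ℂ) t := by
      have := (hasDerivAt_pow 2 t).ofReal_comp
      simpa using this
    have h2 := (((h1.const_mul (π*I : ℂ)).mul_const (Q p)).cexp).const_mul (w p)
    refine h2.congr_deriv ?_
    rw [ee]; push_cast; ring
lemma ee_gauss (s : ℝ) (z : ℂ) : ee s z = cexp (-(-π*I*z)*s) := by rw [ee]; congr 1; ring
lemma sup_FT [SFinite μ] (h : AJ μ w Q 4) (y : E8) : FourierTransform.fourier (fun x : E8 => ∫ p, w p*ee (‖x‖^2) (Q p) ∂μ) y =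
    ∫ p, (w p*(Q p)⁻¹^4)*ee (‖y‖^2) (-1/Q p) ∂μ := by
  have mt := h.mt
  have hre : ∀ p, (-π*I*Q p : ℂ).re = π*(Q p).im := fun p => by simp
  have hb : ∀ p, 0 < (-π*I*Q p : ℂ).re := fun p => by rw [hre]; exact mul_pos Real.pi_pos (h.pos p)
  have dim : Module.finrank ℝ E8 = 8 := by simp
  have iG : ∀ p, Integrable (fun x : E8 => ee (‖x‖^2) (Q p)) := by
    intro p
    have := GaussianFourier.integrable_cexp_neg_mul_sq_norm_add (V := E8) (hb p) 0 0
    simp only [ee_gauss]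
    refine this.congr (ae_of_all _ fun x => ?_)
    simp only; congr 1; push_cast; ring
  have nG : ∀ p, ∫ x : E8, ‖ee (‖x‖^2) (Q p)‖ = (Q p).im⁻¹^4 := by
    intro p
    have h1 : 0 < (Q p).im := h.pos p
    have := GaussianFourier.integral_rexp_neg_mul_sq_norm (V := E8) (b := π*(Q p).im) (by positivity)
    rw [dim] at this
    simp only [norm_ee]
    rw [show (π/(π*(Q p).im))^((8:ℕ)/2 : ℝ) = (Q p).im⁻¹^4 by
      rw [show ((8:ℕ)/2 : ℝ) = (4:ℕ) by norm_num, Real.rpow_natCast]; congr 1; field_simp] at this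
    rw [← this]; congr 1; funext x; congr 1; ring
  have fG : ∀ p, ∫ x : E8, cexp ((-2*π*inner ℝ x y : ℝ)*I)*ee (‖x‖^2) (Q p) = (Q p)⁻¹^4*ee (‖y‖^2) (-1/Q p) := by
    intro p
    have h0 := HH_ne_zero (h.pos p)
    have := fourier_gaussian_innerProductSpace (V := E8) (hb p) y
    rw [Real.fourier_eq', dim] at this
    simp only [smul_eq_mul] at this
    have e1 : ∀ x : E8, ee (‖x‖^2) (Q p) = cexp (-(-π*I*Q p)*(‖x‖:ℂ)^2) := fun x => by rw [ee_gauss]; push_cast; rfl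
    simp only [e1, this]
    have hpi : (π:ℂ) ≠ 0 := by exact_mod_cast Real.pi_ne_zero
    rw [show ((8:ℕ)/2 : ℂ) = (4:ℕ) by norm_num, Complex.cpow_natCast, ee]
    have e2 : (π/(-π*I*Q p) : ℂ) = I*(Q p)⁻¹ := by
      field_simp; rw [I_sq]
    rw [e2, mul_pow, I_pow_four, one_mul]
    congr 2
    push_cast
    field_simp
    linear_combination ((‖y‖:ℂ)^2)*I_sq
  have meas : AEStronglyMeasurable (fun q : E8 × (ℝ × ℝ) => cexp ((-2*π*inner ℝ q.1 y : ℝ)*I)*(w q.2*ee (‖q.1‖^2) (Q q.2)))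
      (volume.prod μ) := by
    refine AEStronglyMeasurable.mul (Continuous.aestronglyMeasurable (by fun_prop)) (AEStronglyMeasurable.mul h.mw.comp_snd ?_)
    refine Measurable.aestronglyMeasurable ?_
    unfold ee; fun_prop
  have n1 : ∀ (x : E8) p, ‖cexp ((-2*π*inner ℝ x y : ℝ)*I)*(w p*ee (‖x‖^2) (Q p))‖ = ‖w p‖*‖ee (‖x‖^2) (Q p)‖ := fun x p => by
    rw [norm_mul, Complex.norm_exp_ofReal_mul_I, one_mul, norm_mul]
  have int : Integrable (fun q : E8 × (ℝ × ℝ) => cexp ((-2*π*inner ℝ q.1 y : ℝ)*I)*(w q.2*ee (‖q.1‖^2) (Q q.2)))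
      (volume.prod μ) := by
    rw [integrable_prod_iff' meas]
    refine ⟨ae_of_all _ fun p => ?_, ?_⟩
    · refine Integrable.mono' ((iG p).norm.const_mul ‖w p‖) ?_ (ae_of_all _ fun x => (n1 x p).le)
      refine (Continuous.aestronglyMeasurable ?_)
      simp only; unfold ee; fun_prop
    · simp only [n1, integral_const_mul, nG]
      have : Integrable (fun p => w p*((Q p).im⁻¹^4 : ℝ)) μ := by
        refine h.int (C := 1) (by fun_prop) fun p => ?_
        have h1 : 0 < (Q p).im := h.pos p
        rw [Complex.norm_real, Real.norm_of_nonneg (by positivity), one_mul]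
        exact pow_le_pow_left₀ (by positivity) (MM_facts (h.pos p)).2.2.1 4
      refine this.norm.congr (ae_of_all _ fun p => ?_)
      have h1 : 0 < (Q p).im := h.pos p
      simp only
      rw [norm_mul, Complex.norm_real, Real.norm_of_nonneg (by positivity)]
  rw [Real.fourier_eq']
  simp only [smul_eq_mul, ← integral_const_mul]
  rw [integral_integral_swap int]
  congr 1; funext p
  rw [mul_assoc, ← fG, ← integral_const_mul]
  congr 1; funext x; ring
lemma s_hasDeriv (G : 𝓢(ℝ, ℂ)) (s : ℝ) : HasDerivAt G (SchwartzMap.derivCLM ℂ ℂ G s) s :=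
  (G.differentiableAt (x := s)).hasDerivAt
lemma s_div (g : 𝓢(ℝ, ℂ)) (h0 : g 0 = 0) : ∃ ψ : 𝓢(ℝ, ℂ), ∀ r : ℝ, g r = r*ψ r := by
  obtain ⟨h, hh⟩ : ∃ h : 𝓢(ℝ, ℂ), FourierTransform.fourier h = g :=
    ⟨FourierTransformInv.fourierInv g, FourierTransform.fourier_fourierInv_eq g⟩
  have hi : Integrable h := h.integrable
  have z : ∫ t, h t = 0 := by
    rw [← h0, ← hh, SchwartzMap.fourier_coe, Real.fourier_real_eq]; simp
  set H : ℝ → ℂ := fun x => ∫ t in Iic x, h t with hH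
  have dH : ∀ x, HasDerivAt H (h x) x := by
    intro x
    have e : H = fun y => H 0+∫ t in (0:ℝ)..y, h t := by
      funext y
      rw [← intervalIntegral.integral_Iic_sub_Iic hi.integrableOn hi.integrableOn]; simp [hH]
    rw [e]
    exact (intervalIntegral.integral_hasDerivAt_right (hi.intervalIntegrable)
      (h.continuous.stronglyMeasurableAtFilter _ _) h.continuous.continuousAt).const_add _
  have bH : ∀ (k : ℕ) (s : ℝ), |s|^k*‖H s‖ ≤ ∫ t, ‖t‖^k*‖h t‖ := by
    intro k s
    have ik := h.integrable_pow_mul volume k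
    have gen : ∀ S : Set ℝ, MeasurableSet S → (∀ t ∈ S, |s| ≤ |t|) → |s|^k*‖∫ t in S, h t‖ ≤ ∫ t, ‖t‖^k*‖h t‖ := by
      intro S mS hS
      refine (mul_le_mul_of_nonneg_left (norm_integral_le_integral_norm _) (by positivity)).trans ?_
      rw [← integral_const_mul]
      refine (setIntegral_mono_on (hi.norm.const_mul _).integrableOn ik.integrableOn mS fun t ht => ?_).trans
        (setIntegral_le_integral ik (ae_of_all _ fun t => by positivity))
      exact mul_le_mul_of_nonneg_right (pow_le_pow_left₀ (abs_nonneg _) (hS t ht) k) (norm_nonneg _)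
    rcases le_total s 0 with hs | hs
    · refine gen _ measurableSet_Iic fun t ht => ?_
      have : t ≤ s := ht
      rw [abs_of_nonpos hs, abs_of_nonpos (this.trans hs)]; linarith
    · have : H s = -∫ t in Ioi s, h t := by
        rw [eq_neg_iff_add_eq_zero, ← z]
        exact intervalIntegral.integral_Iic_add_Ioi hi.integrableOn hi.integrableOn
      rw [this, norm_neg]
      refine gen _ measurableSet_Ioi fun t ht => ?_
      have : s < t := ht
      rw [abs_of_nonneg hs, abs_of_nonneg (hs.trans this.le)]; exact this.le
  obtain ⟨K, hK⟩ := schwartz_of (P := fun f => f = H ∨ ∃ G : 𝓢(ℝ, ℂ), f = G) (h := H) (by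
    rintro f (rfl | ⟨G, rfl⟩)
    · exact ⟨h, Or.inr ⟨h, rfl⟩, dH⟩
    · exact ⟨_, Or.inr ⟨SchwartzMap.derivCLM ℂ ℂ G, rfl⟩, s_hasDeriv G⟩) (by
    rintro f (rfl | ⟨G, rfl⟩) k
    · exact ⟨_, bH k⟩
    · obtain ⟨C, hC⟩ := G.decay k 0
      exact ⟨C, fun s => by simpa using hC.2 s⟩) (Or.inl rfl)
  have hKH : (K : ℝ → ℂ) = H := funext hK
  refine ⟨(2*π*I : ℂ) • FourierTransform.fourier K, fun r => ?_⟩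
  have dK : deriv (K : ℝ → ℂ) = h := by rw [hKH]; exact funext fun x => (dH x).deriv
  have := Real.fourier_deriv K.integrable K.differentiable (by rw [dK]; exact hi)
  rw [dK, ← SchwartzMap.fourier_coe, hh] at this
  rw [this, smul_apply, SchwartzMap.fourier_coe]
  simp only [smul_eq_mul]; ring
lemma s_step (φ : 𝓢(ℝ, ℂ)) (he : ∀ r, φ (-r) = φ r) :
    ∃ χ : 𝓢(ℝ, ℂ), (∀ r, χ (-r) = χ r) ∧ ∀ r : ℝ, HasDerivAt φ (-(2*r*χ r)) r := by
  have od : ∀ r, SchwartzMap.derivCLM ℂ ℂ φ (-r) = -SchwartzMap.derivCLM ℂ ℂ φ r := by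
    intro r
    have h1 : HasDerivAt (fun r => φ (-r)) _ r := (s_hasDeriv φ (-r)).scomp r (hasDerivAt_neg r)
    have h2 : (fun r => φ (-r)) = φ := funext he
    rw [h2] at h1
    have := h1.unique (s_hasDeriv φ r)
    rw [← this]; simp
  obtain ⟨ψ, hψ⟩ := s_div (SchwartzMap.derivCLM ℂ ℂ φ) (by
    have := od 0; rw [neg_zero] at this; linear_combination this/2)
  refine ⟨(-1/2 : ℂ) • ψ, fun r => ?_, fun r => ?_⟩
  · rcases eq_or_ne r 0 with rfl | hr
    · simp
    · have h1 := od r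
      rw [hψ, hψ] at h1
      have : (r : ℂ) ≠ 0 := ofReal_ne_zero.2 hr
      rw [smul_apply, smul_apply]
      congr 1
      refine mul_left_cancel₀ this ?_
      push_cast at h1; linear_combination -h1
  · refine (s_hasDeriv φ r).congr_deriv ?_
    rw [hψ, smul_apply, smul_eq_mul]; ring
lemma s_poly (χ : 𝓢(ℝ, ℂ)) (r : ℝ) (k : ℕ) : ∃ G : 𝓢(ℝ, ℂ), ∀ ρ : ℝ, G ρ = ((ρ:ℂ)^2-r^2)^k*χ ρ := by
  refine ⟨SchwartzMap.smulLeftCLM ℂ (fun ρ : ℝ => (ρ^2-r^2)^k) χ, fun ρ => ?_⟩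
  rw [SchwartzMap.smulLeftCLM_apply_apply (by fun_prop)]
  simp
lemma s_taylor (φ : 𝓢(ℝ, ℂ)) (he : ∀ r, φ (-r) = φ r) (k : ℕ) : ∃ χ : 𝓢(ℝ, ℂ), (∀ r, χ (-r) = χ r) ∧
    ∀ r : ℝ, φ r = ∫ ρ in Ioi r, 2*ρ*χ ρ*((ρ:ℂ)^2-r^2)^k/k.factorial := by
  induction k with
  | zero =>
    obtain ⟨χ, h1, h2⟩ := s_step φ he
    refine ⟨χ, h1, fun r => ?_⟩
    have e : (fun ρ : ℝ => -(2*ρ*χ ρ)) = SchwartzMap.derivCLM ℂ ℂ φ :=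
      funext fun ρ => (h2 ρ).unique (s_hasDeriv φ ρ)
    have := integral_Ioi_of_hasDerivAt_of_tendsto' (a := r) (fun ρ _ => h2 ρ)
      (by rw [e]; exact (SchwartzMap.integrable _).integrableOn) (φ.tendsto_cocompact.mono_left atTop_le_cocompact)
    rw [integral_neg] at this
    simp only [pow_zero, Nat.factorial_zero, Nat.cast_one, mul_one, div_one]
    linear_combination this
  | succ k ih =>
    obtain ⟨χ, h1, h2⟩ := ih
    obtain ⟨θ, h3, h4⟩ := s_step χ h1
    refine ⟨θ, h3, fun r => ?_⟩
    rw [h2 r]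
    have hf : ((k+1).factorial : ℂ) ≠ 0 := by exact_mod_cast Nat.factorial_ne_zero _
    have hf' : (k.factorial : ℂ) ≠ 0 := by exact_mod_cast Nat.factorial_ne_zero _
    obtain ⟨G, hG⟩ := s_poly χ r (k+1)
    obtain ⟨L, hL⟩ := s_poly (SchwartzMap.derivCLM ℂ ℂ χ) r (k+1)
    have dG : ∀ ρ : ℝ, SchwartzMap.derivCLM ℂ ℂ G ρ = (k+1)*((ρ:ℂ)^2-r^2)^k*(2*ρ)*χ ρ+L ρ := by
      intro ρ
      have d1 : HasDerivAt (fun ρ : ℝ => ((ρ:ℂ)^2-r^2)^(k+1)) ((k+1)*((ρ:ℂ)^2-r^2)^k*(2*ρ)) ρ := by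
        have := ((((hasDerivAt_id (ρ : ℂ)).pow 2).sub_const ((r:ℂ)^2)).pow (k+1)).comp_ofReal
        convert! this using 1
        simp
      have d2 := d1.mul (s_hasDeriv χ ρ)
      have e : (G : ℝ → ℂ) = (fun ρ : ℝ => ((ρ:ℂ)^2-r^2)^(k+1))*χ := funext hG
      rw [← e] at d2
      rw [(s_hasDeriv G ρ).unique d2, hL]
    have i1 : ∫ ρ in Ioi r, SchwartzMap.derivCLM ℂ ℂ G ρ = 0 := by
      have := integral_Ioi_of_hasDerivAt_of_tendsto' (a := r) (fun ρ _ => s_hasDeriv G ρ)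
        (SchwartzMap.integrable _).integrableOn (G.tendsto_cocompact.mono_left atTop_le_cocompact)
      rw [this, hG]; simp
    have lhs : (fun ρ : ℝ => 2*ρ*χ ρ*((ρ:ℂ)^2-r^2)^k/k.factorial) =
        fun ρ : ℝ => ((k+1).factorial : ℂ)⁻¹*(SchwartzMap.derivCLM ℂ ℂ G ρ-L ρ) := by
      funext ρ
      rw [dG, Nat.factorial_succ]; push_cast
      have : (k+1 : ℂ) ≠ 0 := by exact_mod_cast k.succ_ne_zero
      field_simp; ring
    have rhs : (fun ρ : ℝ => 2*ρ*θ ρ*((ρ:ℂ)^2-r^2)^(k+1)/(k+1).factorial) =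
        fun ρ : ℝ => -(((k+1).factorial : ℂ)⁻¹*L ρ) := by
      funext ρ
      rw [hL, ← (h4 ρ).unique (s_hasDeriv χ ρ)]; field_simp
    have gi : IntegrableOn (SchwartzMap.derivCLM ℂ ℂ G) (Ioi r) := (SchwartzMap.integrable _).integrableOn
    have li : IntegrableOn L (Ioi r) := (SchwartzMap.integrable _).integrableOn
    rw [lhs, rhs, integral_const_mul, integral_sub gi li, i1, integral_neg, integral_const_mul]; ring
lemma gam_int {p : ℂ} (hp : 0 < p.re) (k : ℕ) : IntegrableOn (fun w : ℝ => (w:ℂ)^k/k.factorial*cexp (-p*w)) (Ioi 0) := by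
  have h := integrableOn_rpow_mul_exp_neg_mul_rpow (p := 1) (s := k) (by linarith [(Nat.cast_nonneg k : (0:ℝ) ≤ k)]) one_pos hp
  refine Integrable.mono' h (by fun_prop) ((ae_restrict_iff' measurableSet_Ioi).2 (ae_of_all _ fun w hw => ?_))
  have hw' : 0 < w := hw
  rw [norm_mul, Complex.norm_exp, norm_div, norm_pow, Complex.norm_real, Real.norm_of_nonneg hw'.le, Real.rpow_natCast, Real.rpow_one]
  have : (-p*w).re = -p.re*w := by simp
  rw [this]
  refine mul_le_mul_of_nonneg_right (div_le_self (by positivity) ?_) (by positivity)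
  rw [Complex.norm_natCast]; exact_mod_cast k.factorial_pos
lemma gam {p : ℂ} (hp : 0 < p.re) (k : ℕ) : ∫ w : ℝ in Ioi 0, (w:ℂ)^k/k.factorial*cexp (-p*w) = p⁻¹^(k+1) := by
  have p0 : p ≠ 0 := fun h => by simp [h] at hp
  induction k with
  | zero =>
    have := integral_exp_mul_complex_Ioi (a := -p) (by simpa using hp) 0
    simp only [pow_zero, Nat.factorial_zero, Nat.cast_one, div_one, one_mul]
    rw [this]; simp [neg_div_neg_eq]
  | succ k ih =>
    have i1 := gam_int hp k
    have i2 := gam_int hp (k+1)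
    have d : ∀ w : ℝ, HasDerivAt (fun w : ℝ => (w:ℂ)^(k+1)/(k+1).factorial*cexp (-p*w))
        ((w:ℂ)^k/k.factorial*cexp (-p*w)-p*((w:ℂ)^(k+1)/(k+1).factorial*cexp (-p*w))) w := by
      intro w
      have h1 := ((hasDerivAt_pow (k+1) (w:ℂ)).div_const ((k+1).factorial : ℂ)).mul (((hasDerivAt_id (w:ℂ)).const_mul (-p)).cexp)
      refine h1.comp_ofReal.congr_deriv ?_
      have : (k+1 : ℂ) ≠ 0 := by exact_mod_cast k.succ_ne_zero
      have hf' : (k.factorial : ℂ) ≠ 0 := by exact_mod_cast Nat.factorial_ne_zero _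
      simp only [Nat.factorial_succ, id_eq, add_tsub_cancel_right]; push_cast
      field_simp
      ring
    have i3 : IntegrableOn (fun w : ℝ => (w:ℂ)^k/k.factorial*cexp (-p*w)-p*((w:ℂ)^(k+1)/(k+1).factorial*cexp (-p*w))) (Ioi 0) :=
      i1.sub (i2.const_mul p)
    have t := tendsto_zero_of_hasDerivAt_of_integrableOn_Ioi (fun w _ => d w) i3 i2
    have := integral_Ioi_of_hasDerivAt_of_tendsto' (fun w _ => d w) i3 t
    rw [integral_sub i1 (i2.const_mul p), integral_const_mul, ih] at this
    simp only [ofReal_zero, ne_eq, Nat.add_eq_zero_iff, one_ne_zero, and_false, not_false_eq_true, zero_pow, zero_div, zero_mul, sub_zero] at this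
    rw [pow_succ' _ (k+1), eq_inv_mul_iff_mul_eq₀ p0]
    linear_combination -this
lemma inv_p {δ : ℝ} (h0 : 0 < δ) (h1 : δ ≤ 1) (ξ : ℝ) : ‖((δ:ℂ)+2*π*I*ξ)⁻¹‖ ≤ 2*δ⁻¹*(1+|ξ|)⁻¹ := by
  have a1 := Complex.abs_re_le_norm ((δ:ℂ)+2*π*I*ξ)
  have a2 := Complex.abs_im_le_norm ((δ:ℂ)+2*π*I*ξ)
  simp at a1 a2
  rw [abs_of_pos h0] at a1
  rw [abs_of_pos Real.pi_pos] at a2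
  have h3 := Real.pi_gt_three
  have h4 := abs_nonneg ξ
  rw [norm_inv, show 2*δ⁻¹*(1+|ξ|)⁻¹ = (δ*(1+|ξ|)/2)⁻¹ by field_simp]
  refine inv_anti₀ (by positivity) ?_
  nlinarith
lemma lap_int {δ : ℝ} (h0 : 0 < δ) (h1 : δ ≤ 1) (k : ℕ) : Integrable (fun ξ : ℝ => ((δ:ℂ)+2*π*I*ξ)⁻¹^(k+2)) := by
  have := (integrable_one_add_norm (E := ℝ) (μ := volume) (r := 2) (by simp)).const_mul ((2*δ⁻¹)^(k+2))
  refine this.mono' (Measurable.aestronglyMeasurable (by fun_prop)) (ae_of_all _ fun ξ => ?_)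
  rw [norm_pow]
  have h4 := abs_nonneg ξ
  refine (pow_le_pow_left₀ (norm_nonneg _) (inv_p h0 h1 ξ) _).trans ?_
  rw [mul_pow]
  refine mul_le_mul_of_nonneg_left ?_ (by positivity)
  rw [Real.rpow_neg (by positivity), Real.norm_eq_abs, show (2:ℝ) = (2:ℕ) by norm_num, Real.rpow_natCast, inv_pow]
  exact inv_anti₀ (by positivity) (pow_le_pow_right₀ (by linarith) (by omega))
lemma lap {δ : ℝ} (h0 : 0 < δ) (h1 : δ ≤ 1) (k : ℕ) (w : ℝ) :
    ((max w 0 : ℝ) : ℂ)^(k+1)/(k+1).factorial =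
      ∫ ξ : ℝ, cexp (((δ:ℂ)+2*π*I*ξ)*w)*((δ:ℂ)+2*π*I*ξ)⁻¹^(k+2) := by
  set g : ℝ → ℂ := fun w => ((max w 0 : ℝ) : ℂ)^(k+1)/(k+1).factorial*cexp (-(δ:ℂ)*w) with hg
  have eg : ∀ e : ℝ → ℂ, (fun w => e w*g w) = (Ioi 0).indicator fun w : ℝ => e w*((w:ℂ)^(k+1)/(k+1).factorial*cexp (-(δ:ℂ)*w)) := by
    intro e
    funext w
    by_cases hw : 0 < w
    · rw [indicator_of_mem (show w ∈ Ioi 0 from hw), hg]; simp only; rw [max_eq_left hw.le]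
    · rw [indicator_of_notMem (by simpa using hw), hg]; simp only; rw [max_eq_right (not_lt.1 hw)]; simp
  have cg : Continuous g := by rw [hg]; fun_prop
  have ig : Integrable g := by
    have := eg fun _ => 1
    simp only [one_mul] at this
    rw [show g = _ from this, integrable_indicator_iff measurableSet_Ioi]
    exact gam_int (p := δ) (by simpa using h0) (k+1)
  have Fg : FourierTransform.fourier g = fun ξ : ℝ => ((δ:ℂ)+2*π*I*ξ)⁻¹^(k+2) := by
    funext ξ
    rw [Real.fourier_real_eq_integral_exp_smul]
    simp only [smul_eq_mul]
    rw [eg, integral_indicator measurableSet_Ioi, ← gam (by simp [h0])]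
    congr 1
    funext w
    rw [mul_left_comm, ← Complex.exp_add]
    congr 2; push_cast; ring
  have inv := congrFun (cg.fourierInv_fourier_eq ig (by rw [Fg]; exact lap_int h0 h1 k)) w
  rw [Fg, Real.fourierInv_eq'] at inv
  have := congrArg (fun z => cexp (δ*w)*z) inv
  simp only [hg] at this
  rw [mul_left_comm, ← Complex.exp_add, show (δ:ℂ)*w + -(δ:ℂ)*w = 0 by ring, Complex.exp_zero, mul_one] at this
  rw [← this, ← integral_const_mul]
  congr 1
  funext ξ
  rw [smul_eq_mul, ← mul_assoc, ← Complex.exp_add]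
  congr 2
  simp only [RCLike.inner_apply, conj_trivial]; push_cast; ring
lemma e8_norm (r : ℝ) : ‖r • (EuclideanSpace.single 0 1 : E8)‖ = |r| := by
  rw [norm_smul]; simp
lemma rep (f : 𝓢(E8, ℂ)) (hf : ∀ x y : E8, ‖x‖ = ‖y‖ → f x = f y) (J : ℕ) :
    ∃ w Q, AJ ((volume.restrict (Ioi (0:ℝ))).prod (volume : Measure ℝ)) w Q J ∧
      ∀ x : E8, f x = ∫ p, w p*ee (‖x‖^2) (Q p) ∂((volume.restrict (Ioi (0:ℝ))).prod (volume : Measure ℝ)) := by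
  set e : E8 := EuclideanSpace.single 0 1
  have hL : (fun r : ℝ => r • e).HasTemperateGrowth :=
    ((1 : ℝ →L[ℝ] ℝ).smulRight e).hasTemperateGrowth
  have anti : AntilipschitzWith 1 (fun r : ℝ => r • e) := AntilipschitzWith.of_le_mul_dist fun r s => by
    rw [dist_eq_norm, dist_eq_norm, ← sub_smul, e8_norm]; simp
  set φ : 𝓢(ℝ, ℂ) := SchwartzMap.compCLMOfAntilipschitz ℂ hL anti f
  have hφ : ∀ r : ℝ, φ r = f (r • e) := fun r => rfl
  obtain ⟨χ, -, hχ⟩ := s_taylor φ (fun r => by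
    rw [hφ, hφ]; exact hf _ _ (by rw [e8_norm, e8_norm, abs_neg])) (J+1)
  set δ : ℝ → ℝ := fun ρ => (1+ρ^2)⁻¹ with hδ
  have δ0 : ∀ ρ, 0 < δ ρ := fun ρ => by rw [hδ]; positivity
  have δ1 : ∀ ρ, δ ρ ≤ 1 := fun ρ => inv_le_one_of_one_le₀ (by nlinarith [sq_nonneg ρ])
  set P : ℝ × ℝ → ℂ := fun p => (δ p.1 : ℂ)+2*π*I*p.2 with hP
  have mP : Measurable P := by rw [hP, hδ]; fun_prop
  have pi0 : (π : ℂ) ≠ 0 := by exact_mod_cast Real.pi_ne_zero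
  set w : ℝ × ℝ → ℂ := fun p => 2*p.1*χ p.1*(cexp (P p*((p.1^2 : ℝ) : ℂ))*(P p)⁻¹^(J+2)) with hw
  set Q : ℝ × ℝ → ℂ := fun p => I*P p/π with hQ
  have imQ : ∀ p, (Q p).im = δ p.1/π := fun p => by
    simp only [hQ]; rw [Complex.div_ofReal_im]; simp [hP]
  have h3 := Real.pi_gt_three
  have h4 := Real.pi_lt_four
  have aj : AJ ((volume.restrict (Ioi (0:ℝ))).prod (volume : Measure ℝ)) w Q J := by
    have mχ : Measurable χ := χ.continuous.measurable
    have mw : Measurable w := by rw [hw]; fun_prop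
    have mt : Measurable Q := by rw [hQ]; fun_prop
    have mm := MM_meas
    refine ⟨mw.aestronglyMeasurable, mt, fun p => ?_, ?_⟩
    · show 0 < (Q p).im
      rw [imQ]; exact div_pos (δ0 _) Real.pi_pos
    set G : 𝓢(ℝ, ℂ) := SchwartzMap.smulLeftCLM ℂ (fun ρ : ℝ => ρ*(1+ρ^2)^(2*J+2)) χ
    have hG : ∀ ρ : ℝ, ‖G ρ‖ = |ρ| * (1+ρ^2)^(2*J+2)*‖χ ρ‖ := fun ρ => by
      rw [SchwartzMap.smulLeftCLM_apply_apply (by fun_prop), norm_smul, norm_mul, norm_pow, Real.norm_eq_abs,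
        Real.norm_of_nonneg (by positivity : (0:ℝ) ≤ 1+ρ^2)]
    have i1 : Integrable (fun ρ => ‖G ρ‖) (volume.restrict (Ioi (0:ℝ))) := G.integrable.norm.integrableOn
    have i2 := integrable_one_add_norm (E := ℝ) (μ := volume) (r := 2) (by simp)
    have i3 := (i1.mul_prod i2).const_mul (2*(rexp 1*2^(J+2))*6^J)
    refine i3.mono' (Measurable.aestronglyMeasurable (by fun_prop)) (ae_of_all _ fun p => ?_)
    obtain ⟨ρ, ξ⟩ := p
    have hξ := abs_nonneg ξ
    have hρ := sq_nonneg ρ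
    have M0 : 0 ≤ MM (Q (ρ, ξ)) := by
      unfold MM; have := div_pos (δ0 ρ) Real.pi_pos; rw [imQ]; positivity
    have b1 : ‖cexp (P (ρ, ξ)*((ρ^2 : ℝ) : ℂ))‖ ≤ rexp 1 := by
      rw [Complex.norm_exp]
      refine Real.exp_le_exp.2 ?_
      rw [Complex.re_mul_ofReal]
      have : (P (ρ, ξ)).re = (1+ρ^2)⁻¹ := by show _ = δ ρ; simp [hP]
      rw [this, inv_mul_le_iff₀ (by positivity)]; linarith
    have b2 : ‖(P (ρ, ξ))⁻¹^(J+2)‖ ≤ (2*(1+ρ^2)*(1+|ξ|)⁻¹)^(J+2) := by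
      rw [norm_pow]
      refine pow_le_pow_left₀ (norm_nonneg _) ?_ _
      have := inv_p (δ0 ρ) (δ1 ρ) ξ
      simp only [hδ] at this
      rw [inv_inv] at this; exact this
    have b3 : MM (Q (ρ, ξ)) ≤ 6*(1+ρ^2)*(1+|ξ|) := by
      have nP : ‖P (ρ, ξ)‖ ≤ 1+2*π*|ξ| := by
        refine (norm_add_le _ _).trans (add_le_add ?_ (le_of_eq ?_))
        · rw [Complex.norm_real, Real.norm_of_nonneg (δ0 _).le]; exact δ1 _
        · simp [abs_of_pos Real.pi_pos]
      unfold MM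
      have n1 : ‖Q (ρ, ξ)‖ ≤ 1+2*|ξ| := by
        simp only [hQ]
        rw [norm_div, norm_mul, Complex.norm_I, one_mul, Complex.norm_real, Real.norm_of_nonneg Real.pi_pos.le,
          div_le_iff₀ Real.pi_pos]
        nlinarith
      have n2 : (Q (ρ, ξ)).im⁻¹ = π*(1+ρ^2) := by rw [imQ, inv_div]; simp only [hδ]; rw [div_inv_eq_mul]
      rw [n2]
      nlinarith [mul_nonneg hρ hξ]
    have b4 := pow_le_pow_left₀ M0 b3 J
    rw [Real.norm_of_nonneg (by positivity), hG]
    have n0 : ‖w (ρ, ξ)‖ ≤ 2*|ρ| * ‖χ ρ‖*(rexp 1*(2*(1+ρ^2)*(1+|ξ|)⁻¹)^(J+2)) := by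
      simp only [hw]
      rw [norm_mul, norm_mul, norm_mul, norm_mul (cexp _), Complex.norm_real, Complex.norm_ofNat, Real.norm_eq_abs]
      exact mul_le_mul_of_nonneg_left (mul_le_mul b1 b2 (norm_nonneg _) (by positivity)) (by positivity)
    refine (mul_le_mul n0 b4 (by positivity) (by positivity)).trans (le_of_eq ?_)
    rw [Real.rpow_neg (by positivity), Real.norm_eq_abs]
    have : (1+|ξ|)^(2:ℝ) = (1+|ξ|)^2 := by exact_mod_cast Real.rpow_natCast _ 2
    simp only
    rw [this]
    have : 1+|ξ| ≠ 0 := by positivity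
    rw [show 2*J+2 = J+2+J by ring, pow_add (1+ρ^2), mul_pow, mul_pow, mul_pow, mul_pow, inv_pow,
      pow_add (1+|ξ|) J 2]
    field_simp
  refine ⟨w, Q, aj, fun x => ?_⟩
  have hee : ∀ p, ee (‖x‖^2) (Q p) = cexp (P p*((-‖x‖^2 : ℝ) : ℂ)) := fun p => by
    unfold ee; simp only [hQ]
    congr 1; push_cast; field_simp; rw [Complex.I_sq]; ring
  have ii : Integrable (fun p => w p*ee (‖x‖^2) (Q p)) ((volume.restrict (Ioi (0:ℝ))).prod (volume : Measure ℝ)) :=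
    (aj.mono (Nat.zero_le J)).int (C := 1) (by unfold ee; have := aj.mt; fun_prop) fun p => by
      simpa using norm_ee_le (sq_nonneg ‖x‖) (aj.pos p)
  rw [integral_prod _ ii, show f x = φ ‖x‖ from hf _ _ (by rw [e8_norm]; simp), hχ]
  have sub : Ioi ‖x‖ ⊆ Ioi (0:ℝ) := Ioi_subset_Ioi (norm_nonneg x)
  have key : ∀ ρ : ℝ, ∫ ξ, w (ρ, ξ)*ee (‖x‖^2) (Q (ρ, ξ)) =
      2*ρ*χ ρ*(((max (ρ^2-‖x‖^2) 0 : ℝ) : ℂ)^(J+1)/(J+1).factorial) := by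
    intro ρ
    rw [lap (δ0 ρ) (δ1 ρ) J, ← integral_const_mul]
    congr 1; funext ξ
    rw [hee]
    simp only [hw, hP]
    rw [mul_assoc, mul_right_comm (cexp _), ← Complex.exp_add]
    congr 3; push_cast; ring_nf
  simp only [key]
  rw [setIntegral_eq_of_subset_of_forall_sdiff_eq_zero measurableSet_Ioi sub]
  · refine setIntegral_congr_fun measurableSet_Ioi fun ρ hρ => ?_
    have h : ‖x‖ < ρ := hρ
    rw [max_eq_left (by nlinarith [norm_nonneg x])]; push_cast; ring
  · rintro ρ ⟨h5, h6⟩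
    have h5' : 0 < ρ := h5
    have h6' : ρ ≤ ‖x‖ := by simpa using h6
    rw [max_eq_right (by nlinarith)]; simp
def R8 (G : 𝓢(ℝ, ℂ)) : 𝓢(E8, ℂ) :=
  SchwartzMap.compCLM ℂ (g := fun x : E8 => ‖x‖^2) (Function.hasTemperateGrowth_norm_sq E8)
    ⟨1, 1, fun x => by rw [Real.norm_of_nonneg (sq_nonneg _)]; nlinarith [sq_nonneg (‖x‖-1)]⟩ G
lemma R8_apply (G : 𝓢(ℝ, ℂ)) (x : E8) : R8 G x = G (‖x‖^2) := rfl
lemma R8_rad (k : ℂ) (G : 𝓢(ℝ, ℂ)) : IsRadial (k • R8 G) := fun x y h => by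
  show k*G (‖x‖^2) = k*G (‖y‖^2)
  rw [h]
variable {μ : Measure (ℝ × ℝ)} {w Q : ℝ × ℝ → ℂ}
lemma norm_e (t : ℝ) : ‖t • e₁‖^2 = t^2 := by
  have : ‖t • e₁‖ = |t| := e8_norm t
  rw [this, sq_abs]
lemma rv {F : 𝓢(E8, ℂ)} (hF : ∀ x, F x = ∫ p, w p*ee (‖x‖^2) (Q p) ∂μ) (n : ℕ) :
    radVal F (√(2*n)) = ∫ p, w p*cexp (2*π*I*n*Q p) ∂μ := by
  rw [radVal, hF, norm_e, Real.sq_sqrt (by positivity)]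
  congr 1; funext p
  unfold ee
  congr 2; push_cast; ring
lemma rd {F : 𝓢(E8, ℂ)} (hF : ∀ x, F x = ∫ p, w p*ee (‖x‖^2) (Q p) ∂μ) (h : AJ μ w Q 1) (n : ℕ) :
    radDeriv F (√(2*n)) = 2*π*I*(√(2*n) : ℝ)*∫ p, (w p*Q p)*cexp (2*π*I*n*Q p) ∂μ := by
  rw [radDeriv, ← (sup_deriv h n).deriv]
  congr 1; funext t
  rw [hF, norm_e]
lemma sub_sum {g : ℕ → ℂ} (h0 : g 0 = 0) (hs : Summable fun n => ‖g n‖) :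
    (Summable fun n : {n : ℕ // 1 ≤ n} => ‖g n‖) ∧ ∑' n : {n : ℕ // 1 ≤ n}, g n = ∑' n, g n := by
  refine ⟨hs.subtype {n | 1 ≤ n}, tsum_subtype_eq_of_support_subset (s := {n | 1 ≤ n}) fun n hn => ?_⟩
  rcases Nat.eq_zero_or_pos n with rfl | h
  · exact absurd h0 hn
  · exact h
end
end Interp
open Interp Complex Filter Topology Set MeasureTheory
open scoped Real SchwartzMap

/-- The interpolation theorem in dimension 8: there is an interpolation basis of radial
Schwartz functions reconstructing every radial Schwartz function from the values and radial
derivatives of it and its Fourier transform at the radii `√(2n)`, `n ≥ 1`, with all four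
series converging absolutely. -/
theorem interpolation_dim8 :
    ∃ a b c d : ℕ → SchwartzMap (EuclideanSpace ℝ (Fin 8)) ℂ,
      (∀ n : ℕ, IsRadial (a n)) ∧ (∀ n : ℕ, IsRadial (b n)) ∧
      (∀ n : ℕ, IsRadial (c n)) ∧ (∀ n : ℕ, IsRadial (d n)) ∧
      ∀ f : SchwartzMap (EuclideanSpace ℝ (Fin 8)) ℂ, IsRadial f → ∀ x : EuclideanSpace ℝ (Fin 8),
        Summable (fun n : {n : ℕ // 1 ≤ n} =>
          ‖radVal f (Real.sqrt (2 * (n : ℕ))) * a n x‖) ∧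
        Summable (fun n : {n : ℕ // 1 ≤ n} =>
          ‖radDeriv f (Real.sqrt (2 * (n : ℕ))) * b n x‖) ∧
        Summable (fun n : {n : ℕ // 1 ≤ n} =>
          ‖radVal (FT f) (Real.sqrt (2 * (n : ℕ))) * c n x‖) ∧
        Summable (fun n : {n : ℕ // 1 ≤ n} =>
          ‖radDeriv (FT f) (Real.sqrt (2 * (n : ℕ))) * d n x‖) ∧
        f x = (∑' n : {n : ℕ // 1 ≤ n}, radVal f (Real.sqrt (2 * (n : ℕ))) * a n x)
            + (∑' n : {n : ℕ // 1 ≤ n}, radDeriv f (Real.sqrt (2 * (n : ℕ))) * b n x)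
            + (∑' n : {n : ℕ // 1 ≤ n}, radVal (FT f) (Real.sqrt (2 * (n : ℕ))) * c n x)
            + (∑' n : {n : ℕ // 1 ≤ n}, radDeriv (FT f) (Real.sqrt (2 * (n : ℕ))) * d n x) := by
  obtain ⟨a, b, c, d, D, A, g⟩ := gi_exists
  refine ⟨fun n => (1:ℂ) • R8 (a n), fun n => (2*π*I*(√(2*n) : ℝ))⁻¹ • R8 (b n), fun n => (1:ℂ) • R8 (c n),
    fun n => (2*π*I*(√(2*n) : ℝ))⁻¹ • R8 (d n), fun n => R8_rad _ _, fun n => R8_rad _ _, fun n => R8_rad _ _,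
    fun n => R8_rad _ _, fun f hf x => ?_⟩
  obtain ⟨w, Q, h1, hF⟩ := rep f hf (3*(A+3)+4)
  set μ := (volume.restrict (Ioi (0:ℝ))).prod (volume : Measure ℝ)
  have h2 := h1.inv
  set w' : ℝ × ℝ → ℂ := fun p => w p*(Q p)⁻¹^4 with hw'
  set Q' : ℝ × ℝ → ℂ := fun p => -1/Q p with hQ'
  have hF' : ∀ y, FT f y = ∫ p, w' p*ee (‖y‖^2) (Q' p) ∂μ := fun y => by
    rw [← sup_FT (h1.mono (by omega)) y]
    show FourierTransform.fourier (f : E8 → ℂ) y = _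
    rw [show (f : E8 → ℂ) = _ from funext hF]
  have s0 := sq_nonneg ‖x‖
  obtain ⟨za, zb, zc, zd⟩ := g.z _ s0
  have qa := qs (h1.mono (show A+2 ≤ _ by omega)) g.D0 fun n => g.ba n _ s0
  have qb := qs (h1.mono (show A+2+1 ≤ _ by omega)).mul_tau g.D0 fun n => g.bb n _ s0
  have qc := qs (h2.mono (show A+2 ≤ _ by omega)) g.D0 fun n => g.bc n _ s0
  have qd := qs (h2.mono (show A+2+1 ≤ _ by omega)).mul_tau g.D0 fun n => g.bd n _ s0
  have ea : ∀ n : ℕ, radVal f (√(2*n))*((1:ℂ) • R8 (a n)) x =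
      a n (‖x‖^2)*∫ p, w p*cexp (2*π*I*n*Q p) ∂μ := fun n => by
    rw [rv hF, one_smul, R8_apply, mul_comm]
  have ec : ∀ n : ℕ, radVal (FT f) (√(2*n))*((1:ℂ) • R8 (c n)) x =
      c n (‖x‖^2)*∫ p, w' p*cexp (2*π*I*n*Q' p) ∂μ := fun n => by
    rw [rv hF', one_smul, R8_apply, mul_comm]
  have c0 : ∀ n : ℕ, n ≠ 0 → 2*π*I*(√(2*n) : ℝ) ≠ 0 := fun n hn => by
    have : 0 < √(2*n) := Real.sqrt_pos.2 (by positivity)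
    have := Real.pi_ne_zero
    have := I_ne_zero
    simp; tauto
  have eb : ∀ n : ℕ, radDeriv f (√(2*n))*((2*π*I*(√(2*n) : ℝ))⁻¹ • R8 (b n)) x =
      b n (‖x‖^2)*∫ p, (w p*Q p)*cexp (2*π*I*n*Q p) ∂μ := fun n => by
    rw [rd hF (h1.mono (by omega)), smul_apply, R8_apply, smul_eq_mul]
    rcases eq_or_ne n 0 with rfl | hn
    · rw [zb]; simp
    · rw [mul_mul_mul_comm, mul_inv_cancel₀ (c0 n hn), one_mul, mul_comm]
  have ed : ∀ n : ℕ, radDeriv (FT f) (√(2*n))*((2*π*I*(√(2*n) : ℝ))⁻¹ • R8 (d n)) x =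
      d n (‖x‖^2)*∫ p, (w' p*Q' p)*cexp (2*π*I*n*Q' p) ∂μ := fun n => by
    rw [rd hF' (h2.mono (by omega)), smul_apply, R8_apply, smul_eq_mul]
    rcases eq_or_ne n 0 with rfl | hn
    · rw [zd]; simp
    · rw [mul_mul_mul_comm, mul_inv_cancel₀ (c0 n hn), one_mul, mul_comm]
  simp only [ea, eb, ec, ed]
  have sa := sub_sum (by simp [za]) qa.2.2
  have sb := sub_sum (by simp [zb]) qb.2.2
  have sc := sub_sum (by simp [zc]) qc.2.2
  have sd := sub_sum (by simp [zd]) qd.2.2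
  refine ⟨sa.1, sb.1, sc.1, sd.1, ?_⟩
  rw [sa.2, sb.2, sc.2, sd.2]
  have lhs := hF x
  have e : ∀ p, w p*ee (‖x‖^2) (Q p) = ∑' n : ℕ, (a n (‖x‖^2)*(w p*cexp (2*π*I*n*Q p))
      + b n (‖x‖^2)*((w p*Q p)*cexp (2*π*I*n*Q p))+(c n (‖x‖^2)*(w' p*cexp (2*π*I*n*Q' p))
      + d n (‖x‖^2)*((w' p*Q' p)*cexp (2*π*I*n*Q' p)))) := fun p => by
    rw [← ((g.h _ s0 _ (h1.pos p)).mul_left (w p)).tsum_eq]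
    congr 1; funext n
    simp only [hw', hQ']; ring
  have key := hasSum_integral_of_summable_integral_norm (μ := μ) (F := fun (n : ℕ) p =>
      a n (‖x‖^2)*(w p*cexp (2*π*I*n*Q p))
      + b n (‖x‖^2)*((w p*Q p)*cexp (2*π*I*n*Q p))+(c n (‖x‖^2)*(w' p*cexp (2*π*I*n*Q' p))
      + d n (‖x‖^2)*((w' p*Q' p)*cexp (2*π*I*n*Q' p))))
      (fun n => ((qa.1 n).add (qb.1 n)).add ((qc.1 n).add (qd.1 n))) ?_
  · simp only [← e] at key
    rw [← lhs] at key
    rw [← qa.2.2.of_norm.tsum_add qb.2.2.of_norm, ← (qa.2.2.of_norm.add qb.2.2.of_norm).tsum_add qc.2.2.of_norm,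
      ← ((qa.2.2.of_norm.add qb.2.2.of_norm).add qc.2.2.of_norm).tsum_add qd.2.2.of_norm, ← key.tsum_eq]
    congr 1; funext n
    have i1 := (qa.1 n).add (qb.1 n)
    have i2 := (qc.1 n).add (qd.1 n)
    refine (integral_add i1 i2).trans ?_
    simp only [Pi.add_apply]
    rw [integral_add (qa.1 n) (qb.1 n), integral_add (qc.1 n) (qd.1 n)]
    simp only [integral_const_mul]
    ring
  · refine Summable.of_nonneg_of_le (fun n => integral_nonneg fun p => norm_nonneg _) (fun n => ?_)
      ((qa.2.1.add qb.2.1).add (qc.2.1.add qd.2.1))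
    have i1 := (qa.1 n).norm.add (qb.1 n).norm
    have i2 := (qc.1 n).norm.add (qd.1 n).norm
    refine (integral_mono (((qa.1 n).add (qb.1 n)).add ((qc.1 n).add (qd.1 n))).norm (i1.add i2) fun p =>
      (norm_add_le _ _).trans (add_le_add (norm_add_le _ _) (norm_add_le _ _))).trans (le_of_eq ?_)
    refine (integral_add i1 i2).trans ?_
    rw [← integral_add (qa.1 n).norm (qb.1 n).norm, ← integral_add (qc.1 n).norm (qd.1 n).norm]
    rfl

end
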